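/- Let ω ∈ Ω and let μ_ω be the limiting distribution of Ê(x;ω)/σ(X;ω) (the Borel probability measure with lim_{X→∞} (1/X)·∫_X^{2X} F(Ê(x;ω)/σ(X;ω)) dx = ∫ F dμ_ω for every bounded continuous F). Then for every continuous function F : ℝ → ℝ of polynomial growth (i.e. there exist C > 0 and an integer n ≥ 0 with |F(α)| ≤ C·(1+|α|)^n for all α), one has lim_{X→∞} (1/X)·∫_X^{2X} F(Ê(x;ω)/σ(X;ω)) dx = ∫_ℝ F(α) dμ_ω(α). -/

import Mathlib

open MeasureTheory Filter Real

noncomputable section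

/-- The Cygan–Korányi norm on `ℝ³`. -/
def cyganNorm (u : ℝ × ℝ × ℝ) : ℝ :=
  ((u.1 ^ 2 + u.2.1 ^ 2) ^ 2 + u.2.2 ^ 2) ^ ((1 : ℝ) / 4)

/-- The unit ball for the Cygan–Korányi norm. -/
def cyganBall : Set (ℝ × ℝ × ℝ) := {u | cyganNorm u ≤ 1}

/-- The Heisenberg dilation `δ_x`. -/
def heisDil (x : ℝ) (u : ℝ × ℝ × ℝ) : ℝ × ℝ × ℝ := (x * u.1, x * u.2.1, x ^ 2 * u.2.2)

/-- Euclidean volume of the Cygan–Korányi unit ball. -/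
def volB : ℝ := (volume cyganBall).toReal

/-- `N(x)`: the number of integer lattice points inside `δ_x B`. -/
def latticeCount (x : ℝ) : ℕ :=
  Set.ncard {p : ℤ × ℤ × ℤ | ((p.1 : ℝ), (p.2.1 : ℝ), (p.2.2 : ℝ)) ∈ heisDil x '' cyganBall}

/-- The error term `E(x;ω)` for the shell count. -/
def Eshell (ω : ℝ → ℝ) (x : ℝ) : ℝ :=
  ((latticeCount (x + ω x) : ℝ) - (latticeCount x : ℝ))
    - volB * ∑ j ∈ Finset.Icc 1 4, (Nat.choose 4 j : ℝ) * x ^ (4 - j) * ω x ^ j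

/-- The normalized error term `Ê(x;ω) = E(x;ω)/x²`. -/
def Ehat (ω : ℝ → ℝ) (x : ℝ) : ℝ := Eshell ω x / x ^ 2

/-- `σ(X;ω)`, the square root of the variance of `Ê(x;ω)` over `[X,2X]`. -/
def sigmaShell (ω : ℝ → ℝ) (X : ℝ) : ℝ :=
  Real.sqrt ((1 / X) * ∫ x in X..(2 * X), Ehat ω x ^ 2)

/-- `M_j(X;ω) = (1/X)·∫_X^{2X} (ω(x)·log ω(x))^j dx`. -/
def Mom (j : ℕ) (X : ℝ) (ω : ℝ → ℝ) : ℝ :=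
  (1 / X) * ∫ x in X..(2 * X), (ω x * Real.log (ω x)) ^ j

/-- `L_j(ω) = lim_{X→∞} M_j(X;ω)/M_2(X;ω)^{j/2}`. -/
def Llim (ω : ℝ → ℝ) (j : ℕ) : ℝ :=
  limUnder atTop fun X => Mom j X ω / Mom 2 X ω ^ (j / 2)

/-- The Gaussian moment factor `j!/(2^{j/2}·(j/2)!)`. -/
def gaussMoment (j : ℕ) : ℝ :=
  (Nat.factorial j : ℝ) / (2 ^ (j / 2) * (Nat.factorial (j / 2) : ℝ))

/-- The regularity class `Ω` of gap width functions. -/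
structure OmegaClass (ω : ℝ → ℝ) : Prop where
  contDiff : ContDiffOn ℝ 2 ω (Set.Ioi 0)
  pos : ∀ x, 0 < x → 0 < ω x
  tendsto_zero : Tendsto ω atTop (nhds 0)
  deriv_small : ∀ᶠ x in atTop, |deriv ω x| < 1 / 2
  zeros_bound : ∃ C > (0 : ℝ), ∃ ξ > (0 : ℝ), ∀ᶠ X in atTop,
    {x ∈ Set.Icc X (2 * X) | deriv ω x = 0}.Finite ∧
    {x ∈ Set.Icc X (2 * X) | deriv (deriv ω) x = 0}.Finite ∧
    ({x ∈ Set.Icc X (2 * X) | deriv ω x = 0}.ncard : ℝ) *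
        sSup (ω '' Set.Icc X (2 * X)) ≤ C * X ^ ((1 : ℝ) / 2) ∧
    ({x ∈ Set.Icc X (2 * X) | deriv (deriv ω) x = 0}.ncard : ℝ) ≤ C * X ^ (1 - ξ)
  mom2_lower : ∀ α > (0 : ℝ), ∃ c > (0 : ℝ), ∀ᶠ X in atTop, c * X ^ (-α) ≤ Mom 2 X ω
  Llim_exists : ∀ j : ℕ, Even j →
    Tendsto (fun X => Mom j X ω / Mom 2 X ω ^ (j / 2)) atTop (nhds (Llim ω j))
  carleman : Tendsto (fun n => ∑ k ∈ Finset.range n,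
      (gaussMoment (2 * (k + 1)) * Llim ω (2 * (k + 1))) ^
        ((-1 : ℝ) / (2 * ((k : ℝ) + 1)))) atTop atTop

/-- `r₂(m)`: the number of representations of `m` as a sum of two integer squares. -/
def r2 (m : ℕ) : ℕ := Set.ncard {p : ℤ × ℤ | p.1 ^ 2 + p.2 ^ 2 = (m : ℤ)}

/-- The sawtooth function `ψ(t) = t − ⌊t⌋ − 1/2`. -/
def sawtooth (t : ℝ) : ℝ := t - ⌊t⌋ - 1 / 2

/-- The sawtooth sum `Ξ_ψ(x;ω)`. -/
def XiPsi (ω : ℝ → ℝ) (x : ℝ) : ℝ :=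
  (∑ m ∈ Finset.Icc 1 ⌊(x + ω x) ^ 2⌋₊,
      (r2 m : ℝ) * sawtooth (Real.sqrt ((x + ω x) ^ 4 - (m : ℝ) ^ 2)))
    - ∑ m ∈ Finset.Icc 1 ⌊x ^ 2⌋₊, (r2 m : ℝ) * sawtooth (Real.sqrt (x ^ 4 - (m : ℝ) ^ 2))

/-- Gaussian integers of given norm. -/
def gaussSet (n : ℕ) : Set GaussianInt := {z | Zsqrtd.norm z = (n : ℤ)}

lemma gauss_norm_eq (z : GaussianInt) : Zsqrtd.norm z = z.re ^ 2 + z.im ^ 2 := by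
  rw [Zsqrtd.norm_def]; ring

lemma gaussSet_finite (n : ℕ) : (gaussSet n).Finite := by
  have h : (gaussSet n) ⊆ (fun p : ℤ × ℤ => (⟨p.1, p.2⟩ : GaussianInt)) ''
      (Set.Icc (-(n:ℤ)) n ×ˢ Set.Icc (-(n:ℤ)) n) := by
    intro z hz
    have hz' : z.re ^ 2 + z.im ^ 2 = (n : ℤ) := by rw [← gauss_norm_eq]; exact hz
    refine ⟨(z.re, z.im), ?_, rfl⟩
    simp only [Set.mem_prod, Set.mem_Icc]
    refine ⟨⟨?_, ?_⟩, ?_, ?_⟩ <;> nlinarith [sq_nonneg z.re, sq_nonneg z.im]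
  exact (((Set.finite_Icc _ _).prod (Set.finite_Icc _ _)).image _).subset h

lemma r2_eq_gauss (n : ℕ) : r2 n = (gaussSet n).ncard := by
  unfold r2
  have : gaussSet n = (fun p : ℤ × ℤ => (⟨p.1, p.2⟩ : GaussianInt)) ''
      {p : ℤ × ℤ | p.1 ^ 2 + p.2 ^ 2 = (n : ℤ)} := by
    ext z
    simp only [gaussSet, Set.mem_ofPred_eq, Set.mem_image, gauss_norm_eq]
    constructor
    · intro h; exact ⟨(z.re, z.im), h, rfl⟩
    · rintro ⟨p, hp, rfl⟩; exact hp
  rw [this, Set.ncard_image_of_injective]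
  intro p q h
  simp only [Zsqrtd.mk.injEq] at h
  exact Prod.ext h.1 h.2

lemma gauss_ncard_le_of_image {m : ℕ} {s : Set GaussianInt} (f : GaussianInt → GaussianInt)
    (h : s ⊆ f '' gaussSet m) : s.ncard ≤ (gaussSet m).ncard :=
  (Set.ncard_le_ncard h ((gaussSet_finite m).image f)).trans (Set.ncard_image_le (gaussSet_finite m))

lemma gauss_step_split {p : ℕ} (hp : p.Prime) {w : GaussianInt} (hw : w.norm = (p : ℤ)) (e l : ℕ) :
    (gaussSet (p ^ (e + 1) * l)).ncard ≤ (gaussSet (p ^ e * l)).ncard + (gaussSet l).ncard := by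
  have hp0 : (p : ℤ) ≠ 0 := by exact_mod_cast hp.ne_zero
  have hprime : Prime w := by
    rw [← irreducible_iff_prime]
    refine ⟨?_, ?_⟩
    · intro hu
      have := Zsqrtd.norm_eq_one_iff.2 hu
      rw [hw] at this
      exact hp.one_lt.ne' (by simpa using this)
    · intro a b hab
      have h1 : a.norm.natAbs * b.norm.natAbs = p := by
        rw [← Int.natAbs_mul, ← Zsqrtd.norm_mul, ← hab, hw]; simp
      rw [← Zsqrtd.norm_eq_one_iff, ← Zsqrtd.norm_eq_one_iff]
      rcases (Nat.prime_mul_iff.1 (h1 ▸ hp)) with h | h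
      · right; exact h.2
      · left; exact h.2
  have hsub : gaussSet (p ^ (e + 1) * l) ⊆
      ((fun z => w * z) '' gaussSet (p ^ e * l)) ∪ ((fun z => star w ^ (e+1) * z) '' gaussSet l) := by
    intro z hz
    have hz' : z.norm = (p : ℤ) ^ (e+1) * l := by
      have := hz; simp only [gaussSet, Set.mem_ofPred_eq] at this; rw [this]; push_cast; rfl
    by_cases hd : w ∣ z
    · left
      obtain ⟨v, rfl⟩ := hd
      refine ⟨v, ?_, rfl⟩
      rw [Zsqrtd.norm_mul, hw] at hz'
      simp only [gaussSet, Set.mem_ofPred_eq]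
      push_cast
      apply mul_left_cancel₀ hp0
      rw [hz']; ring
    · right
      have h1 : w ^ (e+1) ∣ z * star z := by
        rw [← Zsqrtd.norm_eq_mul_conj, hz']
        refine ⟨star w ^ (e+1) * (l : GaussianInt), ?_⟩
        rw [← mul_assoc, ← mul_pow, ← Zsqrtd.norm_eq_mul_conj, hw]
        push_cast; rfl
      have h2 : w ^ (e+1) ∣ star z := hprime.pow_dvd_of_dvd_mul_left _ hd h1
      obtain ⟨v, hv⟩ := h2
      have h3 : z = star w ^ (e+1) * star v := by
        have := congrArg star hv
        rw [star_star] at this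
        rw [this, star_mul, star_pow, mul_comm]
      refine ⟨star v, ?_, h3.symm⟩
      have h4 : (star w).norm = (p:ℤ) := by rw [Zsqrtd.norm_conj, hw]
      have h5 : ∀ k, (star w ^ k).norm = (p:ℤ) ^ k := by
        intro k
        induction k with
        | zero => simp
        | succ k ih => rw [pow_succ, Zsqrtd.norm_mul, ih, h4, pow_succ]
      rw [h3, Zsqrtd.norm_mul, h5] at hz'
      exact mul_left_cancel₀ (pow_ne_zero _ hp0) hz'
  calc _ ≤ _ := Set.ncard_le_ncard hsub
        (((gaussSet_finite _).image _).union ((gaussSet_finite _).image _))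
    _ ≤ _ := Set.ncard_union_le _ _
    _ ≤ _ := add_le_add (Set.ncard_image_le (gaussSet_finite _))
        (Set.ncard_image_le (gaussSet_finite _))

lemma gauss_inert_dvd {p : ℕ} (hp : Prime (p : GaussianInt)) {z : GaussianInt}
    (h : (p : ℤ) ∣ z.norm) : (p : GaussianInt) ∣ z := by
  have h1 : (p : GaussianInt) ∣ z * star z := by
    rw [← Zsqrtd.norm_eq_mul_conj]
    obtain ⟨k, hk⟩ := h
    exact ⟨(k : GaussianInt), by rw [hk]; push_cast; rfl⟩
  rcases hp.dvd_or_dvd h1 with h | h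
  · exact h
  · obtain ⟨v, hv⟩ := h
    refine ⟨star v, ?_⟩
    have := congrArg star hv
    rw [star_star] at this
    rw [this, star_mul, mul_comm]
    simp

lemma gauss_prime_pow {p : ℕ} (hp : p.Prime) (e l : ℕ) (hl : ¬ p ∣ l) :
    (gaussSet (p ^ e * l)).ncard ≤ (e + 1) * (gaussSet l).ncard := by
  have := Fact.mk hp
  have hp0 : (p : ℤ) ≠ 0 := by exact_mod_cast hp.ne_zero
  by_cases h4 : p % 4 = 3
  · have hpr := GaussianInt.prime_of_nat_prime_of_mod_four_eq_three p h4
    have hnp : Zsqrtd.norm (p : GaussianInt) = (p : ℤ) ^ 2 := by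
      rw [Zsqrtd.norm_natCast]; ring
    suffices h : (gaussSet (p ^ e * l)).ncard ≤ (gaussSet l).ncard by nlinarith
    induction e using Nat.strong_induction_on with
    | _ e ih =>
      match e with
      | 0 => simp
      | 1 =>
        have : gaussSet (p ^ 1 * l) = ∅ := by
          rw [Set.eq_empty_iff_forall_notMem]
          intro z hz
          have hz' : z.norm = (p : ℤ) * l := by
            have := hz; simp only [gaussSet, Set.mem_ofPred_eq] at this; rw [this]; push_cast; ring
          obtain ⟨v, rfl⟩ := gauss_inert_dvd hpr ⟨_, hz'⟩
          rw [Zsqrtd.norm_mul, hnp] at hz'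
          apply hl
          have : (p : ℤ) ∣ l := ⟨v.norm, mul_left_cancel₀ hp0 (by rw [← hz']; ring)⟩
          exact_mod_cast this
        rw [this]; simp
      | (e + 2) =>
        refine le_trans ?_ (ih e (by omega))
        apply gauss_ncard_le_of_image (fun z => (p : GaussianInt) * z)
        intro z hz
        have hz' : z.norm = (p : ℤ) ^ 2 * (p ^ e * l) := by
          have := hz; simp only [gaussSet, Set.mem_ofPred_eq] at this; rw [this]; push_cast; ring
        obtain ⟨v, rfl⟩ := gauss_inert_dvd hpr (by rw [hz']; exact ⟨p * (p ^ e * l), by ring⟩)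
        refine ⟨v, ?_, rfl⟩
        rw [Zsqrtd.norm_mul, hnp] at hz'
        have := mul_left_cancel₀ (pow_ne_zero _ hp0) hz'
        simp only [gaussSet, Set.mem_ofPred_eq]; rw [this]; push_cast; rfl
  · obtain ⟨a, b, hab⟩ := Nat.Prime.sq_add_sq (p := p) h4
    have hw : Zsqrtd.norm (⟨a, b⟩ : GaussianInt) = (p : ℤ) := by
      rw [gauss_norm_eq]; simp only; exact_mod_cast hab
    induction e with
    | zero => simp
    | succ e ih =>
      refine (gauss_step_split hp hw e l).trans ?_
      nlinarith

lemma gauss_one : (gaussSet 1).ncard ≤ 4 := by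
  have : gaussSet 1 ⊆ (({⟨1,0⟩, ⟨-1,0⟩, ⟨0,1⟩, ⟨0,-1⟩} : Finset GaussianInt) : Set GaussianInt) := by
    rintro ⟨a, b⟩ hz
    simp only [gaussSet, Set.mem_ofPred_eq, gauss_norm_eq] at hz
    push_cast at hz
    have ha : -1 ≤ a ∧ a ≤ 1 := by constructor <;> nlinarith [sq_nonneg a, sq_nonneg b]
    have hb : -1 ≤ b ∧ b ≤ 1 := by constructor <;> nlinarith [sq_nonneg a, sq_nonneg b]
    obtain ⟨ha1, ha2⟩ := ha
    obtain ⟨hb1, hb2⟩ := hb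
    interval_cases a <;> interval_cases b <;> simp_all
  have h2 := Set.ncard_le_ncard this (Finset.finite_toSet _)
  rw [Set.ncard_coe_finset] at h2
  exact h2.trans (by decide)

lemma r2_le_divisors (n : ℕ) (hn : 0 < n) : r2 n ≤ 4 * n.divisors.card := by
  rw [r2_eq_gauss]
  induction n using Nat.strong_induction_on with
  | _ n ih =>
    rcases Nat.lt_or_ge 1 n with h1 | h1
    · obtain ⟨p, hp, hpn⟩ := Nat.exists_prime_and_dvd h1.ne'
      obtain ⟨e, l, hl, rfl⟩ := Nat.exists_eq_pow_mul_and_not_dvd hn.ne' p hp.ne_one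
      have he : e ≠ 0 := by
        rintro rfl; simp at hpn; exact hl hpn
      have hl0 : 0 < l := Nat.pos_of_ne_zero (by rintro rfl; simp at hl)
      have hlt : l < p ^ e * l := by
        have : 1 < p ^ e := Nat.one_lt_pow he hp.one_lt
        nlinarith
      have hco : Nat.Coprime (p ^ e) l := Nat.Coprime.pow_left _ ((Nat.Prime.coprime_iff_not_dvd hp).2 hl)
      rw [hco.card_divisors_mul, Nat.divisors_prime_pow hp, Finset.card_map, Finset.card_range]
      refine (gauss_prime_pow hp e l hl).trans ?_
      have := ih l hlt hl0
      nlinarith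
    · have : n = 1 := by omega
      subst this
      simpa using gauss_one

lemma add_one_le_mul_two_rpow (ε : ℝ) (hε : 0 < ε) :
    ∃ K : ℝ, 1 ≤ K ∧ ∀ e : ℕ, (e : ℝ) + 1 ≤ K * ((2 : ℝ) ^ e) ^ ε := by
  refine ⟨1 + 1 / (ε * Real.log 2), ?_, ?_⟩
  · have : 0 < Real.log 2 := Real.log_pos one_lt_two
    have : 0 < 1 / (ε * Real.log 2) := by positivity
    linarith
  · intro e
    have hl : 0 < Real.log 2 := Real.log_pos one_lt_two
    have h1 : ((2 : ℝ) ^ e) ^ ε = Real.exp (e * ε * Real.log 2) := by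
      rw [← Real.rpow_natCast, ← Real.rpow_mul (by norm_num), Real.rpow_def_of_pos (by norm_num)]
      congr 1; ring
    rw [h1]
    have h2 := Real.add_one_le_exp ((e : ℝ) * ε * Real.log 2)
    have h3 : (1:ℝ) ≤ Real.exp (e * ε * Real.log 2) := by
      apply Real.one_le_exp; positivity
    have h4 : (e : ℝ) ≤ 1 / (ε * Real.log 2) * Real.exp (e * ε * Real.log 2) := by
      rw [div_mul_eq_mul_div, le_div_iff₀ (by positivity)]
      nlinarith
    nlinarith

lemma divisor_bound (ε : ℝ) (hε : 0 < ε) :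
    ∃ C : ℝ, 0 < C ∧ ∀ n : ℕ, 0 < n → (n.divisors.card : ℝ) ≤ C * (n : ℝ) ^ ε := by
  obtain ⟨K, hK1, hK⟩ := add_one_le_mul_two_rpow ε hε
  obtain ⟨P, hP⟩ := exists_nat_ge ((2 : ℝ) ^ (1 / ε))
  refine ⟨K ^ P, by positivity, ?_⟩
  intro n hn
  rw [Nat.card_divisors hn.ne']
  push_cast
  have hprod : (n : ℝ) ^ ε = ∏ p ∈ n.primeFactors, (((p : ℝ) ^ (n.factorization p)) ^ ε) := by
    conv_lhs => rw [← Nat.prod_factorization_pow_eq_self hn.ne']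
    rw [Finsupp.prod, Nat.support_factorization, Real.finsetProd_rpow]
    · push_cast; rfl
    · intros; positivity
  have hle : ∏ p ∈ n.primeFactors, ((n.factorization p : ℝ) + 1) ≤
      ∏ p ∈ n.primeFactors, ((if p < P then K else 1) * ((p : ℝ) ^ (n.factorization p)) ^ ε) := by
    apply Finset.prod_le_prod
    · intros; positivity
    · intro p hp
      have hpp := Nat.prime_of_mem_primeFactors hp
      have hp2 : (2 : ℝ) ≤ p := by exact_mod_cast hpp.two_le
      split_ifs with h
      · refine (hK _).trans ?_
        gcongr
      · rw [one_mul]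
        have h1 : (2 : ℝ) ^ (1 / ε) ≤ p := hP.trans (by exact_mod_cast not_lt.1 h)
        have h2 : (2 : ℝ) ≤ (p : ℝ) ^ ε := by
          calc (2 : ℝ) = ((2 : ℝ) ^ (1 / ε)) ^ ε := by
                rw [← Real.rpow_mul (by norm_num), one_div_mul_cancel hε.ne', Real.rpow_one]
            _ ≤ _ := by gcongr
        have h3 : ((p : ℝ) ^ (n.factorization p)) ^ ε = ((p : ℝ) ^ ε) ^ (n.factorization p) := by
          rw [← Real.rpow_natCast, ← Real.rpow_natCast, ← Real.rpow_mul (by positivity),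
            ← Real.rpow_mul (by positivity), mul_comm]
        rw [h3]
        calc ((n.factorization p : ℝ) + 1) ≤ (2 : ℝ) ^ (n.factorization p) := by
              exact_mod_cast Nat.lt_two_pow_self
          _ ≤ _ := by gcongr
  refine hle.trans ?_
  rw [Finset.prod_mul_distrib, ← hprod]
  gcongr
  rw [Finset.prod_ite, Finset.prod_const, Finset.prod_const_one, mul_one]
  apply pow_le_pow_right₀ hK1
  calc _ ≤ (Finset.range P).card := Finset.card_le_card (by
        intro x hx; simp only [Finset.mem_filter] at hx; exact Finset.mem_range.2 hx.2)
    _ = P := Finset.card_range P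

lemma r2_bound (ε : ℝ) (hε : 0 < ε) :
    ∃ C : ℝ, 0 < C ∧ ∀ n : ℕ, 0 < n → (r2 n : ℝ) ≤ C * (n : ℝ) ^ ε := by
  obtain ⟨C, hC, h⟩ := divisor_bound ε hε
  refine ⟨4 * C, by positivity, fun n hn => ?_⟩
  have h1 : (r2 n : ℝ) ≤ 4 * (n.divisors.card : ℝ) := by exact_mod_cast r2_le_divisors n hn
  have := h n hn
  nlinarith

lemma sum_inv_sq_le_two (K : ℕ) : ∑ k ∈ Finset.Icc 1 K, (1 : ℝ) / (k : ℝ) ^ 2 ≤ 2 := by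
  have h : ∀ K : ℕ, ∑ k ∈ Finset.Icc 1 (K+1), (1 : ℝ) / (k : ℝ) ^ 2 ≤ 2 - 1 / ((K:ℝ)+1) := by
    intro K
    induction K with
    | zero => simp; norm_num
    | succ K ih =>
      rw [Finset.sum_Icc_succ_top (by omega)]
      have : (1:ℝ) / ((K + 1 + 1 : ℕ) : ℝ) ^ 2 ≤ 1 / ((K:ℝ)+1) - 1 / ((K:ℝ) + 1 + 1) := by
        push_cast
        rw [div_sub_div _ _ (by positivity) (by positivity), div_le_div_iff₀ (by positivity) (by positivity)]
        nlinarith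
      push_cast at this ih ⊢
      linarith
  rcases K with _ | K
  · simp
  · refine (h K).trans ?_
    have : (0:ℝ) < 1 / ((K:ℝ)+1) := by positivity
    linarith

lemma sum_multiples_inv_sq (R d : ℕ) (hd : 0 < d) :
    ∑ n ∈ (Finset.Icc 1 R).filter (fun n => d ∣ n), (1 : ℝ) / (n : ℝ) ^ 2 ≤ 2 / (d : ℝ) ^ 2 := by
  have hsub : (Finset.Icc 1 R).filter (fun n => d ∣ n) ⊆ (Finset.Icc 1 R).image (fun k => d * k) := by
    intro n hn
    simp only [Finset.mem_filter, Finset.mem_Icc] at hn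
    obtain ⟨⟨h1, h2⟩, k, rfl⟩ := hn
    simp only [Finset.mem_image, Finset.mem_Icc]
    refine ⟨k, ⟨Nat.pos_of_ne_zero (by rintro rfl; simp at h1), ?_⟩, rfl⟩
    nlinarith
  calc _ ≤ ∑ n ∈ (Finset.Icc 1 R).image (fun k => d * k), (1 : ℝ) / (n : ℝ) ^ 2 :=
        Finset.sum_le_sum_of_subset_of_nonneg hsub (by intros; positivity)
    _ = ∑ k ∈ Finset.Icc 1 R, (1 : ℝ) / ((d * k : ℕ) : ℝ) ^ 2 := by
        rw [Finset.sum_image]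
        intro a _ b _ h
        exact Nat.eq_of_mul_eq_mul_left hd h
    _ = (1 / (d:ℝ)^2) * ∑ k ∈ Finset.Icc 1 R, (1 : ℝ) / (k : ℝ) ^ 2 := by
        rw [Finset.mul_sum]
        apply Finset.sum_congr rfl
        intro k _
        push_cast
        rw [mul_pow, ← one_div_mul_one_div]
    _ ≤ (1 / (d:ℝ)^2) * 2 := by gcongr; exact sum_inv_sq_le_two R
    _ = _ := by ring

lemma log_le_harm (R : ℕ) : Real.log R ≤ ∑ n ∈ Finset.Icc 1 R, (1 : ℝ) / n := by
  rcases Nat.eq_zero_or_pos R with rfl | hR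
  · simp
  have h := log_add_one_le_harmonic R
  have h2 : Real.log R ≤ Real.log ((R:ℝ) + 1) :=
    Real.log_le_log (by exact_mod_cast hR) (by linarith)
  rw [harmonic_eq_sum_Icc] at h
  push_cast at h
  simp only [one_div]
  exact h2.trans h

lemma harm_le_log (R : ℕ) : ∑ n ∈ Finset.Icc 1 R, (1 : ℝ) / n ≤ 1 + Real.log R := by
  have h := harmonic_le_one_add_log R
  rw [harmonic_eq_sum_Icc] at h
  push_cast at h
  simp only [one_div]
  exact h

lemma sum_totient_div_sq (R : ℕ) :
    Real.log R / 2 ≤ ∑ d ∈ Finset.Icc 1 R, (Nat.totient d : ℝ) / (d : ℝ) ^ 2 := by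
  have h1 : ∑ n ∈ Finset.Icc 1 R, (1 : ℝ) / n =
      ∑ n ∈ Finset.Icc 1 R, ∑ d ∈ Finset.Icc 1 R,
        if d ∣ n then (Nat.totient d : ℝ) * (1 / (n : ℝ) ^ 2) else 0 := by
    apply Finset.sum_congr rfl
    intro n hn
    simp only [Finset.mem_Icc] at hn
    rw [← Finset.sum_filter]
    have : (Finset.Icc 1 R).filter (fun d => d ∣ n) = n.divisors := by
      ext d
      simp only [Finset.mem_filter, Finset.mem_Icc, Nat.mem_divisors]
      constructor
      · rintro ⟨_, h⟩; exact ⟨h, by omega⟩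
      · rintro ⟨h, h0⟩
        exact ⟨⟨Nat.pos_of_dvd_of_pos h (by omega), (Nat.le_of_dvd (by omega) h).trans hn.2⟩, h⟩
    rw [this, ← Finset.sum_mul]
    have h2 : ∑ d ∈ n.divisors, (Nat.totient d : ℝ) = n := by
      exact_mod_cast Nat.sum_totient n
    rw [h2]
    have : (n : ℝ) ≠ 0 := by exact_mod_cast (by omega : n ≠ 0)
    field_simp
  have h3 := log_le_harm R
  rw [h1, Finset.sum_comm] at h3
  have h4 : ∀ d ∈ Finset.Icc 1 R, (∑ n ∈ Finset.Icc 1 R,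
        if d ∣ n then (Nat.totient d : ℝ) * (1 / (n : ℝ) ^ 2) else 0) ≤
        2 * ((Nat.totient d : ℝ) / (d : ℝ) ^ 2) := by
    intro d hd
    simp only [Finset.mem_Icc] at hd
    rw [← Finset.sum_filter, ← Finset.mul_sum]
    have := sum_multiples_inv_sq R d (by omega)
    calc _ ≤ (Nat.totient d : ℝ) * (2 / (d:ℝ)^2) := by gcongr
      _ = _ := by ring
  have h5 := h3.trans (Finset.sum_le_sum h4)
  rw [← Finset.mul_sum] at h5
  linarith

/-- integer box -/
def ibox (T : ℕ) : Finset (ℤ × ℤ) := Finset.Icc (-(T:ℤ)) T ×ˢ Finset.Icc (-(T:ℤ)) T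

lemma r2_eq_box (T l : ℕ) (h : l ≤ T ^ 2) :
    r2 l = ((ibox T).filter (fun p => p.1 ^ 2 + p.2 ^ 2 = (l:ℤ))).card := by
  unfold r2
  rw [← Set.ncard_coe_finset]
  congr 1
  ext p
  simp only [Set.mem_ofPred_eq, Finset.coe_filter, ibox, Finset.mem_product, Finset.mem_Icc]
  constructor
  · intro hp
    have hl : (l:ℤ) ≤ (T:ℤ)^2 := by exact_mod_cast h
    refine ⟨⟨abs_le.1 (abs_le_of_sq_le_sq (by nlinarith [sq_nonneg p.2]) (by positivity)),
      abs_le.1 (abs_le_of_sq_le_sq (by nlinarith [sq_nonneg p.1]) (by positivity))⟩, hp⟩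
  · exact fun hp => hp.2

/-- pairs of lattice points with the same norm in [1,Z] -/
def eqPairs (T Z : ℕ) : Finset ((ℤ × ℤ) × (ℤ × ℤ)) :=
  (ibox T ×ˢ ibox T).filter (fun x => x.1.1 ^ 2 + x.1.2 ^ 2 = x.2.1 ^ 2 + x.2.2 ^ 2 ∧
    1 ≤ x.1.1 ^ 2 + x.1.2 ^ 2 ∧ x.1.1 ^ 2 + x.1.2 ^ 2 ≤ (Z : ℤ))

lemma sum_r2_sq_eq (T Z : ℕ) (h : Z ≤ T ^ 2) (f : ℤ → ℝ) :
    ∑ l ∈ Finset.Icc 1 Z, (r2 l : ℝ) ^ 2 * f l =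
      ∑ x ∈ eqPairs T Z, f (x.1.1 ^ 2 + x.1.2 ^ 2) := by
  have hmap : ∀ x ∈ eqPairs T Z, (x.1.1 ^ 2 + x.1.2 ^ 2).toNat ∈ Finset.Icc 1 Z := by
    intro x hx
    simp only [eqPairs, Finset.mem_filter] at hx
    simp only [Finset.mem_Icc]
    omega
  rw [← Finset.sum_fiberwise_of_maps_to hmap]
  apply Finset.sum_congr rfl
  intro l hl
  simp only [Finset.mem_Icc] at hl
  have h1 : (eqPairs T Z).filter (fun x => (x.1.1 ^ 2 + x.1.2 ^ 2).toNat = l) =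
      ((ibox T).filter (fun p => p.1 ^ 2 + p.2 ^ 2 = (l:ℤ))) ×ˢ
      ((ibox T).filter (fun p => p.1 ^ 2 + p.2 ^ 2 = (l:ℤ))) := by
    ext x
    simp only [eqPairs, Finset.mem_filter, Finset.mem_product]
    constructor
    · rintro ⟨⟨⟨h1, h2⟩, h3, h4, h5⟩, h6⟩
      refine ⟨⟨h1, by omega⟩, h2, by omega⟩
    · rintro ⟨⟨h1, h2⟩, h3, h4⟩
      refine ⟨⟨⟨h1, h3⟩, by omega, by omega, by omega⟩, by omega⟩
  rw [h1]
  have h2 : ∀ x ∈ ((ibox T).filter (fun p => p.1 ^ 2 + p.2 ^ 2 = (l:ℤ))) ×ˢ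
      ((ibox T).filter (fun p => p.1 ^ 2 + p.2 ^ 2 = (l:ℤ))), f (x.1.1 ^ 2 + x.1.2 ^ 2) = f l := by
    intro x hx
    simp only [Finset.mem_filter, Finset.mem_product] at hx
    rw [hx.1.2]
  rw [Finset.sum_congr rfl h2, Finset.sum_const, Finset.card_product, r2_eq_box T l (hl.2.trans h)]
  simp only [nsmul_eq_mul]
  push_cast
  ring

/-- coprime pairs (j,i) with `i<j≤V` -/
def copPairs (V : ℕ) : Finset (ℕ × ℕ) :=
  (Finset.Icc 1 V ×ˢ Finset.range V).filter (fun x => x.2 < x.1 ∧ Nat.Coprime x.1 x.2)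

def ltPairs (V : ℕ) : Finset (ℕ × ℕ) :=
  (Finset.Icc 1 V ×ˢ Finset.range V).filter (fun x => x.2 < x.1)

lemma copPairs_sum (V : ℕ) :
    Real.log V / 4 ≤ ∑ x ∈ copPairs V, (1:ℝ) / ((x.1:ℝ) ^ 2 + (x.2:ℝ) ^ 2) := by
  unfold copPairs
  rw [Finset.sum_filter, Finset.sum_product]
  have h := sum_totient_div_sq V
  have h2 : ∑ d ∈ Finset.Icc 1 V, (1/2) * ((Nat.totient d : ℝ) / (d : ℝ) ^ 2) ≤
      ∑ x ∈ Finset.Icc 1 V, ∑ y ∈ Finset.range V,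
        if y < x ∧ Nat.Coprime x y then (1:ℝ) / ((x:ℝ) ^ 2 + (y:ℝ) ^ 2) else 0 := by
    apply Finset.sum_le_sum
    intro d hd
    simp only [Finset.mem_Icc] at hd
    rw [← Finset.sum_filter]
    have hset : (Finset.range V).filter (fun y => y < d ∧ Nat.Coprime d y) =
        (Finset.range d).filter (fun y => Nat.Coprime d y) := by
      ext y
      simp only [Finset.mem_filter, Finset.mem_range]
      constructor
      · rintro ⟨_, h⟩; exact h
      · rintro h; exact ⟨by omega, h⟩
    rw [hset]
    have hd0 : (0:ℝ) < d := by exact_mod_cast hd.1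
    calc (1/2) * ((Nat.totient d : ℝ) / (d : ℝ) ^ 2)
        = ∑ y ∈ (Finset.range d).filter (fun y => Nat.Coprime d y), (1:ℝ) / (2 * (d:ℝ)^2) := by
          rw [Finset.sum_const, Nat.totient_eq_card_coprime, nsmul_eq_mul]
          field_simp
      _ ≤ _ := by
          apply Finset.sum_le_sum
          intro y hy
          simp only [Finset.mem_filter, Finset.mem_range] at hy
          have : (y:ℝ) ≤ d := by exact_mod_cast hy.1.le
          apply one_div_le_one_div_of_le (by positivity)
          have : (y:ℝ)^2 ≤ (d:ℝ)^2 := by gcongr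
          linarith
  rw [← Finset.mul_sum] at h2
  linarith

lemma ltPairs_sum (V : ℕ) :
    Real.log V / 4 ≤ ∑ x ∈ ltPairs V, (1:ℝ) / ((x.1:ℝ) ^ 2 + (x.2:ℝ) ^ 2) := by
  refine (copPairs_sum V).trans ?_
  apply Finset.sum_le_sum_of_subset_of_nonneg
  · intro x hx
    simp only [copPairs, ltPairs, Finset.mem_filter] at hx ⊢
    exact ⟨hx.1, hx.2.1⟩
  · intros; positivity

lemma sq_box {a b Z : ℤ} (h : a ^ 2 + b ^ 2 ≤ Z) : (-Z ≤ a ∧ a ≤ Z) ∧ (-Z ≤ b ∧ b ≤ Z) := by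
  refine ⟨⟨?_, ?_⟩, ?_, ?_⟩ <;> nlinarith [sq_nonneg (a+1), sq_nonneg (a-1), sq_nonneg (b+1), sq_nonneg (b-1), sq_nonneg a, sq_nonneg b]

set_option maxHeartbeats 1000000 in
lemma sum_r2_sq_lower_aux (V Z : ℕ) (h : 4 * V ^ 4 ≤ Z) :
    (Real.log V / 4) ^ 2 ≤ ∑ l ∈ Finset.Icc 1 Z, (r2 l : ℝ) ^ 2 / l := by
  have h0 : ∑ l ∈ Finset.Icc 1 Z, (r2 l : ℝ) ^ 2 / l =
      ∑ l ∈ Finset.Icc 1 Z, (r2 l : ℝ) ^ 2 * (fun t : ℤ => (1:ℝ) / (t:ℝ)) l := by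
    apply Finset.sum_congr rfl
    intro l _
    simp only [Int.cast_natCast]
    ring
  have hZT : Z ≤ Z ^ 2 := by nlinarith [Nat.zero_le Z, sq_nonneg ((Z:ℤ) - 1), Nat.le_self_pow (n := 2) (by norm_num) Z]
  refine le_trans ?_ (h0.trans (sum_r2_sq_eq Z Z hZT (fun t : ℤ => (1:ℝ) / (t:ℝ)))).ge
  let g : (ℕ × ℕ) × (ℕ × ℕ) → (ℤ × ℤ) × (ℤ × ℤ) := fun x =>
    (((x.1.1:ℤ) * x.2.1 + x.1.2 * x.2.2, (x.1.2:ℤ) * x.2.1 - x.1.1 * x.2.2),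
     ((x.1.1:ℤ) * x.2.1 - x.1.2 * x.2.2, (x.1.2:ℤ) * x.2.1 + x.1.1 * x.2.2))
  have hg1 : ∀ x, (g x).1.1 ^ 2 + (g x).1.2 ^ 2 =
      ((x.1.1:ℤ)^2 + (x.1.2:ℤ)^2) * ((x.2.1:ℤ)^2 + (x.2.2:ℤ)^2) := by
    intro x; simp only [g]; ring
  have hg2 : ∀ x, (g x).2.1 ^ 2 + (g x).2.2 ^ 2 =
      ((x.1.1:ℤ)^2 + (x.1.2:ℤ)^2) * ((x.2.1:ℤ)^2 + (x.2.2:ℤ)^2) := by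
    intro x; simp only [g]; ring
  have hinj : Set.InjOn g (copPairs V ×ˢ ltPairs V : Finset _) := by
    rintro ⟨⟨j, i⟩, ⟨h, k⟩⟩ hx ⟨⟨j', i'⟩, ⟨h', k'⟩⟩ hx' hgg
    simp only [copPairs, ltPairs, Finset.coe_product, Set.mem_prod, Finset.mem_coe,
      Finset.mem_filter, Finset.mem_product, Finset.mem_Icc, Finset.mem_range] at hx hx'
    simp only [g, Prod.mk.injEq] at hgg
    obtain ⟨⟨e1, e2⟩, e3, e4⟩ := hgg
    have q1 : (j * h : ℤ) = j' * h' := by linarith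
    have q2 : (i * h : ℤ) = i' * h' := by linarith
    have q3 : (j * k : ℤ) = j' * k' := by linarith
    have q1' : j * h = j' * h' := by exact_mod_cast q1
    have q2' : i * h = i' * h' := by exact_mod_cast q2
    have q3' : j * k = j' * k' := by exact_mod_cast q3
    have hh : h = h' := by
      have a1 : Nat.gcd (j * h) (i * h) = h := by
        rw [Nat.gcd_mul_right, hx.1.2.2, one_mul]
      have a2 : Nat.gcd (j' * h') (i' * h') = h' := by
        rw [Nat.gcd_mul_right, hx'.1.2.2, one_mul]
      rw [← a1, ← a2, q1', q2']
    subst hh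
    have hpos : 0 < h := hx.2.1.1.1
    have hj : j = j' := Nat.eq_of_mul_eq_mul_right hpos q1'
    have hi : i = i' := Nat.eq_of_mul_eq_mul_right hpos q2'
    subst hj hi
    have hk : k = k' := Nat.eq_of_mul_eq_mul_left hx.1.1.1.1 q3'
    subst hk
    rfl
  have hsub : (copPairs V ×ˢ ltPairs V).image g ⊆ eqPairs Z Z := by
    intro y hy
    rw [Finset.mem_image] at hy
    obtain ⟨x, hx, rfl⟩ := hy
    have hn1 := hg1 x
    have hn2 := hg2 x
    simp only [copPairs, ltPairs, Finset.mem_filter, Finset.mem_product, Finset.mem_Icc,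
      Finset.mem_range] at hx
    obtain ⟨⟨⟨⟨a1, a2⟩, a3⟩, a4, a5⟩, ⟨⟨b1, b2⟩, b3⟩, b4⟩ := hx
    have c1 : (1:ℤ) ≤ (x.1.1:ℤ)^2 + (x.1.2:ℤ)^2 := by
      have : (1:ℤ) ≤ x.1.1 := by exact_mod_cast a1
      nlinarith [sq_nonneg (x.1.2:ℤ)]
    have c2 : (1:ℤ) ≤ (x.2.1:ℤ)^2 + (x.2.2:ℤ)^2 := by
      have : (1:ℤ) ≤ x.2.1 := by exact_mod_cast b1
      nlinarith [sq_nonneg (x.2.2:ℤ)]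
    have d1 : (x.1.1:ℤ)^2 + (x.1.2:ℤ)^2 ≤ 2 * (V:ℤ)^2 := by
      have e1 : (x.1.1:ℤ) ≤ V := by exact_mod_cast a2
      have e2 : (x.1.2:ℤ) ≤ V := by exact_mod_cast a3.le
      have e3 : (x.1.1:ℤ)^2 ≤ (V:ℤ)^2 := by gcongr
      have e4 : (x.1.2:ℤ)^2 ≤ (V:ℤ)^2 := by gcongr
      linarith
    have d2 : (x.2.1:ℤ)^2 + (x.2.2:ℤ)^2 ≤ 2 * (V:ℤ)^2 := by
      have e1 : (x.2.1:ℤ) ≤ V := by exact_mod_cast b2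
      have e2 : (x.2.2:ℤ) ≤ V := by exact_mod_cast b3.le
      have e3 : (x.2.1:ℤ)^2 ≤ (V:ℤ)^2 := by gcongr
      have e4 : (x.2.2:ℤ)^2 ≤ (V:ℤ)^2 := by gcongr
      linarith
    have hZ : ((x.1.1:ℤ)^2 + (x.1.2:ℤ)^2) * ((x.2.1:ℤ)^2 + (x.2.2:ℤ)^2) ≤ Z := by
      calc _ ≤ (2 * (V:ℤ)^2) * (2 * (V:ℤ)^2) := by gcongr
        _ = 4 * (V:ℤ)^4 := by ring
        _ ≤ Z := by exact_mod_cast h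
    have hone : 1 ≤ ((x.1.1:ℤ)^2 + (x.1.2:ℤ)^2) * ((x.2.1:ℤ)^2 + (x.2.2:ℤ)^2) := by nlinarith
    simp only [eqPairs, Finset.mem_filter, Finset.mem_product, ibox, Finset.mem_Icc]
    refine ⟨⟨⟨⟨?_, ?_⟩, ?_, ?_⟩, ⟨?_, ?_⟩, ?_, ?_⟩, by rw [hn1, hn2], by rw [hn1]; exact hone, by rw [hn1]; exact hZ⟩
    · exact (sq_box (hn1.le.trans hZ)).1.1
    · exact (sq_box (hn1.le.trans hZ)).1.2
    · exact (sq_box (hn1.le.trans hZ)).2.1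
    · exact (sq_box (hn1.le.trans hZ)).2.2
    · exact (sq_box (hn2.le.trans hZ)).1.1
    · exact (sq_box (hn2.le.trans hZ)).1.2
    · exact (sq_box (hn2.le.trans hZ)).2.1
    · exact (sq_box (hn2.le.trans hZ)).2.2
  have hlog : 0 ≤ Real.log V := Real.log_natCast_nonneg V
  calc (Real.log V / 4) ^ 2 ≤ (∑ x ∈ copPairs V, (1:ℝ) / ((x.1:ℝ) ^ 2 + (x.2:ℝ) ^ 2)) *
        (∑ x ∈ ltPairs V, (1:ℝ) / ((x.1:ℝ) ^ 2 + (x.2:ℝ) ^ 2)) := by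
        rw [sq]
        exact mul_le_mul (copPairs_sum V) (ltPairs_sum V) (by positivity)
          (Finset.sum_nonneg (by intros; positivity))
    _ = ∑ x ∈ copPairs V ×ˢ ltPairs V, (1:ℝ) / (((g x).1.1 ^ 2 + (g x).1.2 ^ 2 : ℤ) : ℝ) := by
        rw [Finset.sum_mul_sum, Finset.sum_product]
        apply Finset.sum_congr rfl; intro a _
        apply Finset.sum_congr rfl; intro b _
        rw [hg1]
        push_cast
        rw [one_div_mul_one_div]
    _ = ∑ y ∈ (copPairs V ×ˢ ltPairs V).image g, (1:ℝ) / ((y.1.1 ^ 2 + y.1.2 ^ 2 : ℤ) : ℝ) := by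
        rw [Finset.sum_image hinj]
    _ ≤ _ := by
        apply Finset.sum_le_sum_of_subset_of_nonneg hsub
        intro y _ _
        have : (0:ℤ) ≤ y.1.1 ^ 2 + y.1.2 ^ 2 := by positivity
        have : (0:ℝ) ≤ ((y.1.1 ^ 2 + y.1.2 ^ 2 : ℤ) : ℝ) := by exact_mod_cast this
        positivity

lemma r2_one_pos : 1 ≤ r2 1 := by
  rw [r2_eq_box 1 1 (by norm_num)]
  apply Finset.card_pos.2
  exact ⟨(1, 0), by simp [ibox]⟩

/-- `Σ_{l≤Z} r₂(l)²/l ≥ c log² Z`. -/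
lemma sum_r2_sq_lower : ∃ c : ℝ, 0 < c ∧ ∀ Z : ℕ, 1 ≤ Z →
    c * (Real.log Z) ^ 2 ≤ ∑ l ∈ Finset.Icc 1 Z, (r2 l : ℝ) ^ 2 / l := by
  -- take V = ⌊(Z/4)^{1/4}⌋
  set L := Real.log 1024 with hL
  have hLpos : 0 < L := Real.log_pos (by norm_num)
  refine ⟨min (1/(L+1)^2) (1/6400), by positivity, fun Z hZ => ?_⟩
  have hZ0 : (0:ℝ) < Z := by exact_mod_cast hZ
  have hlogZ : 0 ≤ Real.log Z := Real.log_natCast_nonneg Z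
  by_cases hb : Z ≤ 1024
  · have h1 : (1:ℝ) ≤ ∑ l ∈ Finset.Icc 1 Z, (r2 l : ℝ) ^ 2 / l := by
      have := Finset.single_le_sum (f := fun l : ℕ => (r2 l : ℝ) ^ 2 / l) (s := Finset.Icc 1 Z)
        (by intros; positivity) (Finset.mem_Icc.2 ⟨le_refl 1, hZ⟩)
      refine le_trans ?_ this
      have h3 : (1:ℝ) ≤ r2 1 := by exact_mod_cast r2_one_pos
      simp only [Nat.cast_one, div_one]
      nlinarith
    refine le_trans ?_ h1
    have h2 : Real.log Z ≤ L := Real.log_le_log hZ0 (by exact_mod_cast hb)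
    calc _ ≤ (1/(L+1)^2) * (L+1)^2 := by
          gcongr
          · exact min_le_left _ _
          · linarith
      _ = 1 := by field_simp
  · push Not at hb
    set V := ⌊((Z:ℝ)/4) ^ ((1:ℝ)/4)⌋₊ with hV
    have hx0 : (0:ℝ) ≤ ((Z:ℝ)/4) ^ ((1:ℝ)/4) := by positivity
    have hx4 : (((Z:ℝ)/4) ^ ((1:ℝ)/4)) ^ 4 = (Z:ℝ)/4 := by
      rw [← Real.rpow_natCast, ← Real.rpow_mul (by positivity)]; norm_num
    have hVle : (V:ℝ) ≤ ((Z:ℝ)/4) ^ ((1:ℝ)/4) := Nat.floor_le hx0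
    have hVZ : 4 * V ^ 4 ≤ Z := by
      have : (4:ℝ) * (V:ℝ)^4 ≤ Z := by
        have : (V:ℝ)^4 ≤ (((Z:ℝ)/4) ^ ((1:ℝ)/4))^4 := by gcongr
        rw [hx4] at this; linarith
      exact_mod_cast this
    refine le_trans ?_ (sum_r2_sq_lower_aux V Z hVZ)
    have hx2 : 2 ≤ ((Z:ℝ)/4) ^ ((1:ℝ)/4) := by
      by_contra hc
      push Not at hc
      have : (((Z:ℝ)/4) ^ ((1:ℝ)/4))^4 < 2^4 := by gcongr
      rw [hx4] at this
      have : (1024:ℝ) < Z := by exact_mod_cast hb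
      linarith
    have hVge : ((Z:ℝ)/4) ^ ((1:ℝ)/4) / 2 ≤ V := by
      have := Nat.lt_floor_add_one (((Z:ℝ)/4) ^ ((1:ℝ)/4))
      rw [← hV] at this
      linarith
    have hlV : Real.log Z / 20 ≤ Real.log V := by
      have h1 : Real.log (((Z:ℝ)/4) ^ ((1:ℝ)/4) / 2) ≤ Real.log V :=
        Real.log_le_log (by linarith) hVge
      rw [Real.log_div (by linarith) (by norm_num), Real.log_rpow (by positivity),
        Real.log_div hZ0.ne' (by norm_num)] at h1
      have h2 : Real.log 4 = 2 * Real.log 2 := by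
        rw [show (4:ℝ) = 2^2 by norm_num, Real.log_pow]; norm_num
      have h3 : 10 * Real.log 2 ≤ Real.log Z := by
        have : L = 10 * Real.log 2 := by
          rw [hL, show (1024:ℝ) = 2^10 by norm_num, Real.log_pow]; norm_num
        rw [← this]
        exact Real.log_le_log (by norm_num) (by exact_mod_cast hb.le)
      have h4 : 0 < Real.log 2 := Real.log_pos one_lt_two
      linarith
    calc _ ≤ (1/6400) * (Real.log Z)^2 := by gcongr; exact min_le_right _ _
      _ = (Real.log Z / 20 / 4)^2 := by ring
      _ ≤ _ := by gcongr

/-- parametrized quadruples -/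
def quadPar (U : ℕ) : Finset (Σ _ : ℕ, ℤ × ℤ × ℤ) :=
  (Finset.Icc 1 U).sigma (fun p => Finset.Icc (-(p:ℤ)) p ×ˢ
    (Finset.Icc (-((U / p : ℕ):ℤ)) ((U/p : ℕ):ℤ) ×ˢ Finset.Icc (-((U / p : ℕ):ℤ)) ((U/p : ℕ):ℤ)))

lemma card_quadPar (U : ℕ) : ((quadPar U).card : ℝ) ≤ 27 * (U:ℝ)^2 * (1 + Real.log U) := by
  unfold quadPar
  rw [Finset.card_sigma, Nat.cast_sum]
  calc _ ≤ ∑ p ∈ Finset.Icc 1 U, 27 * (U:ℝ)^2 * ((1:ℝ) / p) := by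
        apply Finset.sum_le_sum
        intro p hp
        simp only [Finset.mem_Icc] at hp
        simp only [Finset.card_product, Int.card_Icc]
        have e1 : ((p:ℤ) + 1 - -(p:ℤ)).toNat = 2 * p + 1 := by omega
        have e2 : (((U / p : ℕ):ℤ) + 1 - -((U / p : ℕ):ℤ)).toNat = 2 * (U/p) + 1 := by omega
        rw [e1, e2]
        have hp0 : (1:ℝ) ≤ p := by exact_mod_cast hp.1
        have hU : (p:ℝ) ≤ U := by exact_mod_cast hp.2
        have h1 : ((U / p : ℕ) : ℝ) ≤ (U:ℝ) / p := Nat.cast_div_le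
        have h2 : (1:ℝ) ≤ (U:ℝ)/p := by rw [le_div_iff₀ (by linarith)]; linarith
        push_cast
        calc (2 * (p:ℝ) + 1) * ((2 * ((U / p : ℕ) : ℝ) + 1) * (2 * ((U / p : ℕ) : ℝ) + 1))
            ≤ (3 * (p:ℝ)) * ((3 * ((U:ℝ)/p)) * (3 * ((U:ℝ)/p))) := by
              gcongr <;> linarith
          _ = _ := by field_simp; ring
    _ = 27 * (U:ℝ)^2 * ∑ p ∈ Finset.Icc 1 U, (1:ℝ) / p := by rw [Finset.mul_sum]
    _ ≤ _ := by gcongr; exact harm_le_log U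

def quadMap (x : Σ _ : ℕ, ℤ × ℤ × ℤ) : (ℤ × ℤ) × (ℤ × ℤ) :=
  ((x.2.2.1 * x.1, x.2.1 * x.2.2.2), (x.2.2.1 * x.2.1, x.1 * x.2.2.2))

lemma quad_param (U : ℕ) (p q r s : ℤ) (h : p * q = r * s) (hp : p ≠ 0) (hrp : |r| ≤ |p|)
    (hpU : |p| ≤ U) (hq : |q| ≤ U) (hs : |s| ≤ U) :
    ((p, q), (r, s)) ∈ (quadPar U).image quadMap := by
  -- choose g with sign so that p = g * p', p' > 0
  obtain ⟨g0, p0, r0, hg0, hcop, hpe, hre⟩ : ∃ g p' r' : ℤ, 0 < g ∧ IsCoprime p' r' ∧ p = p' * g ∧ r = r' * g := by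
    have hg : 0 < Int.gcd p r := Int.gcd_pos_of_ne_zero_left r hp
    obtain ⟨a, b, h1, h2, h3⟩ := Int.exists_gcd_one hg
    exact ⟨Int.gcd p r, a, b, by exact_mod_cast hg, Int.isCoprime_iff_gcd_eq_one.2 h1, h2, h3⟩
  obtain ⟨g, p', r', hp'0, hcop, hpe, hre⟩ : ∃ g p' r' : ℤ, 0 < p' ∧ IsCoprime p' r' ∧ p = p' * g ∧ r = r' * g := by
    rcases lt_trichotomy p0 0 with h0 | h0 | h0
    · exact ⟨-g0, -p0, -r0, by linarith, hcop.neg_neg, by rw [hpe]; ring, by rw [hre]; ring⟩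
    · exfalso; apply hp; rw [hpe, h0]; ring
    · exact ⟨g0, p0, r0, h0, hcop, hpe, hre⟩
  have hgne : g ≠ 0 := by rintro rfl; apply hp; rw [hpe]; ring
  have h2 : p' * q = r' * s := by
    have : g * (p' * q) = g * (r' * s) := by rw [hpe, hre] at h; linarith
    exact mul_left_cancel₀ hgne this
  have h3 : p' ∣ s := hcop.dvd_of_dvd_mul_left (Dvd.intro q h2)
  obtain ⟨t, rfl⟩ := h3
  have h4 : q = r' * t := by
    have : p' * q = p' * (r' * t) := by rw [h2]; ring
    exact mul_left_cancel₀ hp'0.ne' this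
  subst h4
  obtain ⟨P, rfl⟩ : ∃ P : ℕ, p' = P := ⟨p'.toNat, by omega⟩
  have hPpos : 0 < P := by exact_mod_cast hp'0
  have hg1 : 1 ≤ |g| := Int.one_le_abs hgne
  rw [hpe, abs_mul, Nat.abs_cast] at hpU
  rw [hpe, hre, abs_mul, abs_mul, Nat.abs_cast] at hrp
  rw [abs_mul, Nat.abs_cast] at hs
  have hr' : |r'| ≤ P := le_of_mul_le_mul_right hrp (by linarith)
  have hgU : |g| ≤ ((U / P : ℕ):ℤ) := by
    rw [Int.natCast_div, Int.le_ediv_iff_mul_le hp'0]; linarith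
  have htU : |t| ≤ ((U / P : ℕ):ℤ) := by
    rw [Int.natCast_div, Int.le_ediv_iff_mul_le hp'0]; linarith
  have hPU : P ≤ U := by
    have : (P:ℤ) ≤ U := by nlinarith
    exact_mod_cast this
  rw [Finset.mem_image]
  refine ⟨⟨P, r', g, t⟩, ?_, ?_⟩
  · simp only [quadPar, Finset.mem_sigma, Finset.mem_product, Finset.mem_Icc]
    exact ⟨⟨hPpos, hPU⟩, abs_le.1 hr', abs_le.1 hgU, abs_le.1 htU⟩
  · simp only [quadMap, hpe, hre]
    ring_nf

lemma card_eqPairs (T Z : ℕ) : ((eqPairs T Z).card : ℝ) ≤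
    2 * (27 * ((2*T:ℕ):ℝ)^2 * (1 + Real.log ((2*T:ℕ):ℝ))) + (2*((2*T:ℕ):ℝ)+1)^2 := by
  set U := 2 * T with hU
  let g : (ℤ × ℤ) × (ℤ × ℤ) → (ℤ × ℤ) × (ℤ × ℤ) := fun x =>
    ((x.1.1 - x.2.1, x.1.1 + x.2.1), (x.2.2 - x.1.2, x.2.2 + x.1.2))
  have hinj : Function.Injective g := by
    rintro ⟨⟨a, b⟩, c, d⟩ ⟨⟨a', b'⟩, c', d'⟩ h
    simp only [g, Prod.mk.injEq] at h ⊢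
    omega
  let sw : (ℤ × ℤ) × (ℤ × ℤ) → (ℤ × ℤ) × (ℤ × ℤ) := fun x => (x.2, x.1)
  let zz : ℤ × ℤ → (ℤ × ℤ) × (ℤ × ℤ) := fun x => ((0, x.1), (0, x.2))
  have hsub : (eqPairs T Z).image g ⊆ ((quadPar U).image quadMap ∪
      ((quadPar U).image quadMap).image sw) ∪ (ibox U).image zz := by
    intro y hy
    rw [Finset.mem_image] at hy
    obtain ⟨⟨⟨a, b⟩, c, d⟩, hx, rfl⟩ := hy
    simp only [eqPairs, Finset.mem_filter, Finset.mem_product, ibox, Finset.mem_Icc] at hx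
    obtain ⟨⟨⟨⟨a1, a2⟩, b1, b2⟩, ⟨c1, c2⟩, d1, d2⟩, heq, -⟩ := hx
    have hpq : (a - c) * (a + c) = (d - b) * (d + b) := by nlinarith
    have k1 : |a - c| ≤ (U:ℤ) := abs_le.2 ⟨by push_cast [hU]; omega, by push_cast [hU]; omega⟩
    have k2 : |a + c| ≤ (U:ℤ) := abs_le.2 ⟨by push_cast [hU]; omega, by push_cast [hU]; omega⟩
    have k3 : |d - b| ≤ (U:ℤ) := abs_le.2 ⟨by push_cast [hU]; omega, by push_cast [hU]; omega⟩
    have k4 : |d + b| ≤ (U:ℤ) := abs_le.2 ⟨by push_cast [hU]; omega, by push_cast [hU]; omega⟩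
    simp only [g, Finset.mem_union]
    by_cases h0 : a - c = 0 ∧ d - b = 0
    · right
      rw [Finset.mem_image]
      refine ⟨(a + c, d + b), ?_, ?_⟩
      · simp only [ibox, Finset.mem_product, Finset.mem_Icc]
        exact ⟨abs_le.1 k2, abs_le.1 k4⟩
      · simp only [zz]; rw [h0.1, h0.2]
    · left
      rcases le_total |d - b| |a - c| with h | h
      · left
        apply quad_param U _ _ _ _ hpq _ h k1 k2 k4
        intro h1
        rw [h1, abs_zero] at h
        exact h0 ⟨h1, abs_nonpos_iff.1 h⟩
      · right
        rw [Finset.mem_image]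
        refine ⟨((d - b, d + b), (a - c, a + c)), ?_, rfl⟩
        apply quad_param U _ _ _ _ hpq.symm _ h k3 k4 k2
        intro h1
        rw [h1, abs_zero] at h
        exact h0 ⟨abs_nonpos_iff.1 h, h1⟩
  have hc : (eqPairs T Z).card ≤ (quadPar U).card + (quadPar U).card + (ibox U).card := by
    rw [← Finset.card_image_of_injective _ hinj]
    refine (Finset.card_le_card hsub).trans ((Finset.card_union_le _ _).trans ?_)
    refine Nat.add_le_add ((Finset.card_union_le _ _).trans (Nat.add_le_add Finset.card_image_le
      (Finset.card_image_le.trans Finset.card_image_le))) Finset.card_image_le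
  have hb : (ibox U).card = (2 * U + 1)^2 := by
    simp only [ibox, Finset.card_product, Int.card_Icc]
    have e1 : ((U:ℤ) + 1 - -(U:ℤ)).toNat = 2 * U + 1 := by omega
    rw [e1]; ring
  have hc' : ((eqPairs T Z).card : ℝ) ≤ (quadPar U).card + (quadPar U).card + (2*(U:ℝ)+1)^2 := by
    rw [hb] at hc; exact_mod_cast hc
  have := card_quadPar U
  linarith

/-- `Σ_{l≤Z} r₂(l)² ≤ C Z (1+log Z)`. -/
lemma sum_r2_sq_upper : ∃ C : ℝ, 0 < C ∧ ∀ Z : ℕ, 1 ≤ Z →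
    ∑ l ∈ Finset.Icc 1 Z, (r2 l : ℝ) ^ 2 ≤ C * Z * (1 + Real.log Z) := by
  refine ⟨5000, by norm_num, fun Z hZ => ?_⟩
  set T := Nat.sqrt Z + 1 with hT
  have h1 : Z ≤ T^2 := by
    have := Nat.lt_succ_sqrt Z
    rw [sq]; exact this.le
  have h2 := sum_r2_sq_eq T Z h1 (fun _ => 1)
  simp only [mul_one, Finset.sum_const, nsmul_eq_mul] at h2
  rw [h2]
  refine (card_eqPairs T Z).trans ?_
  have hs1 : 1 ≤ Nat.sqrt Z := Nat.le_sqrt.2 (by omega)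
  have hs : (Nat.sqrt Z)^2 ≤ Z := by rw [sq]; exact Nat.sqrt_le Z
  have hT4 : (T:ℝ)^2 ≤ 4 * Z := by
    have : T^2 ≤ 4 * Z := by rw [hT]; nlinarith
    exact_mod_cast this
  have hZ1 : (1:ℝ) ≤ Z := by exact_mod_cast hZ
  have hT1 : (1:ℝ) ≤ T := by rw [hT]; push_cast; linarith [Nat.cast_nonneg (α := ℝ) (Nat.sqrt Z)]
  have hlZ : 0 ≤ Real.log Z := Real.log_nonneg hZ1
  have hlog : 1 + Real.log ((2*T:ℕ):ℝ) ≤ 3 * (1 + Real.log Z) := by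
    have e : 2 * Real.log ((2*T:ℕ):ℝ) ≤ 4 * Real.log 2 + Real.log Z := by
      have : Real.log (((2*T:ℕ):ℝ)^2) ≤ Real.log (2^4 * Z) := by
        apply Real.log_le_log (by push_cast; positivity)
        push_cast; nlinarith
      rw [Real.log_pow, Real.log_mul (by norm_num) (by linarith), Real.log_pow] at this
      push_cast at this ⊢
      linarith
    have := Real.log_two_lt_d9
    linarith
  have hA : ((2*T:ℕ):ℝ)^2 ≤ 16 * Z := by push_cast; nlinarith
  have hB : (2*((2*T:ℕ):ℝ)+1)^2 ≤ 100 * Z := by push_cast; nlinarith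
  have hlog0 : 0 ≤ 1 + Real.log ((2*T:ℕ):ℝ) := by
    have := Real.log_natCast_nonneg (2*T)
    linarith
  calc _ ≤ 2 * (27 * (16 * (Z:ℝ)) * (3 * (1 + Real.log Z))) + 100 * Z := by gcongr
    _ ≤ _ := by nlinarith [mul_nonneg (by linarith : (0:ℝ) ≤ Z) hlZ]

section gap
open Polynomial

/-- multiset of all signed sums of square roots -/
def signSums : List ℕ → Multiset ℝ
  | [] => {0}
  | l :: L => (signSums L).map (fun r => r + √(l:ℝ)) + (signSums L).map (fun r => r - √(l:ℝ))

lemma shift_decomp (t : ℝ) (k : ℤ) (ht : t ^ 2 = k) (p : ℤ[X]) :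
    ∃ A B : ℤ[X], (p.map (Int.castRingHom ℝ)).comp (X + C t) =
        A.map (Int.castRingHom ℝ) + C t * B.map (Int.castRingHom ℝ) ∧
      (p.map (Int.castRingHom ℝ)).comp (X - C t) =
        A.map (Int.castRingHom ℝ) - C t * B.map (Int.castRingHom ℝ) := by
  have hpow : ∀ n : ℕ, ∃ A B : ℤ[X], (X + C t)^n =
        A.map (Int.castRingHom ℝ) + C t * B.map (Int.castRingHom ℝ) ∧
      (X - C t)^n = A.map (Int.castRingHom ℝ) - C t * B.map (Int.castRingHom ℝ) := by
    intro n
    induction n with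
    | zero => exact ⟨1, 0, by simp, by simp⟩
    | succ n ih =>
      obtain ⟨A, B, h1, h2⟩ := ih
      have ht' : (C t : ℝ[X]) * C t = C (k:ℝ) := by rw [← C_mul, ← sq, ht]
      refine ⟨A * X + C k * B, A + B * X, ?_, ?_⟩
      · rw [pow_succ, h1]
        simp only [Polynomial.map_add, Polynomial.map_mul, map_X, map_C]
        simp only [eq_intCast]
        linear_combination (B.map (Int.castRingHom ℝ)) * ht'
      · rw [pow_succ, h2]
        simp only [Polynomial.map_add, Polynomial.map_mul, map_X, map_C]
        simp only [eq_intCast]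
        linear_combination (B.map (Int.castRingHom ℝ)) * ht'
  induction p using Polynomial.induction_on' with
  | add p q hp hq =>
    obtain ⟨A, B, h1, h2⟩ := hp
    obtain ⟨A', B', h1', h2'⟩ := hq
    refine ⟨A + A', B + B', ?_, ?_⟩
    · simp only [Polynomial.map_add, add_comp, h1, h1']; ring
    · simp only [Polynomial.map_add, add_comp, h2, h2']; ring
  | monomial n a =>
    obtain ⟨A, B, h1, h2⟩ := hpow n
    refine ⟨C a * A, C a * B, ?_, ?_⟩
    · simp only [map_monomial, monomial_comp, h1, Polynomial.map_mul, map_C]; ring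
    · simp only [map_monomial, monomial_comp, h2, Polynomial.map_mul, map_C]; ring

lemma prod_comp_shift (S : Multiset ℝ) (t : ℝ) :
    ((S.map (fun r => X - C r)).prod).comp (X - C t) =
      ((S.map (fun r => r + t)).map (fun r => X - C r)).prod := by
  induction S using Multiset.induction_on with
  | empty => simp
  | cons a S ih =>
    simp only [Multiset.map_cons, Multiset.prod_cons, mul_comp, ih]
    simp only [sub_comp, X_comp, C_comp, C_add]
    ring

lemma signSums_poly (L : List ℕ) : ∃ q : ℤ[X],
    ((signSums L).map (fun r => X - C r)).prod = q.map (Int.castRingHom ℝ) := by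
  induction L with
  | nil => exact ⟨X, by simp [signSums]⟩
  | cons l L ih =>
    obtain ⟨q, hq⟩ := ih
    have ht : (√(l:ℝ))^2 = ((l:ℤ):ℝ) := by rw [Real.sq_sqrt (by positivity)]; simp
    obtain ⟨A, B, h1, h2⟩ := shift_decomp (√(l:ℝ)) l ht q
    refine ⟨A^2 - C (l:ℤ) * B^2, ?_⟩
    have e2 := prod_comp_shift (signSums L) (√(l:ℝ))
    have e1 := prod_comp_shift (signSums L) (-√(l:ℝ))
    rw [C_neg, sub_neg_eq_add] at e1
    simp only [signSums, Multiset.map_add, Multiset.prod_add]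
    simp only [← sub_eq_add_neg] at e1
    rw [← e1, ← e2, hq, h1, h2]
    have ht' : (C (√(l:ℝ)) : ℝ[X]) * C (√(l:ℝ)) = C (l:ℝ) := by rw [← C_mul, ← sq, ht]; simp
    simp only [Polynomial.map_sub, Polynomial.map_mul, Polynomial.map_pow, map_C]
    simp only [eq_intCast, Int.cast_natCast]
    linear_combination (-(B.map (Int.castRingHom ℝ))^2) * ht'

lemma one_le_prod_of_poly (S : Multiset ℝ) (q : ℤ[X])
    (h : (S.map (fun r => X - C r)).prod = q.map (Int.castRingHom ℝ)) :
    1 ≤ |(S.filter (fun r => r ≠ 0)).prod| := by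
  have hsplit : S = S.filter (fun r => r ≠ 0) + S.filter (fun r => ¬ (r ≠ 0)) :=
    (Multiset.filter_add_not _ _).symm
  set S1 := S.filter (fun r => r ≠ 0) with hS1
  set S0 := S.filter (fun r => ¬ (r ≠ 0)) with hS0
  have h0 : (S0.map (fun r => X - C r)).prod = (X : ℝ[X])^(Multiset.card S0) := by
    have : S0.map (fun r => (X : ℝ[X]) - C r) = Multiset.replicate (Multiset.card S0) X := by
      rw [Multiset.eq_replicate]
      refine ⟨by simp, ?_⟩
      intro b hb
      rw [Multiset.mem_map] at hb
      obtain ⟨r, hr, rfl⟩ := hb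
      simp only [hS0, Multiset.mem_filter, not_not] at hr
      rw [hr.2]; simp
    rw [this, Multiset.prod_replicate]
  rw [hsplit, Multiset.map_add, Multiset.prod_add, h0] at h
  have hc := congrArg (fun p => coeff p (Multiset.card S0)) h
  simp only [coeff_map] at hc
  have hc2 : ((S1.map (fun r => X - C r)).prod * X ^ (Multiset.card S0)).coeff (Multiset.card S0) =
      ((S1.map (fun r => (X:ℝ[X]) - C r)).prod).eval 0 := by
    have := coeff_mul_X_pow (S1.map (fun r => (X:ℝ[X]) - C r)).prod (Multiset.card S0) 0
    rw [zero_add] at this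
    rw [this, coeff_zero_eq_eval_zero]
  rw [hc2, eval_multiset_prod, Multiset.map_map] at hc
  have h3 : |(S1.map (eval 0 ∘ fun r => (X:ℝ[X]) - C r)).prod| = |S1.prod| := by
    have : (eval 0 ∘ fun r => (X:ℝ[X]) - C r) = fun r => -r := by
      ext r; simp
    rw [this, Multiset.prod_map_neg, abs_mul, abs_pow, abs_neg, abs_one, one_pow, one_mul]
  have hne : S1.prod ≠ 0 := by
    apply Multiset.prod_ne_zero
    simp [hS1]
  rw [← h3, hc, eq_intCast, ← Int.cast_abs]
  have : (q.coeff (Multiset.card S0)) ≠ 0 := by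
    intro h5
    rw [h5] at hc
    rw [hc] at h3
    simp at h3
    exact hne (abs_eq_zero.1 h3.symm)
  exact_mod_cast Int.one_le_abs this

lemma multiset_gap (S : Multiset ℝ) (B : ℝ) (hB : 1 ≤ B) (hS : ∀ r ∈ S, |r| ≤ B)
    (h1 : 1 ≤ |S.prod|) (a : ℝ) (ha : a ∈ S) : 1 ≤ |a| * B ^ (Multiset.card S) := by
  obtain ⟨S', rfl⟩ := Multiset.exists_cons_of_mem ha
  have h2 : ∀ S' : Multiset ℝ, (∀ r ∈ S', |r| ≤ B) → |S'.prod| ≤ B ^ (Multiset.card S') := by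
    intro S'
    induction S' using Multiset.induction_on with
    | empty => simp
    | cons b S' ih =>
      intro h
      rw [Multiset.prod_cons, abs_mul, Multiset.card_cons, pow_succ, mul_comm (B^_)]
      exact mul_le_mul (h b (by simp)) (ih (fun r hr => h r (by simp [hr]))) (abs_nonneg _) (by linarith)
  rw [Multiset.prod_cons, abs_mul] at h1
  refine h1.trans ?_
  have h3 := h2 S' (fun r hr => hS r (by simp [hr]))
  gcongr
  refine h3.trans (pow_le_pow_right₀ hB (by simp))

lemma signSums_card (L : List ℕ) : Multiset.card (signSums L) = 2 ^ L.length := by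
  induction L with
  | nil => simp [signSums]
  | cons l L ih => simp [signSums, ih, pow_succ]; ring

lemma signSums_bound (L : List ℕ) (Y : ℕ) (h : ∀ l ∈ L, l ≤ Y) :
    ∀ r ∈ signSums L, |r| ≤ L.length * √(Y:ℝ) := by
  induction L with
  | nil => simp [signSums]
  | cons l L ih =>
    intro r hr
    have ih' := ih (fun l hl => h l (by simp [hl]))
    have hl : √(l:ℝ) ≤ √(Y:ℝ) := Real.sqrt_le_sqrt (by exact_mod_cast h l (by simp))
    simp only [signSums, Multiset.mem_add, Multiset.mem_map] at hr
    simp only [List.length_cons]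
    push_cast
    rcases hr with ⟨r', hr', rfl⟩ | ⟨r', hr', rfl⟩
    · have := abs_add_le r' √(l:ℝ)
      rw [abs_of_nonneg (Real.sqrt_nonneg (l:ℝ))] at this
      linarith [ih' r' hr']
    · have := abs_sub r' √(l:ℝ)
      rw [abs_of_nonneg (Real.sqrt_nonneg (l:ℝ))] at this
      linarith [ih' r' hr']

lemma mem_signSums {ι : Type*} (l : ι → ℕ) (e : ι → ℝ) (he : ∀ i, e i = 1 ∨ e i = -1) (L : List ι) :
    (L.map (fun i => e i * √(l i : ℝ))).sum ∈ signSums (L.map l) := by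
  induction L with
  | nil => simp [signSums]
  | cons i L ih =>
    simp only [List.map_cons, List.sum_cons, signSums, Multiset.mem_add, Multiset.mem_map]
    rcases he i with h | h
    · left; exact ⟨_, ih, by rw [h]; ring⟩
    · right; exact ⟨_, ih, by rw [h]; ring⟩

lemma sqrt_sum_gap {ι : Type*} [Fintype ι] (l : ι → ℕ) (e : ι → ℝ) (he : ∀ i, e i = 1 ∨ e i = -1)
    (Y : ℕ) (hl : ∀ i, l i ≤ Y) (hne : ∑ i, e i * √(l i : ℝ) ≠ 0) :
    1 ≤ |∑ i, e i * √(l i : ℝ)| * (Fintype.card ι * √(Y:ℝ) + 1) ^ (2 ^ Fintype.card ι) := by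
  set L := (Finset.univ : Finset ι).toList with hL
  have hlen : L.length = Fintype.card ι := by simp [hL]
  have hsum : (L.map (fun i => e i * √(l i : ℝ))).sum = ∑ i, e i * √(l i : ℝ) := by
    rw [hL, Finset.sum_map_toList]
  have hmem := mem_signSums l e he L
  rw [hsum] at hmem
  obtain ⟨q, hq⟩ := signSums_poly (L.map l)
  have h1 := one_le_prod_of_poly _ q hq
  have hb := signSums_bound (L.map l) Y (by
    intro k hk; rw [List.mem_map] at hk; obtain ⟨i, _, rfl⟩ := hk; exact hl i)
  rw [List.length_map, hlen] at hb
  have hB : 1 ≤ Fintype.card ι * √(Y:ℝ) + 1 := by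
    have : 0 ≤ Fintype.card ι * √(Y:ℝ) := by positivity
    linarith
  have := multiset_gap _ _ hB (fun r hr => (hb r (Multiset.mem_of_mem_filter hr)).trans (by linarith)) h1
    (∑ i, e i * √(l i : ℝ)) (Multiset.mem_filter.2 ⟨hmem, hne⟩)
  refine this.trans ?_
  gcongr
  refine (Multiset.card_le_card (Multiset.filter_le _ _)).trans ?_
  rw [signSums_card, List.length_map, hlen]

end gap

section indep
open Polynomial

lemma not_isSquare_mul_squarefree (m m0 : ℕ) (hm : Squarefree m) (hm0 : Squarefree m0) (h : m ≠ m0) :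
    ¬ IsSquare (m * m0) := by
  rintro ⟨a, ha⟩
  apply h
  have key : ∀ m m0 : ℕ, Squarefree m → Squarefree m0 → m * m0 = a * a → m ∣ m0 := by
    intro m m0 hm hm0 ha
    have h1 : m ∣ a ^ 2 := by rw [sq, ← ha]; exact dvd_mul_right _ _
    obtain ⟨b, rfl⟩ : m ∣ a := (hm.dvd_pow_iff_dvd (by norm_num)).1 h1
    have : m0 = m * (b * b) := by
      have hpos : 0 < m := Nat.pos_of_ne_zero hm.ne_zero
      apply Nat.eq_of_mul_eq_mul_left hpos
      rw [ha]; ring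
    exact ⟨_, this⟩
  exact Nat.dvd_antisymm (key m m0 hm hm0 ha) (key m0 m hm0 hm (by rw [mul_comm]; exact ha))

lemma trace_sqrt_zero (K : IntermediateField ℚ ℝ) [FiniteDimensional ℚ K] (x : K) (k : ℕ)
    (hk : ¬ IsSquare k) (hx : (x:ℝ) ^ 2 = k) : Algebra.trace ℚ K x = 0 := by
  have hirr : Irreducible (X ^ 2 - C (k:ℚ)) := by
    apply X_pow_sub_C_irreducible_of_prime Nat.prime_two
    intro b hb
    apply hk
    have : IsSquare (k:ℚ) := ⟨b, by rw [← hb]; ring⟩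
    exact_mod_cast this
  have hmin : minpoly ℚ x = X ^ 2 - C (k:ℚ) := by
    refine (minpoly.eq_of_irreducible_of_monic hirr ?_ ?_).symm
    · have : x ^ 2 = (k:K) := by
        apply Subtype.ext; push_cast; exact hx
      simp [this]
    · exact monic_X_pow_sub_C _ (by norm_num)
  rw [trace_eq_finrank_mul_minpoly_nextCoeff, hmin]
  have : (X ^ 2 - C (k:ℚ)).nextCoeff = 0 := by
    rw [nextCoeff_of_natDegree_pos (by rw [natDegree_X_pow_sub_C]; norm_num), natDegree_X_pow_sub_C]
    simp [coeff_X_pow, coeff_C]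
  rw [this]; simp

/-- linear independence of square roots of distinct squarefree integers -/
lemma sqrt_indep (s : Finset ℕ) (hs : ∀ m ∈ s, Squarefree m) (c : ℕ → ℚ)
    (h : ∑ m ∈ s, (c m : ℝ) * √(m:ℝ) = 0) : ∀ m ∈ s, c m = 0 := by
  intro m0 hm0
  let S : Set ℝ := (fun m : ℕ => √(m:ℝ)) '' (s : Set ℕ)
  have : Finite S := (s.finite_toSet.image _).to_subtype
  have hint : ∀ x ∈ S, IsIntegral ℚ x := by
    rintro x ⟨m, _, rfl⟩
    refine ⟨X ^ 2 - C (m:ℚ), monic_X_pow_sub_C _ (by norm_num), ?_⟩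
    simp [Real.sq_sqrt (Nat.cast_nonneg m)]
  have : FiniteDimensional ℚ (IntermediateField.adjoin ℚ S) :=
    IntermediateField.finiteDimensional_adjoin hint
  set K := IntermediateField.adjoin ℚ S with hK
  have hmem : ∀ m ∈ s, √(m:ℝ) ∈ K := fun m hm =>
    IntermediateField.subset_adjoin ℚ S ⟨m, hm, rfl⟩
  let y : ℕ → K := fun m => if hm : m ∈ s then ⟨√(m:ℝ), hmem m hm⟩ else 0
  have hy : ∀ m ∈ s, ((y m : K) : ℝ) = √(m:ℝ) := by
    intro m hm; simp [y, hm]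
  have h2 : ∑ m ∈ s, (c m) • (y m * y m0) = 0 := by
    apply Subtype.ext
    have : ((∑ m ∈ s, (c m) • (y m * y m0) : K) : ℝ) = (∑ m ∈ s, (c m : ℝ) * √(m:ℝ)) * √(m0:ℝ) := by
      rw [Finset.sum_mul]
      push_cast
      apply Finset.sum_congr rfl
      intro m hm
      rw [← hy m hm, ← hy m0 hm0, Rat.smul_def]
      push_cast
      ring
    rw [this, h]; simp
  have h3 := congrArg (Algebra.trace ℚ K) h2
  rw [map_sum, map_zero, Finset.sum_eq_single m0] at h3
  · rw [map_smul] at h3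
    have h4 : y m0 * y m0 = algebraMap ℚ K (m0:ℚ) := by
      apply Subtype.ext
      push_cast
      rw [hy m0 hm0, Real.mul_self_sqrt (Nat.cast_nonneg _)]
    rw [h4, Algebra.trace_algebraMap] at h3
    have h5 : (Module.finrank ℚ K : ℚ) ≠ 0 := by
      exact_mod_cast (Module.finrank_pos (R := ℚ) (M := K)).ne'
    have h6 : (m0:ℚ) ≠ 0 := by exact_mod_cast (hs m0 hm0).ne_zero
    simp only [smul_eq_mul, nsmul_eq_mul, mul_eq_zero] at h3
    tauto
  · intro m hm hne
    rw [map_smul]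
    rw [trace_sqrt_zero K (y m * y m0) (m * m0) (not_isSquare_mul_squarefree m m0 (hs m hm) (hs m0 hm0) hne)]
    · simp
    · push_cast
      rw [hy m hm, hy m0 hm0, mul_pow, Real.sq_sqrt (Nat.cast_nonneg _), Real.sq_sqrt (Nat.cast_nonneg _)]
  · intro hh; exact absurd hm0 hh

end indep

section cluster
open Classical

/-- zero-sum weighted count -/
def Zsum {J : Type} [Fintype J] (lam : J → ℝ) (c : J → ℝ) (ι : Type) [Fintype ι] : ℝ :=
  ∑ f : ι → J, if ∑ i, lam (f i) = 0 then ∏ i, c (f i) else 0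

/-- zero-sum weighted count in a single class -/
def Ssum {J : Type} [Fintype J] (cls : J → ℕ) (lam : J → ℝ) (c : J → ℝ) (ι : Type) [Fintype ι] : ℝ :=
  ∑ f : ι → J, if (∀ i j, cls (f i) = cls (f j)) ∧ ∑ i, lam (f i) = 0 then ∏ i, c (f i) else 0

lemma Ssum_equiv {J : Type} [Fintype J] (cls : J → ℕ) (lam : J → ℝ) (c : J → ℝ) (ι κ : Type)
    [Fintype ι] [Fintype κ] (e : ι ≃ κ) : Ssum cls lam c ι = Ssum cls lam c κ := by
  unfold Ssum
  apply Fintype.sum_equiv (Equiv.arrowCongr e (Equiv.refl J))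
  intro f
  have h1 : ∑ i, lam (f i) = ∑ k, lam ((Equiv.arrowCongr e (Equiv.refl J)) f k) := by
    apply Fintype.sum_equiv e
    intro i; simp
  have h2 : ∏ i, c (f i) = ∏ k, c ((Equiv.arrowCongr e (Equiv.refl J)) f k) := by
    apply Fintype.prod_equiv e
    intro i; simp
  have h3 : (∀ i j, cls (f i) = cls (f j)) ↔ (∀ i j, cls ((Equiv.arrowCongr e (Equiv.refl J)) f i) =
      cls ((Equiv.arrowCongr e (Equiv.refl J)) f j)) := by
    constructor
    · intro h i j; exact h _ _
    · intro h i j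
      have := h (e i) (e j)
      simpa using this
  rw [h1, h2]
  simp only [h3]

lemma pi_split {ι J : Type} (p : ι → Prop) {_ : Fintype ({i // p i} → J)}
    {_ : Fintype ({i // ¬ p i} → J)} {_ : Fintype (ι → J)} (A : ({i // p i} → J) → ℝ)
    (B : ({i // ¬ p i} → J) → ℝ) :
    (∑ f, A f) * (∑ g, B g) = ∑ f : ι → J, A (fun i => f i) * B (fun i => f i) := by
  rw [Finset.sum_mul_sum, ← Fintype.sum_prod_type']
  symm
  exact Fintype.sum_equiv (Equiv.piEquivPiSubtypeProd p (fun _ => J)) _ _ (fun f => rfl)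

lemma Zsum_rec {J : Type} [Fintype J] (cls : J → ℕ) (lam : J → ℝ) (c : J → ℝ) (hc : ∀ j, 0 ≤ c j)
    (ι : Type) [Fintype ι] (i0 : ι)
    (hind : ∀ f : ι → J, ∑ i, lam (f i) = 0 → ∀ m,
      ∑ i ∈ Finset.univ.filter (fun i => cls (f i) = m), lam (f i) = 0) :
    Zsum lam c ι ≤ ∑ B ∈ (Finset.univ : Finset (Finset ι)).filter (fun B => i0 ∈ B),
      Ssum cls lam c {i // i ∈ B} * Zsum lam c {i // ¬ i ∈ B} := by
  let Bf : (ι → J) → Finset ι := fun f => Finset.univ.filter (fun i => cls (f i) = cls (f i0))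
  have h1 : Zsum lam c ι = ∑ B ∈ (Finset.univ : Finset (Finset ι)).filter (fun B => i0 ∈ B),
      ∑ f : ι → J, if Bf f = B ∧ ∑ i, lam (f i) = 0 then ∏ i, c (f i) else 0 := by
    unfold Zsum
    rw [Finset.sum_comm]
    apply Finset.sum_congr rfl
    intro f _
    rw [Finset.sum_eq_single (Bf f)]
    · simp
    · intro B _ hB
      rw [if_neg]
      rintro ⟨h, _⟩; exact hB h.symm
    · intro h
      exfalso; apply h
      simp [Bf]
  rw [h1]
  apply Finset.sum_le_sum
  intro B _
  have h2 : Ssum cls lam c {i // i ∈ B} * Zsum lam c {i // ¬ i ∈ B} =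
      ∑ f : ι → J, (if (∀ i j : {i // i ∈ B}, cls (f i) = cls (f j)) ∧ ∑ i : {i // i ∈ B}, lam (f i) = 0
        then ∏ i : {i // i ∈ B}, c (f i) else 0) *
       (if ∑ i : {i // ¬ i ∈ B}, lam (f i) = 0 then ∏ i : {i // ¬ i ∈ B}, c (f i) else 0) := by
    unfold Ssum Zsum
    exact pi_split (fun i => i ∈ B) _ _
  rw [h2]
  apply Finset.sum_le_sum
  intro f _
  have hnn1 : 0 ≤ ∏ i : {i // i ∈ B}, c (f i) := Finset.prod_nonneg (fun _ _ => hc _)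
  have hnn2 : 0 ≤ ∏ i : {i // ¬ i ∈ B}, c (f i) := Finset.prod_nonneg (fun _ _ => hc _)
  by_cases h : Bf f = B ∧ ∑ i, lam (f i) = 0
  · rw [if_pos h]
    obtain ⟨hB, hs⟩ := h
    have hmemB : ∀ i, i ∈ B ↔ cls (f i) = cls (f i0) := by
      intro i; rw [← hB]; simp [Bf]
    have e1 : ∑ i : {i // i ∈ B}, lam (f i) = 0 := by
      have := hind f hs (cls (f i0))
      rw [← this]
      rw [Finset.sum_subtype _ (p := fun i => i ∈ B)]
      intro i; simp [hmemB]
    have e2 : ∑ i : {i // i ∈ B}, lam (f i) + ∑ i : {i // ¬ i ∈ B}, lam (f i) = ∑ i, lam (f i) := by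
      convert Fintype.sum_subtype_add_sum_subtype (fun i => i ∈ B) (fun i => lam (f i))
    have e3 : (∏ i : {i // i ∈ B}, c (f i)) * ∏ i : {i // ¬ i ∈ B}, c (f i) = ∏ i, c (f i) := by
      convert Fintype.prod_subtype_mul_prod_subtype (fun i => i ∈ B) (fun i => c (f i))
    rw [if_pos, if_pos, e3]
    · rw [e1, hs, zero_add] at e2; exact e2
    · refine ⟨fun i j => ?_, e1⟩
      rw [(hmemB i).1 i.2, (hmemB j).1 j.2]
  · rw [if_neg h]
    apply mul_nonneg <;> split_ifs <;> first | assumption | exact le_refl _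

lemma Zsum_bound (K : ℕ → ℝ) (hK : ∀ s, 0 ≤ K s) (n : ℕ) : ∃ C : ℝ, 0 ≤ C ∧
    ∀ (J : Type) [Fintype J] (cls : J → ℕ) (lam : J → ℝ) (c : J → ℝ) (w : ℝ), 0 ≤ w → (∀ j, 0 ≤ c j) →
    (∀ (ι : Type) [Fintype ι] (f : ι → J), ∑ i, lam (f i) = 0 → ∀ m,
      ∑ i ∈ Finset.univ.filter (fun i => cls (f i) = m), lam (f i) = 0) →
    (∀ s, 1 ≤ s → Ssum cls lam c (Fin s) ≤ K s * w ^ s) →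
    ∀ (ι : Type) [Fintype ι], Fintype.card ι = n → Zsum lam c ι ≤ C * w ^ n := by
  induction n using Nat.strong_induction_on with
  | _ n ih =>
    choose! C hC0 hC using ih
    rcases Nat.eq_zero_or_pos n with rfl | hn
    · refine ⟨1, by norm_num, ?_⟩
      intro J _ cls lam c w hw hc hind hS ι _ hι
      have : IsEmpty ι := Fintype.card_eq_zero_iff.1 hι
      unfold Zsum
      simp
    refine ⟨2 ^ n * ∑ s ∈ Finset.range (n+1), (K s * |C (n - s)|), ?_, ?_⟩
    · exact mul_nonneg (by positivity) (Finset.sum_nonneg (fun s _ => mul_nonneg (hK s) (abs_nonneg _)))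
    intro J _ cls lam c w hw hc hind hS ι _ hι
    have hne : Nonempty ι := Fintype.card_pos_iff.1 (by omega)
    obtain ⟨i0⟩ := hne
    refine (Zsum_rec cls lam c hc ι i0 (hind ι)).trans ?_
    have hZnn : ∀ (κ : Type) [Fintype κ], 0 ≤ Zsum lam c κ := by
      intro κ _
      apply Finset.sum_nonneg
      intro f _
      split_ifs
      · exact Finset.prod_nonneg (fun _ _ => hc _)
      · exact le_refl _
    calc _ ≤ ∑ B ∈ (Finset.univ : Finset (Finset ι)).filter (fun B => i0 ∈ B),
          (∑ s ∈ Finset.range (n+1), (K s * |C (n - s)|)) * w ^ n := by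
          apply Finset.sum_le_sum
          intro B hB
          simp only [Finset.mem_filter, Finset.mem_univ, true_and] at hB
          have hBpos : 1 ≤ B.card := Finset.card_pos.2 ⟨i0, hB⟩
          have hBle : B.card ≤ n := by rw [← hι]; exact Finset.card_le_univ B
          have c1 : Fintype.card {i // i ∈ B} = B.card := Fintype.card_coe B
          have c2 : Fintype.card {i // ¬ i ∈ B} = n - B.card := by
            rw [Fintype.card_subtype_compl, c1, hι]
          have e1 : Ssum cls lam c {i // i ∈ B} ≤ K B.card * w ^ B.card := by
            rw [Ssum_equiv cls lam c _ (Fin B.card) (Fintype.equivFinOfCardEq c1)]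
            exact hS _ hBpos
          have e2 : Zsum lam c {i // ¬ i ∈ B} ≤ |C (n - B.card)| * w ^ (n - B.card) := by
            refine (hC (n - B.card) (by omega) J cls lam c w hw hc hind hS _ c2).trans ?_
            gcongr; exact le_abs_self _
          calc _ ≤ (K B.card * w ^ B.card) * (|C (n - B.card)| * w ^ (n - B.card)) := by
                apply mul_le_mul e1 e2 (hZnn _)
                exact mul_nonneg (hK _) (by positivity)
            _ = (K B.card * |C (n - B.card)|) * w ^ n := by
                rw [show w ^ n = w ^ B.card * w ^ (n - B.card) by rw [← pow_add]; congr 1; omega]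
                ring
            _ ≤ _ := by
                gcongr
                apply Finset.single_le_sum (f := fun s => K s * |C (n - s)|)
                  (fun s _ => mul_nonneg (hK s) (abs_nonneg _))
                rw [Finset.mem_range]; omega
      _ ≤ ∑ B ∈ (Finset.univ : Finset (Finset ι)),
          (∑ s ∈ Finset.range (n+1), (K s * |C (n - s)|)) * w ^ n := by
          apply Finset.sum_le_sum_of_subset_of_nonneg (Finset.filter_subset _ _)
          intro _ _ _
          exact mul_nonneg (Finset.sum_nonneg (fun s _ => mul_nonneg (hK s) (abs_nonneg _))) (by positivity)
      _ = _ := by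
          rw [Finset.sum_const, Finset.card_univ, Fintype.card_finset, hι, nsmul_eq_mul]
          push_cast; ring

end cluster

lemma abel_compare (a b g : ℕ → ℝ) (hg : ∀ k, 1 ≤ k → g (k+1) ≤ g k) (hg0 : ∀ k, 0 ≤ g k)
    (hab : ∀ k, ∑ l ∈ Finset.Icc 1 k, a l ≤ ∑ l ∈ Finset.Icc 1 k, b l) (Y : ℕ) :
    ∑ l ∈ Finset.Icc 1 Y, a l * g l ≤ ∑ l ∈ Finset.Icc 1 Y, b l * g l := by
  have h : ∀ Y : ℕ, (∑ l ∈ Finset.Icc 1 (Y+1), b l - ∑ l ∈ Finset.Icc 1 (Y+1), a l) * g (Y+1) ≤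
      ∑ l ∈ Finset.Icc 1 (Y+1), b l * g l - ∑ l ∈ Finset.Icc 1 (Y+1), a l * g l := by
    intro Y
    induction Y with
    | zero => simp; linarith
    | succ Y ih =>
      have e : ∀ f : ℕ → ℝ, ∑ l ∈ Finset.Icc 1 (Y+1+1), f l = ∑ l ∈ Finset.Icc 1 (Y+1), f l + f (Y+1+1) :=
        fun f => Finset.sum_Icc_succ_top (by omega) f
      rw [e, e, e, e]
      have h1 := hg (Y+1) (by omega)
      have h2 := hab (Y+1)
      nlinarith [mul_nonneg (sub_nonneg.2 h1) (sub_nonneg.2 h2)]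
  rcases Y with _ | Y
  · simp
  · have h1 := h Y
    have h2 := hab (Y+1)
    have := mul_nonneg (sub_nonneg.2 h2) (hg0 (Y+1))
    linarith

lemma log_succ_le (k : ℕ) (hk : 1 ≤ k) : Real.log ((k:ℝ)+1) ≤ Real.log k + 1 / k := by
  have hk0 : (0:ℝ) < k := by exact_mod_cast hk
  have h1 : Real.log (((k:ℝ)+1)/k) ≤ ((k:ℝ)+1)/k - 1 := Real.log_le_sub_one_of_pos (by positivity)
  rw [Real.log_div (by positivity) hk0.ne'] at h1
  have : ((k:ℝ)+1)/k - 1 = 1 / k := by field_simp; ring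
  linarith

lemma sum_two_add_log (Z : ℕ) (hZ : 1 ≤ Z) :
    (Z:ℝ) * (1 + Real.log Z) ≤ ∑ l ∈ Finset.Icc 1 Z, (2 + Real.log l) := by
  induction Z, hZ using Nat.le_induction with
  | base => simp
  | succ k hk ih =>
    rw [Finset.sum_Icc_succ_top (by omega)]
    have h := log_succ_le k hk
    have hk0 : (0:ℝ) < k := by exact_mod_cast hk
    push_cast
    have h2 : (k:ℝ) * Real.log ((k:ℝ)+1) ≤ k * Real.log k + 1 := by
      calc _ ≤ (k:ℝ) * (Real.log k + 1/k) := by gcongr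
        _ = _ := by field_simp
    nlinarith

lemma sum_log_tail (Z : ℕ) (hZ : 1 ≤ Z) (Y : ℕ) (hY : Z ≤ Y) :
    ∑ l ∈ Finset.Ioc Z Y, (2 + Real.log l) / (l:ℝ)^2 ≤ (4 + Real.log Z) / Z - (4 + Real.log Y)/Y := by
  induction Y, hY using Nat.le_induction with
  | base => simp
  | succ k hk ih =>
    rw [← Finset.insert_Ioc_right_eq_Ioc_add_one hk, Finset.sum_insert (by simp)]
    have hk1 : 1 ≤ k := hZ.trans hk
    have hk0 : (1:ℝ) ≤ k := by exact_mod_cast hk1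
    have h := log_succ_le k hk1
    have h3 : (2 + Real.log ((k+1:ℕ):ℝ)) / ((k+1:ℕ):ℝ)^2 ≤
        (4 + Real.log k)/k - (4 + Real.log ((k+1:ℕ):ℝ))/((k+1:ℕ):ℝ) := by
      push_cast
      set x := Real.log (k:ℝ)
      set y := Real.log ((k:ℝ)+1)
      have hx : 0 ≤ x := Real.log_nonneg hk0
      have hy : 0 ≤ y := Real.log_nonneg (by linarith)
      have hd : (k:ℝ) * (y - x) ≤ 1 := by
        calc (k:ℝ) * (y - x) ≤ (k:ℝ) * (1/k) := by gcongr; linarith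
          _ = 1 := by field_simp
      have hd2 : (y - x) ≤ 1 := by nlinarith
      rw [div_sub_div _ _ (by positivity) (by positivity), div_le_div_iff₀ (by positivity) (by positivity)]
      have : (2 + y) * (k * (k+1)) ≤ ((4 + x) * (k+1) - k * (4 + y)) * ((k:ℝ)+1)^2 := by
        have e : 2 + y ≤ (4 + x) * (k+1) - k * (4 + y) := by nlinarith
        have e0 : (0:ℝ) ≤ 2 + y := by linarith
        calc (2 + y) * (k * (k+1)) ≤ (2+y) * ((k:ℝ)+1)^2 := by gcongr; nlinarith
          _ ≤ _ := by gcongr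
      exact this
    linarith

/-- the coefficient majorant -/
def gw (w : ℝ) (l : ℕ) : ℝ := min (2 / (l:ℝ)) (2 * π * w / √(l:ℝ))

lemma gw_nonneg (w : ℝ) (hw : 0 ≤ w) (l : ℕ) : 0 ≤ gw w l := by
  unfold gw
  apply le_min <;> positivity

def cw (w : ℝ) (l : ℕ) : ℝ := (r2 l : ℝ) * gw w l

lemma cw_nonneg (w : ℝ) (hw : 0 ≤ w) (l : ℕ) : 0 ≤ cw w l :=
  mul_nonneg (Nat.cast_nonneg _) (gw_nonneg w hw l)

lemma half_le_log (w : ℝ) (h0 : 0 < w) (h1 : w ≤ 1/2) : 1/2 ≤ -Real.log w := by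
  have : Real.log w ≤ Real.log (1/2) := Real.log_le_log h0 h1
  rw [one_div, Real.log_inv] at this
  have := Real.log_two_gt_d9
  linarith

lemma sum_cw_sq : ∃ C : ℝ, 0 < C ∧ ∀ w : ℝ, 0 < w → w ≤ 1/2 → ∀ Y : ℕ,
    ∑ l ∈ Finset.Icc 1 Y, (cw w l)^2 ≤ C * (w * Real.log w)^2 := by
  obtain ⟨C, hC, hCb⟩ := sum_r2_sq_upper
  refine ⟨C * 2000, by positivity, fun w h0 h1 Y => ?_⟩
  have hL := half_le_log w h0 h1
  set L := -Real.log w with hLdef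
  have hcomp : ∑ l ∈ Finset.Icc 1 Y, (cw w l)^2 ≤
      ∑ l ∈ Finset.Icc 1 Y, (C * (2 + Real.log l)) * (gw w l)^2 := by
    have := abel_compare (fun l => (r2 l : ℝ)^2) (fun l => C * (2 + Real.log l)) (fun l => (gw w l)^2)
      ?_ (fun _ => sq_nonneg _) ?_ Y
    · refine le_trans (le_of_eq ?_) this
      apply Finset.sum_congr rfl; intro l _; unfold cw; ring
    · intro k hk
      have hk0 : (0:ℝ) < k := by exact_mod_cast hk
      have : gw w (k+1) ≤ gw w k := by
        unfold gw
        push_cast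
        apply min_le_min
        · gcongr; linarith
        · gcongr; linarith
      have h2 := gw_nonneg w h0.le (k+1)
      gcongr
    · intro k
      rcases Nat.eq_zero_or_pos k with rfl | hk
      · simp
      rw [← Finset.mul_sum]
      refine (hCb k hk).trans ?_
      rw [mul_assoc]
      gcongr
      exact sum_two_add_log k hk
  refine hcomp.trans ?_
  simp only [mul_assoc]
  rw [← Finset.mul_sum]
  apply mul_le_mul_of_nonneg_left _ hC.le
  have hw2 : 1 / w^2 ≥ 4 := by
    rw [ge_iff_le, le_div_iff₀ (by positivity)]; nlinarith
  set Z := ⌊1 / w^2⌋₊ with hZ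
  have hZle : (Z:ℝ) ≤ 1/w^2 := Nat.floor_le (by positivity)
  have hZlt : 1/w^2 < Z + 1 := Nat.lt_floor_add_one _
  have hZ3 : (3:ℝ) ≤ Z := by linarith
  have hZ1 : 1 ≤ Z := by
    have : (1:ℝ) ≤ Z := by linarith
    exact_mod_cast this
  have hZw : 1 ≤ 2 * w^2 * Z := by
    have : 1/w^2 ≤ 2 * Z := by linarith
    rw [div_le_iff₀ (by positivity)] at this; linarith
  have hlogZ : Real.log Z ≤ 2 * L := by
    have : Real.log Z ≤ Real.log (1/w^2) := Real.log_le_log (by linarith) hZle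
    rw [one_div, Real.log_inv, Real.log_pow] at this
    push_cast at this; rw [hLdef]; linarith
  have hlogZ0 : 0 ≤ Real.log Z := Real.log_natCast_nonneg Z
  -- split
  have hnn : ∀ l : ℕ, 0 ≤ (2 + Real.log l) * (gw w l)^2 := fun l =>
    mul_nonneg (by have := Real.log_natCast_nonneg l; linarith) (sq_nonneg _)
  have hsplit : ∑ l ∈ Finset.Icc 1 Y, (2 + Real.log l) * (gw w l)^2 ≤
      ∑ l ∈ Finset.Icc 1 Z, (2 + Real.log l) * (gw w l)^2 +
      ∑ l ∈ Finset.Ioc Z (max Y Z), (2 + Real.log l) * (gw w l)^2 := by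
    rw [← Finset.sum_union]
    · apply Finset.sum_le_sum_of_subset_of_nonneg
      · intro l hl
        simp only [Finset.mem_Icc, Finset.mem_union, Finset.mem_Ioc, le_max_iff] at hl ⊢
        omega
      · intro l _ _; exact hnn l
    · rw [Finset.disjoint_left]; intro l; simp only [Finset.mem_Icc, Finset.mem_Ioc]; omega
  have hA : ∑ l ∈ Finset.Icc 1 Z, (2 + Real.log l) * (gw w l)^2 ≤ 40 * w^2 * ((2 + 2*L) * (1 + 2*L)) := by
    calc _ ≤ ∑ l ∈ Finset.Icc 1 Z, (40 * w^2 * (2 + 2*L)) * ((1:ℝ)/l) := by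
          apply Finset.sum_le_sum
          intro l hl
          simp only [Finset.mem_Icc] at hl
          have hl0 : (0:ℝ) < l := by exact_mod_cast hl.1
          have e1 : Real.log l ≤ 2*L := (Real.log_le_log hl0 (by exact_mod_cast hl.2)).trans hlogZ
          have e2 : (gw w l)^2 ≤ 40 * w^2 * ((1:ℝ)/l) := by
            have : gw w l ≤ 2 * π * w / √(l:ℝ) := min_le_right _ _
            calc (gw w l)^2 ≤ (2 * π * w / √(l:ℝ))^2 := by
                  gcongr; exact gw_nonneg w h0.le l
              _ = (4 * π^2) * w^2 * ((1:ℝ)/l) := by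
                  rw [div_pow, Real.sq_sqrt hl0.le]; ring
              _ ≤ _ := by
                  gcongr
                  nlinarith [Real.pi_lt_d2, Real.pi_pos]
          calc _ ≤ (2 + 2*L) * (40 * w^2 * ((1:ℝ)/l)) := by
                gcongr
            _ = _ := by ring
      _ = (40 * w^2 * (2 + 2*L)) * ∑ l ∈ Finset.Icc 1 Z, ((1:ℝ)/l) := by rw [Finset.mul_sum]
      _ ≤ (40 * w^2 * (2 + 2*L)) * (1 + 2 * L) := by
          gcongr
          exact (harm_le_log Z).trans (by linarith)
      _ = _ := by ring
  have hB : ∑ l ∈ Finset.Ioc Z (max Y Z), (2 + Real.log l) * (gw w l)^2 ≤ 8 * w^2 * (4 + 2*L) := by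
    calc _ ≤ ∑ l ∈ Finset.Ioc Z (max Y Z), 4 * ((2 + Real.log l) / (l:ℝ)^2) := by
          apply Finset.sum_le_sum
          intro l hl
          have e0 := Real.log_natCast_nonneg l
          have : gw w l ≤ 2 / (l:ℝ) := min_le_left _ _
          calc _ ≤ (2 + Real.log l) * (2 / (l:ℝ))^2 := by
                gcongr; exact gw_nonneg w h0.le l
            _ = _ := by ring
      _ = 4 * ∑ l ∈ Finset.Ioc Z (max Y Z), ((2 + Real.log l) / (l:ℝ)^2) := by rw [Finset.mul_sum]
      _ ≤ 4 * ((4 + 2*L)/Z) := by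
          gcongr
          refine (sum_log_tail Z hZ1 _ (le_max_right _ _)).trans ?_
          have e0 := Real.log_natCast_nonneg (max Y Z)
          have : 0 ≤ (4 + Real.log ((max Y Z : ℕ):ℝ)) / ((max Y Z : ℕ):ℝ) := by positivity
          have : (4 + Real.log Z)/Z ≤ (4 + 2*L)/Z := by gcongr
          linarith
      _ ≤ _ := by
          rw [← mul_div_assoc, div_le_iff₀ (by linarith)]
          have : 0 ≤ 4 + 2*L := by linarith
          nlinarith
  refine hsplit.trans ((add_le_add hA hB).trans ?_)
  have : (w * Real.log w)^2 = w^2 * L^2 := by rw [hLdef]; ring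
  rw [this]
  have hw : 0 < w^2 := by positivity
  have key : 40 * ((2 + 2*L) * (1 + 2*L)) + 8 * (4 + 2*L) ≤ 2000 * L^2 := by nlinarith
  nlinarith

section rho

lemma rho_sum_bound (t : ℕ) (ht : 1 ≤ t) : ∃ C : ℝ, 0 ≤ C ∧ ∀ Y : ℕ,
    ∑ x ∈ (Fintype.piFinset (fun _ : Fin (t+1) => (Finset.Icc (-(Y:ℤ)) Y).erase 0)).filter
      (fun x => ∑ i, x i = 0), ∏ i, |((x i : ℤ) : ℝ)| ^ (-(1 - 1/(2*((t:ℝ)+1)))) ≤ C := by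
  set p : ℝ := 1 - 1/(2*((t:ℝ)+1)) with hp
  have ht0 : (1:ℝ) ≤ t := by exact_mod_cast ht
  have hp0 : 0 < p := by
    rw [hp]
    have : 1/(2*((t:ℝ)+1)) < 1 := by rw [div_lt_one (by positivity)]; linarith
    linarith
  set q : ℝ := p + p / t with hq
  have hq1 : 1 < q := by
    have : q = ((t:ℝ) + 1/2)/t := by
      rw [hq, hp]; field_simp; ring
    rw [this, lt_div_iff₀ (by linarith)]; linarith
  have hsum : Summable (fun n : ℤ => |(n:ℝ)| ^ (-q)) := Real.summable_abs_int_rpow hq1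
  set Q := ∑' n : ℤ, |(n:ℝ)| ^ (-q) with hQ
  have hQ0 : 0 ≤ Q := tsum_nonneg (fun n => by positivity)
  refine ⟨((t:ℝ)+1) * Q ^ t, by positivity, fun Y => ?_⟩
  set D := (Finset.Icc (-(Y:ℤ)) Y).erase 0 with hD
  set S := (Fintype.piFinset (fun _ : Fin (t+1) => D)).filter (fun x => ∑ i, x i = 0) with hS
  have hne : ∀ x ∈ S, ∀ i, x i ∈ D := by
    intro x hx
    rw [hS, Finset.mem_filter, Fintype.mem_piFinset] at hx
    exact hx.1
  have h1 : ∀ x ∈ S, ∏ i, |((x i : ℤ) : ℝ)| ^ (-p) ≤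
      ∑ k : Fin (t+1), ∏ j : Fin t, |((x (k.succAbove j) : ℤ) : ℝ)| ^ (-q) := by
    intro x hx
    obtain ⟨k, hk⟩ := Finite.exists_max (fun i => |((x i : ℤ) : ℝ)|)
    refine le_trans ?_ (Finset.single_le_sum (f := fun k : Fin (t+1) => ∏ j : Fin t, |((x (k.succAbove j) : ℤ) : ℝ)| ^ (-q))
      (fun _ _ => Finset.prod_nonneg (fun _ _ => by positivity)) (Finset.mem_univ k))
    have hpos : ∀ i, 0 < |((x i : ℤ) : ℝ)| := by
      intro i
      have := hne x hx i
      rw [hD, Finset.mem_erase] at this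
      rw [abs_pos]; exact_mod_cast this.1
    rw [Fin.prod_univ_succAbove _ k]
    have e1 : |((x k : ℤ) : ℝ)| ^ (-p) = ∏ j : Fin t, |((x k : ℤ) : ℝ)| ^ (-(p/t)) := by
      rw [Finset.prod_const, Finset.card_univ, Fintype.card_fin, ← Real.rpow_natCast, ← Real.rpow_mul (hpos k).le]
      congr 1; field_simp
    rw [e1, ← Finset.prod_mul_distrib]
    apply Finset.prod_le_prod
    · intro j _; positivity
    · intro j _
      rw [show -q = -(p/t) + -p by rw [hq]; ring, Real.rpow_add (hpos _)]
      apply mul_le_mul_of_nonneg_right _ (by positivity)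
      apply Real.rpow_le_rpow_of_nonpos (hpos _) (hk _)
      have : 0 ≤ p / t := by positivity
      linarith
  refine (Finset.sum_le_sum h1).trans ?_
  rw [Finset.sum_comm]
  have h2 : ∀ k : Fin (t+1), ∑ x ∈ S, ∏ j : Fin t, |((x (k.succAbove j) : ℤ) : ℝ)| ^ (-q) ≤ Q ^ t := by
    intro k
    let res : (Fin (t+1) → ℤ) → (Fin t → ℤ) := fun x j => x (k.succAbove j)
    have hinj : Set.InjOn res S := by
      intro x hx y hy hxy
      have hx0 : ∑ i, x i = 0 := (Finset.mem_filter.1 (Finset.mem_coe.1 hx)).2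
      have hy0 : ∑ i, y i = 0 := (Finset.mem_filter.1 (Finset.mem_coe.1 hy)).2
      rw [Fin.sum_univ_succAbove _ k] at hx0 hy0
      have hj : ∀ j, x (k.succAbove j) = y (k.succAbove j) := fun j => congrFun hxy j
      have hk : x k = y k := by
        have : ∑ j, x (k.succAbove j) = ∑ j, y (k.succAbove j) := Finset.sum_congr rfl (fun j _ => hj j)
        omega
      funext i
      rcases Fin.eq_self_or_eq_succAbove k i with rfl | ⟨j, rfl⟩
      · exact hk
      · exact hj j
    calc ∑ x ∈ S, ∏ j : Fin t, |((x (k.succAbove j) : ℤ) : ℝ)| ^ (-q)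
        = ∑ y ∈ S.image res, ∏ j : Fin t, |((y j : ℤ) : ℝ)| ^ (-q) := by
          rw [Finset.sum_image hinj]
      _ ≤ ∑ y ∈ Fintype.piFinset (fun _ : Fin t => D), ∏ j : Fin t, |((y j : ℤ) : ℝ)| ^ (-q) := by
          apply Finset.sum_le_sum_of_subset_of_nonneg
          · intro y hy
            rw [Finset.mem_image] at hy
            obtain ⟨x, hx, rfl⟩ := hy
            rw [Fintype.mem_piFinset]
            exact fun j => hne x hx _
          · intros; exact Finset.prod_nonneg (fun _ _ => by positivity)
      _ = ∏ j : Fin t, ∑ n ∈ D, |((n : ℤ) : ℝ)| ^ (-q) := by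
          rw [Finset.prod_univ_sum]
      _ = (∑ n ∈ D, |((n : ℤ) : ℝ)| ^ (-q)) ^ t := by simp
      _ ≤ Q ^ t := by
          gcongr
          exact hsum.sum_le_tsum D (fun _ _ => by positivity)
  refine (Finset.sum_le_sum (fun k _ => h2 k)).trans ?_
  simp

end rho

section inst
open Classical

/-- squarefree part -/
def sqfp (n : ℕ) : ℕ := (Nat.sq_mul_squarefree n).choose
/-- square part root -/
def sqrtp (n : ℕ) : ℕ := (Nat.sq_mul_squarefree n).choose_spec.choose

lemma sqp_spec (n : ℕ) : (sqrtp n) ^ 2 * sqfp n = n ∧ Squarefree (sqfp n) :=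
  (Nat.sq_mul_squarefree n).choose_spec.choose_spec

abbrev JJ (Y : ℕ) : Type := Bool × Fin Y

def lev {Y : ℕ} (j : JJ Y) : ℕ := (j.2 : ℕ) + 1
def sgn {Y : ℕ} (j : JJ Y) : ℤ := if j.1 then 1 else -1
def rho {Y : ℕ} (j : JJ Y) : ℤ := sgn j * (sqrtp (lev j) : ℤ)
def clsJ {Y : ℕ} (j : JJ Y) : ℕ := sqfp (lev j)
def lamJ {Y : ℕ} (j : JJ Y) : ℝ := (sgn j : ℝ) * √(lev j : ℝ)

lemma lev_pos {Y : ℕ} (j : JJ Y) : 1 ≤ lev j := Nat.succ_le_succ (Nat.zero_le _)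
lemma lev_le {Y : ℕ} (j : JJ Y) : lev j ≤ Y := j.2.2
lemma sgn_cases {Y : ℕ} (j : JJ Y) : sgn j = 1 ∨ sgn j = -1 := by
  unfold sgn; split_ifs <;> simp
lemma sgn_abs {Y : ℕ} (j : JJ Y) : |sgn j| = 1 := by
  rcases sgn_cases j with h | h <;> rw [h] <;> simp

lemma sqrtp_pos {Y : ℕ} (j : JJ Y) : 1 ≤ sqrtp (lev j) := by
  have h := (sqp_spec (lev j)).1
  have h2 := lev_pos j
  by_contra hc
  have : sqrtp (lev j) = 0 := by omega
  rw [this] at h; simp at h; omega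

lemma clsJ_pos {Y : ℕ} (j : JJ Y) : 1 ≤ clsJ j := by
  exact Nat.pos_of_ne_zero (sqp_spec (lev j)).2.ne_zero

lemma lamJ_eq {Y : ℕ} (j : JJ Y) : lamJ j = (rho j : ℝ) * √(clsJ j : ℝ) := by
  unfold lamJ rho clsJ
  have h := (sqp_spec (lev j)).1
  have : (lev j : ℝ) = (sqrtp (lev j) : ℝ)^2 * (sqfp (lev j) : ℝ) := by exact_mod_cast h.symm
  conv_lhs => rw [this]
  rw [Real.sqrt_mul (by positivity), Real.sqrt_sq (by positivity)]
  push_cast; ring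

lemma rho_abs {Y : ℕ} (j : JJ Y) : |rho j| = sqrtp (lev j) := by
  unfold rho; rw [abs_mul, sgn_abs, one_mul, Nat.abs_cast]

lemma rho_ne {Y : ℕ} (j : JJ Y) : rho j ≠ 0 := by
  rw [← abs_pos, rho_abs]; exact_mod_cast sqrtp_pos j

lemma lev_eq {Y : ℕ} (j : JJ Y) : (lev j : ℝ) = |(rho j : ℝ)|^2 * (clsJ j : ℝ) := by
  have h := (sqp_spec (lev j)).1
  have h2 : |(rho j : ℝ)| = (sqrtp (lev j) : ℝ) := by
    rw [← Int.cast_abs, rho_abs]; simp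
  rw [h2]; unfold clsJ; exact_mod_cast h.symm

lemma JJ_ext {Y : ℕ} (j k : JJ Y) (h1 : sgn j = sgn k) (h2 : lev j = lev k) : j = k := by
  apply Prod.ext
  · unfold sgn at h1
    rcases hj : j.1 <;> rcases hk : k.1 <;> simp [hj, hk] at h1 <;> rfl
  · apply Fin.ext; unfold lev at h2; omega

lemma rho_cls_inj {Y : ℕ} (j k : JJ Y) (h1 : rho j = rho k) (h2 : clsJ j = clsJ k) : j = k := by
  have hl : lev j = lev k := by
    have a := lev_eq j; have b := lev_eq k
    rw [h1, h2, ← b] at a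
    exact_mod_cast a
  refine JJ_ext j k ?_ hl
  unfold rho at h1
  rw [hl] at h1
  have := sqrtp_pos k
  exact mul_right_cancel₀ (by positivity) h1

lemma lamJ_indep {Y : ℕ} (ι : Type) [Fintype ι] (f : ι → JJ Y) (h : ∑ i, lamJ (f i) = 0) (m : ℕ) :
    ∑ i ∈ Finset.univ.filter (fun i => clsJ (f i) = m), lamJ (f i) = 0 := by
  set s := Finset.univ.image (fun i => clsJ (f i)) with hs
  let c : ℕ → ℚ := fun m => ((∑ i ∈ Finset.univ.filter (fun i => clsJ (f i) = m), rho (f i) : ℤ) : ℚ)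
  have hfib : ∀ m, ∑ i ∈ Finset.univ.filter (fun i => clsJ (f i) = m), lamJ (f i) = (c m : ℝ) * √(m:ℝ) := by
    intro m
    simp only [c]
    push_cast
    rw [Finset.sum_mul]
    apply Finset.sum_congr rfl
    intro i hi
    rw [lamJ_eq, (Finset.mem_filter.1 hi).2]
  have h2 : ∑ m ∈ s, (c m : ℝ) * √(m:ℝ) = 0 := by
    rw [← h, ← Finset.sum_fiberwise_of_maps_to (s := Finset.univ) (t := s) (g := fun i => clsJ (f i))
      (fun i _ => Finset.mem_image_of_mem _ (Finset.mem_univ i))]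
    apply Finset.sum_congr rfl
    intro m _
    rw [hfib]
  have h3 := sqrt_indep s (by
    intro m hm
    rw [hs, Finset.mem_image] at hm
    obtain ⟨i, _, rfl⟩ := hm
    exact (sqp_spec _).2) c h2
  rw [hfib]
  by_cases hm : m ∈ s
  · rw [h3 m hm]; simp
  · have : Finset.univ.filter (fun i => clsJ (f i) = m) = ∅ := by
      apply Finset.filter_eq_empty_iff.2
      intro i _ hi
      apply hm; rw [hs, Finset.mem_image]; exact ⟨i, Finset.mem_univ _, hi⟩
    simp only [c, this]; simp

/-- weights on JJ -/
def cJ {Y : ℕ} (w : ℝ) (j : JJ Y) : ℝ := cw w (lev j)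

lemma Ssum_eq_filter {J : Type} [Fintype J] (cls : J → ℕ) (lam : J → ℝ) (c : J → ℝ) (ι : Type) [Fintype ι] :
    ∃ S : Finset (ι → J), (∀ f ∈ S, (∀ i j, cls (f i) = cls (f j)) ∧ ∑ i, lam (f i) = 0) ∧
    Ssum cls lam c ι = ∑ f ∈ S, ∏ i, c (f i) := by
  refine ⟨Finset.univ.filter (fun f : ι → J =>
      (∀ i j, cls (f i) = cls (f j)) ∧ ∑ i, lam (f i) = 0), fun f hf => (Finset.mem_filter.1 hf).2, ?_⟩
  unfold Ssum
  rw [Finset.sum_filter]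

lemma Ssum_one (Y : ℕ) (w : ℝ) : Ssum clsJ lamJ (cJ w) (J := JJ Y) (Fin 1) = 0 := by
  unfold Ssum
  apply Finset.sum_eq_zero
  intro f _
  rw [if_neg]
  rintro ⟨_, h⟩
  simp only [Finset.univ_unique, Finset.sum_singleton] at h
  rw [lamJ_eq] at h
  have h1 := rho_ne (f default)
  have h2 := clsJ_pos (f default)
  have h3 : √(clsJ (f default) : ℝ) ≠ 0 := by positivity
  have h4 : (rho (f default) : ℝ) ≠ 0 := by exact_mod_cast h1
  exact (mul_ne_zero h4 h3) h

lemma sum_JJ (Y : ℕ) (F : ℕ → ℝ) : ∑ j : JJ Y, F (lev j) = 2 * ∑ l ∈ Finset.Icc 1 Y, F l := by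
  rw [Fintype.sum_prod_type]
  simp only [lev]
  rw [Fintype.sum_bool]
  have : ∑ x : Fin Y, F (↑x + 1) = ∑ l ∈ Finset.Icc 1 Y, F l := by
    rw [Fin.sum_univ_eq_sum_range (fun k => F (k+1)) Y, Finset.sum_bij (fun k _ => k + 1)]
    · intro a ha; simp at ha ⊢; omega
    · intro a _ b _ h; omega
    · intro b hb; simp at hb; exact ⟨b - 1, by simp; omega, by omega⟩
    · intro a _; rfl
  rw [this]; ring

lemma lamJ_sum_zero {Y : ℕ} (j k : JJ Y) (h : lamJ j + lamJ k = 0) : lev j = lev k ∧ sgn k = - sgn j := by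
  have h1 : (lamJ j)^2 = (lamJ k)^2 := by rw [show lamJ j = -lamJ k by linarith]; ring
  have hsq : ∀ j : JJ Y, (lamJ j)^2 = lev j := by
    intro j; unfold lamJ
    rw [mul_pow, Real.sq_sqrt (by positivity)]
    rcases sgn_cases j with h | h <;> rw [h] <;> simp
  rw [hsq, hsq] at h1
  have hl : lev j = lev k := by exact_mod_cast h1
  refine ⟨hl, ?_⟩
  unfold lamJ at h
  rw [hl] at h
  have hpos : (0:ℝ) < √(lev k : ℝ) := by
    apply Real.sqrt_pos.2; exact_mod_cast lev_pos k
  have : ((sgn j : ℝ) + (sgn k : ℝ)) * √(lev k : ℝ) = 0 := by linarith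
  rcases mul_eq_zero.1 this with h5 | h5
  · have : sgn j + sgn k = 0 := by exact_mod_cast h5
    linarith
  · exact absurd h5 hpos.ne'

lemma Ssum_two (Y : ℕ) (w : ℝ) :
    Ssum clsJ lamJ (cJ w) (J := JJ Y) (Fin 2) ≤ 2 * ∑ l ∈ Finset.Icc 1 Y, (cw w l)^2 := by
  rw [← sum_JJ Y (fun l => (cw w l)^2)]
  obtain ⟨S, hS, hSe⟩ := Ssum_eq_filter clsJ lamJ (cJ w) (J := JJ Y) (Fin 2)
  rw [hSe]
  have hmem : ∀ f ∈ S, lamJ (f 0) + lamJ (f 1) = 0 := by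
    intro f hf
    have := (hS f hf).2
    rwa [Fin.sum_univ_two] at this
  have hinj : Set.InjOn (fun f : Fin 2 → JJ Y => f 0) S := by
    intro f hf g hg hfg
    simp only at hfg
    have h1 := lamJ_sum_zero _ _ (hmem f hf)
    have h2 := lamJ_sum_zero _ _ (hmem g hg)
    funext i
    fin_cases i
    · exact hfg
    · apply JJ_ext
      · simp only [Fin.mk_one]
        rw [h1.2, h2.2, hfg]
      · simp only [Fin.mk_one]
        rw [← h1.1, ← h2.1, hfg]
  calc _ = ∑ f ∈ S, (cw w (lev (f 0)))^2 := by
        apply Finset.sum_congr rfl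
        intro f hf
        rw [Fin.prod_univ_two]
        unfold cJ
        rw [← (lamJ_sum_zero _ _ (hmem f hf)).1]; ring
    _ = ∑ j ∈ S.image (fun f : Fin 2 → JJ Y => f 0), (cw w (lev j))^2 := by
        rw [Finset.sum_image hinj]
    _ ≤ _ := by
        apply Finset.sum_le_sum_of_subset_of_nonneg (Finset.subset_univ _)
        intros; positivity

set_option maxHeartbeats 1000000 in
lemma Ssum_ge_three (t : ℕ) (ht : 2 ≤ t) : ∃ C : ℝ, 0 ≤ C ∧ ∀ (Y : ℕ) (w : ℝ), 0 ≤ w →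
    Ssum clsJ lamJ (cJ w) (J := JJ Y) (Fin (t+1)) ≤ C * w ^ (t+1) := by
  have ht0 : (2:ℝ) ≤ t := by exact_mod_cast ht
  set ε : ℝ := 1 / (4 * ((t:ℝ)+1)) with hε
  have hε0 : 0 < ε := by rw [hε]; positivity
  obtain ⟨A, hA, hAb⟩ := r2_bound ε hε0
  obtain ⟨R, hR, hRb⟩ := rho_sum_bound t (by omega)
  have hsum : Summable (fun n : ℕ => (n:ℝ) ^ (-(5/4):ℝ)) := Real.summable_nat_rpow.2 (by norm_num)
  set Q := ∑' n : ℕ, (n:ℝ) ^ (-(5/4):ℝ) with hQ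
  have hQ0 : 0 ≤ Q := tsum_nonneg (fun n => by positivity)
  refine ⟨(A * (2 * π)) ^ (t+1) * (Q * R), by positivity, fun Y w hw => ?_⟩
  set p : ℝ := 1 - 1/(2*((t:ℝ)+1)) with hp
  have hcb : ∀ j : JJ Y, cJ w j ≤ (A * (2 * π) * w) * ((clsJ j : ℝ) ^ (-(p/2)) * |(rho j : ℝ)| ^ (-p)) := by
    intro j
    have hl0 : (0:ℝ) < lev j := by exact_mod_cast lev_pos j
    have hr0 : 0 < |(rho j : ℝ)| := by rw [abs_pos]; exact_mod_cast rho_ne j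
    have hm0 : (0:ℝ) < clsJ j := by exact_mod_cast clsJ_pos j
    have e1 : cJ w j ≤ (A * (lev j : ℝ)^ε) * (2 * π * w / √(lev j : ℝ)) := by
      unfold cJ cw
      apply mul_le_mul (hAb _ (lev_pos j)) (min_le_right _ _) (gw_nonneg w hw _)
      positivity
    refine e1.trans (le_of_eq ?_)
    have e2 : (lev j : ℝ)^ε / √(lev j : ℝ) = (lev j : ℝ) ^ (-(p/2)) := by
      rw [Real.sqrt_eq_rpow, ← Real.rpow_sub hl0]
      congr 1
      rw [hp, hε]; field_simp; ring
    have e3 : (lev j : ℝ) ^ (-(p/2)) = (clsJ j : ℝ) ^ (-(p/2)) * |(rho j : ℝ)| ^ (-p) := by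
      rw [lev_eq, Real.mul_rpow (by positivity) hm0.le, ← Real.rpow_natCast, ← Real.rpow_mul hr0.le, mul_comm]
      congr 2
      push_cast; ring
    rw [← e3, ← e2]; ring
  obtain ⟨S, hS, hSe⟩ := Ssum_eq_filter clsJ lamJ (cJ w) (J := JJ Y) (Fin (t+1))
  rw [hSe]
  set T := (Fintype.piFinset (fun _ : Fin (t+1) => (Finset.Icc (-(Y:ℤ)) Y).erase 0)).filter
      (fun x => ∑ i, x i = 0) with hT
  let g : (Fin (t+1) → JJ Y) → ℕ × (Fin (t+1) → ℤ) := fun f => (clsJ (f 0), fun i => rho (f i))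
  have hmono : ∀ f ∈ S, ∀ i, clsJ (f i) = clsJ (f 0) := fun f hf i => (hS f hf).1 i 0
  have hinj : Set.InjOn g S := by
    intro f hf f' hf' h
    simp only [g, Prod.mk.injEq] at h
    funext i
    apply rho_cls_inj
    · exact congrFun h.2 i
    · rw [hmono f hf, hmono f' hf', h.1]
  have himg : S.image g ⊆ Finset.Icc 1 Y ×ˢ T := by
    intro y hy
    rw [Finset.mem_image] at hy
    obtain ⟨f, hf, rfl⟩ := hy
    simp only [g, Finset.mem_product, Finset.mem_Icc, hT, Finset.mem_filter, Fintype.mem_piFinset,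
      Finset.mem_erase]
    have hlm : ∀ j : JJ Y, clsJ j ≤ Y := by
      intro j
      refine le_trans ?_ (lev_le j)
      have := (sqp_spec (lev j)).1
      exact Nat.le_of_dvd (lev_pos j) ⟨_, by rw [mul_comm] at this; exact this.symm⟩
    have hlr : ∀ j : JJ Y, |rho j| ≤ (Y:ℤ) := by
      intro j
      rw [rho_abs]
      have h1 := (sqp_spec (lev j)).1
      have h2 : sqrtp (lev j) ≤ lev j := Nat.le_of_dvd (lev_pos j) ⟨sqrtp (lev j) * sqfp (lev j), by
        conv_lhs => rw [← h1]
        ring⟩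
      exact_mod_cast h2.trans (lev_le j)
    refine ⟨⟨clsJ_pos _, hlm _⟩, fun i => ⟨rho_ne _, abs_le.1 (hlr _)⟩, ?_⟩
    have h0 := (hS f hf).2
    have h1 : (∑ i, (rho (f i) : ℝ)) * √(clsJ (f 0) : ℝ) = 0 := by
      rw [← h0, Finset.sum_mul]
      apply Finset.sum_congr rfl
      intro i _
      rw [lamJ_eq, hmono f hf i]
    have h2 := clsJ_pos (f 0)
    have h3 : √(clsJ (f 0) : ℝ) ≠ 0 := by positivity
    have h4 := (mul_eq_zero.1 h1).resolve_right h3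
    exact_mod_cast h4
  calc ∑ f ∈ S, ∏ i, cJ w (f i)
      ≤ ∑ f ∈ S, (A * (2 * π) * w) ^ (t+1) * ((((g f).1 : ℕ) : ℝ) ^ (-(5/4):ℝ) *
          ∏ i, |(((g f).2 i : ℤ) : ℝ)| ^ (-p)) := by
        apply Finset.sum_le_sum
        intro f hf
        calc ∏ i, cJ w (f i) ≤ ∏ i, ((A * (2 * π) * w) * ((clsJ (f 0) : ℝ) ^ (-(p/2)) * |(rho (f i) : ℝ)| ^ (-p))) := by
              apply Finset.prod_le_prod
              · intro i _; exact cw_nonneg w hw _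
              · intro i _
                rw [← hmono f hf i]; exact hcb _
          _ = (A * (2 * π) * w) ^ (t+1) * (((clsJ (f 0) : ℝ) ^ (-(p/2)))^(t+1) * ∏ i, |(rho (f i) : ℝ)| ^ (-p)) := by
              have hgen : ∀ (a b : ℝ) (c : Fin (t+1) → ℝ), ∏ i, (a * (b * c i)) = a ^ (t+1) * (b ^ (t+1) * ∏ i, c i) := by
                intro a b c
                rw [Finset.prod_mul_distrib, Finset.prod_mul_distrib, Finset.prod_const, Finset.prod_const,
                  Finset.card_univ, Fintype.card_fin]
              exact hgen _ _ _
          _ ≤ _ := by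
              simp only [g]
              have hm1 : (1:ℝ) ≤ clsJ (f 0) := by exact_mod_cast clsJ_pos (f 0)
              have : ((clsJ (f 0) : ℝ) ^ (-(p/2)))^(t+1) ≤ (clsJ (f 0) : ℝ) ^ (-(5/4):ℝ) := by
                rw [← Real.rpow_natCast, ← Real.rpow_mul (by linarith)]
                apply Real.rpow_le_rpow_of_exponent_le hm1
                push_cast
                have : -(p/2) * ((t:ℝ)+1) = -(((t:ℝ)+1)/2 - 1/4) := by
                  rw [hp]; field_simp; ring
                rw [this]; linarith
              have h5 : 0 ≤ ∏ i, |(rho (f i) : ℝ)| ^ (-p) := Finset.prod_nonneg (fun _ _ => by positivity)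
              gcongr
    _ = (A * (2 * π) * w) ^ (t+1) * ∑ y ∈ S.image g, (((y.1 : ℕ) : ℝ) ^ (-(5/4):ℝ) *
          ∏ i, |((y.2 i : ℤ) : ℝ)| ^ (-p)) := by
        rw [Finset.sum_image hinj, Finset.mul_sum]
    _ ≤ (A * (2 * π) * w) ^ (t+1) * ∑ y ∈ Finset.Icc 1 Y ×ˢ T, (((y.1 : ℕ) : ℝ) ^ (-(5/4):ℝ) *
          ∏ i, |((y.2 i : ℤ) : ℝ)| ^ (-p)) := by
        apply mul_le_mul_of_nonneg_left _ (by positivity)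
        apply Finset.sum_le_sum_of_subset_of_nonneg himg
        intro y _ _
        exact mul_nonneg (by positivity) (Finset.prod_nonneg (fun _ _ => by positivity))
    _ = (A * (2 * π) * w) ^ (t+1) * ((∑ m ∈ Finset.Icc 1 Y, ((m : ℕ) : ℝ) ^ (-(5/4):ℝ)) *
          ∑ x ∈ T, ∏ i, |((x i : ℤ) : ℝ)| ^ (-p)) := by
        rw [Finset.sum_mul_sum, Finset.sum_product]
    _ ≤ (A * (2 * π) * w) ^ (t+1) * (Q * R) := by
        apply mul_le_mul_of_nonneg_left _ (by positivity)
        apply mul_le_mul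
        · exact hsum.sum_le_tsum _ (fun _ _ => by positivity)
        · exact hRb Y
        · exact Finset.sum_nonneg (fun _ _ => Finset.prod_nonneg (fun _ _ => by positivity))
        · exact hQ0
    _ = _ := by rw [mul_pow (A * (2 * π)) w]; ac_rfl

/-- Lemma D: diagonal sums. -/
lemma lemmaD (n : ℕ) : ∃ C : ℝ, 0 ≤ C ∧ ∀ (Y : ℕ) (w : ℝ), 0 < w → w ≤ 1/2 →
    Zsum lamJ (cJ w) (J := JJ Y) (Fin n) ≤ C * |w * Real.log w| ^ n := by
  obtain ⟨C2, hC2, hC2b⟩ := sum_cw_sq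
  have h3 : ∀ s : ℕ, ∃ K : ℝ, 0 ≤ K ∧ ∀ (Y : ℕ) (w : ℝ), 0 < w → w ≤ 1/2 → 1 ≤ s →
      Ssum clsJ lamJ (cJ w) (J := JJ Y) (Fin s) ≤ K * |w * Real.log w| ^ s := by
    intro s
    match s with
    | 0 => exact ⟨0, le_refl _, fun Y w _ _ h => absurd h (by norm_num)⟩
    | 1 => exact ⟨0, le_refl _, fun Y w _ _ _ => by rw [Ssum_one]; simp⟩
    | 2 =>
      refine ⟨2 * C2, by positivity, fun Y w h0 h1 _ => ?_⟩
      refine (Ssum_two Y w).trans ?_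
      have := hC2b w h0 h1 Y
      rw [sq_abs]; linarith
    | (t+3) =>
      obtain ⟨C, hC, hCb⟩ := Ssum_ge_three (t+2) (by omega)
      refine ⟨C * 2 ^ (t+3), by positivity, fun Y w h0 h1 _ => ?_⟩
      refine (hCb Y w h0.le).trans ?_
      have hL := half_le_log w h0 h1
      have : w ≤ 2 * |w * Real.log w| := by
        rw [abs_mul, abs_of_pos h0, abs_of_neg (by linarith : Real.log w < 0)]
        nlinarith
      rw [mul_assoc, ← mul_pow]
      gcongr
  choose K hK0 hK using h3
  obtain ⟨C, hC, hCb⟩ := Zsum_bound K hK0 n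
  refine ⟨C, hC, fun Y w h0 h1 => ?_⟩
  refine hCb (JJ Y) clsJ lamJ (cJ w) (|w * Real.log w|) (abs_nonneg _) (fun j => cw_nonneg w h0.le _) ?_
    (fun s hs => hK s Y w h0 h1 hs) (Fin n) (Fintype.card_fin n)
  intro ι _ f hf m
  exact lamJ_indep ι f hf m

end inst

section tv

lemma tv_no_zero (g g' : ℝ → ℝ) (a b W : ℝ) (hab : a ≤ b)
    (hd : ∀ x ∈ Set.Icc a b, HasDerivAt g (g' x) x) (hc : ContinuousOn g' (Set.Icc a b))
    (hg : ∀ x ∈ Set.Icc a b, 0 ≤ g x ∧ g x ≤ W) (hz : ∀ x ∈ Set.Ioo a b, g' x ≠ 0) :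
    ∫ x in a..b, |g' x| ≤ W := by
  have hint : IntervalIntegrable g' volume a b := (hc.mono (by rw [Set.uIcc_of_le hab])).intervalIntegrable
  have hft : ∫ x in a..b, g' x = g b - g a :=
    intervalIntegral.integral_eq_sub_of_hasDerivAt (fun x hx => hd x (by rwa [Set.uIcc_of_le hab] at hx)) hint
  have ha := hg a ⟨le_refl _, hab⟩
  have hb := hg b ⟨hab, le_refl _⟩
  have hsign : (∀ x ∈ Set.Ioo a b, 0 ≤ g' x) ∨ (∀ x ∈ Set.Ioo a b, g' x ≤ 0) := by
    by_contra hcon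
    push Not at hcon
    obtain ⟨⟨x, hx, hx0⟩, ⟨y, hy, hy0⟩⟩ := hcon
    have hpre := (isPreconnected_Ioo (a := a) (b := b)).intermediate_value hx hy (hc.mono Set.Ioo_subset_Icc_self)
    obtain ⟨z, hz1, hz2⟩ := hpre ⟨hx0.le, hy0.le⟩
    exact hz z hz1 hz2
  have hae : ∀ h : ℝ → ℝ, (∀ x ∈ Set.Ioo a b, |g' x| = h x) → ∫ x in a..b, |g' x| = ∫ x in a..b, h x := by
    intro h hh
    rw [intervalIntegral.integral_of_le hab, intervalIntegral.integral_of_le hab,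
      integral_Ioc_eq_integral_Ioo, integral_Ioc_eq_integral_Ioo]
    exact setIntegral_congr_fun measurableSet_Ioo (fun x hx => hh x hx)
  rcases hsign with h | h
  · rw [hae g' (fun x hx => abs_of_nonneg (h x hx)), hft]; linarith
  · rw [hae (fun x => - g' x) (fun x hx => abs_of_nonpos (h x hx)), intervalIntegral.integral_neg, hft]; linarith

lemma tv_bound (g g' : ℝ → ℝ) (W : ℝ) (n : ℕ) : ∀ (S : Finset ℝ), S.card = n → ∀ (a b : ℝ), a ≤ b →
    (∀ x ∈ Set.Icc a b, HasDerivAt g (g' x) x) → ContinuousOn g' (Set.Icc a b) →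
    (∀ x ∈ Set.Icc a b, 0 ≤ g x ∧ g x ≤ W) → (∀ x ∈ Set.Ioo a b, g' x = 0 → x ∈ S) →
    ∫ x in a..b, |g' x| ≤ ((n:ℝ) + 1) * W := by
  induction n using Nat.strong_induction_on with
  | _ n ih =>
    intro S hS a b hab hd hc hg hz
    have hW : 0 ≤ W := by
      have := hg a ⟨le_refl _, hab⟩; linarith
    by_cases hex : ∃ z ∈ Set.Ioo a b, g' z = 0
    · obtain ⟨z, hzI, hz0⟩ := hex
      have hzS := hz z hzI hz0
      set S1 := S.filter (fun x => x < z)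
      set S2 := S.filter (fun x => z < x)
      have hcard : S1.card + S2.card + 1 ≤ n := by
        have hdis : Disjoint S1 S2 := by
          rw [Finset.disjoint_left]
          intro x h1 h2
          have := (Finset.mem_filter.1 h1).2
          have := (Finset.mem_filter.1 h2).2
          linarith
        rw [← Finset.card_union_of_disjoint hdis, ← hS]
        have hlt : S1 ∪ S2 ⊂ S := by
          rw [Finset.ssubset_iff_of_subset]
          · refine ⟨z, hzS, ?_⟩
            simp [S1, S2]
          · intro x hx
            rcases Finset.mem_union.1 hx with h | h <;> exact (Finset.mem_filter.1 h).1
        exact Finset.card_lt_card hlt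
      have hsub1 : Set.Icc a z ⊆ Set.Icc a b := Set.Icc_subset_Icc_right hzI.2.le
      have hsub2 : Set.Icc z b ⊆ Set.Icc a b := Set.Icc_subset_Icc_left hzI.1.le
      have i1 := ih S1.card (by omega) S1 rfl a z hzI.1.le (fun x hx => hd x (hsub1 hx)) (hc.mono hsub1)
        (fun x hx => hg x (hsub1 hx)) (fun x hx h0 => Finset.mem_filter.2 ⟨hz x ⟨hx.1, hx.2.trans hzI.2⟩ h0, hx.2⟩)
      have i2 := ih S2.card (by omega) S2 rfl z b hzI.2.le (fun x hx => hd x (hsub2 hx)) (hc.mono hsub2)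
        (fun x hx => hg x (hsub2 hx)) (fun x hx h0 => Finset.mem_filter.2 ⟨hz x ⟨hzI.1.trans hx.1, hx.2⟩ h0, hx.1⟩)
      have hI1 : IntervalIntegrable (fun x => |g' x|) volume a z :=
        ((hc.mono hsub1).abs.mono (by rw [Set.uIcc_of_le hzI.1.le])).intervalIntegrable
      have hI2 : IntervalIntegrable (fun x => |g' x|) volume z b :=
        ((hc.mono hsub2).abs.mono (by rw [Set.uIcc_of_le hzI.2.le])).intervalIntegrable
      rw [← intervalIntegral.integral_add_adjacent_intervals hI1 hI2]
      have : ((S1.card : ℝ) + S2.card + 1) ≤ n := by exact_mod_cast hcard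
      nlinarith
    · push Not at hex
      have := tv_no_zero g g' a b W hab hd hc hg hex
      have hn : (0:ℝ) ≤ n := by positivity
      nlinarith

end tv

section regular

/-- Concrete regularity consequences of the class Ω. -/
lemma omega_reg (ω : ℝ → ℝ) (hω : OmegaClass ω) (δ : ℝ) (hδ : 0 < δ) : ∃ C : ℝ, 0 ≤ C ∧ ∀ᶠ X in atTop, 1 ≤ X ∧
    (∀ x ∈ Set.Icc X (2*X), HasDerivAt ω (deriv ω x) x) ∧ ContinuousOn (deriv ω) (Set.Icc X (2*X)) ∧
    ContinuousOn ω (Set.Icc X (2*X)) ∧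
    (∀ x ∈ Set.Icc X (2*X), 0 < ω x ∧ ω x ≤ δ) ∧ ∫ x in X..(2*X), |deriv ω x| ≤ C * X ^ ((1:ℝ)/2) := by
  obtain ⟨C, hC, ξ, hξ, hz⟩ := hω.zeros_bound
  refine ⟨C + δ, by positivity, ?_⟩
  have hsmall : ∀ᶠ x in atTop, ω x ≤ δ := by
    have := hω.tendsto_zero.eventually (gt_mem_nhds hδ)
    exact this.mono (fun x hx => le_of_lt hx)
  obtain ⟨A, hA⟩ := eventually_atTop.1 hsmall
  filter_upwards [hz, eventually_ge_atTop 1, eventually_ge_atTop A] with X hX hX1 hXA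
  obtain ⟨hf1, _, hb1, _⟩ := hX
  have hX2 : X ≤ 2 * X := by linarith
  have hsub : Set.Icc X (2*X) ⊆ Set.Ioi 0 := fun x hx => lt_of_lt_of_le (by linarith) hx.1
  have hd : ∀ x ∈ Set.Icc X (2*X), HasDerivAt ω (deriv ω x) x := by
    intro x hx
    exact ((hω.contDiff.differentiableOn (by norm_num)).differentiableAt (Ioi_mem_nhds (hsub hx))).hasDerivAt
  have hc : ContinuousOn (deriv ω) (Set.Icc X (2*X)) :=
    (hω.contDiff.continuousOn_deriv_of_isOpen isOpen_Ioi (by norm_num)).mono hsub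
  have hco : ContinuousOn ω (Set.Icc X (2*X)) := hω.contDiff.continuousOn.mono hsub
  have hb : ∀ x ∈ Set.Icc X (2*X), 0 < ω x ∧ ω x ≤ δ := fun x hx => ⟨hω.pos x (hsub hx), hA x (hXA.trans hx.1)⟩
  refine ⟨hX1, hd, hc, hco, hb, ?_⟩
  set W := sSup (ω '' Set.Icc X (2*X)) with hW
  have hbdd : BddAbove (ω '' Set.Icc X (2*X)) := ⟨δ, by rintro _ ⟨x, hx, rfl⟩; exact (hb x hx).2⟩
  have hWd : W ≤ δ := csSup_le ⟨ω X, X, ⟨le_refl _, hX2⟩, rfl⟩ (by rintro _ ⟨x, hx, rfl⟩; exact (hb x hx).2)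
  have h := tv_bound ω (deriv ω) W hf1.toFinset.card hf1.toFinset rfl X (2*X) hX2 hd hc
    (fun x hx => ⟨(hb x hx).1.le, le_csSup hbdd ⟨x, hx, rfl⟩⟩)
    (fun x hx h0 => by rw [Set.Finite.mem_toFinset]; exact ⟨⟨hx.1.le, hx.2.le⟩, h0⟩)
  rw [← Set.ncard_eq_toFinset_card _ hf1] at h
  have h1 : (1:ℝ) ≤ X ^ ((1:ℝ)/2) := Real.one_le_rpow hX1 (by norm_num)
  nlinarith

end regular

section osc

def eC (t : ℝ) : ℂ := Complex.exp ((2 * π * t : ℝ) * Complex.I)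

lemma eC_norm (t : ℝ) : ‖eC t‖ = 1 := by unfold eC; exact Complex.norm_exp_ofReal_mul_I _
lemma eC_add (s t : ℝ) : eC (s + t) = eC s * eC t := by
  unfold eC; rw [← Complex.exp_add]; congr 1; push_cast; ring
lemma eC_zero : eC 0 = 1 := by unfold eC; simp
lemma eC_sum {ι : Type} (s : Finset ι) (f : ι → ℝ) : eC (∑ i ∈ s, f i) = ∏ i ∈ s, eC (f i) := by
  classical
  induction s using Finset.induction_on with
  | empty => simp [eC_zero]
  | insert a s ha ih => rw [Finset.sum_insert ha, Finset.prod_insert ha, eC_add, ih]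
lemma eC_re (t : ℝ) : (eC t).re = Real.cos (2 * π * t) := by
  unfold eC; exact Complex.exp_ofReal_mul_I_re _
lemma eC_add_neg (t : ℝ) : eC t + eC (-t) = ((2 * Real.cos (2*π*t) : ℝ) : ℂ) := by
  unfold eC
  push_cast
  rw [Complex.two_cos]; congr 2; ring
lemma eC_hasDeriv (lam : ℝ) (x : ℝ) : HasDerivAt (fun x : ℝ => eC (lam * x)) ((2 * π * lam : ℝ) * Complex.I * eC (lam * x)) x := by
  unfold eC
  have h1 : HasDerivAt (fun x : ℝ => (((2 * π * (lam * x) : ℝ)) : ℂ) * Complex.I) (((2 * π * lam : ℝ) : ℂ) * Complex.I) x := by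
    have : HasDerivAt (fun x : ℝ => 2 * π * (lam * x)) (2 * π * lam) x := by
      have := ((hasDerivAt_id x).const_mul lam).const_mul (2*π)
      simpa using this
    exact this.ofReal_comp.mul_const _
  have := h1.cexp
  convert this using 1
  ring
lemma eC_cont : Continuous eC := by unfold eC; fun_prop

lemma eC_sub_one (t : ℝ) : ‖eC t - 1‖ ≤ 2 * π * |t| := by
  unfold eC
  have := Real.norm_exp_I_mul_ofReal_sub_one_le (x := 2 * π * t)
  rw [mul_comm Complex.I] at this
  refine this.trans ?_
  rw [Real.norm_eq_abs, abs_mul, abs_of_pos (by positivity : 0 < 2 * π)]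

lemma eC_sub_one_two (t : ℝ) : ‖eC t - 1‖ ≤ 2 := by
  refine (norm_sub_le _ _).trans ?_
  rw [eC_norm]; norm_num

lemma osc_bound (ω ω' : ℝ → ℝ) (X T : ℝ) (hX : 0 ≤ X)
    (hd : ∀ x ∈ Set.Icc X (2*X), HasDerivAt ω (ω' x) x) (hc : ContinuousOn ω' (Set.Icc X (2*X)))
    (hco : ContinuousOn ω (Set.Icc X (2*X)))
    (hT : ∫ x in X..(2*X), |ω' x| ≤ T) (Lam : ℝ) (hL : Lam ≠ 0) (β β' : ℝ → ℂ)
    (hβ : ∀ w, HasDerivAt β (β' w) w) (hβc : Continuous β') (M M' : ℝ) (hM : ∀ w, ‖β w‖ ≤ M) (hM' : ∀ w, ‖β' w‖ ≤ M') :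
    ‖∫ x in X..(2*X), eC (Lam * x) * β (ω x)‖ ≤ (2 * M + M' * T) / (2 * π * |Lam|) := by
  have hX2 : X ≤ 2 * X := by linarith
  have hM'0 : 0 ≤ M' := (norm_nonneg _).trans (hM' 0)
  set K : ℂ := (2 * π * Lam : ℝ) * Complex.I with hK
  have hKn : ‖K‖ = 2 * π * |Lam| := by
    rw [hK, norm_mul, Complex.norm_I, mul_one, Complex.norm_real, Real.norm_eq_abs, abs_mul, abs_of_pos (by positivity : 0 < 2 * π)]
  have hKpos : 0 < 2 * π * |Lam| := by positivity
  have hK0 : K ≠ 0 := by rw [← norm_pos_iff, hKn]; exact hKpos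
  have hu : ∀ x ∈ Set.uIcc X (2*X), HasDerivAt (fun x => β (ω x)) (((ω' x : ℝ) : ℂ) * β' (ω x)) x := by
    intro x hx
    rw [Set.uIcc_of_le hX2] at hx
    have := (hβ (ω x)).scomp x (hd x hx)
    rw [Complex.real_smul] at this
    exact this
  have hv : ∀ x ∈ Set.uIcc X (2*X), HasDerivAt (fun x : ℝ => eC (Lam * x)) (K * eC (Lam * x)) x :=
    fun x _ => eC_hasDeriv Lam x
  have hu'c : ContinuousOn (fun x => ((ω' x : ℝ) : ℂ) * β' (ω x)) (Set.Icc X (2*X)) :=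
    (Complex.continuous_ofReal.comp_continuousOn hc).mul (hβc.comp_continuousOn hco)
  have hv'c : Continuous (fun x : ℝ => K * eC (Lam * x)) :=
    continuous_const.mul (eC_cont.comp (continuous_const.mul continuous_id))
  have hparts := intervalIntegral.integral_mul_deriv_eq_deriv_mul hu hv
    ((hu'c.mono (by rw [Set.uIcc_of_le hX2])).intervalIntegrable) (hv'c.intervalIntegrable _ _)
  have e1 : ∫ x in X..(2*X), β (ω x) * (K * eC (Lam * x)) = K * ∫ x in X..(2*X), eC (Lam * x) * β (ω x) := by
    rw [← intervalIntegral.integral_const_mul]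
    congr 1; funext x; ring
  rw [e1] at hparts
  have hbound : ‖K * ∫ x in X..(2*X), eC (Lam * x) * β (ω x)‖ ≤ 2 * M + M' * T := by
    rw [hparts]
    refine (norm_sub_le _ _).trans ?_
    have b1 : ‖β (ω (2*X)) * eC (Lam * (2*X)) - β (ω X) * eC (Lam * X)‖ ≤ 2 * M := by
      refine (norm_sub_le _ _).trans ?_
      rw [norm_mul, norm_mul, eC_norm, eC_norm]
      linarith [hM (ω (2*X)), hM (ω X)]
    have b2 : ‖∫ x in X..(2*X), ((ω' x : ℝ) : ℂ) * β' (ω x) * eC (Lam * x)‖ ≤ M' * T := by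
      refine (intervalIntegral.norm_integral_le_integral_norm hX2).trans ?_
      refine le_trans ?_ (mul_le_mul_of_nonneg_left hT hM'0)
      rw [← intervalIntegral.integral_const_mul]
      apply intervalIntegral.integral_mono_on hX2
      · apply ContinuousOn.intervalIntegrable
        rw [Set.uIcc_of_le hX2]
        exact (hu'c.mul (eC_cont.comp (continuous_const.mul continuous_id)).continuousOn).norm
      · apply ContinuousOn.intervalIntegrable
        rw [Set.uIcc_of_le hX2]
        exact continuousOn_const.mul hc.abs
      · intro x _
        rw [norm_mul, norm_mul, eC_norm, mul_one, Complex.norm_real, Real.norm_eq_abs, mul_comm]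
        exact mul_le_mul_of_nonneg_right (hM' _) (abs_nonneg _)
    linarith
  rw [norm_mul, hKn] at hbound
  rw [le_div_iff₀ hKpos]; linarith

/-- product of (e(lam_i w) - 1) -/
def betaF {n : ℕ} (lam : Fin n → ℝ) (w : ℝ) : ℂ := ∏ i, (eC (lam i * w) - 1)
def betaF' {n : ℕ} (lam : Fin n → ℝ) (w : ℝ) : ℂ :=
  ∑ i, (∏ j ∈ Finset.univ.erase i, (eC (lam j * w) - 1)) * ((2 * π * lam i : ℝ) * Complex.I * eC (lam i * w))

lemma betaF_deriv {n : ℕ} (lam : Fin n → ℝ) (w : ℝ) : HasDerivAt (betaF lam) (betaF' lam w) w := by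
  unfold betaF betaF'
  have := HasDerivAt.fun_finsetProd (u := Finset.univ) (f := fun i (w:ℝ) => eC (lam i * w) - 1)
    (f' := fun i => (2 * π * lam i : ℝ) * Complex.I * eC (lam i * w)) (x := w)
    (fun i _ => (eC_hasDeriv (lam i) w).sub_const 1)
  simpa only [smul_eq_mul] using this

lemma betaF_norm {n : ℕ} (lam : Fin n → ℝ) (w : ℝ) : ‖betaF lam w‖ ≤ 2 ^ n := by
  unfold betaF
  rw [norm_prod]
  calc _ ≤ ∏ i : Fin n, (2:ℝ) := Finset.prod_le_prod (fun _ _ => norm_nonneg _) (fun i _ => eC_sub_one_two _)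
    _ = _ := by simp

lemma betaF'_norm {n : ℕ} (lam : Fin n → ℝ) (L : ℝ) (hL : ∀ i, |lam i| ≤ L) (w : ℝ) :
    ‖betaF' lam w‖ ≤ n * (2 ^ n * (2 * π * L)) := by
  unfold betaF'
  refine (norm_sum_le _ _).trans ?_
  calc _ ≤ ∑ i : Fin n, (2 ^ n * (2 * π * L)) := by
        apply Finset.sum_le_sum
        intro i _
        rw [norm_mul, norm_mul, norm_mul, eC_norm, Complex.norm_I, mul_one, mul_one, Complex.norm_real, norm_prod]
        have hL0 : 0 ≤ L := (abs_nonneg _).trans (hL i)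
        apply mul_le_mul
        · calc _ ≤ ∏ j ∈ Finset.univ.erase i, (2:ℝ) := Finset.prod_le_prod (fun _ _ => norm_nonneg _) (fun i _ => eC_sub_one_two _)
            _ = 2 ^ (Finset.univ.erase i).card := by simp
            _ ≤ 2 ^ n := by
              apply pow_le_pow_right₀ (by norm_num)
              refine (Finset.card_le_univ _).trans ?_
              simp
        · rw [Real.norm_eq_abs, abs_mul, abs_of_pos (by positivity : 0 < 2 * π)]
          exact mul_le_mul_of_nonneg_left (hL i) (by positivity)
        · exact norm_nonneg _
        · positivity
    _ = _ := by simp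

lemma betaF'_cont {n : ℕ} (lam : Fin n → ℝ) : Continuous (betaF' lam) := by
  unfold betaF'
  have := eC_cont
  fun_prop

end osc

section expand
open Classical

def aw (l : ℕ) : ℝ := (r2 l : ℝ) / l
def PY (Y : ℕ) (y : ℝ) : ℝ := -(√2/π) * ∑ l ∈ Finset.Icc 1 Y, aw l * Real.cos (2 * π * (√(l:ℝ) * y))
def kk : ℝ := -(√2/(2*π))
def dP (Y : ℕ) (ω : ℝ → ℝ) (x : ℝ) : ℝ := PY Y (x + ω x) - PY Y x

lemma aw_nonneg (l : ℕ) : 0 ≤ aw l := by unfold aw; positivity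

lemma kk_abs : |kk| ≤ 1 := by
  unfold kk
  rw [abs_neg, abs_of_nonneg (by positivity), div_le_one (by positivity)]
  have : √2 ≤ 2 := by rw [Real.sqrt_le_left (by norm_num)]; norm_num
  linarith [Real.pi_gt_three]

lemma sum_JJ' (Y : ℕ) (F : ℕ → ℝ → ℂ) : ∑ j : JJ Y, F (lev j) (sgn j) = ∑ l ∈ Finset.Icc 1 Y, (F l 1 + F l (-1)) := by
  rw [Fintype.sum_prod_type, Fintype.sum_bool, Finset.sum_add_distrib]
  simp only [lev, sgn]
  have : ∀ G : ℕ → ℂ, ∑ x : Fin Y, G (↑x + 1) = ∑ l ∈ Finset.Icc 1 Y, G l := by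
    intro G
    rw [Fin.sum_univ_eq_sum_range (fun k => G (k+1)) Y, Finset.sum_bij (fun k _ => k + 1)]
    · intro a ha; simp at ha ⊢; omega
    · intro a _ b _ h; omega
    · intro b hb; simp at hb; exact ⟨b - 1, by simp; omega, by omega⟩
    · intro a _; rfl
  rw [← this, ← this]
  simp

lemma PY_expand (Y : ℕ) (y : ℝ) : ((PY Y y : ℝ) : ℂ) = ∑ j : JJ Y, ((kk * aw (lev j) : ℝ) : ℂ) * eC (lamJ j * y) := by
  have := sum_JJ' Y (fun l s => ((kk * aw l : ℝ) : ℂ) * eC (s * √(l:ℝ) * y))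
  unfold lamJ
  rw [this]
  unfold PY
  rw [Finset.mul_sum]
  push_cast
  apply Finset.sum_congr rfl
  intro l _
  rw [← mul_add, show (-1 * √(l:ℝ) * y) = -(1 * √(l:ℝ) * y) by ring, eC_add_neg]
  unfold kk
  push_cast
  rw [show (2:ℂ) * π * (1 * ((√(l:ℝ) : ℝ):ℂ) * y) = 2 * π * ((√(l:ℝ) : ℝ) * y) by ring]
  have : (π:ℂ) ≠ 0 := by exact_mod_cast Real.pi_ne_zero
  field_simp

lemma dP_expand (Y : ℕ) (ω : ℝ → ℝ) (x : ℝ) : ((dP Y ω x : ℝ) : ℂ) =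
    ∑ j : JJ Y, ((kk * aw (lev j) : ℝ) : ℂ) * (eC (lamJ j * x) * (eC (lamJ j * ω x) - 1)) := by
  unfold dP
  rw [Complex.ofReal_sub, PY_expand, PY_expand, ← Finset.sum_sub_distrib]
  apply Finset.sum_congr rfl
  intro j _
  rw [mul_add, eC_add]; ring

def Lamf {Y n : ℕ} (f : Fin n → JJ Y) : ℝ := ∑ i, lamJ (f i)
def coefA {Y n : ℕ} (f : Fin n → JJ Y) : ℝ := ∏ i, (kk * aw (lev (f i)))
def Diag (Y n : ℕ) (w : ℝ) : ℂ :=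
  ∑ f : Fin n → JJ Y, if Lamf f = 0 then ((coefA f : ℝ) : ℂ) * betaF (fun i => lamJ (f i)) w else 0

lemma dP_pow (Y n : ℕ) (ω : ℝ → ℝ) (x : ℝ) : (((dP Y ω x)^n : ℝ) : ℂ) =
    ∑ f : Fin n → JJ Y, ((coefA f : ℝ) : ℂ) * (eC (Lamf f * x) * betaF (fun i => lamJ (f i)) (ω x)) := by
  rw [Complex.ofReal_pow, dP_expand, Fintype.sum_pow]
  apply Finset.sum_congr rfl
  intro f _
  rw [Finset.prod_mul_distrib, Finset.prod_mul_distrib]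
  unfold coefA Lamf betaF
  rw [Finset.sum_mul, eC_sum]
  push_cast
  rfl

lemma aw_bound : ∃ A : ℝ, 0 < A ∧ ∀ l : ℕ, aw l ≤ A := by
  obtain ⟨C, hC, h⟩ := r2_bound 1 (by norm_num)
  refine ⟨C, hC, fun l => ?_⟩
  rcases Nat.eq_zero_or_pos l with rfl | hl
  · unfold aw; simp; exact hC.le
  · have := h l hl
    rw [Real.rpow_one] at this
    unfold aw
    rw [div_le_iff₀ (by exact_mod_cast hl)]; exact this

lemma Lamf_gap {Y n : ℕ} (hY : 1 ≤ Y) (f : Fin n → JJ Y) (h : Lamf f ≠ 0) :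
    1 / |Lamf f| ≤ (((n:ℝ)+1) * Y) ^ (2^n) := by
  have hg := sqrt_sum_gap (fun i => lev (f i)) (fun i => (sgn (f i) : ℝ))
    (fun i => by rcases sgn_cases (f i) with h | h <;> rw [h] <;> simp) Y (fun i => lev_le _) h
  rw [Fintype.card_fin] at hg
  have hp : 0 < |Lamf f| := abs_pos.2 h
  rw [div_le_iff₀ hp]
  change 1 ≤ |Lamf f| * _ at hg
  refine hg.trans ?_
  rw [mul_comm]
  apply mul_le_mul_of_nonneg_right _ hp.le
  have hY1 : (1:ℝ) ≤ Y := by exact_mod_cast hY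
  have h2 : √(Y:ℝ) ≤ Y := by
    rw [Real.sqrt_le_left (by linarith)]; nlinarith
  apply pow_le_pow_left₀ (by positivity)
  have hn : (0:ℝ) ≤ n := by positivity
  nlinarith

lemma dP_moment (ω : ℝ → ℝ) (hω : OmegaClass ω) (n : ℕ) : ∃ C : ℝ, 0 ≤ C ∧ ∃ D : ℕ, ∀ᶠ X in atTop, ∀ Y : ℕ, 1 ≤ Y →
    ‖((∫ x in X..(2*X), (dP Y ω x)^n : ℝ) : ℂ) - ∫ x in X..(2*X), Diag Y n (ω x)‖ ≤ C * X ^ ((1:ℝ)/2) * (Y:ℝ)^D := by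
  obtain ⟨A, hA, hAb⟩ := aw_bound
  obtain ⟨C, hC, hreg⟩ := omega_reg ω hω 1 one_pos
  refine ⟨2 ^ n * A ^ n * ((2 * 2 ^ n + n * (2 ^ n * (2 * π)) * C) * ((n:ℝ)+1) ^ (2^n)), by positivity, n + 1 + 2^n, ?_⟩
  filter_upwards [hreg] with X hX Y hY
  obtain ⟨hX1, hd, hc, hco, hb, hT⟩ := hX
  have hX2 : X ≤ 2 * X := by linarith
  have hY1 : (1:ℝ) ≤ Y := by exact_mod_cast hY
  have hXs : (1:ℝ) ≤ X ^ ((1:ℝ)/2) := Real.one_le_rpow hX1 (by norm_num)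
  set s := X ^ ((1:ℝ)/2) with hs
  have hbc : ∀ f : Fin n → JJ Y, Continuous (betaF (fun i => lamJ (f i))) := fun f =>
    continuous_iff_continuousAt.2 (fun w => (betaF_deriv _ w).continuousAt)
  have hcont1 : ∀ f : Fin n → JJ Y, ContinuousOn (fun x => ((coefA f : ℝ) : ℂ) * (eC (Lamf f * x) * betaF (fun i => lamJ (f i)) (ω x)))
      (Set.uIcc X (2*X)) := by
    intro f
    rw [Set.uIcc_of_le hX2]
    exact continuousOn_const.mul ((eC_cont.comp (continuous_const.mul continuous_id)).continuousOn.mul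
      ((hbc f).comp_continuousOn hco))
  have hcont2 : ∀ f : Fin n → JJ Y, ContinuousOn (fun x => if Lamf f = 0 then ((coefA f : ℝ) : ℂ) * betaF (fun i => lamJ (f i)) (ω x) else 0)
      (Set.uIcc X (2*X)) := by
    intro f
    rw [Set.uIcc_of_le hX2]
    split_ifs
    · exact continuousOn_const.mul ((hbc f).comp_continuousOn hco)
    · exact continuousOn_const
  rw [← intervalIntegral.integral_ofReal]
  simp_rw [dP_pow]
  unfold Diag
  rw [intervalIntegral.integral_finsetSum (fun f _ => (hcont1 f).intervalIntegrable),
    intervalIntegral.integral_finsetSum (fun f _ => (hcont2 f).intervalIntegrable), ← Finset.sum_sub_distrib]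
  refine (norm_sum_le _ _).trans ?_
  have hterm : ∀ f : Fin n → JJ Y, ‖(∫ x in X..(2*X), ((coefA f : ℝ) : ℂ) * (eC (Lamf f * x) * betaF (fun i => lamJ (f i)) (ω x))) -
      ∫ x in X..(2*X), if Lamf f = 0 then ((coefA f : ℝ) : ℂ) * betaF (fun i => lamJ (f i)) (ω x) else 0‖ ≤
      A ^ n * ((2 * 2 ^ n + n * (2 ^ n * (2 * π)) * C) * (Y * s) * (((n:ℝ)+1) * Y) ^ (2^n)) := by
    intro f
    by_cases h0 : Lamf f = 0
    · simp only [h0, if_true, zero_mul, eC_zero, one_mul, sub_self, norm_zero]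
      positivity
    · simp only [h0, if_false, intervalIntegral.integral_zero, sub_zero]
      rw [intervalIntegral.integral_const_mul, norm_mul]
      apply mul_le_mul
      · rw [Complex.norm_real, Real.norm_eq_abs]
        unfold coefA
        rw [Finset.abs_prod]
        calc _ ≤ ∏ i : Fin n, A := by
              apply Finset.prod_le_prod (fun _ _ => abs_nonneg _)
              intro i _
              rw [abs_mul, abs_of_nonneg (aw_nonneg _)]
              have := kk_abs
              have h2 := hAb (lev (f i))
              have h3 := aw_nonneg (lev (f i))
              nlinarith [abs_nonneg kk]
          _ = _ := by simp
      · have hlam : ∀ i, |lamJ (f i)| ≤ (Y:ℝ) := by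
          intro i
          unfold lamJ
          rw [abs_mul, ← Int.cast_abs, sgn_abs, abs_of_nonneg (Real.sqrt_nonneg _), Int.cast_one, one_mul]
          have : (lev (f i) : ℝ) ≤ Y := by exact_mod_cast lev_le (f i)
          rw [Real.sqrt_le_left (by linarith)]; nlinarith
        have h1 := osc_bound ω (deriv ω) X (C * s) (by linarith) hd hc hco hT (Lamf f) h0
          (betaF (fun i => lamJ (f i))) (betaF' (fun i => lamJ (f i))) (betaF_deriv _) (betaF'_cont _) (2^n)
          (n * (2 ^ n * (2 * π * Y))) (betaF_norm _) (betaF'_norm _ _ hlam)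
        refine h1.trans ?_
        have hg := Lamf_gap hY f h0
        have hLp : 0 < |Lamf f| := abs_pos.2 h0
        have hpi : 1 ≤ 2 * π := by linarith [Real.pi_gt_three]
        calc (2 * 2 ^ n + n * (2 ^ n * (2 * π * Y)) * (C * s)) / (2 * π * |Lamf f|)
            ≤ (2 * 2 ^ n + n * (2 ^ n * (2 * π * Y)) * (C * s)) / (1 * |Lamf f|) := by gcongr
          _ = (2 * 2 ^ n + n * (2 ^ n * (2 * π * Y)) * (C * s)) * (1 / |Lamf f|) := by rw [one_mul, mul_one_div]
          _ ≤ ((2 * 2 ^ n + n * (2 ^ n * (2 * π)) * C) * (Y * s)) * (((n:ℝ)+1) * Y) ^ (2^n) := by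
              apply mul_le_mul _ hg (by positivity) (by positivity)
              have : (1:ℝ) ≤ Y * s := one_le_mul_of_one_le_of_one_le hY1 hXs
              have h2 : (0:ℝ) ≤ 2 * 2 ^ n := by positivity
              nlinarith
      · exact norm_nonneg _
      · positivity
  refine (Finset.sum_le_sum (fun f _ => hterm f)).trans (le_of_eq ?_)
  rw [Finset.sum_const, Finset.card_univ, nsmul_eq_mul]
  simp only [Fintype.card_pi, Fintype.card_prod, Fintype.card_bool, Fintype.card_fin, Finset.prod_const, Finset.card_univ]
  push_cast
  rw [mul_pow, mul_pow, pow_add, pow_add, pow_one]; ring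

lemma coef_le_cw (w : ℝ) (hw : 0 < w) {Y : ℕ} (j : JJ Y) : aw (lev j) * ‖eC (lamJ j * w) - 1‖ ≤ cJ w j := by
  unfold aw cJ cw gw
  rw [div_mul_eq_mul_div, mul_div_assoc]
  apply mul_le_mul_of_nonneg_left _ (by positivity)
  have hl : (0:ℝ) < lev j := by exact_mod_cast lev_pos j
  apply le_min
  · gcongr; exact eC_sub_one_two _
  · have h1 := eC_sub_one (lamJ j * w)
    have h2 : |lamJ j * w| = √(lev j:ℝ) * w := by
      unfold lamJ
      rw [abs_mul, abs_mul, ← Int.cast_abs, sgn_abs, abs_of_nonneg (Real.sqrt_nonneg _), Int.cast_one, one_mul, abs_of_pos hw]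
    rw [h2] at h1
    have hs : 0 < √(lev j:ℝ) := Real.sqrt_pos.2 hl
    rw [div_le_div_iff₀ hl hs]
    have h3 : √(lev j:ℝ) * √(lev j:ℝ) = lev j := Real.mul_self_sqrt hl.le
    calc _ ≤ (2 * π * (√(lev j:ℝ) * w)) * √(lev j:ℝ) := by gcongr
      _ = 2 * π * w * (√(lev j:ℝ) * √(lev j:ℝ)) := by ring
      _ = _ := by rw [h3]

lemma Diag_bound (n : ℕ) : ∃ C : ℝ, 0 ≤ C ∧ ∀ (Y : ℕ) (w : ℝ), 0 < w → w ≤ 1/2 → ‖Diag Y n w‖ ≤ C * |w * Real.log w| ^ n := by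
  obtain ⟨C, hC, h⟩ := lemmaD n
  refine ⟨C, hC, fun Y w h0 h1 => le_trans ?_ (h Y w h0 h1)⟩
  unfold Diag Zsum
  refine (norm_sum_le _ _).trans ?_
  refine le_trans (b := ∑ f : Fin n → JJ Y, if Lamf f = 0 then ∏ i, cJ w (f i) else 0) ?_ (le_of_eq ?_)
  swap
  · apply Finset.sum_congr
    · ext f; simp
    · intro f _; rfl
  apply Finset.sum_le_sum
  intro f _
  split_ifs
  · unfold coefA betaF
    rw [norm_mul, Complex.norm_real, norm_prod, norm_prod, ← Finset.prod_mul_distrib]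
    apply Finset.prod_le_prod (fun _ _ => by positivity)
    intro i _
    refine le_trans ?_ (coef_le_cw w h0 (f i))
    apply mul_le_mul_of_nonneg_right _ (norm_nonneg _)
    rw [norm_mul, Real.norm_eq_abs, Real.norm_eq_abs, abs_of_nonneg (aw_nonneg _)]
    have := kk_abs
    have h3 := aw_nonneg (lev (f i))
    nlinarith
  · simp

end expand

section lower
open Classical

def flipJ {Y : ℕ} (j : JJ Y) : JJ Y := (!j.1, j.2)

lemma lev_flip {Y : ℕ} (j : JJ Y) : lev (flipJ j) = lev j := rfl
lemma sgn_flip {Y : ℕ} (j : JJ Y) : sgn (flipJ j) = - sgn j := by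
  unfold sgn flipJ; rcases h : j.1 <;> simp
lemma lam_flip {Y : ℕ} (j : JJ Y) : lamJ (flipJ j) = - lamJ j := by
  unfold lamJ; rw [sgn_flip, lev_flip]; push_cast; ring
lemma lam_zero_iff {Y : ℕ} (j k : JJ Y) : lamJ j + lamJ k = 0 ↔ k = flipJ j := by
  constructor
  · intro h
    have := lamJ_sum_zero j k h
    apply JJ_ext
    · rw [sgn_flip]; exact this.2
    · rw [lev_flip]; exact this.1.symm
  · rintro rfl; rw [lam_flip]; ring

lemma eC_prod (t : ℝ) : (eC t - 1) * (eC (-t) - 1) = ((4 * (Real.sin (π * t))^2 : ℝ) : ℂ) := by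
  have h1 : eC t * eC (-t) = 1 := by rw [← eC_add]; simp [eC_zero]
  have h2 := eC_add_neg t
  have : (eC t - 1) * (eC (-t) - 1) = 2 - (eC t + eC (-t)) := by linear_combination h1
  rw [this, h2, show 2 * π * t = 2 * (π * t) by ring, Real.cos_two_mul, Real.cos_sq']
  push_cast; ring

lemma Diag_two (Y : ℕ) (w : ℝ) : Diag Y 2 w =
    ((kk^2 * (2 * ∑ l ∈ Finset.Icc 1 Y, (aw l)^2 * (4 * (Real.sin (π * (√(l:ℝ) * w)))^2)) : ℝ) : ℂ) := by
  unfold Diag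
  rw [← (finTwoArrowEquiv (JJ Y)).symm.sum_comp, Fintype.sum_prod_type]
  have h1 : ∀ j : JJ Y, (∑ k : JJ Y, if Lamf ((finTwoArrowEquiv (JJ Y)).symm (j, k)) = 0 then
      ((coefA ((finTwoArrowEquiv (JJ Y)).symm (j, k)) : ℝ) : ℂ) *
        betaF (fun i => lamJ ((finTwoArrowEquiv (JJ Y)).symm (j, k) i)) w else 0) =
      ((kk^2 * ((aw (lev j))^2 * (4 * (Real.sin (π * (√(lev j:ℝ) * w)))^2)) : ℝ) : ℂ) := by
    intro j
    have e : ∀ k : JJ Y, (Lamf ((finTwoArrowEquiv (JJ Y)).symm (j, k)) = 0) = (k = flipJ j) := by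
      intro k
      rw [← lam_zero_iff]
      unfold Lamf
      rw [Fin.sum_univ_two]; rfl
    simp_rw [e]
    rw [Finset.sum_ite_eq' Finset.univ (flipJ j)]
    rw [if_pos (Finset.mem_univ _)]
    unfold coefA betaF
    rw [Fin.prod_univ_two, Fin.prod_univ_two]
    simp only [finTwoArrowEquiv_symm_apply, Matrix.cons_val_zero, Matrix.cons_val_one]
    rw [lev_flip, lam_flip, neg_mul, eC_prod, ← Complex.ofReal_mul]
    congr 1
    have : (Real.sin (π * (lamJ j * w)))^2 = (Real.sin (π * (√(lev j:ℝ) * w)))^2 := by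
      unfold lamJ
      rcases sgn_cases j with h | h
      · rw [h]; simp
      · rw [h, show π * (((-1:ℤ):ℝ) * √(lev j:ℝ) * w) = -(π * (√(lev j:ℝ) * w)) by push_cast; ring, Real.sin_neg, neg_sq]
    rw [this]; ring
  rw [Finset.sum_congr rfl (fun j _ => h1 j)]
  rw [← Complex.ofReal_sum, ← Finset.mul_sum]
  congr 2
  exact sum_JJ Y (fun l => (aw l)^2 * (4 * (Real.sin (π * (√(l:ℝ) * w)))^2))

lemma kk_sq_pos : 0 < kk^2 := by
  have : kk ≠ 0 := by unfold kk; rw [neg_ne_zero]; positivity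
  positivity

lemma log_sq_le (w : ℝ) (h0 : 0 < w) (h1 : w ≤ 1/2) : w * (Real.log w)^2 ≤ 4 := by
  have hs : 0 < √w := Real.sqrt_pos.2 h0
  have hlog : Real.log w = 2 * Real.log (√w) := by
    rw [Real.log_sqrt h0.le]; ring
  have hle := Real.log_le_sub_one_of_pos (inv_pos.2 hs)
  rw [Real.log_inv] at hle
  have hneg : Real.log (√w) ≤ 0 := Real.log_nonpos hs.le (by rw [Real.sqrt_le_left (by norm_num)]; linarith)
  have h2 : √w * (-Real.log (√w)) ≤ 1 := by
    have : √w * (√w)⁻¹ = 1 := mul_inv_cancel₀ hs.ne'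
    nlinarith
  have h3 : 0 ≤ √w * (-Real.log (√w)) := mul_nonneg hs.le (by linarith)
  have h4 : √w * √w = w := Real.mul_self_sqrt h0.le
  have : w * (Real.log w)^2 = 4 * (√w * (-Real.log (√w)))^2 := by
    rw [hlog]
    calc _ = (√w * √w) * (2 * Real.log (√w))^2 := by rw [h4]
      _ = _ := by ring
  rw [this]; nlinarith

lemma diag_two_lower : ∃ c : ℝ, 0 < c ∧ ∃ C : ℝ, 0 ≤ C ∧ ∀ (Y : ℕ) (w : ℝ), 1 ≤ Y → 0 < w → w ≤ 1/8 →
    c * (w * Real.log w)^2 - C * (Y:ℝ)^(-(1/2):ℝ) ≤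
    kk^2 * (2 * ∑ l ∈ Finset.Icc 1 Y, (aw l)^2 * (4 * (Real.sin (π * (√(l:ℝ) * w)))^2)) := by
  obtain ⟨c, hc, hcb⟩ := sum_r2_sq_lower
  have hk := kk_sq_pos
  refine ⟨32 * kk^2 * c, by positivity, 32 * kk^2 * c * 4, by positivity, fun Y w hY h0 h1 => ?_⟩
  have hY1 : (1:ℝ) ≤ Y := by exact_mod_cast hY
  set Z := min Y ⌊1/(4*w^2)⌋₊ with hZ
  have hfl : (1:ℝ) ≤ 1/(4*w^2) := by
    rw [le_div_iff₀ (by positivity)]; nlinarith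
  have hfl1 : 1 ≤ ⌊1/(4*w^2)⌋₊ := by
    rw [Nat.one_le_floor_iff]; exact hfl
  have hZ1 : 1 ≤ Z := le_min hY hfl1
  have hmain : 16 * w^2 * (∑ l ∈ Finset.Icc 1 Z, (r2 l:ℝ)^2 / l) ≤
      ∑ l ∈ Finset.Icc 1 Y, (aw l)^2 * (4 * (Real.sin (π * (√(l:ℝ) * w)))^2) := by
    rw [Finset.mul_sum]
    have hsub : Finset.Icc 1 Z ⊆ Finset.Icc 1 Y := Finset.Icc_subset_Icc_right (min_le_left _ _)
    refine le_trans ?_ (Finset.sum_le_sum_of_subset_of_nonneg hsub (fun _ _ _ => by positivity))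
    apply Finset.sum_le_sum
    intro l hl
    rw [Finset.mem_Icc] at hl
    have hl0 : (0:ℝ) < l := by exact_mod_cast hl.1
    have hlw : (l:ℝ) ≤ 1/(4*w^2) := by
      have : l ≤ ⌊1/(4*w^2)⌋₊ := hl.2.trans (min_le_right _ _)
      exact (Nat.le_floor_iff (by positivity)).1 this
    rw [le_div_iff₀ (by positivity)] at hlw
    set s := √(l:ℝ) with hs
    have hss : s * s = l := Real.mul_self_sqrt hl0.le
    have hs0 : 0 < s := Real.sqrt_pos.2 hl0
    have hsw : s * w ≤ 1/2 := by
      by_contra hcon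
      push Not at hcon
      have : (1/2)*(1/2) < (s*w)*(s*w) := mul_lt_mul'' hcon hcon (by norm_num) (by norm_num)
      nlinarith
    have hsin : 2 * (s * w) ≤ Real.sin (π * (s * w)) := by
      have := Real.mul_le_sin (x := π * (s*w)) (by positivity) (by nlinarith [Real.pi_pos])
      refine le_trans (le_of_eq ?_) this
      field_simp
    have hsq : (2 * (s*w))^2 ≤ (Real.sin (π * (s * w)))^2 := pow_le_pow_left₀ (by positivity) hsin 2
    calc 16 * w^2 * ((r2 l:ℝ)^2/l) = (aw l)^2 * (4 * (2 * (s*w))^2) := by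
          unfold aw
          rw [show (2 * (s*w))^2 = 4 * (s*s) * w^2 by ring, hss]
          field_simp
          ring
      _ ≤ _ := by gcongr
  have hZlow := hcb Z hZ1
  have hlow : 16 * c * (w^2 * (Real.log Z)^2) ≤
      ∑ l ∈ Finset.Icc 1 Y, (aw l)^2 * (4 * (Real.sin (π * (√(l:ℝ) * w)))^2) := by
    refine le_trans ?_ hmain
    calc _ = 16 * w^2 * (c * (Real.log Z)^2) := by ring
      _ ≤ _ := by gcongr
  have key : (w * Real.log w)^2 - 4 * (Y:ℝ)^(-(1/2):ℝ) ≤ w^2 * (Real.log Z)^2 := by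
    rcases le_or_gt ⌊1/(4*w^2)⌋₊ Y with h | h
    · have hZe : Z = ⌊1/(4*w^2)⌋₊ := min_eq_right h
      have hYp : 0 ≤ (Y:ℝ)^(-(1/2):ℝ) := by positivity
      have hZr : 1/(8*w^2) ≤ (Z:ℝ) := by
        have h2 : 1/(4*w^2) < (Z:ℝ) + 1 := by rw [hZe]; exact Nat.lt_floor_add_one _
        have h3 : (1:ℝ) ≤ Z := by exact_mod_cast hZ1
        have h4 : 1/(8*w^2) = (1/(4*w^2))/2 := by field_simp; norm_num
        rw [h4]; linarith
      have hlw : Real.log w ≤ Real.log (1/8) := Real.log_le_log h0 h1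
      have h8 : Real.log (1/8) = - Real.log 8 := by rw [one_div, Real.log_inv]
      have hlz : -Real.log w ≤ Real.log Z := by
        have h5 : Real.log (1/(8*w^2)) ≤ Real.log Z := Real.log_le_log (by positivity) hZr
        rw [one_div, Real.log_inv, Real.log_mul (by norm_num) (by positivity), Real.log_pow] at h5
        push_cast at h5
        linarith
      have h8p : 0 < Real.log 8 := Real.log_pos (by norm_num)
      have : (Real.log w)^2 ≤ (Real.log Z)^2 := by
        rw [← neg_sq (Real.log w)]
        exact pow_le_pow_left₀ (by linarith) hlz 2
      have h9 : w^2 * (Real.log w)^2 ≤ w^2 * (Real.log Z)^2 := by gcongr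
      rw [mul_pow]; linarith
    · have hYw : (Y:ℝ) ≤ 1/(4*w^2) := by
        have : (Y:ℝ) ≤ (⌊1/(4*w^2)⌋₊:ℝ) := by exact_mod_cast h.le
        exact this.trans (Nat.floor_le (by positivity))
      have hw2 : w ≤ (Y:ℝ)^(-(1/2):ℝ) := by
        rw [Real.rpow_neg (by positivity), ← Real.sqrt_eq_rpow]
        rw [le_inv_comm₀ h0 (by positivity)]
        rw [Real.sqrt_le_left (by positivity)]
        refine hYw.trans ?_
        rw [inv_pow, one_div]
        apply inv_anti₀ (by positivity)
        nlinarith [sq_nonneg w]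
      have h5 := log_sq_le w h0 (by linarith)
      have h6 : (w * Real.log w)^2 ≤ 4 * (Y:ℝ)^(-(1/2):ℝ) := by
        calc (w * Real.log w)^2 = w * (w * (Real.log w)^2) := by ring
          _ ≤ w * 4 := by gcongr
          _ ≤ _ := by linarith
      have : 0 ≤ w^2 * (Real.log Z)^2 := by positivity
      linarith
  have hk2 : 0 ≤ kk^2 * (32 * c) := by positivity
  calc 32 * kk^2 * c * (w * Real.log w)^2 - 32 * kk^2 * c * 4 * (Y:ℝ)^(-(1/2):ℝ)
      = kk^2 * (32 * c) * ((w * Real.log w)^2 - 4 * (Y:ℝ)^(-(1/2):ℝ)) := by ring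
    _ ≤ kk^2 * (32 * c) * (w^2 * (Real.log Z)^2) := by gcongr
    _ = kk^2 * (2 * (16 * c * (w^2 * (Real.log Z)^2))) := by ring
    _ ≤ _ := by gcongr

lemma wlog_cont (ω : ℝ → ℝ) (X : ℝ) (hco : ContinuousOn ω (Set.Icc X (2*X))) (hb : ∀ x ∈ Set.Icc X (2*X), 0 < ω x) :
    ContinuousOn (fun x => ω x * Real.log (ω x)) (Set.Icc X (2*X)) :=
  hco.mul (hco.log (fun x hx => (hb x hx).ne'))

lemma Diag_cont (Y n : ℕ) : Continuous (Diag Y n) := by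
  unfold Diag
  apply continuous_finsetSum
  intro f _
  split_ifs
  · exact continuous_const.mul (continuous_iff_continuousAt.2 (fun w => (betaF_deriv _ w).continuousAt))
  · exact continuous_const

lemma rpow_half_div (X : ℝ) (hX : 1 ≤ X) : 1/X * X^((1:ℝ)/2) = X^(-(1/2):ℝ) := by
  have : X^(-(1/2):ℝ) = X^((1:ℝ)/2 - 1) := by norm_num
  rw [this, Real.rpow_sub (by linarith), Real.rpow_one]; ring

theorem propB_upper (ω : ℝ → ℝ) (hω : OmegaClass ω) (k : ℕ) : ∃ C : ℝ, 0 ≤ C ∧ ∃ D : ℕ, ∀ᶠ X in atTop, ∀ Y : ℕ, 1 ≤ Y →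
    (1/X) * ∫ x in X..(2*X), (dP Y ω x)^(2*k) ≤ C * Mom (2*k) X ω + C * X ^ (-(1/2):ℝ) * (Y:ℝ)^D := by
  obtain ⟨C1, hC1, D, hm⟩ := dP_moment ω hω (2*k)
  obtain ⟨C2, hC2, hD⟩ := Diag_bound (2*k)
  obtain ⟨C3, hC3, hreg⟩ := omega_reg ω hω (1/2) (by norm_num)
  refine ⟨C1 + C2, by positivity, D, ?_⟩
  filter_upwards [hm, hreg] with X hX hr Y hY
  obtain ⟨hX1, -, -, hco, hb, -⟩ := hr
  have hX2 : X ≤ 2 * X := by linarith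
  have h1 := hX Y hY
  have h2 : ‖∫ x in X..(2*X), Diag Y (2*k) (ω x)‖ ≤ C2 * ∫ x in X..(2*X), (ω x * Real.log (ω x))^(2*k) := by
    refine (intervalIntegral.norm_integral_le_integral_norm hX2).trans ?_
    rw [← intervalIntegral.integral_const_mul]
    apply intervalIntegral.integral_mono_on hX2
    · apply ContinuousOn.intervalIntegrable
      rw [Set.uIcc_of_le hX2]
      exact ((Diag_cont Y _).comp_continuousOn hco).norm
    · apply ContinuousOn.intervalIntegrable
      rw [Set.uIcc_of_le hX2]
      exact continuousOn_const.mul ((wlog_cont ω X hco (fun x hx => (hb x hx).1)).pow _)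
    · intro x hx
      have := hD Y (ω x) (hb x hx).1 (hb x hx).2
      rwa [(even_two_mul k).pow_abs] at this
  have h3 : ∫ x in X..(2*X), (dP Y ω x)^(2*k) ≤ C1 * X ^ ((1:ℝ)/2) * (Y:ℝ)^D +
      C2 * ∫ x in X..(2*X), (ω x * Real.log (ω x))^(2*k) := by
    have e : ‖((∫ x in X..(2*X), (dP Y ω x)^(2*k) : ℝ) : ℂ)‖ ≤ _ := norm_le_norm_sub_add _ (∫ x in X..(2*X), Diag Y (2*k) (ω x))
    rw [Complex.norm_real, Real.norm_eq_abs] at e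
    have := le_abs_self (∫ x in X..(2*X), (dP Y ω x)^(2*k))
    linarith
  have hMn : 0 ≤ Mom (2*k) X ω := by
    unfold Mom
    apply mul_nonneg (by positivity)
    apply intervalIntegral.integral_nonneg hX2
    intro x _
    exact (even_two_mul k).pow_nonneg _
  have hp : 0 ≤ X ^ (-(1/2):ℝ) * (Y:ℝ)^D := by positivity
  calc _ ≤ (1/X) * (C1 * X ^ ((1:ℝ)/2) * (Y:ℝ)^D +
      C2 * ∫ x in X..(2*X), (ω x * Real.log (ω x))^(2*k)) := by gcongr
    _ = C1 * (X ^ (-(1/2):ℝ) * (Y:ℝ)^D) + C2 * Mom (2*k) X ω := by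
      rw [← rpow_half_div X hX1]; unfold Mom; ring
    _ ≤ _ := by nlinarith

theorem propB_lower (ω : ℝ → ℝ) (hω : OmegaClass ω) : ∃ c : ℝ, 0 < c ∧ ∃ C : ℝ, 0 ≤ C ∧ ∃ D : ℕ, ∀ᶠ X in atTop, ∀ Y : ℕ, 1 ≤ Y →
    c * Mom 2 X ω - C * (Y:ℝ)^(-(1/2):ℝ) - C * X ^ (-(1/2):ℝ) * (Y:ℝ)^D ≤ (1/X) * ∫ x in X..(2*X), (dP Y ω x)^2 := by
  obtain ⟨C1, hC1, D, hm⟩ := dP_moment ω hω 2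
  obtain ⟨c, hc, C2, hC2, hD⟩ := diag_two_lower
  obtain ⟨C3, hC3, hreg⟩ := omega_reg ω hω (1/8) (by norm_num)
  refine ⟨c, hc, C1 + C2, by positivity, D, ?_⟩
  filter_upwards [hm, hreg] with X hX hr Y hY
  obtain ⟨hX1, -, -, hco, hb, -⟩ := hr
  have hX2 : X ≤ 2 * X := by linarith
  have hX0 : 0 < X := by linarith
  have h1 := hX Y hY
  simp_rw [Diag_two] at h1
  rw [intervalIntegral.integral_ofReal, ← Complex.ofReal_sub, Complex.norm_real, Real.norm_eq_abs] at h1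
  set g : ℝ → ℝ := fun w => kk^2 * (2 * ∑ l ∈ Finset.Icc 1 Y, (aw l)^2 * (4 * (Real.sin (π * (√(l:ℝ) * w)))^2)) with hg
  have hgc : Continuous g := by rw [hg]; fun_prop
  have h2 : ∫ x in X..(2*X), (c * (ω x * Real.log (ω x))^2 - C2 * (Y:ℝ)^(-(1/2):ℝ)) ≤ ∫ x in X..(2*X), g (ω x) := by
    apply intervalIntegral.integral_mono_on hX2
    · apply ContinuousOn.intervalIntegrable
      rw [Set.uIcc_of_le hX2]
      exact (continuousOn_const.mul ((wlog_cont ω X hco (fun x hx => (hb x hx).1)).pow _)).sub continuousOn_const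
    · apply ContinuousOn.intervalIntegrable
      rw [Set.uIcc_of_le hX2]
      exact hgc.comp_continuousOn hco
    · intro x hx
      exact hD Y (ω x) hY (hb x hx).1 (hb x hx).2
  rw [intervalIntegral.integral_sub, intervalIntegral.integral_const_mul, intervalIntegral.integral_const] at h2
  rotate_left
  · apply ContinuousOn.intervalIntegrable
    rw [Set.uIcc_of_le hX2]
    exact (continuousOn_const.mul ((wlog_cont ω X hco (fun x hx => (hb x hx).1)).pow _))
  · exact intervalIntegrable_const
  have h3 := (abs_le.1 h1).1
  have h4 : c * (∫ x in X..(2*X), (ω x * Real.log (ω x))^2) - X * (C2 * (Y:ℝ)^(-(1/2):ℝ)) - C1 * X ^ ((1:ℝ)/2) * (Y:ℝ)^D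
      ≤ ∫ x in X..(2*X), (dP Y ω x)^2 := by
    rw [smul_eq_mul, show 2 * X - X = X by ring] at h2
    change _ ≤ _ - ∫ x in X..(2*X), g (ω x) at h3
    linarith
  have hp : 0 ≤ X ^ (-(1/2):ℝ) * (Y:ℝ)^D := by positivity
  have hp2 : 0 ≤ (Y:ℝ)^(-(1/2):ℝ) := by positivity
  calc _ ≤ c * Mom 2 X ω - C2 * (Y:ℝ)^(-(1/2):ℝ) - C1 * (X ^ (-(1/2):ℝ) * (Y:ℝ)^D) := by nlinarith
    _ = (1/X) * (c * (∫ x in X..(2*X), (ω x * Real.log (ω x))^2) - X * (C2 * (Y:ℝ)^(-(1/2):ℝ)) - C1 * X ^ ((1:ℝ)/2) * (Y:ℝ)^D) := by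
      rw [← rpow_half_div X hX1]; unfold Mom
      field_simp
    _ ≤ _ := by gcongr

end lower

section saw

def TK (K : ℕ) (u : ℝ) : ℝ := -∑ k ∈ Finset.Icc 1 K, Real.sin (2 * π * k * u) / (π * k)
def EK (K : ℕ) (u : ℝ) : ℝ := sawtooth u - TK K u

lemma int_cos (j : ℤ) (hj : j ≠ 0) : ∫ u in (0:ℝ)..1, Real.cos (2 * π * j * u) = 0 := by
  have hj' : (j:ℝ) ≠ 0 := by exact_mod_cast hj
  have h0 : 2 * π * (j:ℝ) ≠ 0 := by positivity
  rw [intervalIntegral.integral_comp_mul_left (fun x => Real.cos x) h0, integral_cos]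
  have : Real.sin (2 * π * j * 1) = 0 := by
    rw [show 2 * π * (j:ℝ) * 1 = ((2 * j : ℤ) : ℝ) * π by push_cast; ring]; exact Real.sin_int_mul_pi _
  rw [this]; simp

lemma int_sin_sin (k n : ℕ) (hk : 1 ≤ k) (hkn : k < n) :
    ∫ u in (0:ℝ)..1, Real.sin (2 * π * k * u) * Real.sin (2 * π * n * u) = 0 := by
  have h1 := int_cos ((k:ℤ) - n) (by omega)
  have h2 := int_cos ((k:ℤ) + n) (by omega)
  have e : ∀ u : ℝ, Real.sin (2 * π * k * u) * Real.sin (2 * π * n * u) =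
      (1/2) * (Real.cos (2 * π * ((k:ℤ) - n : ℤ) * u) - Real.cos (2 * π * ((k:ℤ) + n : ℤ) * u)) := by
    intro u
    push_cast
    rw [show 2 * π * ((k:ℝ) - n) * u = 2 * π * k * u - 2 * π * n * u by ring,
      show 2 * π * ((k:ℝ) + n) * u = 2 * π * k * u + 2 * π * n * u by ring, Real.cos_sub, Real.cos_add]
    ring
  simp_rw [e]
  rw [intervalIntegral.integral_const_mul, intervalIntegral.integral_sub, h1, h2]
  · simp
  · exact (by fun_prop : Continuous _).intervalIntegrable _ _
  · exact (by fun_prop : Continuous _).intervalIntegrable _ _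

lemma int_sin_sq (n : ℕ) (hn : 1 ≤ n) : ∫ u in (0:ℝ)..1, Real.sin (2 * π * n * u) ^ 2 = 1/2 := by
  have h2 := int_cos (2 * (n:ℤ)) (by omega)
  have e : ∀ u : ℝ, Real.sin (2 * π * n * u) ^ 2 = 1/2 - (1/2) * Real.cos (2 * π * (2 * (n:ℤ) : ℤ) * u) := by
    intro u
    push_cast
    rw [show 2 * π * (2 * (n:ℝ)) * u = 2 * (2 * π * n * u) by ring, Real.cos_two_mul, Real.sin_sq]
    ring
  simp_rw [e]
  rw [intervalIntegral.integral_sub, intervalIntegral.integral_const_mul, h2]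
  · simp
  · exact intervalIntegrable_const
  · exact (by fun_prop : Continuous _).intervalIntegrable _ _

lemma int_lin_sin (n : ℕ) (hn : 1 ≤ n) : ∫ u in (0:ℝ)..1, (u - 1/2) * Real.sin (2 * π * n * u) = -(1/(2 * π * n)) := by
  have hn0 : (0:ℝ) < n := by exact_mod_cast hn
  have h0 : (0:ℝ) < 2 * π * n := by positivity
  set a := 2 * π * (n:ℝ) with ha
  have hd : ∀ x ∈ Set.uIcc (0:ℝ) 1, HasDerivAt (fun u => -(u - 1/2) * Real.cos (a * u) / a + Real.sin (a * u) / a^2)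
      ((x - 1/2) * Real.sin (a * x)) x := by
    intro x _
    have h1 : HasDerivAt (fun u : ℝ => a * u) a x := by simpa using (hasDerivAt_id x).const_mul a
    have h2 : HasDerivAt (fun u : ℝ => -(u - 1/2)) (-1) x := ((hasDerivAt_id x).sub_const _).neg
    have h3 := ((h2.mul h1.cos).div_const a).add (h1.sin.div_const (a^2))
    refine h3.congr_deriv ?_
    field_simp
    ring
  rw [intervalIntegral.integral_eq_sub_of_hasDerivAt hd ((by fun_prop : Continuous _).intervalIntegrable _ _)]
  have hc : Real.cos (a * 1) = 1 := by
    rw [ha, show 2 * π * (n:ℝ) * 1 = n * (2 * π) by ring]; exact Real.cos_nat_mul_two_pi n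
  have hs : Real.sin (a * 1) = 0 := by
    rw [ha, show 2 * π * (n:ℝ) * 1 = ((2 * n : ℕ):ℝ) * π by push_cast; ring]; exact Real.sin_nat_mul_pi _
  simp only [hc, hs]
  simp
  field_simp
  norm_num

lemma TK_cont (K : ℕ) : Continuous (TK K) := by unfold TK; fun_prop

/-- linear model of the error on (0,1) -/
def EL (K : ℕ) (u : ℝ) : ℝ := (u - 1/2) - TK K u

lemma EL_cont (K : ℕ) : Continuous (EL K) := by
  unfold EL; have := TK_cont K; fun_prop

lemma EL_succ (K : ℕ) (u : ℝ) : EL (K+1) u = EL K u + Real.sin (2 * π * ((K+1:ℕ):ℝ) * u) / (π * ((K+1:ℕ):ℝ)) := by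
  unfold EL TK
  rw [Finset.sum_Icc_succ_top (by omega)]; ring

lemma EL_orth (K n : ℕ) (hn : K < n) : ∫ u in (0:ℝ)..1, EL K u * Real.sin (2 * π * n * u) = -(1/(2 * π * n)) := by
  induction K with
  | zero =>
    unfold EL TK
    simp only [Finset.Icc_eq_empty_of_lt (show (0:ℕ) < 1 by norm_num), Finset.sum_empty, neg_zero, sub_zero]
    exact int_lin_sin n hn
  | succ K ih =>
    simp_rw [EL_succ, add_mul]
    have hc := EL_cont K
    rw [intervalIntegral.integral_add ((by fun_prop : Continuous _).intervalIntegrable _ _)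
      ((by fun_prop : Continuous _).intervalIntegrable _ _), ih (by omega)]
    have e : ∀ u : ℝ, Real.sin (2 * π * ((K+1:ℕ):ℝ) * u) / (π * ((K+1:ℕ):ℝ)) * Real.sin (2 * π * n * u) =
      (1 / (π * ((K+1:ℕ):ℝ))) * (Real.sin (2 * π * ((K+1:ℕ):ℝ) * u) * Real.sin (2 * π * n * u)) := by intro u; ring
    simp_rw [e]
    rw [intervalIntegral.integral_const_mul, int_sin_sin (K+1) n (by omega) hn]; ring

lemma EL_sq (K : ℕ) : ∫ u in (0:ℝ)..1, EL K u ^ 2 = 1/12 - (1/(2*π^2)) * ∑ k ∈ Finset.Icc 1 K, 1/(k:ℝ)^2 := by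
  induction K with
  | zero =>
    unfold EL TK
    simp only [Finset.Icc_eq_empty_of_lt (show (0:ℕ) < 1 by norm_num), Finset.sum_empty, neg_zero, sub_zero, mul_zero]
    have hd : ∀ x ∈ Set.uIcc (0:ℝ) 1, HasDerivAt (fun u : ℝ => (u - 1/2)^3/3) ((x - 1/2)^2) x := by
      intro x _
      have := (((hasDerivAt_id x).sub_const (1/2:ℝ)).pow 3).div_const 3
      refine this.congr_deriv ?_
      simp
    rw [intervalIntegral.integral_eq_sub_of_hasDerivAt hd ((by fun_prop : Continuous _).intervalIntegrable _ _)]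
    norm_num
  | succ K ih =>
    have e : ∀ u : ℝ, EL (K+1) u ^ 2 = EL K u ^ 2 + ((2/(π * ((K+1:ℕ):ℝ))) * (EL K u * Real.sin (2 * π * ((K+1:ℕ):ℝ) * u)) +
        (1/(π * ((K+1:ℕ):ℝ))^2) * Real.sin (2 * π * ((K+1:ℕ):ℝ) * u)^2) := by
      intro u; rw [EL_succ]; field_simp; ring
    simp_rw [e]
    have hc := EL_cont K
    rw [intervalIntegral.integral_add ((by fun_prop : Continuous _).intervalIntegrable _ _)
      ((by fun_prop : Continuous _).intervalIntegrable _ _),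
      intervalIntegral.integral_add ((by fun_prop : Continuous _).intervalIntegrable _ _)
      ((by fun_prop : Continuous _).intervalIntegrable _ _), intervalIntegral.integral_const_mul,
      intervalIntegral.integral_const_mul, ih, EL_orth K (K+1) (by omega), int_sin_sq (K+1) (by omega),
      Finset.sum_Icc_succ_top (by omega)]
    have : ((K+1:ℕ):ℝ) ≠ 0 := by positivity
    field_simp
    ring

lemma zeta_tail (K : ℕ) (hK : 1 ≤ K) : π^2/6 - 1/(K:ℝ) ≤ ∑ k ∈ Finset.Icc 1 K, 1/(k:ℝ)^2 := by
  have hK0 : (0:ℝ) < K := by exact_mod_cast hK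
  have h1 : ∀ N, K ≤ N → ∑ k ∈ Finset.Icc 1 N, 1/(k:ℝ)^2 ≤ (∑ k ∈ Finset.Icc 1 K, 1/(k:ℝ)^2) + 1/(K:ℝ) - 1/(N:ℝ) := by
    intro N hN
    induction N, hN using Nat.le_induction with
    | base => linarith
    | succ N hN ih =>
      rw [Finset.sum_Icc_succ_top (by omega)]
      have hN0 : (0:ℝ) < N := by exact_mod_cast (lt_of_lt_of_le hK hN)
      have : 1/((N+1:ℕ):ℝ)^2 ≤ 1/(N:ℝ) - 1/((N+1:ℕ):ℝ) := by
        push_cast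
        rw [div_sub_div _ _ hN0.ne' (by positivity), div_le_div_iff₀ (by positivity) (by positivity)]
        nlinarith
      linarith
  have h2 := hasSum_zeta_two.tendsto_sum_nat
  have h3 : π^2/6 ≤ (∑ k ∈ Finset.Icc 1 K, 1/(k:ℝ)^2) + 1/(K:ℝ) := by
    apply le_of_tendsto h2
    filter_upwards [eventually_ge_atTop (K+1)] with N hN
    obtain ⟨N, rfl⟩ : ∃ N', N = N' + 1 := ⟨N - 1, by omega⟩
    have h4 : ∑ k ∈ Finset.range (N+1), 1/(k:ℝ)^2 = ∑ k ∈ Finset.Icc 1 N, 1/(k:ℝ)^2 := by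
      rw [Finset.range_eq_Ico, Finset.sum_eq_sum_Ico_succ_bot (by omega)]
      simp
      rfl
    rw [h4]
    have := h1 N (by omega)
    have : (0:ℝ) ≤ 1/(N:ℝ) := by positivity
    linarith
  linarith

lemma EL_sq_le (K : ℕ) (hK : 1 ≤ K) : ∫ u in (0:ℝ)..1, EL K u ^ 2 ≤ 1/K := by
  rw [EL_sq]
  have h := zeta_tail K hK
  have hK0 : (0:ℝ) < K := by exact_mod_cast hK
  have hp : (0:ℝ) < 1/(2*π^2) := by positivity
  have h2 : (1/(2*π^2)) * (π^2/6 - 1/K) ≤ (1/(2*π^2)) * ∑ k ∈ Finset.Icc 1 K, 1/(k:ℝ)^2 := by gcongr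
  have h3 : (1/(2*π^2)) * (π^2/6 - 1/K) = 1/12 - (1/(2*π^2)) * (1/K) := by field_simp; ring
  have h4 : 1/(2*π^2) ≤ 1 := by rw [div_le_one (by positivity)]; nlinarith [Real.pi_gt_three]
  have h5 : (1/(2*π^2)) * (1/(K:ℝ)) ≤ 1 * (1/K) := by gcongr
  linarith

lemma saw_abs (t : ℝ) : |sawtooth t| ≤ 1/2 := by
  unfold sawtooth
  have h1 := Int.floor_le t
  have h2 := Int.lt_floor_add_one t
  rw [abs_le]; constructor <;> linarith

lemma saw_meas : Measurable sawtooth := by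
  unfold sawtooth
  have : Measurable (fun t : ℝ => ((⌊t⌋ : ℤ) : ℝ)) := (measurable_from_top).comp Int.measurable_floor
  exact (measurable_id.sub this).sub_const _

lemma EK_meas (K : ℕ) : Measurable (EK K) := saw_meas.sub (TK_cont K).measurable

lemma TK_abs (K : ℕ) (u : ℝ) : |TK K u| ≤ K := by
  unfold TK
  rw [abs_neg]
  refine (Finset.abs_sum_le_sum_abs _ _).trans ?_
  calc _ ≤ ∑ k ∈ Finset.Icc 1 K, (1:ℝ) := by
        apply Finset.sum_le_sum
        intro k hk
        rw [Finset.mem_Icc] at hk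
        have hk0 : (1:ℝ) ≤ k := by exact_mod_cast hk.1
        rw [abs_div, abs_of_pos (by positivity : 0 < π * (k:ℝ)), div_le_one (by positivity)]
        have := Real.abs_sin_le_one (2 * π * k * u)
        nlinarith [Real.pi_gt_three]
    _ = K := by simp

lemma EK_abs (K : ℕ) (u : ℝ) : |EK K u| ≤ K + 1 := by
  unfold EK
  have h1 := saw_abs u
  have h2 := TK_abs K u
  refine (abs_sub _ _).trans ?_
  linarith

lemma EK_periodic (K : ℕ) : Function.Periodic (EK K) 1 := by
  intro u
  unfold EK sawtooth TK
  rw [Int.floor_add_one]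
  have : ∀ k : ℕ, Real.sin (2 * π * k * (u + 1)) = Real.sin (2 * π * k * u) := by
    intro k
    rw [show 2 * π * k * (u+1) = 2 * π * k * u + k * (2 * π) by ring]
    exact Real.sin_add_nat_mul_two_pi _ _
  simp_rw [this]
  push_cast; ring

lemma EK_sq_int (K : ℕ) (hK : 1 ≤ K) (N : ℕ) : ∫ u in (0:ℝ)..N, EK K u ^ 2 ≤ N / K := by
  have hper : Function.Periodic (fun u => EK K u ^ 2) 1 := fun u => by
    simp only; rw [EK_periodic K u]
  have h1 : ∫ u in (0:ℝ)..1, EK K u ^ 2 = ∫ u in (0:ℝ)..1, EL K u ^ 2 := by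
    rw [intervalIntegral.integral_of_le zero_le_one, intervalIntegral.integral_of_le zero_le_one,
      integral_Ioc_eq_integral_Ioo, integral_Ioc_eq_integral_Ioo]
    apply setIntegral_congr_fun measurableSet_Ioo
    intro u hu
    simp only
    unfold EK EL sawtooth
    have : ⌊u⌋ = 0 := Int.floor_eq_zero_iff.2 ⟨hu.1.le, hu.2⟩
    rw [this]; simp
  have h2 := hper.intervalIntegral_add_zsmul_eq N 0 (by
    intro t₁ t₂
    apply IntervalIntegrable.mono_fun' (g := fun _ => ((K:ℝ)+1)^2) intervalIntegrable_const
    · exact ((EK_meas K).pow_const 2).aestronglyMeasurable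
    · refine Eventually.of_forall (fun u => ?_)
      simp only
      rw [Real.norm_eq_abs, abs_pow]
      exact pow_le_pow_left₀ (abs_nonneg _) (EK_abs K u) 2)
  simp only [zero_add, natCast_zsmul, nsmul_eq_mul, mul_one] at h2
  rw [h2, h1]
  have := EL_sq_le K hK
  have hN : (0:ℝ) ≤ N := by positivity
  calc _ ≤ (N:ℝ) * (1/K) := by gcongr
    _ = _ := by ring

end saw

section vdc

lemma sqrt_hasDeriv (p s : ℝ) (h : p < s) : HasDerivAt (fun s => √(s - p)) (1/(2*√(s-p))) s := by
  have := ((hasDerivAt_id s).sub_const p).sqrt (by simp; linarith)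
  simpa using this

lemma vdc_aux (k : ℕ) (hk : 1 ≤ k) (p q a b : ℝ) (hp : 0 ≤ p) (hpq : p < q) (hqa : q < a) (hab : a ≤ b) :
    ‖∫ s in a..b, eC (k * (√(s-q) - √(s-p)))‖ ≤ 2 * (b * √b) / (k * (q - p)) := by
  have hk0 : (0:ℝ) < k := by exact_mod_cast hk
  have hΔ : 0 < q - p := by linarith
  set u : ℝ → ℝ := fun s => √(s - p) with hu
  set v : ℝ → ℝ := fun s => √(s - q) with hv
  set K : ℂ := (2 * π * k : ℝ) * Complex.I with hK
  have hKn : ‖K‖ = 2 * π * k := by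
    rw [hK, norm_mul, Complex.norm_I, mul_one, Complex.norm_real, Real.norm_eq_abs, abs_of_pos (by positivity)]
  have hK0 : K ≠ 0 := by rw [← norm_pos_iff, hKn]; positivity
  set g : ℝ → ℝ := fun s => 2/(q-p) * (u s^2 * v s + u s * v s^2) with hg
  set g' : ℝ → ℝ := fun s => 2/(q-p) * (v s + u s^2/(2*v s) + v s^2/(2*u s) + u s) with hg'
  set θ' : ℝ → ℝ := fun s => 1/(2*v s) - 1/(2*u s) with hθ'
  have hpos : ∀ s ∈ Set.Icc a b, 0 < u s ∧ 0 < v s ∧ u s^2 = s - p ∧ v s^2 = s - q := by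
    intro s hs
    have h1 : 0 < s - p := by linarith [hs.1]
    have h2 : 0 < s - q := by linarith [hs.1]
    exact ⟨Real.sqrt_pos.2 h1, Real.sqrt_pos.2 h2, Real.sq_sqrt h1.le, Real.sq_sqrt h2.le⟩
  have hdu : ∀ s ∈ Set.Icc a b, HasDerivAt u (1/(2*u s)) s := fun s hs => sqrt_hasDeriv p s (by linarith [hs.1])
  have hdv : ∀ s ∈ Set.Icc a b, HasDerivAt v (1/(2*v s)) s := fun s hs => sqrt_hasDeriv q s (by linarith [hs.1])
  have hdg : ∀ s ∈ Set.Icc a b, HasDerivAt g (g' s) s := by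
    intro s hs
    obtain ⟨h1, h2, _, _⟩ := hpos s hs
    have := ((((hdu s hs).pow 2).mul (hdv s hs)).add ((hdu s hs).mul ((hdv s hs).pow 2))).const_mul (2/(q-p))
    refine this.congr_deriv ?_
    simp only [hg', Pi.pow_apply]
    field_simp
    ring
  have hgθ : ∀ s ∈ Set.Icc a b, g s * θ' s = 1 := by
    intro s hs
    obtain ⟨h1, h2, h3, h4⟩ := hpos s hs
    simp only [hg, hθ']
    have : u s^2 - v s^2 = q - p := by rw [h3, h4]; ring
    rw [← this]
    have hne : u s^2 - v s^2 ≠ 0 := by rw [this]; exact hΔ.ne'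
    field_simp
    ring
  have hdE : ∀ s ∈ Set.Icc a b, HasDerivAt (fun s => eC (k * (v s - u s)) / K) ((θ' s : ℝ) * eC (k * (v s - u s))) s := by
    intro s hs
    have h1 : HasDerivAt (fun s => v s - u s) (θ' s) s := (hdv s hs).sub (hdu s hs)
    have h2 := (eC_hasDeriv k (v s - u s)).scomp s h1
    have h3 := h2.div_const K
    refine h3.congr_deriv ?_
    rw [Complex.real_smul]
    have e : ∀ z w : ℂ, z * (K * w) / K = z * w := fun z w => by field_simp
    exact e _ _
  have huc : Continuous u := by simp only [hu]; fun_prop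
  have hvc : Continuous v := by simp only [hv]; fun_prop
  have hg'c : ContinuousOn g' (Set.Icc a b) := by
    have h1 : ∀ s ∈ Set.Icc a b, (2 * u s) ≠ 0 := fun s hs => by have := (hpos s hs).1; positivity
    have h2 : ∀ s ∈ Set.Icc a b, (2 * v s) ≠ 0 := fun s hs => by have := (hpos s hs).2.1; positivity
    apply ContinuousOn.mul continuousOn_const
    apply ContinuousOn.add _ huc.continuousOn
    apply ContinuousOn.add
    apply ContinuousOn.add hvc.continuousOn
    · exact (huc.pow 2).continuousOn.div (continuous_const.mul hvc).continuousOn h2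
    · exact (hvc.pow 2).continuousOn.div (continuous_const.mul huc).continuousOn h1
  have hθ'c : ContinuousOn θ' (Set.Icc a b) := by
    have h1 : ∀ s ∈ Set.Icc a b, (2 * u s) ≠ 0 := fun s hs => by have := (hpos s hs).1; positivity
    have h2 : ∀ s ∈ Set.Icc a b, (2 * v s) ≠ 0 := fun s hs => by have := (hpos s hs).2.1; positivity
    exact (continuousOn_const.div (continuous_const.mul hvc).continuousOn h2).sub
      (continuousOn_const.div (continuous_const.mul huc).continuousOn h1)
  have hec : Continuous (fun s => eC (k * (v s - u s))) := eC_cont.comp (by fun_prop)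
  have huI : Set.uIcc a b = Set.Icc a b := Set.uIcc_of_le hab
  have hparts := intervalIntegral.integral_mul_deriv_eq_deriv_mul (a := a) (b := b) (u := fun s => ((g s : ℝ) : ℂ))
    (u' := fun s => ((g' s : ℝ) : ℂ)) (v := fun s => eC (k * (v s - u s)) / K)
    (v' := fun s => (θ' s : ℝ) * eC (k * (v s - u s)))
    (fun s hs => (hdg s (huI ▸ hs)).ofReal_comp) (fun s hs => hdE s (huI ▸ hs))
    (by apply ContinuousOn.intervalIntegrable; rw [huI]; exact Complex.continuous_ofReal.comp_continuousOn hg'c)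
    (by apply ContinuousOn.intervalIntegrable; rw [huI]
        exact (Complex.continuous_ofReal.comp_continuousOn hθ'c).mul hec.continuousOn)
  have e1 : ∫ s in a..b, ((g s : ℝ) : ℂ) * ((θ' s : ℝ) * eC (k * (v s - u s))) = ∫ s in a..b, eC (k * (v s - u s)) := by
    apply intervalIntegral.integral_congr
    intro s hs
    rw [huI] at hs
    simp only
    rw [← mul_assoc, ← Complex.ofReal_mul, hgθ s hs]; simp
  rw [e1] at hparts
  have hg0 : ∀ s ∈ Set.Icc a b, 0 ≤ g s := by
    intro s hs
    obtain ⟨h1, h2, _, _⟩ := hpos s hs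
    simp only [hg]; positivity
  have hg'0 : ∀ s ∈ Set.Icc a b, 0 ≤ g' s := by
    intro s hs
    obtain ⟨h1, h2, _, _⟩ := hpos s hs
    simp only [hg']; positivity
  have hKp : 0 < 2 * π * k := by positivity
  have hbd : ‖∫ s in a..b, eC (k * (v s - u s))‖ ≤ 2 * g b / (2 * π * k) := by
    rw [hparts]
    refine (norm_sub_le _ _).trans ?_
    have b1 : ‖((g b : ℝ) : ℂ) * (eC (k * (v b - u b)) / K) - ((g a : ℝ) : ℂ) * (eC (k * (v a - u a)) / K)‖ ≤ (g b + g a)/(2*π*k) := by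
      refine (norm_sub_le _ _).trans ?_
      rw [norm_mul, norm_mul, norm_div, norm_div, eC_norm, eC_norm, hKn, Complex.norm_real, Complex.norm_real,
        Real.norm_of_nonneg (hg0 b ⟨hab, le_refl _⟩), Real.norm_of_nonneg (hg0 a ⟨le_refl _, hab⟩)]
      apply le_of_eq; ring
    have b2 : ‖∫ s in a..b, ((g' s : ℝ) : ℂ) * (eC (k * (v s - u s)) / K)‖ ≤ (g b - g a)/(2*π*k) := by
      refine (intervalIntegral.norm_integral_le_integral_norm hab).trans ?_
      have : ∫ s in a..b, ‖((g' s : ℝ) : ℂ) * (eC (k * (v s - u s)) / K)‖ = ∫ s in a..b, g' s / (2*π*k) := by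
        apply intervalIntegral.integral_congr
        intro s hs
        rw [huI] at hs
        simp only
        rw [norm_mul, norm_div, eC_norm, hKn, Complex.norm_real, Real.norm_of_nonneg (hg'0 s hs)]; ring
      rw [this, intervalIntegral.integral_div, intervalIntegral.integral_eq_sub_of_hasDerivAt
        (fun s hs => hdg s (huI ▸ hs)) (by apply ContinuousOn.intervalIntegrable; rw [huI]; exact hg'c)]
    have : (g b + g a)/(2*π*k) + (g b - g a)/(2*π*k) = 2 * g b / (2*π*k) := by ring
    linarith
  refine hbd.trans ?_
  have hb0 : 0 ≤ b := by linarith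
  have hub : u b ≤ √b := Real.sqrt_le_sqrt (by linarith)
  have hvb : v b ≤ √b := Real.sqrt_le_sqrt (by linarith)
  have hgb : g b ≤ 4/(q-p) * (b * √b) := by
    simp only [hg]
    obtain ⟨h1, h2, h3, h4⟩ := hpos b ⟨hab, le_refl _⟩
    have h5 : u b ^ 2 * v b ≤ b * √b := by
      rw [h3]; apply mul_le_mul (by linarith) hvb h2.le hb0
    have h6 : u b * v b ^ 2 ≤ b * √b := by
      rw [h4, mul_comm]; apply mul_le_mul (by linarith) hub h1.le hb0
    calc _ ≤ 2/(q-p) * (b * √b + b * √b) := by gcongr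
      _ = _ := by ring
  have hbb : 0 ≤ b * √b := by positivity
  calc 2 * g b / (2 * π * k) ≤ 2 * (4/(q-p) * (b * √b)) / (2 * π * k) := by gcongr
    _ = (4/π) * ((b * √b) / (k * (q-p))) := by field_simp
    _ ≤ 2 * ((b * √b) / (k * (q-p))) := by
        apply mul_le_mul_of_nonneg_right _ (by positivity)
        rw [div_le_iff₀ Real.pi_pos]; linarith [Real.pi_gt_three]
    _ = _ := by ring

lemma vdc (k : ℕ) (hk : 1 ≤ k) (p q a b : ℝ) (hp : 0 ≤ p) (hpq : p < q) (hqa : q ≤ a) (hab : a ≤ b) :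
    ‖∫ s in a..b, eC (k * (√(s-q) - √(s-p)))‖ ≤ 2 * (b * √b) / (k * (q - p)) := by
  have hc : Continuous (fun s => eC (k * (√(s-q) - √(s-p)))) := eC_cont.comp (by fun_prop)
  rcases hab.eq_or_lt with rfl | hlt
  · simp
    have : 0 < q - p := by linarith
    have : 0 ≤ a := by linarith
    positivity
  · apply le_of_forall_pos_le_add
    intro δ hδ
    set a' := min (a + δ) b with ha'
    have h1 : a < a' := lt_min (by linarith) hlt
    have h2 : a' ≤ b := min_le_right _ _
    have h3 := vdc_aux k hk p q a' b hp hpq (by linarith) h2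
    rw [← intervalIntegral.integral_add_adjacent_intervals (hc.intervalIntegrable a a') (hc.intervalIntegrable a' b)]
    have h4 : ‖∫ s in a..a', eC (k * (√(s-q) - √(s-p)))‖ ≤ δ := by
      have := intervalIntegral.norm_integral_le_of_norm_le_const (a := a) (b := a') (C := 1)
        (f := fun s => eC (k * (√(s-q) - √(s-p)))) (fun s _ => (eC_norm _).le)
      rw [abs_of_pos (by linarith), one_mul] at this
      have h5 : a' ≤ a + δ := min_le_left _ _
      linarith
    exact (norm_add_le _ _).trans (by linarith)

end vdc

section cov

def vE (K m : ℕ) (s : ℝ) : ℝ := if (m:ℝ)^2 ≤ s then EK K √(s - (m:ℝ)^2) else 0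

lemma vE_meas (K m : ℕ) : Measurable (vE K m) := by
  unfold vE
  apply Measurable.ite measurableSet_Ici _ measurable_const
  exact (EK_meas K).comp (by fun_prop)

lemma vE_abs (K m : ℕ) (s : ℝ) : |vE K m s| ≤ K + 1 := by
  unfold vE; split_ifs
  · exact EK_abs _ _
  · simp; positivity

lemma vE_int (K m N : ℕ) (hK : 1 ≤ K) (s0 s1 : ℝ) (h01 : s0 ≤ s1) (h1 : s1 ≤ (N:ℝ)^2) :
    ∫ s in s0..s1, vE K m s ^ 2 ≤ 2 * (N:ℝ)^2 / K := by
  have hN : (0:ℝ) ≤ N := by positivity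
  have hint : ∀ (h : ℝ → ℝ) (B : ℝ), Measurable h → (∀ s, |h s| ≤ B) → ∀ S : Set ℝ, volume S < ⊤ → IntegrableOn h S := by
    intro h B hm hb S hS
    exact Measure.integrableOn_of_bounded hS.ne hm.aestronglyMeasurable (M := B) (Eventually.of_forall (fun s => hb s))
  have hbd : ∀ s, |vE K m s ^ 2| ≤ ((K:ℝ)+1)^2 := by
    intro s; rw [abs_pow]; exact pow_le_pow_left₀ (abs_nonneg _) (vE_abs _ _ _) 2
  have hbd2 : ∀ s, |EK K √(s - (m:ℝ)^2) ^ 2| ≤ ((K:ℝ)+1)^2 := by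
    intro s; rw [abs_pow]; exact pow_le_pow_left₀ (abs_nonneg _) (EK_abs _ _) 2
  set I := Set.Icc ((m:ℝ)^2) ((m:ℝ)^2 + (N:ℝ)^2) with hI
  rw [intervalIntegral.integral_of_le h01]
  have e1 : ∀ s, vE K m s ^ 2 = Set.indicator (Set.Ici ((m:ℝ)^2)) (fun s => EK K √(s - (m:ℝ)^2) ^ 2) s := by
    intro s
    unfold vE
    by_cases h : (m:ℝ)^2 ≤ s
    · rw [if_pos h, Set.indicator_of_mem (by exact h)]
    · rw [if_neg h, Set.indicator_of_notMem (by exact h)]; simp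
  simp_rw [e1]
  rw [setIntegral_indicator measurableSet_Ici]
  have hmeasE : Measurable (fun s => EK K √(s - (m:ℝ)^2) ^ 2) := ((EK_meas K).comp (by fun_prop)).pow_const 2
  have step1 : ∫ s in Set.Ioc s0 s1 ∩ Set.Ici ((m:ℝ)^2), EK K √(s - (m:ℝ)^2) ^ 2 ≤ ∫ s in I, EK K √(s - (m:ℝ)^2) ^ 2 := by
    apply setIntegral_mono_set (hint _ _ hmeasE hbd2 I (by simp [hI]))
    · exact Eventually.of_forall (fun s => by positivity)
    · apply LE.le.eventuallyLE
      intro s hs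
      exact ⟨hs.2, by have := hs.1.2; nlinarith [sq_nonneg (m:ℝ)]⟩
  refine step1.trans ?_
  rw [hI, integral_Icc_eq_integral_Ioo]
  have himg : (fun u : ℝ => u^2 + (m:ℝ)^2) '' (Set.Ioo 0 (N:ℝ)) = Set.Ioo ((m:ℝ)^2) ((m:ℝ)^2 + (N:ℝ)^2) := by
    ext s
    simp only [Set.mem_image, Set.mem_Ioo]
    constructor
    · rintro ⟨u, ⟨h0, h2⟩, rfl⟩
      constructor <;> nlinarith
    · rintro ⟨h2, h3⟩
      refine ⟨√(s - (m:ℝ)^2), ⟨Real.sqrt_pos.2 (by linarith), ?_⟩, ?_⟩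
      · rw [Real.sqrt_lt' (by by_contra hc; have : (N:ℝ) = 0 := by linarith
                              rw [this] at h3; nlinarith)]; linarith
      · rw [Real.sq_sqrt (by linarith)]; ring
  have hcov := integral_image_eq_integral_abs_deriv_smul (s := Set.Ioo 0 (N:ℝ)) (f := fun u : ℝ => u^2 + (m:ℝ)^2)
    (f' := fun u => 2 * u) measurableSet_Ioo (fun u _ => by
      have := ((hasDerivAt_id u).pow 2).add_const ((m:ℝ)^2)
      refine (this.congr_deriv ?_).hasDerivWithinAt
      simp) (by
      intro x hx y hy hxy
      simp only at hxy
      have h1 : 0 < x := hx.1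
      have h2 : 0 < y := hy.1
      nlinarith) (fun s => EK K √(s - (m:ℝ)^2) ^ 2)
  rw [himg] at hcov
  rw [hcov]
  have e2 : ∀ u ∈ Set.Ioo 0 (N:ℝ), |2 * u| • EK K √(u^2 + (m:ℝ)^2 - (m:ℝ)^2) ^ 2 ≤ 2 * N * EK K u ^ 2 := by
    intro u hu
    rw [smul_eq_mul, abs_of_pos (by linarith [hu.1]), add_sub_cancel_right, Real.sqrt_sq hu.1.le]
    have := hu.2
    gcongr
  have hEK2 : IntegrableOn (fun u => 2 * N * EK K u ^ 2) (Set.Ioo 0 (N:ℝ)) := by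
    apply Integrable.const_mul
    exact hint _ (((K:ℝ)+1)^2) ((EK_meas K).pow_const 2) (fun s => by
      rw [abs_pow]; exact pow_le_pow_left₀ (abs_nonneg _) (EK_abs _ _) 2) _ (by simp)
  have step2 : ∫ u in Set.Ioo 0 (N:ℝ), |2 * u| • EK K √(u^2 + (m:ℝ)^2 - (m:ℝ)^2) ^ 2 ≤ ∫ u in Set.Ioo 0 (N:ℝ), 2 * N * EK K u ^ 2 := by
    apply setIntegral_mono_on _ hEK2 measurableSet_Ioo e2
    apply Integrable.mono' hEK2
    · apply Measurable.aestronglyMeasurable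
      simp only [smul_eq_mul]
      exact (by fun_prop : Measurable fun u:ℝ => |2*u|).mul (((EK_meas K).comp (by fun_prop)).pow_const 2)
    · rw [ae_restrict_iff' measurableSet_Ioo]
      refine Eventually.of_forall (fun u hu => ?_)
      rw [Real.norm_of_nonneg (by positivity)]
      exact e2 u hu
  refine step2.trans ?_
  rw [integral_const_mul, ← integral_Ioc_eq_integral_Ioo, ← intervalIntegral.integral_of_le hN]
  have := EK_sq_int K hK N
  calc 2 * (N:ℝ) * _ ≤ 2 * N * (N / K) := by gcongr
    _ = _ := by ring

end cov

section psiL2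

lemma bint {h : ℝ → ℝ} {B : ℝ} (hm : Measurable h) (hb : ∀ s, |h s| ≤ B) (a b : ℝ) : IntervalIntegrable h volume a b := by
  rw [intervalIntegrable_iff]
  exact Measure.integrableOn_of_bounded (by simp) hm.aestronglyMeasurable (M := B) (Eventually.of_forall (fun s => hb s))

lemma isum {ι : Type*} (S : Finset ι) (f : ι → ℝ → ℝ) {a b : ℝ} (h : ∀ i ∈ S, IntervalIntegrable (f i) volume a b) :
    IntervalIntegrable (fun s => ∑ i ∈ S, f i s) volume a b := by
  have := IntervalIntegrable.sum S h
  rwa [show (∑ i ∈ S, f i) = (fun s => ∑ i ∈ S, f i s) by ext s; simp] at this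

lemma chi_int (q : ℝ) (f : ℝ → ℝ) (s0 s1 : ℝ) (h01 : s0 ≤ s1) :
    ∫ s in s0..s1, (if q ≤ s then f s else 0) = if max s0 q ≤ s1 then ∫ s in (max s0 q)..s1, f s else 0 := by
  have e1 : ∀ s, (if q ≤ s then f s else 0) = Set.indicator (Set.Ici q) f s := by
    intro s
    by_cases h : q ≤ s
    · rw [if_pos h, Set.indicator_of_mem (by exact h)]
    · rw [if_neg h, Set.indicator_of_notMem (by exact h)]
  simp_rw [e1]
  rw [intervalIntegral.integral_of_le h01, ← integral_Icc_eq_integral_Ioc, setIntegral_indicator measurableSet_Ici]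
  have e2 : Set.Icc s0 s1 ∩ Set.Ici q = Set.Icc (max s0 q) s1 := by
    ext s; simp; tauto
  rw [e2]
  split_ifs with h
  · rw [intervalIntegral.integral_of_le h, integral_Icc_eq_integral_Ioc]
  · rw [Set.Icc_eq_empty h]; simp

lemma corr_int (k m m' : ℕ) (hk : 1 ≤ k) (hm : m < m') (s0 s1 : ℝ) (h0 : 0 ≤ s0) (h01 : s0 ≤ s1) :
    |∫ s in s0..s1, (if (m':ℝ)^2 ≤ s then Real.cos (2*π*(k*(√(s-(m':ℝ)^2) - √(s-(m:ℝ)^2)))) else 0)|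
      ≤ 2 * (s1 * √s1) * (1 / ((m':ℝ)^2 - (m:ℝ)^2)) := by
  have hmr : (m:ℝ) < m' := by exact_mod_cast hm
  have hm0 : (0:ℝ) ≤ m := by positivity
  have hk1 : (1:ℝ) ≤ k := by exact_mod_cast hk
  have hs1 : 0 ≤ s1 := h0.trans h01
  have hd : 0 < (m':ℝ)^2 - (m:ℝ)^2 := by nlinarith
  rw [chi_int _ _ _ _ h01]
  split_ifs with h
  · have hv := vdc k hk ((m:ℝ)^2) ((m':ℝ)^2) (max s0 ((m':ℝ)^2)) s1 (by positivity) (by linarith) (le_max_right _ _) h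
    have hc : Continuous (fun s => eC (k * (√(s-(m':ℝ)^2) - √(s-(m:ℝ)^2)))) := eC_cont.comp (by fun_prop)
    have : ∫ s in (max s0 ((m':ℝ)^2))..s1, Real.cos (2*π*(k*(√(s-(m':ℝ)^2) - √(s-(m:ℝ)^2))))
        = (∫ s in (max s0 ((m':ℝ)^2))..s1, eC (k * (√(s-(m':ℝ)^2) - √(s-(m:ℝ)^2)))).re := by
      have := Complex.reCLM.intervalIntegral_comp_comm (hc.intervalIntegrable (μ := volume) (max s0 ((m':ℝ)^2)) s1)
      rw [Complex.reCLM_apply] at this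
      rw [← this]
      congr 1
      ext s
      rw [Complex.reCLM_apply, eC_re]
    rw [this]
    refine (Complex.abs_re_le_norm _).trans (hv.trans ?_)
    rw [div_eq_mul_one_div]
    gcongr
    nlinarith
  · simp; positivity

lemma double_w (M : ℕ) : ∑ m' ∈ Finset.range (M+1), ∑ m ∈ Finset.range (M+1),
    (if m < m' then 1 / ((m':ℝ)^2 - (m:ℝ)^2) else 0) ≤ (1 + Real.log M)^2 := by
  have hH := harm_le_log M
  set H := ∑ n ∈ Finset.Icc 1 M, (1:ℝ)/n with hHd
  have hH0 : 0 ≤ H := Finset.sum_nonneg (fun _ _ => by positivity)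
  have step : ∀ m' ∈ Finset.range (M+1), ∑ m ∈ Finset.range (M+1), (if m < m' then 1 / ((m':ℝ)^2 - (m:ℝ)^2) else 0)
      ≤ (1/(m':ℝ)) * H := by
    intro m' hm'
    rw [← Finset.sum_filter]
    have hf : (Finset.range (M+1)).filter (fun m => m < m') = Finset.range m' := by
      ext m; simp at hm' ⊢; omega
    rw [hf]
    calc ∑ m ∈ Finset.range m', 1 / ((m':ℝ)^2 - (m:ℝ)^2) ≤ ∑ m ∈ Finset.range m', (1/(m':ℝ)) * (1/((m':ℝ) - m)) := by
          apply Finset.sum_le_sum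
          intro m hm
          rw [Finset.mem_range] at hm
          have h1 : (m:ℝ) < m' := by exact_mod_cast hm
          have h0 : (0:ℝ) ≤ m := by positivity
          have h3 : 0 < (m':ℝ) - m := by linarith
          have h4 : 0 < (m':ℝ) := by linarith
          rw [one_div_mul_one_div]
          apply one_div_le_one_div_of_le (by positivity)
          nlinarith
      _ = (1/(m':ℝ)) * ∑ m ∈ Finset.range m', (1/((m':ℝ) - m)) := by rw [Finset.mul_sum]
      _ ≤ _ := by
          apply mul_le_mul_of_nonneg_left _ (by positivity)
          rw [← Finset.sum_range_reflect]
          calc ∑ j ∈ Finset.range m', 1/((m':ℝ) - ((m' - 1 - j : ℕ):ℝ)) = ∑ j ∈ Finset.range m', 1/(((j+1:ℕ)):ℝ) := by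
                apply Finset.sum_congr rfl
                intro j hj
                rw [Finset.mem_range] at hj
                congr 1
                have : m' = (m' - 1 - j) + (j + 1) := by omega
                have h2 : (m':ℝ) = ((m' - 1 - j : ℕ):ℝ) + ((j+1:ℕ):ℝ) := by exact_mod_cast this
                linarith
            _ = ∑ n ∈ Finset.Icc 1 m', 1/(n:ℝ) := by
                rw [Finset.range_eq_Ico, Finset.sum_Ico_add' (fun n : ℕ => 1/(n:ℝ)) 0 m' 1]
                apply Finset.sum_congr _ (fun _ _ => rfl)
                ext; simp
                try omega
            _ ≤ H := by
                apply Finset.sum_le_sum_of_subset_of_nonneg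
                · apply Finset.Icc_subset_Icc_right; simp at hm'; omega
                · intros; positivity
  refine (Finset.sum_le_sum step).trans ?_
  rw [← Finset.sum_mul]
  have : ∑ m' ∈ Finset.range (M+1), 1/(m':ℝ) = H := by
    rw [Finset.sum_range_succ']
    simp only [Nat.cast_zero, div_zero, add_zero]
    rw [Finset.range_eq_Ico, Finset.sum_Ico_add' (fun n : ℕ => 1/(n:ℝ)) 0 M 1]
    apply Finset.sum_congr _ (fun _ _ => rfl)
    ext; simp
    try omega
  rw [this, ← sq]
  gcongr

/-- exponential sums at frequency `k`, imaginary part -/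
def SkS (k M : ℕ) (s : ℝ) : ℝ := ∑ m ∈ Finset.range (M+1), (r2 m : ℝ) * (if (m:ℝ)^2 ≤ s then Real.sin (2*π*(k*√(s-(m:ℝ)^2))) else 0)
def CkS (k M : ℕ) (s : ℝ) : ℝ := ∑ m ∈ Finset.range (M+1), (r2 m : ℝ) * (if (m:ℝ)^2 ≤ s then Real.cos (2*π*(k*√(s-(m:ℝ)^2))) else 0)

def corr (k m m' : ℕ) (s : ℝ) : ℝ := if (m:ℝ)^2 ≤ s ∧ (m':ℝ)^2 ≤ s then Real.cos (2*π*(k*(√(s-(m':ℝ)^2) - √(s-(m:ℝ)^2)))) else 0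

lemma corr_meas (k m m' : ℕ) : Measurable (corr k m m') := by
  unfold corr
  apply Measurable.ite (measurableSet_Ici.inter measurableSet_Ici) _ measurable_const
  fun_prop

lemma corr_abs (k m m' : ℕ) (s : ℝ) : |corr k m m' s| ≤ 1 := by
  unfold corr; split_ifs
  · exact abs_cos_le_one _
  · simp

lemma corr_symm (k m m' : ℕ) (s : ℝ) : corr k m m' s = corr k m' m s := by
  unfold corr
  have : Real.cos (2*π*(k*(√(s-(m':ℝ)^2) - √(s-(m:ℝ)^2)))) = Real.cos (2*π*(k*(√(s-(m:ℝ)^2) - √(s-(m':ℝ)^2)))) := by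
    rw [← Real.cos_neg]; congr 1; ring
  simp only [this, and_comm]

lemma SkS_sq_le (k M : ℕ) (s : ℝ) : SkS k M s ^ 2 ≤ ∑ m ∈ Finset.range (M+1), ∑ m' ∈ Finset.range (M+1), (r2 m : ℝ) * r2 m' * corr k m m' s := by
  have : ∑ m ∈ Finset.range (M+1), ∑ m' ∈ Finset.range (M+1), (r2 m : ℝ) * r2 m' * corr k m m' s = CkS k M s ^ 2 + SkS k M s ^ 2 := by
    rw [sq, sq, CkS, SkS, Finset.sum_mul_sum, Finset.sum_mul_sum, ← Finset.sum_add_distrib]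
    apply Finset.sum_congr rfl; intro m _
    rw [← Finset.sum_add_distrib]
    apply Finset.sum_congr rfl; intro m' _
    unfold corr
    by_cases h1 : (m:ℝ)^2 ≤ s <;> by_cases h2 : (m':ℝ)^2 ≤ s <;> simp only [h1, h2, if_true, if_false, and_true, true_and, and_false, false_and, mul_zero, add_zero, zero_mul]
    rw [show 2*π*(k*(√(s-(m':ℝ)^2) - √(s-(m:ℝ)^2))) = 2*π*(k*√(s-(m':ℝ)^2)) - 2*π*(k*√(s-(m:ℝ)^2)) by ring, Real.cos_sub]
    ring
  rw [this]; nlinarith [sq_nonneg (CkS k M s)]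

lemma SkS_meas (k M : ℕ) : Measurable (SkS k M) := by
  unfold SkS
  apply Finset.measurable_fun_sum
  intro m _
  apply Measurable.const_mul
  apply Measurable.ite measurableSet_Ici _ measurable_const
  fun_prop

lemma SkS_abs (k M : ℕ) (s : ℝ) : |SkS k M s| ≤ ∑ m ∈ Finset.range (M+1), (r2 m : ℝ) := by
  unfold SkS
  refine (Finset.abs_sum_le_sum_abs _ _).trans (Finset.sum_le_sum (fun m _ => ?_))
  rw [abs_mul, abs_of_nonneg (by positivity : (0:ℝ) ≤ r2 m)]
  apply mul_le_of_le_one_right (by positivity)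
  split_ifs
  · exact abs_sin_le_one _
  · simp

lemma SkS_int (k M : ℕ) (hk : 1 ≤ k) (R s0 s1 : ℝ) (h0 : 0 ≤ s0) (h01 : s0 ≤ s1)
    (hR : ∀ m ≤ M, (r2 m : ℝ) ≤ R) :
    ∫ s in s0..s1, SkS k M s ^ 2 ≤ R^2 * ((M+1) * s1 + 4 * (s1*√s1) * (1 + Real.log M)^2) := by
  have hs1 : 0 ≤ s1 := h0.trans h01
  have hR0 : 0 ≤ R := le_trans (by positivity) (hR 0 (by omega))
  have hi : ∀ m m', IntervalIntegrable (fun s => (r2 m : ℝ) * r2 m' * corr k m m' s) volume s0 s1 :=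
    fun m m' => (bint (corr_meas k m m') (corr_abs k m m') s0 s1).const_mul _
  have hSk : IntervalIntegrable (fun s => SkS k M s ^ 2) volume s0 s1 := by
    apply bint (B := (∑ m ∈ Finset.range (M+1), (r2 m : ℝ))^2) ((SkS_meas k M).pow_const 2)
    intro s; rw [abs_pow]; exact pow_le_pow_left₀ (abs_nonneg _) (SkS_abs _ _ _) 2
  have h2 : ∀ m ∈ Finset.range (M+1), IntervalIntegrable (fun s => ∑ m' ∈ Finset.range (M+1), (r2 m : ℝ) * r2 m' * corr k m m' s) volume s0 s1 := by
    intro m _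
    exact isum _ _ (fun m' _ => hi m m')
  have h3 : IntervalIntegrable (fun s => ∑ m ∈ Finset.range (M+1), ∑ m' ∈ Finset.range (M+1), (r2 m : ℝ) * r2 m' * corr k m m' s) volume s0 s1 := by
    exact isum _ _ h2
  refine (intervalIntegral.integral_mono_on h01 hSk h3 (fun s _ => SkS_sq_le k M s)).trans ?_
  rw [intervalIntegral.integral_finsetSum h2]
  have hlt : ∀ m m', m < m' → |∫ s in s0..s1, corr k m m' s| ≤ 2 * (s1 * √s1) * (1 / ((m':ℝ)^2 - (m:ℝ)^2)) := by
    intro m m' hmm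
    have := corr_int k m m' hk hmm s0 s1 h0 h01
    convert this using 3
    ext s
    unfold corr
    have : ((m:ℝ)^2 ≤ s ∧ (m':ℝ)^2 ≤ s) ↔ (m':ℝ)^2 ≤ s := by
      refine ⟨fun h => h.2, fun h => ⟨le_trans ?_ h, h⟩⟩
      have : (m:ℝ) ≤ m' := by exact_mod_cast hmm.le
      gcongr
    simp only [this]
  set w : ℕ → ℕ → ℝ := fun m' m => if m < m' then 1 / ((m':ℝ)^2 - (m:ℝ)^2) else 0 with hw
  have hw0 : ∀ m' m, 0 ≤ w m' m := by
    intro m' m; simp only [hw]; split_ifs with h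
    · have : (m:ℝ) ≤ m' := by exact_mod_cast h.le
      have : (m:ℝ)^2 ≤ (m':ℝ)^2 := by gcongr
      apply one_div_nonneg.2; linarith
    · exact le_refl _
  have hb : ∀ m ∈ Finset.range (M+1), ∀ m' ∈ Finset.range (M+1), ∫ s in s0..s1, (r2 m : ℝ) * r2 m' * corr k m m' s
      ≤ R^2 * ((if m = m' then s1 else 0) + 2 * (s1 * √s1) * (w m' m + w m m')) := by
    intro m hm m' hm'
    rw [intervalIntegral.integral_const_mul]
    have hRR : (r2 m : ℝ) * r2 m' ≤ R^2 := by
      rw [sq]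
      apply mul_le_mul (hR m (by simp at hm; omega)) (hR m' (by simp at hm'; omega)) (by positivity) hR0
    have hss : 0 ≤ s1 * √s1 := by positivity
    have hrhs : 0 ≤ ((if m = m' then s1 else 0) + 2 * (s1 * √s1) * (w m' m + w m m')) := by
      have := hw0 m m'; have := hw0 m' m
      have : 0 ≤ (if m = m' then s1 else 0) := by split_ifs <;> simp [hs1]
      positivity
    have hI : ∫ s in s0..s1, corr k m m' s ≤ ((if m = m' then s1 else 0) + 2 * (s1 * √s1) * (w m' m + w m m')) := by
      rcases lt_trichotomy m m' with h | h | h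
      · rw [if_neg h.ne, zero_add]
        refine (le_abs_self _).trans ((hlt m m' h).trans ?_)
        simp only [hw, if_pos h, if_neg h.not_gt, add_zero]; exact le_refl _
      · subst h
        have h5 := intervalIntegral.norm_integral_le_of_norm_le_const (a := s0) (b := s1) (C := 1)
          (f := corr k m m) (fun s _ => corr_abs k m m s)
        rw [abs_of_nonneg (by linarith), one_mul, Real.norm_eq_abs] at h5
        have := le_abs_self (∫ s in s0..s1, corr k m m s)
        simp only [hw, if_true, lt_irrefl, if_false]
        linarith
      · rw [if_neg h.ne', zero_add]
        have := hlt m' m h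
        simp_rw [corr_symm k m m']
        refine (le_abs_self _).trans (this.trans ?_)
        simp only [hw, if_pos h, if_neg h.not_gt, zero_add]; exact le_refl _
    calc (r2 m : ℝ) * r2 m' * ∫ s in s0..s1, corr k m m' s ≤ (r2 m : ℝ) * r2 m' * _ := mul_le_mul_of_nonneg_left hI (by positivity)
      _ ≤ _ := mul_le_mul_of_nonneg_right hRR hrhs
  have hdw := double_w M
  calc _ ≤ ∑ m ∈ Finset.range (M+1), ∑ m' ∈ Finset.range (M+1), R^2 * ((if m = m' then s1 else 0) + 2 * (s1 * √s1) * (w m' m + w m m')) := by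
        apply Finset.sum_le_sum; intro m hm
        rw [intervalIntegral.integral_finsetSum (fun m' _ => hi m m')]
        exact Finset.sum_le_sum (fun m' hm' => hb m hm m' hm')
    _ = R^2 * ((M+1) * s1 + 2 * (s1 * √s1) * (∑ m' ∈ Finset.range (M+1), ∑ m ∈ Finset.range (M+1), w m' m + ∑ m' ∈ Finset.range (M+1), ∑ m ∈ Finset.range (M+1), w m' m)) := by
        conv_rhs => rw [Finset.sum_comm]
        simp_rw [← Finset.mul_sum, Finset.sum_add_distrib, ← Finset.mul_sum, Finset.sum_add_distrib]
        rw [show ∑ x ∈ Finset.range (M+1), ∑ i ∈ Finset.range (M+1), w x i = ∑ x ∈ Finset.range (M+1), ∑ i ∈ Finset.range (M+1), w i x from Finset.sum_comm]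
        congr 2
        rw [Finset.sum_congr rfl (g := fun _ => s1)]
        · simp
        · intro m hm
          rw [Finset.sum_ite_eq, if_pos hm]
    _ ≤ R^2 * ((M+1) * s1 + 2 * (s1 * √s1) * ((1 + Real.log M)^2 + (1 + Real.log M)^2)) := by
        gcongr
    _ = _ := by ring

end psiL2

section psifinal

def PsiS (M : ℕ) (s : ℝ) : ℝ := ∑ m ∈ Finset.range (M+1), (r2 m : ℝ) * (if (m:ℝ)^2 ≤ s then sawtooth √(s-(m:ℝ)^2) else 0)

lemma PsiS_meas (M : ℕ) : Measurable (PsiS M) := by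
  unfold PsiS
  apply Finset.measurable_fun_sum
  intro m _
  apply Measurable.const_mul
  apply Measurable.ite measurableSet_Ici _ measurable_const
  exact saw_meas.comp (by fun_prop)

lemma PsiS_abs (M : ℕ) (s : ℝ) : |PsiS M s| ≤ ∑ m ∈ Finset.range (M+1), (r2 m : ℝ) := by
  unfold PsiS
  refine (Finset.abs_sum_le_sum_abs _ _).trans (Finset.sum_le_sum (fun m _ => ?_))
  rw [abs_mul, abs_of_nonneg (by positivity : (0:ℝ) ≤ r2 m)]
  apply mul_le_of_le_one_right (by positivity)
  split_ifs
  · have := saw_abs √(s-(m:ℝ)^2); linarith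
  · simp

lemma PsiS_decomp (K M : ℕ) (s : ℝ) : PsiS M s = ∑ m ∈ Finset.range (M+1), (r2 m : ℝ) * vE K m s
    - ∑ k ∈ Finset.Icc 1 K, (1/(π*k)) * SkS k M s := by
  unfold PsiS SkS
  simp_rw [Finset.mul_sum]
  rw [Finset.sum_comm (s := Finset.Icc 1 K), ← Finset.sum_sub_distrib]
  apply Finset.sum_congr rfl
  intro m _
  unfold vE
  by_cases h : (m:ℝ)^2 ≤ s
  · simp only [h, if_true]
    unfold EK TK
    rw [sub_neg_eq_add, mul_add, Finset.mul_sum, add_sub_assoc, ← Finset.sum_sub_distrib]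
    rw [Finset.sum_eq_zero, add_zero]
    intro k _
    rw [show 2*π*(k*√(s-(m:ℝ)^2)) = 2*π*k*√(s-(m:ℝ)^2) by ring]
    ring
  · simp [h]

lemma PsiS_int (K M N : ℕ) (hK : 1 ≤ K) (R s0 s1 : ℝ) (h0 : 0 ≤ s0) (h01 : s0 ≤ s1) (h1 : s1 ≤ (N:ℝ)^2)
    (hR : ∀ m ≤ M, (r2 m : ℝ) ≤ R) :
    ∫ s in s0..s1, PsiS M s ^ 2 ≤ 4 * R^2 * (M+1)^2 * (N:ℝ)^2 / K +
      2 * (1 + Real.log K)^2 * (R^2 * ((M+1) * s1 + 4 * (s1*√s1) * (1 + Real.log M)^2)) := by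
  have hs1 : 0 ≤ s1 := h0.trans h01
  have hR0 : 0 ≤ R := le_trans (by positivity) (hR 0 (by omega))
  have hH := harm_le_log K
  set H := ∑ n ∈ Finset.Icc 1 K, (1:ℝ)/n with hHd
  have hH0 : 0 ≤ H := Finset.sum_nonneg (fun _ _ => by positivity)
  set W := (R^2 * ((M+1) * s1 + 4 * (s1*√s1) * (1 + Real.log M)^2)) with hW
  have hW0 : 0 ≤ W := by positivity
  have pw : ∀ s, PsiS M s ^ 2 ≤ 2 * (R^2 * (M+1) * ∑ m ∈ Finset.range (M+1), vE K m s ^ 2) + 2 * (H * ∑ k ∈ Finset.Icc 1 K, (1/(k:ℝ)) * SkS k M s ^ 2) := by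
    intro s
    rw [PsiS_decomp K M s]
    set A := ∑ m ∈ Finset.range (M+1), (r2 m : ℝ) * vE K m s with hA
    set B := ∑ k ∈ Finset.Icc 1 K, (1/(π*k)) * SkS k M s with hB
    have hA2 : A ^ 2 ≤ R^2 * (M+1) * ∑ m ∈ Finset.range (M+1), vE K m s ^ 2 := by
      have := Finset.sum_mul_sq_le_sq_mul_sq (Finset.range (M+1)) (fun m => (r2 m : ℝ)) (fun m => vE K m s)
      refine this.trans ?_
      apply mul_le_mul_of_nonneg_right _ (Finset.sum_nonneg (fun _ _ => by positivity))
      calc ∑ m ∈ Finset.range (M+1), (r2 m : ℝ)^2 ≤ ∑ m ∈ Finset.range (M+1), R^2 := by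
            apply Finset.sum_le_sum; intro m hm
            exact pow_le_pow_left₀ (by positivity) (hR m (by simp at hm; omega)) 2
        _ = _ := by simp; ring
    have hB2 : B ^ 2 ≤ H * ∑ k ∈ Finset.Icc 1 K, (1/(k:ℝ)) * SkS k M s ^ 2 := by
      have := Finset.sum_sq_le_sum_mul_sum_of_sq_le_mul (Finset.Icc 1 K) (r := fun k : ℕ => (1/(π*k)) * SkS k M s)
        (f := fun k : ℕ => 1/(k:ℝ)) (g := fun k : ℕ => (1/π)^2 * ((1/(k:ℝ)) * SkS k M s ^ 2))
        (fun _ _ => by positivity) (fun _ _ => by positivity) (fun k _ => le_of_eq <| by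
          rw [show 1/(π*k) = (1/π) * (1/(k:ℝ)) by rw [one_div_mul_one_div]]; ring)
      refine this.trans ?_
      apply mul_le_mul_of_nonneg_left _ hH0
      apply Finset.sum_le_sum; intro k _
      apply mul_le_of_le_one_left (by positivity)
      have : 1/π ≤ 1 := by rw [div_le_one Real.pi_pos]; linarith [Real.pi_gt_three]
      exact pow_le_one₀ (by positivity) this
    nlinarith [sq_nonneg (A + B)]
  have iP : IntervalIntegrable (fun s => PsiS M s ^ 2) volume s0 s1 := by
    apply bint (B := (∑ m ∈ Finset.range (M+1), (r2 m : ℝ))^2) ((PsiS_meas M).pow_const 2)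
    intro s; rw [abs_pow]; exact pow_le_pow_left₀ (abs_nonneg _) (PsiS_abs _ _) 2
  have iS : ∀ k, IntervalIntegrable (fun s => SkS k M s ^ 2) volume s0 s1 := by
    intro k
    apply bint (B := (∑ m ∈ Finset.range (M+1), (r2 m : ℝ))^2) ((SkS_meas k M).pow_const 2)
    intro s; rw [abs_pow]; exact pow_le_pow_left₀ (abs_nonneg _) (SkS_abs _ _ _) 2
  have iV : ∀ m, IntervalIntegrable (fun s => vE K m s ^ 2) volume s0 s1 := by
    intro m
    apply bint (B := ((K:ℝ)+1)^2) ((vE_meas K m).pow_const 2)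
    intro s; rw [abs_pow]; exact pow_le_pow_left₀ (abs_nonneg _) (vE_abs _ _ _) 2
  have i1 := ((isum (Finset.range (M+1)) _ (fun m _ => iV m)).const_mul (R^2 * (M+1))).const_mul 2
  have i2 := ((isum (Finset.Icc 1 K) _ (fun k _ => (iS k).const_mul (1/(k:ℝ)))).const_mul H).const_mul 2
  refine (intervalIntegral.integral_mono_on h01 iP (i1.add i2) (fun s _ => pw s)).trans ?_
  rw [intervalIntegral.integral_add i1 i2]
  simp only [intervalIntegral.integral_const_mul]
  rw [intervalIntegral.integral_finsetSum (fun m _ => iV m), intervalIntegral.integral_finsetSum (fun k _ => (iS k).const_mul (1/(k:ℝ)))]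
  apply add_le_add
  · calc 2 * (R^2 * (M+1) * ∑ m ∈ Finset.range (M+1), ∫ s in s0..s1, vE K m s ^ 2)
        ≤ 2 * (R^2 * (M+1) * ∑ m ∈ Finset.range (M+1), 2 * (N:ℝ)^2 / K) := by
          gcongr with m _
          exact vE_int K m N hK s0 s1 h01 h1
      _ = _ := by simp; ring
  · calc 2 * (H * ∑ k ∈ Finset.Icc 1 K, ∫ s in s0..s1, (1/(k:ℝ)) * SkS k M s ^ 2)
        ≤ 2 * (H * ∑ k ∈ Finset.Icc 1 K, (1/(k:ℝ)) * W) := by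
          gcongr with k hk
          rw [intervalIntegral.integral_const_mul]
          gcongr
          exact SkS_int k M (Finset.mem_Icc.1 hk).1 R s0 s1 h0 h01 hR
      _ = 2 * H^2 * W := by rw [← Finset.sum_mul]; ring
      _ ≤ _ := by gcongr

lemma r2_zero : r2 0 = 1 := by
  unfold r2
  rw [Set.ncard_eq_one]
  refine ⟨(0,0), ?_⟩
  ext ⟨a, b⟩
  simp only [Set.mem_ofPred_eq, Set.mem_singleton_iff, Prod.mk.injEq, Nat.cast_zero]
  constructor
  · intro h
    constructor <;> nlinarith [sq_nonneg a, sq_nonneg b]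
  · rintro ⟨rfl, rfl⟩; simp

lemma r2_bound_X (ε : ℝ) (hε : 0 < ε) : ∃ C, 1 ≤ C ∧ ∀ X : ℝ, 1 ≤ X → ∀ m ≤ ⌊9*X^2⌋₊, (r2 m : ℝ) ≤ C * X^ε := by
  obtain ⟨C, hC, h⟩ := r2_bound (ε/2) (by linarith)
  refine ⟨max 1 (C * 9^(ε/2)), le_max_left _ _, ?_⟩
  intro X hX m hm
  rcases Nat.eq_zero_or_pos m with rfl | hm0
  · rw [r2_zero]
    have h1 : 1 ≤ X^ε := Real.one_le_rpow hX hε.le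
    have h2 : 1 ≤ max 1 (C * 9^(ε/2)) := le_max_left _ _
    push_cast; nlinarith
  · refine (h m hm0).trans ?_
    have h1 : (m:ℝ) ≤ 9*X^2 := (Nat.cast_le.2 hm).trans (Nat.floor_le (by positivity))
    calc C * (m:ℝ)^(ε/2) ≤ C * (9*X^2)^(ε/2) := by gcongr
      _ = (C * 9^(ε/2)) * X^ε := by
          rw [Real.mul_rpow (by positivity) (by positivity), ← Real.rpow_natCast, ← Real.rpow_mul (by linarith)]
          rw [show ((2:ℕ):ℝ) * (ε/2) = ε by push_cast; ring]; ring
      _ ≤ _ := by gcongr; exact le_max_right _ _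

lemma log_le_X (ε : ℝ) (hε : 0 < ε) : ∃ C, 1 ≤ C ∧ ∀ X : ℝ, 1 ≤ X → 1 + Real.log (10*X^2) ≤ C * X^ε := by
  refine ⟨1 + Real.log 10 + 2/ε, ?_, ?_⟩
  · have : 0 ≤ Real.log 10 := Real.log_nonneg (by norm_num)
    have : 0 < 2/ε := by positivity
    linarith
  · intro X hX
    have h1 : 1 ≤ X^ε := Real.one_le_rpow hX hε.le
    have h2 := Real.log_le_rpow_div (by linarith : 0 ≤ X) hε
    have h3 : 0 ≤ Real.log 10 := Real.log_nonneg (by norm_num)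
    rw [Real.log_mul (by norm_num) (by positivity), Real.log_pow]
    push_cast
    have : 2 * (X^ε / ε) = 2/ε * X^ε := by ring
    nlinarith

lemma PsiS_L2s (ε : ℝ) (hε : 0 < ε) : ∃ C, 0 ≤ C ∧ ∀ X : ℝ, 1 ≤ X →
    ∫ s in X^4..81*X^4, PsiS ⌊9*X^2⌋₊ s ^ 2 ≤ C * X^(7+ε) := by
  obtain ⟨C1, hC1, h1⟩ := r2_bound_X (ε/6) (by linarith)
  obtain ⟨C2, hC2, h2⟩ := log_le_X (ε/6) (by linarith)
  refine ⟨40000 * C1^2 + 60000 * C1^2 * C2^4, by positivity, ?_⟩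
  intro X hX
  set M := ⌊9*X^2⌋₊ with hM
  set K := ⌈X⌉₊ with hK
  set N := ⌈9*X^2⌉₊ with hN
  set Z := X^(ε/6) with hZ
  have hX2 : X ≤ X^2 := by nlinarith
  have hX2' : 1 ≤ X^2 := by nlinarith
  have hZ1 : 1 ≤ Z := Real.one_le_rpow hX (by linarith)
  have hM1 : (M:ℝ) ≤ 9*X^2 := Nat.floor_le (by positivity)
  have hMpos : (1:ℝ) ≤ M := by
    have : 1 ≤ M := Nat.le_floor (by push_cast; linarith)
    exact_mod_cast this
  have hK1 : X ≤ K := Nat.le_ceil _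
  have hK2 : (K:ℝ) ≤ X + 1 := (Nat.ceil_lt_add_one (by linarith)).le
  have hN1 : 9*X^2 ≤ N := Nat.le_ceil _
  have hN2 : (N:ℝ) ≤ 9*X^2 + 1 := (Nat.ceil_lt_add_one (by positivity)).le
  have hlogK : 1 + Real.log K ≤ C2 * Z := by
    refine le_trans ?_ (h2 X hX)
    have : Real.log K ≤ Real.log (10*X^2) := Real.log_le_log (by linarith) (by linarith)
    linarith
  have hlogM : 1 + Real.log M ≤ C2 * Z := by
    refine le_trans ?_ (h2 X hX)
    have : Real.log M ≤ Real.log (10*X^2) := Real.log_le_log (by linarith) (by linarith)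
    linarith
  have hlogK0 : 0 ≤ Real.log K := Real.log_nonneg (by linarith)
  have hlogM0 : 0 ≤ Real.log M := Real.log_nonneg (by linarith)
  have key := PsiS_int K M N (by have : (1:ℝ) ≤ K := by linarith
                                 exact_mod_cast this) (C1 * Z) (X^4) (81*X^4) (by positivity) (by nlinarith [pow_pos (by linarith : 0 < X) 4])
    (by calc 81*X^4 = (9*X^2)^2 := by ring
          _ ≤ _ := by gcongr) (h1 X hX)
  have hsq : √(81*X^4) = 9*X^2 := by
    rw [show 81*X^4 = (9*X^2)^2 by ring, Real.sqrt_sq (by positivity)]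
  rw [hsq] at key
  refine key.trans ?_
  have hZ6 : X^(7+ε) = X^7 * Z^6 := by
    rw [Real.rpow_add (by linarith), hZ, ← Real.rpow_natCast (X^(ε/6)), ← Real.rpow_mul (by linarith)]
    congr 1
    · exact_mod_cast Real.rpow_natCast X 7
    · congr 1; push_cast; ring
  rw [hZ6, add_mul (40000 * C1^2)]
  have hX0 : 0 < X := by linarith
  have hZZ : Z^2 ≤ Z^6 := pow_le_pow_right₀ hZ1 (by norm_num)
  have hC0 : 0 < C1 := by linarith
  have hC20 : 0 < C2 := by linarith
  apply add_le_add
  · calc 4 * (C1*Z)^2 * ((M:ℝ)+1)^2 * (N:ℝ)^2 / K ≤ 4 * (C1*Z)^2 * (10*X^2)^2 * (10*X^2)^2 / X := by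
          gcongr
          · linarith
          · linarith
      _ = 40000 * C1^2 * (X^7 * Z^2) := by field_simp; ring
      _ ≤ _ := by gcongr
  · calc 2 * (1 + Real.log K)^2 * ((C1*Z)^2 * ((M+1) * (81*X^4) + 4 * (81*X^4*(9*X^2)) * (1 + Real.log M)^2))
        ≤ 2 * (C2*Z)^2 * ((C1*Z)^2 * ((10*X^2) * (81*X^4) + 4 * (81*X^4*(9*X^2)) * (C2*Z)^2)) := by
          gcongr
          linarith
      _ ≤ 2 * (C2*Z)^2 * ((C1*Z)^2 * ((10*X^2) * (81*X^4) * (C2*Z)^2 + 4 * (81*X^4*(9*X^2)) * (C2*Z)^2)) := by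
          have : 1 ≤ C2 * Z := by nlinarith
          have := le_mul_of_one_le_right (by positivity : 0 ≤ (10*X^2) * (81*X^4)) (one_le_pow₀ (n := 2) this)
          apply mul_le_mul_of_nonneg_left _ (by positivity)
          apply mul_le_mul_of_nonneg_left _ (by positivity)
          linarith
      _ = 7452 * C1^2 * C2^4 * X^6 * Z^6 := by ring
      _ ≤ 60000 * C1^2 * C2^4 * X^7 * Z^6 := by
          have : X^6 ≤ X^7 := pow_le_pow_right₀ hX (by norm_num)
          gcongr
          norm_num
      _ = _ := by ring

lemma PsiS_L2 (ε : ℝ) (hε : 0 < ε) : ∃ C, 0 ≤ C ∧ ∀ X : ℝ, 1 ≤ X →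
    ∫ y in X..3*X, PsiS ⌊9*X^2⌋₊ (y^4) ^ 2 ≤ C * X^(4+ε) := by
  obtain ⟨C, hC, h⟩ := PsiS_L2s ε hε
  refine ⟨C, hC, ?_⟩
  intro X hX
  have hX0 : 0 < X := by linarith
  set M := ⌊9*X^2⌋₊ with hM
  have hh := h X hX
  have h13 : X ≤ 3*X := by linarith
  have himg : (fun y : ℝ => y^4) '' (Set.Icc X (3*X)) = Set.Icc (X^4) (81*X^4) := by
    ext s
    simp only [Set.mem_image, Set.mem_Icc]
    constructor
    · rintro ⟨u, ⟨h0, h2⟩, rfl⟩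
      constructor
      · gcongr
      · calc u^4 ≤ (3*X)^4 := by gcongr; linarith
          _ = _ := by ring
    · rintro ⟨h2, h3⟩
      have hs0 : 0 ≤ s := le_trans (by positivity) h2
      have e4 : √√s ^ 4 = s := by
        rw [show √√s ^ 4 = (√√s ^ 2)^2 by ring, Real.sq_sqrt (Real.sqrt_nonneg _), Real.sq_sqrt hs0]
      refine ⟨√√s, ⟨?_, ?_⟩, e4⟩
      · exact le_of_pow_le_pow_left₀ (n := 4) (by norm_num) (by positivity) (by rw [e4]; exact h2)
      · exact le_of_pow_le_pow_left₀ (n := 4) (by norm_num) (by positivity) (by rw [e4]; linarith [h3, (by ring : (3*X)^4 = 81*X^4)])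
  have hcov := integral_image_eq_integral_abs_deriv_smul (s := Set.Icc X (3*X)) (f := fun u : ℝ => u^4)
    (f' := fun u => 4 * u^3) measurableSet_Icc (fun u _ => by
      have := (hasDerivAt_pow 4 u)
      refine (this.congr_deriv ?_).hasDerivWithinAt
      norm_num) (by
      intro x hx y hy hxy
      exact (pow_left_inj₀ (by linarith [hx.1]) (by linarith [hy.1]) (by norm_num)).1 hxy) (fun s => PsiS M s ^ 2)
  rw [himg, integral_Icc_eq_integral_Ioc, ← intervalIntegral.integral_of_le (by nlinarith [pow_pos hX0 4])] at hcov
  rw [hcov] at hh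
  have hb : ∀ y, |PsiS M (y^4) ^ 2| ≤ (∑ m ∈ Finset.range (M+1), (r2 m : ℝ))^2 := by
    intro s; rw [abs_pow]; exact pow_le_pow_left₀ (abs_nonneg _) (PsiS_abs _ _) 2
  have hme : Measurable (fun y : ℝ => PsiS M (y^4) ^ 2) := ((PsiS_meas M).comp (by fun_prop)).pow_const 2
  have i1 : IntegrableOn (fun y : ℝ => PsiS M (y^4) ^ 2) (Set.Icc X (3*X)) :=
    Measure.integrableOn_of_bounded (by simp) hme.aestronglyMeasurable (Eventually.of_forall hb)
  have i2 : IntegrableOn (fun y : ℝ => |4*y^3| • PsiS M (y^4) ^ 2) (Set.Icc X (3*X)) := by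
    apply IntegrableOn.continuousOn_smul i1 _ isCompact_Icc
    exact (by fun_prop : Continuous fun y : ℝ => |4*y^3|).continuousOn
  have hlow : ∫ y in Set.Icc X (3*X), X^3 * PsiS M (y^4) ^ 2 ≤ ∫ y in Set.Icc X (3*X), |4*y^3| • PsiS M (y^4) ^ 2 := by
    apply setIntegral_mono_on (i1.const_mul _) i2 measurableSet_Icc
    intro y hy
    rw [smul_eq_mul]
    apply mul_le_mul_of_nonneg_right _ (by positivity)
    have : X^3 ≤ y^3 := by gcongr; exact hy.1
    rw [abs_of_nonneg (by have := pow_pos hX0 3; linarith)]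
    linarith [pow_pos hX0 3]
  rw [integral_const_mul, integral_Icc_eq_integral_Ioc, ← intervalIntegral.integral_of_le h13] at hlow
  have h5 := hlow.trans hh
  have : C * X^(7+ε) = X^3 * (C * X^(4+ε)) := by
    rw [show 7+ε = 3 + (4+ε) by ring, Real.rpow_add hX0]
    rw [show X^(3:ℝ) = X^3 by exact_mod_cast Real.rpow_natCast X 3]
    ring
  rw [this] at h5
  exact le_of_mul_le_mul_left h5 (by positivity)

end psifinal

section poisson
open scoped FourierTransform

lemma poisson1 (f : ℝ → ℂ) (hf : Continuous f) (A : ℕ) (hs : ∀ a, (A:ℝ) ≤ |a| → f a = 0)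
    (hsum : Summable fun n : ℤ => ∫ a in (-(A:ℝ))..A, eC (-(a * n)) * f a) :
    ∑ n ∈ Finset.Icc (-(A:ℤ)) A, f n = ∑' n : ℤ, ∫ a in (-(A:ℝ))..A, eC (-(a * n)) * f a := by
  have hFf : ∀ n : ℤ, 𝓕 f (n:ℝ) = ∫ a in (-(A:ℝ))..A, eC (-(a * n)) * f a := by
    intro n
    rw [Real.fourier_real_eq_integral_exp_smul]
    rw [intervalIntegral.integral_eq_integral_of_support_subset]
    · congr 1; ext a
      rw [smul_eq_mul]; unfold eC; congr 2; push_cast; ring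
    · intro a ha
      by_contra hc
      apply ha
      have : (A:ℝ) ≤ |a| := by
        by_contra h
        push Not at h
        rw [abs_lt] at h
        exact hc ⟨h.1, h.2.le⟩
      simp [hs a this]
  have hO : f =O[cocompact ℝ] fun x : ℝ => |x| ^ (-(2:ℝ)) := by
    have : f =ᶠ[cocompact ℝ] fun _ => 0 := by
      have h1 : ∀ᶠ x in cocompact ℝ, x ∉ Set.Icc (-(A:ℝ)) A := (isCompact_Icc).compl_mem_cocompact
      filter_upwards [h1] with x hx
      apply hs
      by_contra h
      push Not at h
      rw [abs_lt] at h
      exact hx ⟨h.1.le, h.2.le⟩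
    exact this.trans_isBigO (Asymptotics.isBigO_zero _ _)
  have := Real.tsum_eq_tsum_fourier_of_rpow_decay_of_summable hf (by norm_num) hO (by simpa only [hFf] using hsum) 0
  simp only [zero_add, QuotientAddGroup.mk_zero, fourier_eval_zero, mul_one, hFf] at this
  rw [← this, tsum_eq_sum]
  intro n hn
  apply hs
  by_contra h
  push Not at h
  rw [abs_lt] at h
  apply hn
  rw [Finset.mem_Icc]
  have h1 : -(A:ℤ) < n := by exact_mod_cast h.1
  have h2 : n < (A:ℤ) := by exact_mod_cast h.2
  omega

def FT2 (F : ℝ → ℝ → ℂ) (A : ℕ) (x y : ℝ) : ℂ := ∫ b in (-(A:ℝ))..A, eC (-(b*y)) * ∫ a in (-(A:ℝ))..A, eC (-(a*x)) * F a b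

lemma poisson2 (F : ℝ → ℝ → ℂ) (hF : Continuous (Function.uncurry F)) (A : ℕ)
    (hs : ∀ a b : ℝ, ((A:ℝ) ≤ |a| ∨ (A:ℝ) ≤ |b|) → F a b = 0)
    (hsum : Summable fun p : ℤ × ℤ => FT2 F A p.1 p.2) :
    ∑ m ∈ Finset.Icc (-(A:ℤ)) A, ∑ n ∈ Finset.Icc (-(A:ℤ)) A, F m n = ∑' p : ℤ × ℤ, FT2 F A p.1 p.2 := by
  set f1 : ℤ → ℝ → ℂ := fun k b => ∫ a in (-(A:ℝ))..A, eC (-(a*k)) * F a b with hf1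
  have hFc : ∀ b, Continuous (fun a => F a b) := fun b => hF.comp (by fun_prop : Continuous fun a : ℝ => (a, b))
  have hf1c : ∀ k, Continuous (f1 k) := by
    intro k
    apply intervalIntegral.continuous_parametric_intervalIntegral_of_continuous'
    have h1 : Continuous fun p : ℝ × ℝ => eC (-(p.2 * (k:ℝ))) := eC_cont.comp (by fun_prop)
    have h2 : Continuous fun p : ℝ × ℝ => F p.2 p.1 := hF.comp (by fun_prop : Continuous fun p : ℝ × ℝ => (p.2, p.1))
    exact h1.mul h2
  have hs1 : ∀ k b, (A:ℝ) ≤ |b| → f1 k b = 0 := by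
    intro k b hb
    simp only [hf1]
    simp [hs _ b (Or.inr hb)]
  have hin : ∀ k : ℤ, ∑ n ∈ Finset.Icc (-(A:ℤ)) A, f1 k n = ∑' l : ℤ, FT2 F A k l := by
    intro k
    exact poisson1 (f1 k) (hf1c k) A (hs1 k) (hsum.prod_factor k)
  set g : ℝ → ℂ := fun a => ∑ n ∈ Finset.Icc (-(A:ℤ)) A, F a n with hg
  have hgF : ∀ k : ℤ, ∫ a in (-(A:ℝ))..A, eC (-(a * k)) * g a = ∑' l : ℤ, FT2 F A k l := by
    intro k
    rw [← hin k]
    simp only [hg, hf1, Finset.mul_sum]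
    rw [intervalIntegral.integral_finsetSum]
    intro n _
    have h1 : Continuous fun a : ℝ => eC (-(a * (k:ℝ))) := eC_cont.comp (by fun_prop)
    exact (h1.mul (hFc n)).intervalIntegrable _ _
  have hgc : Continuous g := continuous_finsetSum _ (fun n _ => hFc n)
  have := poisson1 g hgc A (fun a ha => by simp only [hg]; exact Finset.sum_eq_zero (fun n _ => hs _ _ (Or.inl ha)))
    (by simp only [hgF]; exact hsum.prod)
  simp only [hgF] at this
  rw [hsum.tsum_prod]
  exact this

end poisson

section FTasymp

lemma bp (l : ℝ) (hl : 0 < l) (g g' : ℝ → ℝ) (hg : ∀ a, HasDerivAt g (g' a) a) (hg' : Continuous g') :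
    ∫ a in (-1:ℝ)..1, eC (-(l*a)) * (g a : ℂ) = (eC (-l) * g 1 - eC l * g (-1)) / ((-(2*π*l) : ℝ) * Complex.I)
      - (∫ a in (-1:ℝ)..1, eC (-(l*a)) * (g' a : ℂ)) / ((-(2*π*l) : ℝ) * Complex.I) := by
  set K : ℂ := ((-(2*π*l) : ℝ) * Complex.I) with hK
  have hK0 : K ≠ 0 := by
    rw [hK]; apply mul_ne_zero _ Complex.I_ne_zero
    rw [Complex.ofReal_ne_zero]; have := Real.pi_pos; nlinarith
  have hdE : ∀ a, HasDerivAt (fun a => eC (-(l*a)) / K) (eC (-(l*a))) a := by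
    intro a
    have h2 := eC_hasDeriv (-l) a
    have h3 := h2.div_const K
    have e : ∀ a, eC (-l * a) = eC (-(l*a)) := fun a => by rw [neg_mul]
    simp only [e] at h3
    refine h3.congr_deriv ?_
    rw [show ((2 * π * (-l) : ℝ) : ℂ) * Complex.I = K by rw [hK]; push_cast; ring]
    field_simp
  have hec : Continuous (fun a => eC (-(l*a))) := eC_cont.comp (by fun_prop)
  have hparts := intervalIntegral.integral_mul_deriv_eq_deriv_mul (a := -1) (b := 1) (u := fun s => ((g s : ℝ) : ℂ))
    (u' := fun s => ((g' s : ℝ) : ℂ)) (v := fun a => eC (-(l*a)) / K) (v' := fun a => eC (-(l*a)))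
    (fun s _ => (hg s).ofReal_comp) (fun s _ => hdE s)
    ((Complex.continuous_ofReal.comp hg').intervalIntegrable _ _) (hec.intervalIntegrable _ _)
  have e1 : ∫ a in (-1:ℝ)..1, eC (-(l*a)) * (g a : ℂ) = ∫ a in (-1:ℝ)..1, (g a : ℂ) * eC (-(l*a)) := by
    congr 1; ext a; ring
  rw [e1, hparts]
  have e2 : ∫ a in (-1:ℝ)..1, (g' a : ℂ) * (eC (-(l*a)) / K) = (∫ a in (-1:ℝ)..1, eC (-(l*a)) * (g' a : ℂ)) / K := by
    rw [← intervalIntegral.integral_div]; congr 1; ext a; ring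
  rw [e2]
  congr 1
  rw [mul_one, show -(l * -1) = l by ring]
  ring

/-- the profile after the substitution -/
def rs (s a : ℝ) : ℝ := √(1 + s^2 + a^2*(1-s^2))
def gs0 (s a : ℝ) : ℝ := (1-a^2) * rs s a
def gs1 (s a : ℝ) : ℝ := -2*a*rs s a + (1-a^2)*((1-s^2)*a)/rs s a
def gs2 (s a : ℝ) : ℝ := -2*rs s a - 4*((1-s^2)*a^2)/rs s a + (1-a^2)*((1+s^2)*(1-s^2))/(rs s a)^3
def gs3 (s a : ℝ) : ℝ := -(10*((1-s^2)*a)/rs s a) + 4*((1-s^2)^2*a^3)/(rs s a)^3 - 2*a*((1+s^2)*(1-s^2))/(rs s a)^3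
  - 3*((1-a^2)*((1+s^2)*(1-s^2)^2*a))/(rs s a)^5

lemma rs_cont : Continuous (Function.uncurry rs) := by
  unfold rs Function.uncurry; fun_prop

lemma rs_pos (s a : ℝ) (hs : s^2 ≤ 1) : 1 ≤ rs s a := by
  unfold rs
  apply Real.one_le_sqrt.mpr
  have := mul_nonneg (sq_nonneg a) (by linarith : 0 ≤ 1 - s^2)
  nlinarith [sq_nonneg s]

lemma rs_sq (s a : ℝ) (hs : s^2 ≤ 1) : rs s a ^ 2 = 1 + s^2 + a^2*(1-s^2) := by
  unfold rs
  rw [Real.sq_sqrt]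
  have := mul_nonneg (sq_nonneg a) (by linarith : 0 ≤ 1 - s^2)
  nlinarith [sq_nonneg s]

lemma rs_deriv (s a : ℝ) (hs : s^2 ≤ 1) : HasDerivAt (rs s) ((1-s^2)*a / rs s a) a := by
  have h1 : 1 + s^2 + a^2*(1-s^2) ≠ 0 := by
    have := rs_sq s a hs; have := rs_pos s a hs; nlinarith
  have h2 : HasDerivAt (fun a => 1 + s^2 + a^2*(1-s^2)) (2*a*(1-s^2)) a := by
    have := ((hasDerivAt_pow 2 a).mul_const (1-s^2)).const_add (1+s^2)
    refine this.congr_deriv ?_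
    norm_num
  have h3 := h2.sqrt h1
  refine h3.congr_deriv ?_
  unfold rs
  have : √(1 + s^2 + a^2*(1-s^2)) ≠ 0 := by have := rs_pos s a hs; unfold rs at this; linarith
  field_simp

lemma gs0_deriv (s a : ℝ) (hs : s^2 ≤ 1) : HasDerivAt (gs0 s) (gs1 s a) a := by
  have h := ((hasDerivAt_pow 2 a).const_sub 1).mul (rs_deriv s a hs)
  refine h.congr_deriv ?_
  unfold gs1
  have : rs s a ≠ 0 := by have := rs_pos s a hs; linarith
  field_simp
  ring

lemma gs1_deriv (s a : ℝ) (hs : s^2 ≤ 1) : HasDerivAt (gs1 s) (gs2 s a) a := by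
  have h0 : rs s a ≠ 0 := by have := rs_pos s a hs; linarith
  have h := (((hasDerivAt_id a).const_mul (-2)).mul (rs_deriv s a hs)).add
    ((((hasDerivAt_pow 2 a).const_sub 1).mul ((hasDerivAt_id a).const_mul (1-s^2))).div (rs_deriv s a hs) h0)
  refine h.congr_deriv ?_
  unfold gs2
  have hsq := rs_sq s a hs
  simp only [id]
  have h2 : 1 + s^2 = rs s a ^ 2 - a^2*(1-s^2) := by rw [hsq]; ring
  simp only [h2]
  generalize rs s a = r at *
  clear h
  field_simp
  simp
  ring

lemma gs2_deriv (s a : ℝ) (hs : s^2 ≤ 1) : HasDerivAt (gs2 s) (gs3 s a) a := by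
  have h0 : rs s a ≠ 0 := by have := rs_pos s a hs; linarith
  have h := (((rs_deriv s a hs).const_mul (-2)).sub
    ((((hasDerivAt_pow 2 a).const_mul (1-s^2)).const_mul 4).div (rs_deriv s a hs) h0)).add
    ((((hasDerivAt_pow 2 a).const_sub 1).mul_const ((1+s^2)*(1-s^2))).div ((rs_deriv s a hs).pow 3) (pow_ne_zero 3 h0))
  refine h.congr_deriv ?_
  unfold gs3
  simp only [Pi.pow_apply]
  generalize rs s a = r at *
  clear h
  field_simp
  simp
  ring

lemma gs_cont (s : ℝ) (hs : s^2 ≤ 1) : Continuous (gs1 s) ∧ Continuous (gs2 s) ∧ Continuous (gs3 s) := by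
  have hr : Continuous (rs s) := by unfold rs; fun_prop
  have h0 : ∀ a, rs s a ≠ 0 := fun a => by have := rs_pos s a hs; linarith
  have h3 : ∀ a, rs s a ^ 3 ≠ 0 := fun a => pow_ne_zero 3 (h0 a)
  have h5 : ∀ a, rs s a ^ 5 ≠ 0 := fun a => pow_ne_zero 5 (h0 a)
  refine ⟨?_, ?_, ?_⟩
  · unfold gs1; fun_prop (disch := assumption)
  · unfold gs2; fun_prop (disch := assumption)
  · unfold gs3; fun_prop (disch := assumption)

lemma gs_bounds (s a : ℝ) (hs : s^2 ≤ 1) (ha : a^2 ≤ 1) : |gs2 s a| ≤ 10 ∧ |gs3 s a| ≤ 30 := by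
  unfold gs2 gs3
  have h1 := rs_pos s a hs
  have hsq := rs_sq s a hs
  have hr2 : rs s a ≤ 2 := by
    have : a^2*(1-s^2) ≤ 1*(1-s^2) := by apply mul_le_mul_of_nonneg_right ha; linarith
    nlinarith
  have ha1 : |a| ≤ 1 := by rw [← sq_abs] at ha; nlinarith [abs_nonneg a]
  have hA : |1 + s^2| ≤ 2 := by rw [abs_of_nonneg (by positivity)]; linarith
  have hB : |1 - s^2| ≤ 1 := by rw [abs_of_nonneg (by linarith)]; nlinarith [sq_nonneg s]
  have hD : |1 - a^2| ≤ 1 := by rw [abs_of_nonneg (by linarith)]; nlinarith [sq_nonneg a]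
  generalize rs s a = r at *
  have hr0 : 0 < r := by linarith
  have hdiv : ∀ (n : ℕ) (x c : ℝ), |x| ≤ c → |x / r^n| ≤ c := by
    intro n x c hx
    rw [abs_div, abs_of_pos (by positivity : 0 < r^n)]
    exact (div_le_self (abs_nonneg _) (one_le_pow₀ h1)).trans hx
  have hdiv1 : ∀ (x c : ℝ), |x| ≤ c → |x / r| ≤ c := by
    intro x c hx; have := hdiv 1 x c hx; rwa [pow_one] at this
  have m : ∀ x y c d : ℝ, |x| ≤ c → |y| ≤ d → |x*y| ≤ c*d := by
    intro x y c d hx hy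
    rw [abs_mul]; exact mul_le_mul hx hy (abs_nonneg _) (le_trans (abs_nonneg _) hx)
  have p : ∀ (x c : ℝ) (n : ℕ), |x| ≤ c → |x^n| ≤ c^n := by
    intro x c n hx; rw [abs_pow]; exact pow_le_pow_left₀ (abs_nonneg _) hx n
  have habs : ∀ x : ℝ, 0 ≤ x → |x| ≤ x := fun x hx => (abs_of_nonneg hx).le
  constructor
  · have t1 : |-2*r| ≤ 4 := by rw [abs_mul, abs_of_pos hr0]; norm_num; linarith
    have t2 := hdiv1 _ _ (m _ _ _ _ (habs 4 (by norm_num)) (m _ _ _ _ hB (p _ _ 2 ha1)))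
    have t3 := hdiv 3 _ _ (m _ _ _ _ hD (m _ _ _ _ hA hB))
    rw [abs_le] at t1 t2 t3 ⊢
    obtain ⟨a1, a2⟩ := t1
    obtain ⟨b1, b2⟩ := t2
    obtain ⟨c1, c2⟩ := t3
    constructor <;> linarith
  · have t1 := hdiv1 _ _ (m _ _ _ _ (habs 10 (by norm_num)) (m _ _ _ _ hB ha1))
    have t2 := hdiv 3 _ _ (m _ _ _ _ (habs 4 (by norm_num)) (m _ _ _ _ (p _ _ 2 hB) (p _ _ 3 ha1)))
    have t3 := hdiv 3 _ _ (m _ _ _ _ (m _ _ _ _ (habs 2 (by norm_num)) ha1) (m _ _ _ _ hA hB))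
    have t4 := hdiv 5 _ _ (m _ _ _ _ (habs 3 (by norm_num)) (m _ _ _ _ hD (m _ _ _ _ (m _ _ _ _ hA (p _ _ 2 hB)) ha1)))
    rw [abs_le] at t1 t2 t3 t4 ⊢
    obtain ⟨a1, a2⟩ := t1
    obtain ⟨b1, b2⟩ := t2
    obtain ⟨c1, c2⟩ := t3
    obtain ⟨d1, d2⟩ := t4
    constructor <;> linarith

end FTasymp

section FTasymp2

def Is (s l : ℝ) : ℂ := ∫ a in (-1:ℝ)..1, eC (-(l*a)) * (gs0 s a : ℂ)

lemma Is_asymp (s l : ℝ) (hs : s^2 ≤ 1) (hl : 0 < l) :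
    ‖Is s l + ((√2 * cos (2*π*l) / (π^2*l^2) : ℝ) : ℂ)‖ ≤ 80 / l^3 := by
  have hpi := Real.pi_pos
  have hpi3 := Real.pi_gt_three
  obtain ⟨c1, c2, c3⟩ := gs_cont s hs
  have b0 := bp l hl (gs0 s) (gs1 s) (fun a => gs0_deriv s a hs) c1
  have b1 := bp l hl (gs1 s) (gs2 s) (fun a => gs1_deriv s a hs) c2
  have b2 := bp l hl (gs2 s) (gs3 s) (fun a => gs2_deriv s a hs) c3
  set K : ℂ := ((-(2*π*l) : ℝ) * Complex.I) with hK
  have hKn : ‖K‖ = 2*π*l := by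
    rw [hK, norm_mul, Complex.norm_I, mul_one, Complex.norm_real, norm_neg, Real.norm_of_nonneg (by positivity)]
  have hK0 : K ≠ 0 := by rw [← norm_pos_iff, hKn]; positivity
  have hK2 : K^2 = ((-(4*π^2*l^2) : ℝ) : ℂ) := by
    rw [hK, mul_pow, Complex.I_sq]; push_cast; ring
  have hr1 : rs s 1 = √2 := by unfold rs; congr 1; ring
  have hr2 : rs s (-1) = √2 := by unfold rs; congr 1; ring
  have g01 : gs0 s 1 = 0 := by unfold gs0; ring
  have g02 : gs0 s (-1) = 0 := by unfold gs0; ring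
  have g11 : gs1 s 1 = -2*√2 := by unfold gs1; rw [hr1]; ring
  have g12 : gs1 s (-1) = 2*√2 := by unfold gs1; rw [hr2]; ring
  rw [g01, g02] at b0
  rw [g11, g12] at b1
  have hI2 : ‖∫ a in (-1:ℝ)..1, eC (-(l*a)) * (gs2 s a : ℂ)‖ ≤ 80 / (2*π*l) := by
    rw [b2]
    have e1 : ‖eC (-l) * (gs2 s 1 : ℂ) - eC l * (gs2 s (-1) : ℂ)‖ ≤ 20 := by
      refine (norm_sub_le _ _).trans ?_
      rw [norm_mul, norm_mul, eC_norm, eC_norm, Complex.norm_real, Complex.norm_real, Real.norm_eq_abs, Real.norm_eq_abs]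
      linarith [(gs_bounds s 1 hs (by norm_num)).1, (gs_bounds s (-1) hs (by norm_num)).1]
    have e2 : ‖∫ a in (-1:ℝ)..1, eC (-(l*a)) * (gs3 s a : ℂ)‖ ≤ 60 := by
      have := intervalIntegral.norm_integral_le_of_norm_le_const (a := (-1:ℝ)) (b := 1) (C := 30)
        (f := fun a => eC (-(l*a)) * (gs3 s a : ℂ)) (by
          intro a ha
          rw [Set.uIoc_of_le (by norm_num)] at ha
          rw [norm_mul, eC_norm, one_mul, Complex.norm_real, Real.norm_eq_abs]
          exact (gs_bounds s a hs (by nlinarith [ha.1, ha.2])).2)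
      refine this.trans ?_
      norm_num
    refine (norm_sub_le _ _).trans ?_
    rw [norm_div, norm_div, hKn, ← add_div]
    gcongr
    linarith
  have hmain : Is s l + ((√2 * cos (2*π*l) / (π^2*l^2) : ℝ) : ℂ) = (∫ a in (-1:ℝ)..1, eC (-(l*a)) * (gs2 s a : ℂ)) / K^2 := by
    unfold Is
    rw [b0, b1]
    generalize (∫ a in (-1:ℝ)..1, eC (-(l*a)) * (gs2 s a : ℂ)) = I2
    have e : eC (-l) * ((-2*√2 : ℝ):ℂ) - eC l * ((2*√2 : ℝ):ℂ) = -((2*√2 : ℝ):ℂ) * ((2*cos (2*π*l) : ℝ):ℂ) := by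
      rw [← eC_add_neg]; push_cast; ring
    rw [e]
    have e3 : ((√2 * cos (2*π*l) / (π^2*l^2) : ℝ) : ℂ) = -((4*√2*cos (2*π*l) : ℝ) : ℂ) / K^2 := by
      rw [hK2, ← Complex.ofReal_neg, ← Complex.ofReal_div]; congr 1; field_simp
    rw [e3]
    field_simp
    push_cast
    ring
  rw [hmain, norm_div, norm_pow, hKn, div_le_iff₀ (by positivity)]
  refine hI2.trans ?_
  rw [div_le_iff₀ (by positivity)]
  have : 80 / l^3 * (2*π*l)^2*(2*π*l) = 80 * (2*π)^3 := by field_simp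
  rw [this]
  nlinarith [one_le_pow₀ (by linarith : 1 ≤ 2*π) (n := 3)]

lemma iiswap {f : ℝ → ℝ → ℂ} (hf : Continuous (Function.uncurry f)) (a b c d : ℝ) :
    ∫ x in a..b, ∫ y in c..d, f x y = ∫ y in c..d, ∫ x in a..b, f x y := by
  apply intervalIntegral_intervalIntegral_swap
  apply (hf.continuousOn.integrableOn_compact (isCompact_uIcc.prod isCompact_uIcc)).mono_set
  exact Set.prod_mono Set.uIoc_subset_uIcc Set.uIoc_subset_uIcc

/-- planar profile -/
def ph (a b : ℝ) : ℝ := √(1 - (a^2+b^2)^2)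

lemma ph_cont : Continuous (Function.uncurry ph) := by
  unfold ph Function.uncurry; fun_prop

lemma ph_zero (a b : ℝ) (h : 1 ≤ a^2+b^2) : ph a b = 0 := by
  unfold ph; apply Real.sqrt_eq_zero_of_nonpos; nlinarith

lemma ph_le (a b : ℝ) : ph a b ≤ 1 := by
  unfold ph; rw [Real.sqrt_le_left zero_le_one]; nlinarith [sq_nonneg (a^2+b^2)]

lemma ph_inner (a : ℝ) (ha : a^2 ≤ 1) :
    ∫ b in (-1:ℝ)..1, ph a b = ∫ s in (-1:ℝ)..1, √(1-s^2) * gs0 s a := by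
  set c := √(1-a^2) with hc
  have hc0 : 0 ≤ c := Real.sqrt_nonneg _
  have hc2 : c^2 = 1 - a^2 := Real.sq_sqrt (by linarith)
  have hc1 : c ≤ 1 := by nlinarith [sq_nonneg a]
  have hsupp : Function.support (ph a) ⊆ Set.Ioc (-c) c := by
    intro b hb
    have : a^2+b^2 < 1 := by
      by_contra h; push Not at h; exact hb (ph_zero a b h)
    have : |b| < c := by
      rw [← Real.sqrt_sq_eq_abs]; apply Real.sqrt_lt_sqrt (sq_nonneg _); linarith
    rw [abs_lt] at this
    exact ⟨this.1, this.2.le⟩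
  rw [intervalIntegral.integral_eq_integral_of_support_subset (hsupp.trans (Set.Ioc_subset_Ioc (by linarith) hc1)),
    ← intervalIntegral.integral_eq_integral_of_support_subset hsupp]
  have := intervalIntegral.smul_integral_comp_mul_left (a := -1) (b := 1) (ph a) c
  rw [mul_one, mul_neg_one] at this
  rw [← this, smul_eq_mul, ← intervalIntegral.integral_const_mul]
  apply intervalIntegral.integral_congr
  intro s hs
  rw [Set.uIcc_of_le (by norm_num)] at hs
  have hs2 : s^2 ≤ 1 := by nlinarith [hs.1, hs.2]
  simp only
  unfold ph gs0 rs
  have e : 1 - (a^2+(c*s)^2)^2 = c^2 * ((1-s^2) * (1 + s^2 + a^2*(1-s^2))) := by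
    rw [mul_pow, hc2]; ring
  rw [e, Real.sqrt_mul (sq_nonneg _), Real.sqrt_sq hc0, Real.sqrt_mul (by linarith), ← hc2]
  ring

def Jf (l : ℝ) : ℂ := ∫ a in (-1:ℝ)..1, eC (-(l*a)) * ((∫ b in (-1:ℝ)..1, ph a b : ℝ) : ℂ)

lemma Jf_eq (l : ℝ) : Jf l = ∫ s in (-1:ℝ)..1, (√(1-s^2) : ℂ) * Is s l := by
  have h1 : Jf l = ∫ a in (-1:ℝ)..1, ∫ s in (-1:ℝ)..1, (√(1-s^2) : ℂ) * (eC (-(l*a)) * (gs0 s a : ℂ)) := by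
    unfold Jf
    apply intervalIntegral.integral_congr
    intro a ha
    rw [Set.uIcc_of_le (by norm_num)] at ha
    simp only
    rw [ph_inner a (by nlinarith [ha.1, ha.2]), ← intervalIntegral.integral_ofReal, ← intervalIntegral.integral_const_mul]
    congr 1; ext s; push_cast; ring
  have hcont : Continuous (Function.uncurry fun a s : ℝ => (√(1-s^2) : ℂ) * (eC (-(l*a)) * (gs0 s a : ℂ))) := by
    unfold Function.uncurry gs0 rs
    have := eC_cont
    fun_prop
  rw [h1, iiswap hcont]
  unfold Is
  congr 1; ext s
  rw [← intervalIntegral.integral_const_mul]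

lemma Jf_asymp (l : ℝ) (hl : 0 < l) : ‖Jf l + ((√2 / (2*π) * cos (2*π*l) / l^2 : ℝ) : ℂ)‖ ≤ 160 / l^3 := by
  have hIc : Continuous fun s => Is s l := by
    unfold Is
    apply intervalIntegral.continuous_parametric_intervalIntegral_of_continuous'
    unfold Function.uncurry gs0 rs
    have := eC_cont
    fun_prop
  have e : ((√2 / (2*π) * cos (2*π*l) / l^2 : ℝ) : ℂ) = ∫ s in (-1:ℝ)..1, (√(1-s^2) : ℂ) * ((√2 * cos (2*π*l) / (π^2*l^2) : ℝ) : ℂ) := by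
    rw [intervalIntegral.integral_mul_const, intervalIntegral.integral_ofReal, integral_sqrt_one_sub_sq]
    rw [← Complex.ofReal_mul]; congr 1
    have := Real.pi_pos
    field_simp
  rw [Jf_eq, e, ← intervalIntegral.integral_add]
  · have := intervalIntegral.norm_integral_le_of_norm_le_const (a := (-1:ℝ)) (b := 1) (C := 80/l^3)
        (f := fun s => (√(1-s^2) : ℂ) * Is s l + (√(1-s^2) : ℂ) * ((√2 * cos (2*π*l) / (π^2*l^2) : ℝ) : ℂ)) (by
          intro s hs
          rw [Set.uIoc_of_le (by norm_num)] at hs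
          have hs2 : s^2 ≤ 1 := by nlinarith [hs.1, hs.2]
          rw [← mul_add, norm_mul, Complex.norm_real, Real.norm_of_nonneg (Real.sqrt_nonneg _)]
          have h1 : √(1-s^2) ≤ 1 := by rw [Real.sqrt_le_left zero_le_one]; nlinarith [sq_nonneg s]
          have h2 := Is_asymp s l hs2 hl
          nlinarith [norm_nonneg (Is s l + ((√2 * cos (2*π*l) / (π^2*l^2) : ℝ) : ℂ)), Real.sqrt_nonneg (1-s^2)])
    refine this.trans (le_of_eq ?_)
    rw [show |(1:ℝ) - -1| = 2 by norm_num]; ring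
  · apply Continuous.intervalIntegrable; fun_prop
  · apply Continuous.intervalIntegrable; fun_prop

end FTasymp2

section FT2D

lemma C_int (f : ℝ → ℝ → ℂ) (hf : Continuous (Function.uncurry f)) (A : ℝ)
    (hs : ∀ a b : ℝ, (A ≤ |a| ∨ A ≤ |b|) → f a b = 0) :
    ∫ z : ℂ, f z.re z.im = ∫ b in (-A)..A, ∫ a in (-A)..A, f a b := by
  have hin : Integrable (Function.uncurry f) (volume.prod volume) := by
    apply Continuous.integrable_of_hasCompactSupport hf
    apply HasCompactSupport.intro (K := Set.Icc (-A) A ×ˢ Set.Icc (-A) A) (isCompact_Icc.prod isCompact_Icc)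
    rintro ⟨a, b⟩ hab
    apply hs
    by_contra h
    push Not at h
    rw [abs_lt, abs_lt] at h
    exact hab ⟨⟨h.1.1.le, h.1.2.le⟩, ⟨h.2.1.le, h.2.2.le⟩⟩
  have h1 : ∫ z : ℂ, f z.re z.im = ∫ p : ℝ × ℝ, Function.uncurry f p := by
    rw [← Complex.volume_preserving_equiv_real_prod.integral_comp' (Function.uncurry f)]
    rfl
  have hsub : ∀ g : ℝ → ℂ, (∀ a, A ≤ |a| → g a = 0) → ∫ a, g a = ∫ a in (-A)..A, g a := by
    intro g hg
    rw [intervalIntegral.integral_eq_integral_of_support_subset]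
    intro a ha
    by_contra hc
    apply ha
    apply hg
    by_contra h
    push Not at h
    rw [abs_lt] at h
    exact hc ⟨h.1, h.2.le⟩
  rw [h1, show (volume : Measure (ℝ × ℝ)) = volume.prod volume from rfl, integral_prod_symm _ hin]
  simp only [Function.uncurry]
  rw [hsub]
  · congr 1; ext b
    exact hsub _ (fun a ha => hs a b (Or.inl ha))
  · intro b hb
    have : ∀ a, f a b = 0 := fun a => hs a b (Or.inr hb)
    simp [this]

lemma ph_supp (t : ℝ) (ht : 0 < t) (A : ℝ) (hA : t ≤ A) (a b : ℝ) (h : A ≤ |a| ∨ A ≤ |b|) : ph (a/t) (b/t) = 0 := by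
  apply ph_zero
  rw [div_pow, div_pow, ← add_div, le_div_iff₀ (by positivity), one_mul]
  rcases h with h | h
  · nlinarith [sq_abs a, sq_nonneg b]
  · nlinarith [sq_abs b, sq_nonneg a]

lemma C_rot (g : ℂ → ℂ) (u : Circle) : ∫ z : ℂ, g (u * z) = ∫ z, g z := by
  have h := (rotation u).measurePreserving
  have := h.integral_comp' (f := (rotation u).toHomeomorph.toMeasurableEquiv) g
  exact this

lemma ph_norm (t : ℝ) (z : ℂ) : ph (z.re/t) (z.im/t) = √(1 - (‖z‖^2/t^2)^2) := by
  unfold ph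
  rw [← Complex.normSq_eq_norm_sq, Complex.normSq_apply]
  congr 3
  ring

lemma FT2_ph (t : ℝ) (ht : 0 < t) (A : ℕ) (hA : t ≤ A) (x y : ℝ) :
    FT2 (fun a b => (ph (a/t) (b/t) : ℂ)) A x y = (t^2 : ℝ) * Jf (t * √(x^2+y^2)) := by
  have hphc := ph_cont
  have heC := eC_cont
  have hpt : Continuous (fun p : ℝ × ℝ => ph (p.1/t) (p.2/t)) :=
    hphc.comp (by fun_prop : Continuous fun p : ℝ × ℝ => (p.1/t, p.2/t))
  have h1 : FT2 (fun a b => (ph (a/t) (b/t) : ℂ)) A x y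
      = ∫ z : ℂ, eC (-(z.re*x + z.im*y)) * (ph (z.re/t) (z.im/t) : ℂ) := by
    rw [C_int (fun a b => eC (-(a*x + b*y)) * (ph (a/t) (b/t) : ℂ)) _ A]
    · unfold FT2
      congr 1; ext b
      rw [← intervalIntegral.integral_const_mul]
      congr 1; ext a
      rw [← mul_assoc, ← eC_add]; congr 2; ring
    · intro a b hab
      rw [ph_supp t ht A hA a b hab]; simp
    · unfold Function.uncurry
      fun_prop
  have h2 : Jf (t * √(x^2+y^2)) = ∫ z : ℂ, eC (-(t*√(x^2+y^2)*z.re)) * (ph z.re z.im : ℂ) := by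
    rw [C_int (fun a b => eC (-(t*√(x^2+y^2)*a)) * (ph a b : ℂ)) _ 1]
    · unfold Jf
      rw [← iiswap]
      · congr 1; ext a
        rw [← intervalIntegral.integral_ofReal, intervalIntegral.integral_const_mul]
      · unfold Function.uncurry
        have : Continuous (fun p : ℝ × ℝ => ph p.1 p.2) := hphc
        fun_prop
    · intro a b hab
      have := ph_supp 1 one_pos 1 le_rfl a b hab
      rw [div_one, div_one] at this
      rw [this]; simp
    · unfold Function.uncurry
      have : Continuous (fun p : ℝ × ℝ => ph p.1 p.2) := hphc
      fun_prop
  have h3 : ∃ u : Circle, ∀ w : ℂ, (u * w).re * x + (u*w).im * y = √(x^2+y^2) * w.re := by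
    by_cases h0 : x^2+y^2 = 0
    · refine ⟨1, fun w => ?_⟩
      have hx : x = 0 := by nlinarith [sq_nonneg x, sq_nonneg y]
      have hy : y = 0 := by nlinarith [sq_nonneg x, sq_nonneg y]
      simp [hx, hy]
    · have hp : 0 < x^2+y^2 := lt_of_le_of_ne (by positivity) (Ne.symm h0)
      set r := √(x^2+y^2) with hr
      have hr0 : 0 < r := Real.sqrt_pos.mpr hp
      have hr2 : r^2 = x^2+y^2 := Real.sq_sqrt hp.le
      have hmem : (⟨x/r, y/r⟩ : ℂ) ∈ Metric.sphere (0:ℂ) 1 := by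
        rw [mem_sphere_zero_iff_norm, ← sq_eq_sq₀ (norm_nonneg _) zero_le_one, ← Complex.normSq_eq_norm_sq, Complex.normSq_apply]
        simp only
        field_simp
        linarith
      refine ⟨⟨(⟨x/r, y/r⟩ : ℂ), hmem⟩, fun w => ?_⟩
      simp only [Complex.mul_re, Complex.mul_im]
      field_simp
      rw [hr2]
      ring
  obtain ⟨u, hu⟩ := h3
  rw [h1, ← C_rot _ u]
  simp only [hu, ph_norm]
  have h4 := Measure.integral_comp_smul (μ := (volume : Measure ℂ)) (fun z : ℂ => eC (-(√(x^2+y^2)*z.re)) * (√(1 - (‖z‖^2/t^2)^2) : ℂ)) t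
  have h5 : ∀ z : ℂ, ‖(u:ℂ) * z‖ = ‖z‖ := fun z => by rw [norm_mul, Circle.norm_coe, one_mul]
  simp only [h5]
  rw [Complex.finrank_real_complex, abs_of_pos (by positivity), eq_inv_smul_iff₀ (by positivity)] at h4
  rw [← h4, h2, Complex.real_smul]
  congr 1
  congr 1; ext z
  have := ph_norm 1 z
  rw [div_one, div_one] at this
  rw [this]
  congr 2
  · rw [Complex.real_smul, Complex.re_ofReal_mul]; ring
  · rw [norm_smul, Real.norm_of_nonneg ht.le]
    congr 3
    field_simp

end FT2D

section volcomp

lemma vol_sq (r : ℝ) : volume {c : ℝ | c^2 ≤ r} = ENNReal.ofReal (2*√r) := by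
  by_cases hr : 0 ≤ r
  · have : {c : ℝ | c^2 ≤ r} = Set.Icc (-√r) (√r) := by
      ext c
      rw [Set.mem_ofPred_eq, Set.mem_Icc, ← abs_le, ← Real.sqrt_sq_eq_abs]
      exact (Real.sqrt_le_sqrt_iff hr).symm
    rw [this, Real.volume_Icc]; congr 1; ring
  · have : {c : ℝ | c^2 ≤ r} = ∅ := by
      ext c
      simp only [Set.mem_ofPred_eq, Set.mem_empty_iff_false, iff_false, not_le]
      nlinarith [sq_nonneg c]
    rw [this, Real.sqrt_eq_zero_of_nonpos (by linarith)]; simp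

lemma cball_eq : cyganBall = {u : ℝ × ℝ × ℝ | (u.1^2+u.2.1^2)^2 + u.2.2^2 ≤ 1} := by
  ext u
  unfold cyganBall cyganNorm
  simp only [Set.mem_ofPred_eq]
  constructor
  · intro h
    by_contra hc
    push Not at hc
    have := Real.one_lt_rpow hc (by norm_num : (0:ℝ) < 1/4)
    linarith
  · intro h
    exact Real.rpow_le_one (by positivity) h (by norm_num)

lemma volB_eq : volB = ∫ p : ℝ × ℝ, 2 * ph p.1 p.2 := by
  unfold volB
  have hm : MeasurableSet cyganBall := by
    rw [cball_eq]
    exact measurableSet_le (by fun_prop) (by fun_prop)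
  have h1 : volume cyganBall = ∫⁻ p : ℝ × ℝ, ENNReal.ofReal (2 * ph p.1 p.2) := by
    rw [show (volume : Measure (ℝ × ℝ × ℝ)) = volume.prod (volume.prod volume) from rfl, Measure.prod_apply hm]
    rw [show (volume : Measure (ℝ × ℝ)) = volume.prod volume from rfl, lintegral_prod]
    · congr 1; ext a
      rw [Measure.prod_apply (measurable_prodMk_left hm)]
      congr 1; ext b
      unfold ph
      rw [← vol_sq]
      congr 1
      rw [cball_eq]
      ext c
      simp only [Set.mem_preimage, Set.mem_ofPred_eq]
      constructor <;> intro h <;> linarith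
    · have := ph_cont
      unfold Function.uncurry at this
      exact (ENNReal.measurable_ofReal.comp (this.measurable.const_mul 2)).aemeasurable
  rw [h1, ← ofReal_integral_eq_lintegral_ofReal, ENNReal.toReal_ofReal]
  · apply integral_nonneg; intro p; exact mul_nonneg zero_le_two (Real.sqrt_nonneg _)
  · apply Continuous.integrable_of_hasCompactSupport
    · have := ph_cont
      unfold Function.uncurry at this
      fun_prop
    · apply HasCompactSupport.intro (K := Set.Icc (-1:ℝ) 1 ×ˢ Set.Icc (-1:ℝ) 1) (isCompact_Icc.prod isCompact_Icc)
      rintro ⟨a, b⟩ hab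
      have := ph_supp 1 one_pos 1 le_rfl a b (by
        by_contra h
        push Not at h
        rw [abs_lt, abs_lt] at h
        exact hab ⟨⟨h.1.1.le, h.1.2.le⟩, ⟨h.2.1.le, h.2.2.le⟩⟩)
      rw [div_one, div_one] at this
      simp [this]
  · exact Eventually.of_forall fun p => mul_nonneg zero_le_two (Real.sqrt_nonneg _)

lemma volB_Jf : (volB : ℂ) = 2 * Jf 0 := by
  have h := FT2_ph 1 one_pos 1 (by norm_num) 0 0
  simp only [div_one] at h
  rw [show (1:ℝ) * √(0^2+0^2) = 0 by simp] at h
  have h2 : FT2 (fun a b => (ph a b : ℂ)) 1 0 0 = ∫ z : ℂ, (ph z.re z.im : ℂ) := by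
    rw [C_int (fun a b => (ph a b : ℂ)) _ 1]
    · unfold FT2
      simp [eC_zero]
    · intro a b hab
      have := ph_supp 1 one_pos 1 le_rfl a b hab
      rw [div_one, div_one] at this
      rw [this]; simp
    · exact Complex.continuous_ofReal.comp ph_cont
  rw [h2] at h
  have h3 : ∫ z : ℂ, (ph z.re z.im : ℂ) = ∫ p : ℝ × ℝ, (ph p.1 p.2 : ℂ) := by
    rw [← Complex.volume_preserving_equiv_real_prod.integral_comp' (fun p : ℝ × ℝ => (ph p.1 p.2 : ℂ))]
    rfl
  rw [h3, integral_complex_ofReal] at h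
  rw [volB_eq, integral_const_mul, Complex.ofReal_mul, h]
  push_cast; ring

end volcomp

section latticeball

def zball (L : ℕ) : Finset (ℤ × ℤ) :=
  ((Finset.Icc (-(L:ℤ)) L) ×ˢ (Finset.Icc (-(L:ℤ)) L)).filter (fun p => p.1^2+p.2^2 ≤ L)

lemma mem_zball (L : ℕ) (p : ℤ × ℤ) : p ∈ zball L ↔ p.1^2+p.2^2 ≤ L := by
  unfold zball
  rw [Finset.mem_filter, Finset.mem_product, Finset.mem_Icc, Finset.mem_Icc]
  refine ⟨fun h => h.2, fun h => ⟨⟨⟨?_, ?_⟩, ?_, ?_⟩, h⟩⟩ <;>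
    nlinarith [sq_nonneg (p.1), sq_nonneg (p.2), Int.le_self_sq p.1, Int.le_self_sq p.2, Int.le_self_sq (-p.1), Int.le_self_sq (-p.2)]

lemma zball_card (L l : ℕ) (hl : l ≤ L) : ((zball L).filter (fun p => (p.1^2+p.2^2).toNat = l)).card = r2 l := by
  unfold r2
  rw [← Set.ncard_coe_finset]
  congr 1
  ext p
  simp only [Finset.coe_filter, Set.mem_ofPred_eq, mem_zball]
  have := add_nonneg (sq_nonneg p.1) (sq_nonneg p.2)
  generalize p.1^2+p.2^2 = k at *
  omega

lemma zball_sum {E : Type*} [AddCommMonoid E] (L : ℕ) (f : ℕ → E) :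
    ∑ p ∈ zball L, f (p.1^2+p.2^2).toNat = ∑ l ∈ Finset.range (L+1), r2 l • f l := by
  rw [← Finset.sum_fiberwise_of_maps_to (s := zball L) (t := Finset.range (L+1)) (g := fun p => (p.1^2+p.2^2).toNat)]
  · apply Finset.sum_congr rfl
    intro l hl
    rw [Finset.mem_range] at hl
    rw [← zball_card L l (by omega), ← Finset.sum_const]
    apply Finset.sum_congr rfl
    intro p hp
    rw [Finset.mem_filter] at hp
    rw [hp.2]
  · intro p hp
    rw [mem_zball] at hp
    rw [Finset.mem_range]
    omega

lemma zball_tendsto : Tendsto zball atTop atTop := by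
  apply Filter.tendsto_atTop_finset_of_monotone
  · intro a b hab p
    rw [mem_zball, mem_zball]
    intro h
    have : (a:ℤ) ≤ b := by exact_mod_cast hab
    omega
  · intro p
    refine ⟨(p.1^2+p.2^2).toNat, ?_⟩
    rw [mem_zball]
    exact Int.self_le_toNat _

lemma zsummable (f : ℕ → ℂ) (hf : Summable fun l => (r2 l : ℝ) * ‖f l‖) :
    Summable fun p : ℤ × ℤ => f (p.1^2+p.2^2).toNat := by
  apply Summable.of_norm
  apply summable_of_sum_le (c := ∑' l, (r2 l : ℝ) * ‖f l‖) (fun _ => norm_nonneg _)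
  intro s
  obtain ⟨L, hL⟩ := (zball_tendsto.eventually (eventually_ge_atTop s)).exists
  calc ∑ p ∈ s, ‖f (p.1^2+p.2^2).toNat‖ ≤ ∑ p ∈ zball L, ‖f (p.1^2+p.2^2).toNat‖ :=
        Finset.sum_le_sum_of_subset_of_nonneg hL (fun _ _ _ => norm_nonneg _)
    _ = ∑ l ∈ Finset.range (L+1), (r2 l : ℝ) * ‖f l‖ := by
        rw [zball_sum L (fun l => ‖f l‖)]; simp only [nsmul_eq_mul]
    _ ≤ _ := hf.sum_le_tsum _ (fun _ _ => by positivity)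

lemma r2_summable : Summable fun l : ℕ => (r2 l : ℝ) * (l:ℝ)^(-(3/2):ℝ) := by
  obtain ⟨C, hC, h⟩ := r2_bound (1/4) (by norm_num)
  have hs : Summable fun l : ℕ => C * (l:ℝ)^(-(5/4):ℝ) :=
    (Real.summable_nat_rpow.mpr (by norm_num)).mul_left C
  refine hs.of_nonneg_of_le (fun l => by positivity) (fun l => ?_)
  rcases Nat.eq_zero_or_pos l with rfl | hl
  · rw [Nat.cast_zero, Real.zero_rpow (by norm_num), Real.zero_rpow (by norm_num)]; simp
  · have hl' : (0:ℝ) < l := by exact_mod_cast hl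
    have e : (l:ℝ)^(-(5/4):ℝ) = (l:ℝ)^((1/4):ℝ) * (l:ℝ)^(-(3/2):ℝ) := by
      rw [← Real.rpow_add hl']; norm_num
    rw [e, ← mul_assoc]
    gcongr
    exact h l hl

end latticeball

section voronoi

def VM (M : ℕ) (y : ℝ) : ℝ := 2 * ∑ m ∈ Finset.range (M+1), (r2 m : ℝ) * √(1 - (m:ℝ)^2/y^4)

lemma Jf_cont : Continuous Jf := by
  have h1 : Continuous fun a : ℝ => ∫ b in (-1:ℝ)..1, ph a b :=
    intervalIntegral.continuous_parametric_intervalIntegral_of_continuous' ph_cont _ _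
  unfold Jf
  apply intervalIntegral.continuous_parametric_intervalIntegral_of_continuous'
  exact (eC_cont.comp (by fun_prop : Continuous fun q : ℝ × ℝ => -(q.1*q.2))).mul
    (Complex.continuous_ofReal.comp (h1.comp continuous_snd))

lemma box_ph (M : ℕ) (t : ℝ) (ht : 0 < t) (hM : t^2 ≤ M) :
    2 * ∑ m ∈ Finset.Icc (-(M:ℤ)) M, ∑ n ∈ Finset.Icc (-(M:ℤ)) M, ph ((m:ℝ)/t) ((n:ℝ)/t) = VM M t := by
  unfold VM
  congr 1
  have h := zball_sum M (fun l : ℕ => √(1 - (l:ℝ)^2/t^4))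
  simp only [nsmul_eq_mul] at h
  rw [← h, ← Finset.sum_product']
  unfold zball
  rw [Finset.sum_filter]
  apply Finset.sum_congr rfl
  rintro ⟨m, n⟩ _
  simp only
  have hnn : 0 ≤ m^2+n^2 := by positivity
  split_ifs with hc
  · unfold ph
    congr 1
    have : (((m^2+n^2).toNat : ℕ) : ℝ) = (m:ℝ)^2+(n:ℝ)^2 := by
      rw [← Int.cast_natCast, Int.toNat_of_nonneg hnn]; push_cast; ring
    rw [this]; field_simp
  · apply ph_zero
    push Not at hc
    have : (M:ℝ) < (m:ℝ)^2+(n:ℝ)^2 := by exact_mod_cast hc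
    rw [div_pow, div_pow, ← add_div, le_div_iff₀ (by positivity)]; linarith

def FF (y1 y2 a b : ℝ) : ℝ := ∫ t in y1..y2, ph (a / max t y1) (b / max t y1)

lemma HH_cont (y1 : ℝ) (h1 : 0 < y1) : Continuous (fun q : (ℝ × ℝ) × ℝ => ph (q.1.1 / max q.2 y1) (q.1.2 / max q.2 y1)) := by
  have hne : ∀ q : (ℝ × ℝ) × ℝ, max q.2 y1 ≠ 0 := fun q => (lt_of_lt_of_le h1 (le_max_right _ _)).ne'
  have : Continuous (fun q : (ℝ × ℝ) × ℝ => (q.1.1 / max q.2 y1, q.1.2 / max q.2 y1)) := by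
    fun_prop (disch := assumption)
  exact ph_cont.comp this

lemma FF_cont (y1 y2 : ℝ) (h1 : 0 < y1) : Continuous (Function.uncurry (FF y1 y2)) := by
  have := intervalIntegral.continuous_parametric_intervalIntegral_of_continuous' (μ := volume)
    (f := fun (p : ℝ × ℝ) t => ph (p.1 / max t y1) (p.2 / max t y1)) (HH_cont y1 h1) y1 y2
  exact this

def gl (y1 y2 : ℝ) (l : ℕ) : ℂ := ∫ t in y1..y2, ((t^2 : ℝ) : ℂ) * Jf (t * √(l:ℝ))

lemma FT2_FF (y1 y2 : ℝ) (h1 : 0 < y1) (h12 : y1 ≤ y2) (A : ℕ) (hA : y2 ≤ A) (p : ℤ × ℤ) :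
    FT2 (fun a b => (FF y1 y2 a b : ℂ)) A p.1 p.2 = gl y1 y2 (p.1^2+p.2^2).toNat := by
  obtain ⟨m0, n0⟩ := p
  simp only
  set x : ℝ := (m0 : ℝ)
  set y : ℝ := (n0 : ℝ)
  have heC := eC_cont
  have hH := HH_cont y1 h1
  have hHf : ∀ {T : Type} [TopologicalSpace T] (f g h : T → ℝ), Continuous f → Continuous g → Continuous h →
      Continuous fun q => ph (f q / max (h q) y1) (g q / max (h q) y1) := by
    intro T _ f g h hf hg hh
    exact hH.comp (by fun_prop : Continuous fun q => ((f q, g q), h q))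
  have e1 : FT2 (fun a b => (FF y1 y2 a b : ℂ)) A x y
      = ∫ t in y1..y2, FT2 (fun a b => (ph (a / max t y1) (b / max t y1) : ℂ)) A x y := by
    unfold FT2 FF
    rw [iiswap (f := fun t b => eC (-(b*y)) * ∫ a in (-(A:ℝ))..A, eC (-(a*x)) * (ph (a / max t y1) (b / max t y1) : ℂ))]
    · congr 1; ext b
      rw [intervalIntegral.integral_const_mul]
      congr 1
      rw [iiswap (f := fun t a => eC (-(a*x)) * (ph (a / max t y1) (b / max t y1) : ℂ))]
      · congr 1; ext a
        rw [intervalIntegral.integral_const_mul, intervalIntegral.integral_ofReal]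
      · unfold Function.uncurry
        have := hHf (fun q : ℝ × ℝ => q.2) (fun q => b) (fun q => q.1) (by fun_prop) (by fun_prop) (by fun_prop)
        fun_prop
    · unfold Function.uncurry
      apply Continuous.mul (by fun_prop)
      apply intervalIntegral.continuous_parametric_intervalIntegral_of_continuous'
      unfold Function.uncurry
      have := hHf (fun q : (ℝ × ℝ) × ℝ => q.2) (fun q => q.1.2) (fun q => q.1.1) (by fun_prop) (by fun_prop) (by fun_prop)
      fun_prop
  rw [e1]
  unfold gl
  apply intervalIntegral.integral_congr
  intro t ht
  rw [Set.uIcc_of_le h12] at ht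
  simp only
  rw [max_eq_left ht.1, FT2_ph t (by linarith [ht.1]) A (ht.2.trans hA)]
  congr 4
  have hnn : 0 ≤ m0^2+n0^2 := by positivity
  rw [← Int.cast_natCast, Int.toNat_of_nonneg hnn]; push_cast; rfl

def el (y1 y2 : ℝ) (l : ℕ) : ℂ := gl y1 y2 l + ((√2/(2*π) * (1/l) * ∫ t in y1..y2, cos (2*π*(√(l:ℝ)*t)) : ℝ) : ℂ)

lemma el_bound (y1 y2 : ℝ) (h1 : 0 < y1) (h12 : y1 ≤ y2) (l : ℕ) (hl : 1 ≤ l) :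
    ‖el y1 y2 l‖ ≤ 160 * ((y2-y1)/y1) * (l:ℝ)^(-(3/2):ℝ) := by
  have hl0 : (0:ℝ) < l := by exact_mod_cast hl
  have hJ := Jf_cont
  have e : el y1 y2 l = ∫ t in y1..y2, (((t^2 : ℝ) : ℂ) * Jf (t * √(l:ℝ)) + ((√2/(2*π) * (1/l) * cos (2*π*(√(l:ℝ)*t)) : ℝ) : ℂ)) := by
    rw [intervalIntegral.integral_add, intervalIntegral.integral_ofReal, intervalIntegral.integral_const_mul]
    · rfl
    · apply Continuous.intervalIntegrable; fun_prop
    · apply Continuous.intervalIntegrable; fun_prop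
  rw [e]
  have := intervalIntegral.norm_integral_le_of_norm_le_const (a := y1) (b := y2) (C := 160 / y1 * (l:ℝ)^(-(3/2):ℝ))
    (f := fun t => (((t^2 : ℝ) : ℂ) * Jf (t * √(l:ℝ)) + ((√2/(2*π) * (1/l) * cos (2*π*(√(l:ℝ)*t)) : ℝ) : ℂ))) (by
      intro t ht
      rw [Set.uIoc_of_le h12] at ht
      have ht0 : 0 < t := h1.trans ht.1
      have hsl : 0 < √(l:ℝ) := Real.sqrt_pos.mpr hl0
      have hs2 : √(l:ℝ)^2 = l := Real.sq_sqrt hl0.le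
      have hj := Jf_asymp (t*√(l:ℝ)) (by positivity)
      have e2 : (((t^2 : ℝ) : ℂ) * Jf (t * √(l:ℝ)) + ((√2/(2*π) * (1/l) * cos (2*π*(√(l:ℝ)*t)) : ℝ) : ℂ))
        = ((t^2 : ℝ) : ℂ) * (Jf (t * √(l:ℝ)) + ((√2 / (2*π) * cos (2*π*(t*√(l:ℝ))) / (t*√(l:ℝ))^2 : ℝ) : ℂ)) := by
        rw [mul_add]; congr 1
        rw [← Complex.ofReal_mul]; congr 1
        rw [mul_pow, hs2, mul_comm t √(l:ℝ)]; field_simp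
      rw [e2, norm_mul, Complex.norm_real, Real.norm_of_nonneg (sq_nonneg t)]
      have e3 : (l:ℝ)^(-(3/2):ℝ) = 1 / √(l:ℝ)^3 := by
        rw [Real.sqrt_eq_rpow, ← Real.rpow_natCast, ← Real.rpow_mul hl0.le, one_div, ← Real.rpow_neg hl0.le]; norm_num
      calc t^2 * _ ≤ t^2 * (160 / (t*√(l:ℝ))^3) := by gcongr
        _ = 160 / t * (1/√(l:ℝ)^3) := by field_simp
        _ ≤ 160 / y1 * (1/√(l:ℝ)^3) := by gcongr; exact ht.1.le
        _ = _ := by rw [e3])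
  refine this.trans (le_of_eq ?_)
  rw [abs_of_nonneg (by linarith)]; ring

lemma cos_int_bound (y1 y2 k : ℝ) (hk : 0 < k) : |∫ t in y1..y2, cos (2*π*(k*t))| ≤ 1 / k := by
  have hpi := Real.pi_gt_three
  have e : ∫ t in y1..y2, cos (2*π*(k*t)) = (sin (2*π*(k*y2)) - sin (2*π*(k*y1))) / (2*π*k) := by
    have hd : ∀ t ∈ Set.uIcc y1 y2, HasDerivAt (fun t => sin (2*π*(k*t)) / (2*π*k)) (cos (2*π*(k*t))) t := by
      intro t _
      have h1 : HasDerivAt (fun t => 2*π*(k*t)) (2*π*k) t := by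
        have := ((hasDerivAt_id t).const_mul k).const_mul (2*π)
        simpa using this
      refine (h1.sin.div_const (2*π*k)).congr_deriv ?_
      field_simp
    rw [intervalIntegral.integral_eq_sub_of_hasDerivAt hd ((by fun_prop : Continuous _).intervalIntegrable _ _)]
    ring
  rw [e, abs_div, abs_of_pos (by positivity : 0 < 2*π*k), div_le_div_iff₀ (by positivity) hk]
  have h3 : |sin (2*π*(k*y2)) - sin (2*π*(k*y1))| ≤ 2 := by
    refine (abs_sub _ _).trans ?_
    linarith [abs_sin_le_one (2*π*(k*y2)), abs_sin_le_one (2*π*(k*y1))]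
  nlinarith

lemma gl_bound (y1 y2 : ℝ) (h1 : 0 < y1) (h12 : y1 ≤ y2) (l : ℕ) (hl : 1 ≤ l) :
    ‖gl y1 y2 l‖ ≤ (1 + 160 * ((y2-y1)/y1)) * (l:ℝ)^(-(3/2):ℝ) := by
  have hl0 : (0:ℝ) < l := by exact_mod_cast hl
  have hsl : 0 < √(l:ℝ) := Real.sqrt_pos.mpr hl0
  have h := el_bound y1 y2 h1 h12 l hl
  have e : gl y1 y2 l = el y1 y2 l - ((√2/(2*π) * (1/l) * ∫ t in y1..y2, cos (2*π*(√(l:ℝ)*t)) : ℝ) : ℂ) := by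
    unfold el; ring
  rw [e]
  refine (norm_sub_le _ _).trans ?_
  have hc := cos_int_bound y1 y2 √(l:ℝ) hsl
  have h2 : ‖((√2/(2*π) * (1/l) * ∫ t in y1..y2, cos (2*π*(√(l:ℝ)*t)) : ℝ) : ℂ)‖ ≤ (l:ℝ)^(-(3/2):ℝ) := by
    rw [Complex.norm_real, norm_mul, Real.norm_eq_abs, Real.norm_eq_abs, abs_of_nonneg (by positivity)]
    have e3 : (l:ℝ)^(-(3/2):ℝ) = 1 * (1/l) * (1 / √(l:ℝ)) := by
      rw [Real.sqrt_eq_rpow, one_mul, one_div, one_div, ← Real.rpow_neg hl0.le, ← Real.rpow_neg_one, ← Real.rpow_add hl0]; norm_num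
    rw [e3]
    have : √2/(2*π) ≤ 1 := by
      rw [div_le_one (by positivity)]
      have : √2 ≤ 2 := by rw [Real.sqrt_le_left (by norm_num)]; norm_num
      linarith [Real.pi_gt_three]
    gcongr
  linarith

lemma ifsum {ι : Type} (S : Finset ι) (f : ι → ℝ → ℝ) (hf : ∀ i, Continuous (f i)) (a b : ℝ) :
    ∫ t in a..b, ∑ i ∈ S, f i t = ∑ i ∈ S, ∫ t in a..b, f i t :=
  intervalIntegral.integral_finsetSum (fun i _ => (hf i).intervalIntegrable a b)

lemma FF_sum (y1 y2 : ℝ) (h1 : 0 < y1) (h12 : y1 ≤ y2) (M : ℕ) (hM : y2^2 ≤ M) :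
    ∑ m ∈ Finset.Icc (-(M:ℤ)) M, ∑ n ∈ Finset.Icc (-(M:ℤ)) M, FF y1 y2 m n = 1/2 * ∫ t in y1..y2, VM M t := by
  have hcc : ∀ m n : ℤ, Continuous fun t => ph ((m:ℝ) / max t y1) ((n:ℝ) / max t y1) := by
    intro m n
    have hc : Continuous fun t : ℝ => (((m:ℝ), (n:ℝ)), t) := by fun_prop
    have h := (HH_cont y1 h1).comp hc
    simpa only [Function.comp_def] using h
  have s1 : ∀ m : ℤ, ∑ n ∈ Finset.Icc (-(M:ℤ)) M, FF y1 y2 m n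
      = ∫ t in y1..y2, ∑ n ∈ Finset.Icc (-(M:ℤ)) M, ph ((m:ℝ) / max t y1) ((n:ℝ) / max t y1) := by
    intro m
    exact (ifsum (Finset.Icc (-(M:ℤ)) M) (fun n t => ph ((m:ℝ) / max t y1) ((n:ℝ) / max t y1)) (hcc m) y1 y2).symm
  rw [Finset.sum_congr rfl (fun m _ => s1 m)]
  rw [← ifsum (Finset.Icc (-(M:ℤ)) M) (fun m t => ∑ n ∈ Finset.Icc (-(M:ℤ)) M, ph ((m:ℝ) / max t y1) ((n:ℝ) / max t y1))
    (fun m => continuous_finsetSum _ (fun n _ => hcc m n)), ← intervalIntegral.integral_const_mul]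
  apply intervalIntegral.integral_congr
  intro t ht
  rw [Set.uIcc_of_le h12] at ht
  simp only
  have ht0 : 0 < t := by linarith [ht.1]
  rw [max_eq_left ht.1, ← box_ph M t ht0 (le_trans (by gcongr; exact ht.2) hM)]
  ring

lemma voronoi : ∃ C : ℝ, 0 ≤ C ∧ ∀ y1 y2 : ℝ, 0 < y1 → y1 ≤ y2 → ∀ M : ℕ, y2^2 ≤ M → y2 ≤ M →
    ∃ e : ℝ, |e| ≤ C * ((y2-y1)/y1) ∧ Tendsto (fun L => ∫ t in y1..y2, PY L t) atTop
      (nhds ((∫ t in y1..y2, VM M t) - volB * (y2^3-y1^3)/3 - e)) := by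
  set S := ∑' l : ℕ, (r2 l : ℝ) * (l:ℝ)^(-(3/2):ℝ) with hS
  have hS0 : 0 ≤ S := tsum_nonneg fun l => by positivity
  refine ⟨320 * S, by positivity, fun y1 y2 h1 h12 M hM hM1 => ?_⟩
  have hy2 : 0 < y2 := lt_of_lt_of_le h1 h12
  have hmul : ∀ (f : ℕ → ℂ) (B : ℝ), (∀ l ≥ 1, ‖f l‖ ≤ B * (l:ℝ)^(-(3/2):ℝ)) → Summable fun l => (r2 l : ℝ) * ‖f l‖ := by
    intro f B hf
    rw [← summable_nat_add_iff 1]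
    have := (summable_nat_add_iff 1).mpr (r2_summable.mul_left B)
    refine this.of_nonneg_of_le (fun l => by positivity) (fun l => ?_)
    have := mul_le_mul_of_nonneg_left (hf (l+1) (by omega)) (by positivity : (0:ℝ) ≤ r2 (l+1))
    linarith
  have hsg := zsummable (gl y1 y2) (hmul _ _ (gl_bound y1 y2 h1 h12))
  have hP := poisson2 (fun a b => (FF y1 y2 a b : ℂ)) (Complex.continuous_ofReal.comp (FF_cont y1 y2 h1)) M
    (by
      intro a b hab
      have : FF y1 y2 a b = 0 := by
        unfold FF
        rw [intervalIntegral.integral_congr (g := fun _ => 0)]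
        · simp
        · intro t ht
          rw [Set.uIcc_of_le h12] at ht
          simp only
          rw [max_eq_left ht.1, ph_supp t (by linarith [ht.1]) M (ht.2.trans hM1) a b hab]
      simp [this]) (by simpa only [FT2_FF y1 y2 h1 h12 M hM1] using hsg)
  simp only [FT2_FF y1 y2 h1 h12 M hM1] at hP
  have hV : ∑ m ∈ Finset.Icc (-(M:ℤ)) M, ∑ n ∈ Finset.Icc (-(M:ℤ)) M, (FF y1 y2 m n : ℂ) = ((1/2 * ∫ t in y1..y2, VM M t : ℝ) : ℂ) := by
    rw [← FF_sum y1 y2 h1 h12 M hM]; push_cast; rfl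
  rw [hV] at hP
  have hT := (hsg.hasSum.comp zball_tendsto)
  rw [← hP] at hT
  simp only [Function.comp_def] at hT
  have hse := hmul _ _ (el_bound y1 y2 h1 h12)
  set f : ℕ → ℂ := fun l => if l = 0 then 0 else (r2 l : ℂ) * el y1 y2 l with hf
  have hfn : ∀ l, ‖f l‖ ≤ 160 * ((y2-y1)/y1) * ((r2 l : ℝ) * (l:ℝ)^(-(3/2):ℝ)) := by
    intro l
    have hnn : 0 ≤ (y2-y1)/y1 := div_nonneg (by linarith) h1.le
    simp only [hf]
    split_ifs with h0
    · rw [norm_zero]; positivity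
    · rw [norm_mul, Complex.norm_natCast]
      have := mul_le_mul_of_nonneg_left (el_bound y1 y2 h1 h12 l (by omega)) (by positivity : (0:ℝ) ≤ r2 l)
      linarith
  have hfs : Summable fun l => ‖f l‖ := (r2_summable.mul_left _).of_nonneg_of_le (fun _ => norm_nonneg _) hfn
  have hft := hfs.of_norm.hasSum.tendsto_sum_nat
  have hft' := hft.comp (tendsto_add_atTop_nat 1)
  refine ⟨2 * (∑' l, f l).re, ?_, ?_⟩
  · rw [abs_mul, abs_two]
    have h3 : ‖∑' l, f l‖ ≤ 160 * ((y2-y1)/y1) * S := by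
      refine (norm_tsum_le_tsum_norm hfs).trans ?_
      rw [hS, ← tsum_mul_left]
      exact hfs.tsum_le_tsum hfn (r2_summable.mul_left _)
    have := Complex.abs_re_le_norm (∑' l, f l)
    linarith
  · have hid : ∀ L : ℕ, ∫ t in y1..y2, PY L t = 2 * (∑ p ∈ zball L, gl y1 y2 (p.1^2+p.2^2).toNat).re
        - volB * (y2^3-y1^3)/3 - 2 * (∑ l ∈ Finset.range (L+1), f l).re := by
      intro L
      rw [zball_sum]
      have e0 : r2 0 • gl y1 y2 0 = (1/2:ℂ) * ((volB * (y2^3-y1^3)/3 : ℝ) : ℂ) := by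
        rw [r2_zero, one_smul]
        unfold gl
        simp only [Nat.cast_zero, Real.sqrt_zero, mul_zero]
        rw [intervalIntegral.integral_mul_const, intervalIntegral.integral_ofReal, integral_pow]
        have := volB_Jf
        push_cast
        rw [this]; norm_num; ring
      rw [Finset.sum_range_succ', Finset.sum_range_succ' f, e0]
      have e1 : ∀ l : ℕ, r2 (l+1) • gl y1 y2 (l+1) = f (l+1) + ((-(√2/(2*π)) * (aw (l+1) * ∫ t in y1..y2, cos (2*π*(√((l+1:ℕ):ℝ)*t))) : ℝ) : ℂ) := by
        intro l
        simp only [hf, el, aw]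
        rw [if_neg (by omega)]
        rw [nsmul_eq_mul]; push_cast; ring
      simp only [e1]
      rw [Finset.sum_add_distrib, ← Complex.ofReal_sum, ← Finset.mul_sum]
      have e2 : ∫ t in y1..y2, PY L t = -(√2/π) * ∑ l ∈ Finset.range L, aw (l+1) * ∫ t in y1..y2, cos (2*π*(√((l+1:ℕ):ℝ)*t)) := by
        unfold PY
        rw [intervalIntegral.integral_const_mul, intervalIntegral.integral_finsetSum]
        · congr 1
          simp only [intervalIntegral.integral_const_mul]
          apply Finset.sum_nbij' (fun l => l - 1) (fun l => l + 1)
          · intro l hl; rw [Finset.mem_Icc] at hl; rw [Finset.mem_range]; omega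
          · intro l hl; rw [Finset.mem_range] at hl; rw [Finset.mem_Icc]; omega
          · intro l hl; rw [Finset.mem_Icc] at hl; omega
          · intro l hl; omega
          · intro l hl
            rw [Finset.mem_Icc] at hl
            rw [Nat.sub_add_cancel hl.1]
        · intro l _; apply Continuous.intervalIntegrable; fun_prop
      rw [e2]
      simp only [Complex.add_re, Complex.ofReal_re]
      have e3 : f 0 = 0 := by simp [hf]
      rw [e3, Complex.zero_re, show ((1/2:ℂ) * ((volB * (y2^3-y1^3)/3 : ℝ) : ℂ)).re = 1/2 * (volB * (y2^3-y1^3)/3) by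
        rw [show (1/2:ℂ) = ((1/2:ℝ):ℂ) by push_cast; ring, ← Complex.ofReal_mul, Complex.ofReal_re]]
      ring
    simp only [hid]
    have t1 := (Complex.continuous_re.tendsto _).comp hT
    have t2 := (Complex.continuous_re.tendsto _).comp hft'
    simp only [Complex.ofReal_re] at t1
    have := ((t1.const_mul 2).sub_const (volB * (y2^3-y1^3)/3)).sub (t2.const_mul 2)
    refine this.congr' (Eventually.of_forall fun L => rfl) |>.trans (le_of_eq ?_)
    congr 1; ring

end voronoi

section kapsec

def kap (k a b : ℝ) : ℂ := ((1/(b-a) : ℝ) : ℂ) * ∫ t in a..b, eC (k*t)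

lemma eC_int_bound (k a b : ℝ) (hk : k ≠ 0) : ‖∫ t in a..b, eC (k*t)‖ ≤ 1 / |k| := by
  have hpi := Real.pi_gt_three
  have hK : ((2*π*k : ℝ):ℂ) * Complex.I ≠ 0 := by
    apply mul_ne_zero _ Complex.I_ne_zero
    rw [Complex.ofReal_ne_zero]; positivity
  have hd : ∀ t ∈ Set.uIcc a b, HasDerivAt (fun t => eC (k*t) / (((2*π*k : ℝ):ℂ) * Complex.I)) (eC (k*t)) t := by
    intro t _
    refine ((eC_hasDeriv k t).div_const _).congr_deriv ?_
    rw [mul_comm (((2*π*k : ℝ):ℂ) * Complex.I), mul_div_assoc, div_self hK, mul_one]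
  have hc : Continuous fun t => eC (k*t) := eC_cont.comp (by fun_prop)
  rw [intervalIntegral.integral_eq_sub_of_hasDerivAt hd (hc.intervalIntegrable _ _), ← sub_div, norm_div, norm_mul,
    Complex.norm_I, mul_one, Complex.norm_real, Real.norm_eq_abs, abs_mul, abs_of_pos (by positivity : 0 < 2*π)]
  have hk' : 0 < |k| := abs_pos.mpr hk
  rw [div_le_div_iff₀ (by positivity) hk']
  have : ‖eC (k*b) - eC (k*a)‖ ≤ 2 := by
    refine (norm_sub_le _ _).trans ?_
    rw [eC_norm, eC_norm]; norm_num
  nlinarith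

lemma kap_le_one (k a b : ℝ) (hab : a < b) : ‖kap k a b‖ ≤ 1 := by
  unfold kap
  have hh : 0 < b - a := by linarith
  have := intervalIntegral.norm_integral_le_of_norm_le_const (a := a) (b := b) (C := 1) (f := fun t => eC (k*t))
    (fun t _ => (eC_norm _).le)
  rw [abs_of_pos hh, one_mul] at this
  rw [norm_mul, Complex.norm_real, Real.norm_of_nonneg (by positivity)]
  calc _ ≤ 1/(b-a) * (b-a) := by gcongr
    _ = 1 := by field_simp

lemma kap_le (k a b : ℝ) (hab : a < b) (hk : 0 < k) : ‖kap k a b‖ ≤ (k*(b-a))⁻¹ := by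
  unfold kap
  have hh : 0 < b - a := by linarith
  have := eC_int_bound k a b hk.ne'
  rw [abs_of_pos hk] at this
  rw [norm_mul, Complex.norm_real, Real.norm_of_nonneg (by positivity)]
  calc _ ≤ 1/(b-a) * (1/k) := by gcongr
    _ = _ := by field_simp

lemma kap_theta (k a b θ : ℝ) (hab : a < b) (hk : 0 < k) (h0 : 0 < θ) (h1 : θ ≤ 1) : ‖kap k a b‖ ≤ (k*(b-a))^(-θ) := by
  have hh : 0 < b - a := by linarith
  have hu : 0 < k*(b-a) := by positivity
  rcases le_total (k*(b-a)) 1 with h | h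
  · refine (kap_le_one k a b hab).trans ?_
    exact Real.one_le_rpow_of_pos_of_le_one_of_nonpos hu h (by linarith)
  · refine (kap_le k a b hab hk).trans ?_
    rw [← Real.rpow_neg_one]
    exact Real.rpow_le_rpow_of_exponent_le h (by linarith)

lemma avg_cos (k a b x : ℝ) : 1/(b-a) * ∫ t in (x+a)..(x+b), cos (2*π*(k*t)) = (kap k a b * eC (k*x)).re := by
  have hc : Continuous fun t => eC (k*t) := eC_cont.comp (by fun_prop)
  have e1 : ∫ t in (x+a)..(x+b), cos (2*π*(k*t)) = (∫ t in (x+a)..(x+b), eC (k*t)).re := by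
    have := intervalIntegral.intervalIntegral_eq_integral_uIoc (fun t => eC (k*t)) (x+a) (x+b) volume
    rw [← Complex.reCLM_apply, ← ContinuousLinearMap.intervalIntegral_comp_comm]
    · congr 1; ext t; rw [Complex.reCLM_apply, eC_re]
    · exact hc.intervalIntegrable _ _
  have e2 : ∫ t in (x+a)..(x+b), eC (k*t) = eC (k*x) * ∫ t in a..b, eC (k*t) := by
    rw [← intervalIntegral.integral_comp_add_left, ← intervalIntegral.integral_const_mul]
    congr 1; ext t; rw [← eC_add]; congr 1; ring
  rw [e1, e2, kap, ← Complex.re_ofReal_mul]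
  congr 1; ring

end kapsec

section quad

lemma off_sum : ∃ C : ℝ, 0 ≤ C ∧ ∀ S : Finset ℕ, (∀ l ∈ S, 1 ≤ l) →
    ∑ l ∈ S, ∑ l' ∈ S, (if l = l' then 0 else aw l * aw l' * (1/|√(l:ℝ)-√(l':ℝ)|)) ≤ C := by
  obtain ⟨A, hA, hr⟩ := r2_bound (1/16) (by norm_num)
  have hsum1 : Summable fun l : ℕ => (l:ℝ)^(-(37/32):ℝ) := Real.summable_nat_rpow.mpr (by norm_num)
  have hsum2 : Summable fun l : ℕ => (l:ℝ)^(-(39/32):ℝ) := Real.summable_nat_rpow.mpr (by norm_num)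
  set S1 := ∑' l : ℕ, (l:ℝ)^(-(37/32):ℝ)
  set S2 := ∑' l : ℕ, (l:ℝ)^(-(39/32):ℝ)
  have hS1 : 0 ≤ S1 := tsum_nonneg fun l => by positivity
  have hS2 : 0 ≤ S2 := tsum_nonneg fun l => by positivity
  have haw : ∀ l : ℕ, 1 ≤ l → aw l ≤ A * (l:ℝ)^(-(15/16):ℝ) := by
    intro l hl
    have hl0 : (0:ℝ) < l := by exact_mod_cast hl
    unfold aw
    rw [div_le_iff₀ hl0]
    refine (hr l hl).trans (le_of_eq ?_)
    rw [mul_assoc, ← Real.rpow_add_one hl0.ne']; norm_num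
  set g : ℕ → ℕ → ℝ := fun l' l => if l' < l then 2*A^2 * (l':ℝ)^(-(37/32):ℝ) * ((l-l' : ℕ):ℝ)^(-(39/32):ℝ) else 0 with hg
  have hg0 : ∀ l' l, 0 ≤ g l' l := by intro l' l; simp only [hg]; split_ifs <;> positivity
  have key : ∀ l' l : ℕ, 1 ≤ l' → l' < l → aw l * aw l' * (1/|√(l:ℝ)-√(l':ℝ)|) ≤ g l' l := by
    intro l' l h1 hlt
    have hl0 : (0:ℝ) < l := by exact_mod_cast (by omega : 0 < l)
    have hl0' : (0:ℝ) < l' := by exact_mod_cast h1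
    have hltr : (l':ℝ) < l := by exact_mod_cast hlt
    have hj : (((l-l' : ℕ) : ℕ):ℝ) = (l:ℝ) - l' := by push_cast [hlt.le]; ring
    simp only [hg, if_pos hlt]
    rw [hj]
    have hj0 : 0 < (l:ℝ) - l' := by linarith
    have hs : √(l':ℝ) < √(l:ℝ) := Real.sqrt_lt_sqrt hl0'.le hltr
    have e1 : 1/|√(l:ℝ)-√(l':ℝ)| ≤ 2 * √(l:ℝ) / ((l:ℝ)-l') := by
      rw [abs_of_pos (by linarith), div_le_div_iff₀ (by linarith) hj0]
      have h1 := Real.sq_sqrt hl0.le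
      have h2 := Real.sq_sqrt hl0'.le
      have h3 : (l:ℝ) - l' = (√(l:ℝ)-√(l':ℝ)) * (√(l:ℝ)+√(l':ℝ)) := by nlinarith
      rw [h3]
      nlinarith
    have e2 : (l:ℝ)^(-(7/16):ℝ) ≤ ((l:ℝ)-l')^(-(7/32):ℝ) * (l':ℝ)^(-(7/32):ℝ) := by
      rw [show (-(7/16):ℝ) = -(7/32) + -(7/32) by norm_num, Real.rpow_add hl0]
      apply mul_le_mul
      · exact Real.rpow_le_rpow_of_nonpos hj0 (by linarith) (by norm_num)
      · exact Real.rpow_le_rpow_of_nonpos hl0' hltr.le (by norm_num)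
      · positivity
      · positivity
    calc aw l * aw l' * (1/|√(l:ℝ)-√(l':ℝ)|) ≤ (A * (l:ℝ)^(-(15/16):ℝ)) * (A * (l':ℝ)^(-(15/16):ℝ)) * (2 * √(l:ℝ) / ((l:ℝ)-l')) := by
          apply mul_le_mul _ e1 (by positivity) (by positivity)
          exact mul_le_mul (haw l (by omega)) (haw l' h1) (aw_nonneg _) (by positivity)
      _ = 2*A^2 * (l:ℝ)^(-(7/16):ℝ) * ((l':ℝ)^(-(15/16):ℝ) * ((l:ℝ)-l')^(-1:ℝ)) := by
          rw [Real.sqrt_eq_rpow, show (-(7/16):ℝ) = -(15/16) + 1/2 by norm_num, Real.rpow_add hl0, Real.rpow_neg_one]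
          ring
      _ ≤ 2*A^2 * (((l:ℝ)-l')^(-(7/32):ℝ) * (l':ℝ)^(-(7/32):ℝ)) * ((l':ℝ)^(-(15/16):ℝ) * ((l:ℝ)-l')^(-1:ℝ)) := by gcongr
      _ = _ := by
          rw [show (-(37/32):ℝ) = -(7/32) + -(15/16) by norm_num, show (-(39/32):ℝ) = -(7/32) + -1 by norm_num,
            Real.rpow_add hl0', Real.rpow_add hj0]
          ring
  have hgs : ∀ S : Finset ℕ, ∑ l' ∈ S, ∑ l ∈ S, g l' l ≤ 2*A^2*S1*S2 := by
    intro S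
    calc ∑ l' ∈ S, ∑ l ∈ S, g l' l ≤ ∑ l' ∈ S, 2*A^2 * (l':ℝ)^(-(37/32):ℝ) * S2 := by
          apply Finset.sum_le_sum
          intro l' _
          simp only [hg]
          rw [← Finset.sum_filter, ← Finset.mul_sum]
          gcongr
          rw [← Finset.sum_image (f := fun j : ℕ => (j:ℝ)^(-(39/32):ℝ)) (g := fun l => l - l')]
          · exact hsum2.sum_le_tsum _ (fun _ _ => by positivity)
          · intro a ha b hb hab
            simp only [Finset.coe_filter, Set.mem_ofPred_eq] at ha hb
            simp only at hab
            omega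
      _ = 2*A^2 * (∑ l' ∈ S, (l':ℝ)^(-(37/32):ℝ)) * S2 := by rw [← Finset.sum_mul, ← Finset.mul_sum]
      _ ≤ _ := by gcongr; exact hsum1.sum_le_tsum _ (fun _ _ => by positivity)
  refine ⟨2*(2*A^2*S1*S2), by positivity, fun S hS => ?_⟩
  calc _ ≤ ∑ l ∈ S, ∑ l' ∈ S, (g l' l + g l l') := by
        apply Finset.sum_le_sum; intro l hl
        apply Finset.sum_le_sum; intro l' hl'
        split_ifs with h
        · exact add_nonneg (hg0 _ _) (hg0 _ _)
        · rcases lt_or_gt_of_ne h with h | h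
          · have := key l l' (hS l hl) h
            rw [abs_sub_comm, mul_comm (aw l) (aw l')]
            linarith [hg0 l' l]
          · have := key l' l (hS l' hl') h
            linarith [hg0 l l']
    _ = ∑ l ∈ S, ∑ l' ∈ S, g l' l + ∑ l ∈ S, ∑ l' ∈ S, g l l' := by simp only [Finset.sum_add_distrib]
    _ ≤ _ := by
        rw [Finset.sum_comm]
        linarith [hgs S]

lemma diag_sum (ε : ℝ) (hε : 0 < ε) : ∃ C : ℝ, 0 ≤ C ∧ ∀ Y L : ℕ, 1 ≤ Y →
    ∑ l ∈ Finset.Ioc Y L, aw l ^ 2 ≤ C * (Y:ℝ)^(ε-1) := by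
  set δ := min ε 1 / 4 with hδ
  have hm : 0 < min ε 1 := lt_min hε one_pos
  have hm1 : min ε 1 ≤ 1 := min_le_right _ _
  have hm2 : min ε 1 ≤ ε := min_le_left _ _
  obtain ⟨A, hA, hr⟩ := r2_bound δ (by positivity)
  have hsum1 : Summable fun l : ℕ => (l:ℝ)^(-1-δ:ℝ) := Real.summable_nat_rpow.mpr (by linarith)
  have hS : 0 ≤ ∑' l : ℕ, (l:ℝ)^(-1-δ:ℝ) := tsum_nonneg fun l => by positivity
  refine ⟨A^2 * ∑' l : ℕ, (l:ℝ)^(-1-δ:ℝ), by positivity, fun Y L hY => ?_⟩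
  have hY0 : (1:ℝ) ≤ Y := by exact_mod_cast hY
  calc ∑ l ∈ Finset.Ioc Y L, aw l ^ 2 ≤ ∑ l ∈ Finset.Ioc Y L, A^2 * (l:ℝ)^(-1-δ:ℝ) * (Y:ℝ)^(ε-1) := by
        apply Finset.sum_le_sum
        intro l hl
        rw [Finset.mem_Ioc] at hl
        have hYl : (Y:ℝ) ≤ l := by exact_mod_cast hl.1.le
        have hl0 : (0:ℝ) < l := by linarith
        have h1 : aw l ≤ A * (l:ℝ)^(δ-1) := by
          unfold aw
          rw [div_le_iff₀ hl0]
          refine (hr l (by omega)).trans (le_of_eq ?_)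
          rw [mul_assoc, ← Real.rpow_add_one hl0.ne']; norm_num
        have h2 : (l:ℝ)^(3*δ-1) ≤ (Y:ℝ)^(ε-1) := by
          refine (Real.rpow_le_rpow_of_nonpos (by linarith) hYl (by linarith)).trans ?_
          exact Real.rpow_le_rpow_of_exponent_le hY0 (by linarith)
        calc aw l ^ 2 ≤ (A * (l:ℝ)^(δ-1))^2 := by
              have := aw_nonneg l
              gcongr
          _ = A^2 * (l:ℝ)^(-1-δ:ℝ) * (l:ℝ)^(3*δ-1) := by
              rw [mul_pow, mul_assoc, ← Real.rpow_add hl0, ← Real.rpow_natCast ((l:ℝ)^(δ-1)), ← Real.rpow_mul hl0.le]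
              congr 2; push_cast; ring
          _ ≤ _ := by gcongr
    _ = A^2 * (∑ l ∈ Finset.Ioc Y L, (l:ℝ)^(-1-δ:ℝ)) * (Y:ℝ)^(ε-1) := by
        rw [Finset.mul_sum, Finset.sum_mul]
    _ ≤ _ := by
        gcongr
        exact hsum1.sum_le_tsum _ (fun _ _ => by positivity)

lemma quad_bound (X : ℝ) (hX : 0 < X) (S : Finset ℕ) (c : ℕ → ℂ) (hc : ∀ l ∈ S, ‖c l‖ ≤ aw l) :
    ∫ x in X..(3*X), ((∑ l ∈ S, c l * eC (√(l:ℝ)*x)).re)^2 ≤ 2 * X * ∑ l ∈ S, aw l^2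
      + ∑ l ∈ S, ∑ l' ∈ S, (if l = l' then 0 else aw l * aw l' * (1/|√(l:ℝ)-√(l':ℝ)|)) := by
  have hec := eC_cont
  set f : ℝ → ℂ := fun x => ∑ l ∈ S, c l * eC (√(l:ℝ)*x) with hf
  have hfc : Continuous f := by fun_prop
  have e1 : ∫ x in X..(3*X), ((f x).re)^2 ≤ ∫ x in X..(3*X), ‖f x‖^2 := by
    apply intervalIntegral.integral_mono_on (by linarith)
    · apply Continuous.intervalIntegrable
      exact (Complex.continuous_re.comp hfc).pow 2
    · apply Continuous.intervalIntegrable; fun_prop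
    · intro x _
      rw [← sq_abs]
      gcongr
      exact Complex.abs_re_le_norm _
  refine e1.trans ?_
  have e2 : ((∫ x in X..(3*X), ‖f x‖^2 : ℝ) : ℂ) = ∑ l ∈ S, ∑ l' ∈ S, c l * (starRingEnd ℂ) (c l') * ∫ x in X..(3*X), eC ((√(l:ℝ)-√(l':ℝ))*x) := by
    rw [← intervalIntegral.integral_ofReal]
    have e3 : ∀ x, ((‖f x‖^2 : ℝ) : ℂ) = ∑ l ∈ S, ∑ l' ∈ S, c l * (starRingEnd ℂ) (c l') * eC ((√(l:ℝ)-√(l':ℝ))*x) := by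
      intro x
      rw [← Complex.normSq_eq_norm_sq, ← Complex.mul_conj, hf]
      simp only [map_sum, map_mul]
      rw [Finset.sum_mul_sum]
      apply Finset.sum_congr rfl; intro l _
      apply Finset.sum_congr rfl; intro l' _
      have : (starRingEnd ℂ) (eC (√(l':ℝ)*x)) = eC (-(√(l':ℝ)*x)) := by
        unfold eC; rw [← Complex.exp_conj, map_mul, Complex.conj_I, Complex.conj_ofReal]; congr 1; push_cast; ring
      rw [this, sub_mul, sub_eq_add_neg, eC_add]; ring
    simp only [e3]
    rw [intervalIntegral.integral_finsetSum]
    · apply Finset.sum_congr rfl; intro l _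
      rw [intervalIntegral.integral_finsetSum]
      · apply Finset.sum_congr rfl; intro l' _
        rw [intervalIntegral.integral_const_mul]
      · intro l' _; apply Continuous.intervalIntegrable; fun_prop
    · intro l _; apply Continuous.intervalIntegrable; fun_prop
  have e4 : ∫ x in X..(3*X), ‖f x‖^2 ≤ ‖((∫ x in X..(3*X), ‖f x‖^2 : ℝ) : ℂ)‖ := by
    rw [Complex.norm_real]; exact le_abs_self _
  refine e4.trans ?_
  rw [e2, Finset.mul_sum, ← Finset.sum_add_distrib]
  refine (norm_sum_le _ _).trans (Finset.sum_le_sum fun l hl => ?_)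
  have e5 : 2*X*aw l^2 = ∑ l' ∈ S, if l = l' then 2*X*(aw l*aw l') else 0 := by
    rw [Finset.sum_ite_eq, if_pos hl]; ring
  rw [e5, ← Finset.sum_add_distrib]
  refine (norm_sum_le _ _).trans (Finset.sum_le_sum fun l' hl' => ?_)
  rw [norm_mul, norm_mul, RCLike.norm_conj]
  have hcc : ‖c l‖ * ‖c l'‖ ≤ aw l * aw l' := mul_le_mul (hc l hl) (hc l' hl') (norm_nonneg _) (aw_nonneg _)
  split_ifs with h
  · subst h
    have : ‖∫ x in X..(3*X), eC ((√(l:ℝ)-√(l:ℝ))*x)‖ ≤ 2*X := by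
      simp only [sub_self, zero_mul, eC_zero, intervalIntegral.integral_const]
      rw [norm_smul, norm_one, Real.norm_of_nonneg (by linarith)]; linarith
    calc _ ≤ (aw l * aw l) * (2*X) := mul_le_mul hcc this (norm_nonneg _) (mul_nonneg (aw_nonneg _) (aw_nonneg _))
      _ = _ := by ring
  · rw [zero_add]
    have hne : √(l:ℝ)-√(l':ℝ) ≠ 0 := by
      intro h0
      apply h
      have := (Real.sqrt_inj (Nat.cast_nonneg l) (Nat.cast_nonneg l')).mp (by linarith)
      exact_mod_cast this
    exact mul_le_mul hcc (eC_int_bound _ _ _ hne) (norm_nonneg _) (mul_nonneg (aw_nonneg _) (aw_nonneg _))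

end quad

section window

def TL (Y L : ℕ) (a b x : ℝ) : ℝ :=
  -(√2/π) * (∑ l ∈ Finset.Ioc Y L, ((aw l : ℂ) * kap (√(l:ℝ)) a b) * eC (√(l:ℝ)*x)).re

lemma c0_bd : 0 ≤ √2/π ∧ √2/π ≤ 1 := by
  have := Real.pi_gt_three
  refine ⟨by positivity, ?_⟩
  rw [div_le_one (by linarith)]
  have : √2 ≤ 2 := by rw [Real.sqrt_le_left (by norm_num)]; norm_num
  linarith

lemma PY_cont (Y : ℕ) : Continuous (PY Y) := by unfold PY; fun_prop

lemma avg_PY (L : ℕ) (a b x : ℝ) : 1/(b-a) * ∫ t in (x+a)..(x+b), PY L t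
    = -(√2/π) * (∑ l ∈ Finset.Icc 1 L, ((aw l : ℂ) * kap (√(l:ℝ)) a b) * eC (√(l:ℝ)*x)).re := by
  unfold PY
  rw [intervalIntegral.integral_const_mul, intervalIntegral.integral_finsetSum, Complex.re_sum]
  · rw [mul_left_comm, Finset.mul_sum]
    congr 1
    apply Finset.sum_congr rfl
    intro l _
    rw [intervalIntegral.integral_const_mul, mul_left_comm, avg_cos, mul_assoc, Complex.re_ofReal_mul]
  · intro l _
    apply Continuous.intervalIntegrable; fun_prop

lemma avg_PY_split (Y L : ℕ) (hYL : Y ≤ L) (a b x : ℝ) : 1/(b-a) * ∫ t in (x+a)..(x+b), PY L t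
    = (1/(b-a) * ∫ t in (x+a)..(x+b), PY Y t) + TL Y L a b x := by
  rw [avg_PY, avg_PY, TL, ← mul_add, ← Complex.add_re]
  have hd : Disjoint (Finset.Icc 1 Y) (Finset.Ioc Y L) := by
    rw [Finset.disjoint_left]; intro l h1 h2
    rw [Finset.mem_Icc] at h1; rw [Finset.mem_Ioc] at h2; omega
  have hu : Finset.Icc 1 L = Finset.Icc 1 Y ∪ Finset.Ioc Y L := by
    ext l; rw [Finset.mem_union, Finset.mem_Icc, Finset.mem_Icc, Finset.mem_Ioc]; omega
  rw [hu, Finset.sum_union hd]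

lemma TL_split (Y L L' : ℕ) (h1 : Y ≤ L) (h2 : L ≤ L') (a b x : ℝ) : TL Y L' a b x = TL Y L a b x + TL L L' a b x := by
  have e1 := avg_PY_split Y L' (h1.trans h2) a b x
  have e2 := avg_PY_split Y L h1 a b x
  have e3 := avg_PY_split L L' h2 a b x
  linarith

lemma TL_abs (Y L : ℕ) (a b x : ℝ) : |TL Y L a b x| ≤ ∑ l ∈ Finset.Ioc Y L, aw l * ‖kap (√(l:ℝ)) a b‖ := by
  unfold TL
  rw [abs_mul, abs_neg, abs_of_nonneg c0_bd.1]
  refine (mul_le_of_le_one_left (abs_nonneg _) c0_bd.2).trans ?_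
  refine (Complex.abs_re_le_norm _).trans ((norm_sum_le _ _).trans (Finset.sum_le_sum fun l _ => ?_))
  rw [norm_mul, norm_mul, eC_norm, mul_one, Complex.norm_real, Real.norm_of_nonneg (aw_nonneg l)]

lemma PY_lip : ∃ C : ℝ, 0 ≤ C ∧ ∀ (Y : ℕ) (x t : ℝ), |PY Y t - PY Y x| ≤ C * Y * |t - x| := by
  obtain ⟨A, hA, hr⟩ := r2_bound (1/2) (by norm_num)
  refine ⟨2*π*A, by positivity, fun Y x t => ?_⟩
  unfold PY
  rw [← mul_sub, abs_mul, abs_neg, abs_of_nonneg c0_bd.1, ← Finset.sum_sub_distrib]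
  refine (mul_le_of_le_one_left (abs_nonneg _) c0_bd.2).trans ?_
  refine (Finset.abs_sum_le_sum_abs _ _).trans ?_
  calc _ ≤ ∑ l ∈ Finset.Icc 1 Y, 2*π*A*|t-x| := by
        apply Finset.sum_le_sum
        intro l hl
        rw [Finset.mem_Icc] at hl
        have hl0 : (0:ℝ) < l := by exact_mod_cast hl.1
        rw [← mul_sub, abs_mul, abs_of_nonneg (aw_nonneg l)]
        have h1 : |Real.cos (2*π*(√(l:ℝ)*t)) - Real.cos (2*π*(√(l:ℝ)*x))| ≤ 2*π*√(l:ℝ)*|t-x| := by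
          refine (Real.abs_cos_sub_cos_le _ _).trans (le_of_eq ?_)
          rw [show 2*π*(√(l:ℝ)*t) - 2*π*(√(l:ℝ)*x) = (2*π*√(l:ℝ))*(t-x) by ring, abs_mul, abs_of_nonneg (by positivity)]
        have h2 : aw l * √(l:ℝ) ≤ A := by
          unfold aw
          have := hr l hl.1
          rw [← Real.sqrt_eq_rpow] at this
          have h3 := Real.mul_self_sqrt hl0.le
          rw [div_mul_eq_mul_div, div_le_iff₀ hl0]
          nlinarith [Real.sqrt_nonneg (l:ℝ)]
        calc _ ≤ aw l * (2*π*√(l:ℝ)*|t-x|) := by gcongr; exact aw_nonneg l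
          _ = 2*π*(aw l * √(l:ℝ))*|t-x| := by ring
          _ ≤ _ := by gcongr
    _ = _ := by rw [Finset.sum_const, Nat.card_Icc, nsmul_eq_mul]; push_cast; ring

lemma avg_near : ∃ C : ℝ, 0 ≤ C ∧ ∀ (Y : ℕ) (a b x h : ℝ), a < b → |a| ≤ h → |b| ≤ h →
    |1/(b-a) * (∫ t in (x+a)..(x+b), PY Y t) - PY Y x| ≤ C * Y * h := by
  obtain ⟨C, hC, hl⟩ := PY_lip
  refine ⟨C, hC, fun Y a b x h hab ha hb => ?_⟩
  have hh : 0 < b - a := by linarith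
  have hc := PY_cont Y
  have e : 1/(b-a) * (∫ t in (x+a)..(x+b), PY Y t) - PY Y x = 1/(b-a) * ∫ t in (x+a)..(x+b), (PY Y t - PY Y x) := by
    rw [intervalIntegral.integral_sub (hc.intervalIntegrable _ _) (by simp), intervalIntegral.integral_const, smul_eq_mul]
    field_simp; ring
  rw [e, abs_mul, abs_of_pos (by positivity)]
  have := intervalIntegral.norm_integral_le_of_norm_le_const (a := x+a) (b := x+b) (C := C*Y*h) (f := fun t => PY Y t - PY Y x) (by
    intro t ht
    rw [Set.uIoc_of_le (by linarith)] at ht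
    refine (hl Y x t).trans ?_
    gcongr
    rw [abs_le] at *
    constructor <;> linarith [ht.1, ht.2])
  rw [Real.norm_eq_abs, abs_of_pos (by linarith : 0 < x+b-(x+a))] at this
  rw [one_div, inv_mul_le_iff₀ hh]
  linarith

lemma kap_sum (ε : ℝ) (hε : 0 < ε) (hε1 : ε ≤ 1) : ∃ C : ℝ, 0 ≤ C ∧ ∀ (X a b : ℝ), 1 ≤ X → b - a = (X^2)⁻¹ →
    (Summable fun l : ℕ => aw l * ‖kap (√(l:ℝ)) a b‖) ∧ ∑' l : ℕ, aw l * ‖kap (√(l:ℝ)) a b‖ ≤ C * X^ε := by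
  obtain ⟨A, hA, hr⟩ := r2_bound (ε/8) (by positivity)
  have hsum1 : Summable fun l : ℕ => (l:ℝ)^(-1-ε/8:ℝ) := Real.summable_nat_rpow.mpr (by linarith)
  have hS : 0 ≤ ∑' l : ℕ, (l:ℝ)^(-1-ε/8:ℝ) := tsum_nonneg fun l => by positivity
  refine ⟨A * ∑' l : ℕ, (l:ℝ)^(-1-ε/8:ℝ), by positivity, fun X a b hX hab => ?_⟩
  have hX0 : 0 < X := by linarith
  have hk : ∀ l : ℕ, aw l * ‖kap (√(l:ℝ)) a b‖ ≤ A * X^ε * (l:ℝ)^(-1-ε/8:ℝ) := by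
    intro l
    rcases Nat.eq_zero_or_pos l with h | h
    · subst h; unfold aw; simp only [Nat.cast_zero, div_zero, zero_mul]; positivity
    have hl0 : (0:ℝ) < l := by exact_mod_cast h
    have h1 : aw l ≤ A * (l:ℝ)^(ε/8-1) := by
      unfold aw
      rw [div_le_iff₀ hl0]
      refine (hr l h).trans (le_of_eq ?_)
      rw [mul_assoc, ← Real.rpow_add_one hl0.ne']; norm_num
    have hpos : 0 < b - a := by rw [hab]; positivity
    have h2 := kap_theta (√(l:ℝ)) a b (ε/2) (by linarith) (by positivity) (by positivity) (by linarith)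
    have h3 : (√(l:ℝ)*(b-a))^(-(ε/2)) = (l:ℝ)^(-(ε/4)) * X^ε := by
      rw [hab, Real.mul_rpow (by positivity) (by positivity), Real.sqrt_eq_rpow, ← Real.rpow_mul hl0.le,
        Real.inv_rpow (by positivity), Real.rpow_neg (by positivity), inv_inv, ← Real.rpow_natCast X, ← Real.rpow_mul hX0.le]
      congr 2 <;> (push_cast; ring)
    rw [h3] at h2
    calc _ ≤ (A * (l:ℝ)^(ε/8-1)) * ((l:ℝ)^(-(ε/4)) * X^ε) := mul_le_mul h1 h2 (norm_nonneg _) (by positivity)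
      _ = A * X^ε * ((l:ℝ)^(ε/8-1) * (l:ℝ)^(-(ε/4))) := by ring
      _ = _ := by rw [← Real.rpow_add hl0]; congr 2; ring
  have hs : Summable fun l : ℕ => aw l * ‖kap (√(l:ℝ)) a b‖ :=
    Summable.of_nonneg_of_le (fun l => mul_nonneg (aw_nonneg l) (norm_nonneg _)) hk (hsum1.mul_left _)
  refine ⟨hs, ?_⟩
  refine (hs.tsum_le_tsum hk (hsum1.mul_left _)).trans (le_of_eq ?_)
  rw [tsum_mul_left]; ring

lemma summ_tail (f : ℕ → ℝ) (hf : Summable f) (h0 : ∀ n, 0 ≤ f n) (δ : ℝ) (hδ : 0 < δ) (Y : ℕ) :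
    ∃ L0, Y ≤ L0 ∧ ∀ L, L0 ≤ L → ∑ l ∈ Finset.Ioc L0 L, f l ≤ δ := by
  have := (tendsto_sum_nat_add f)
  have := (this.eventually (gt_mem_nhds hδ)).and (eventually_ge_atTop Y)
  obtain ⟨L0, h1, h2⟩ := this.exists
  refine ⟨L0, h2, fun L hL => ?_⟩
  have hs : Summable fun k => f (k+L0) := (summable_nat_add_iff L0).mpr hf
  have h3 := hs.sum_le_tsum (Finset.Icc 1 (L-L0)) (fun _ _ => h0 _)
  have h4 : ∑ l ∈ Finset.Ioc L0 L, f l = ∑ k ∈ Finset.Icc 1 (L-L0), f (k+L0) := by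
    rw [← Finset.sum_image (g := fun k => k + L0) (f := f)]
    · congr 1
      ext l
      rw [Finset.mem_Ioc, Finset.mem_image]
      constructor
      · intro h; exact ⟨l - L0, by rw [Finset.mem_Icc]; omega, by omega⟩
      · rintro ⟨k, hk, rfl⟩; rw [Finset.mem_Icc] at hk; omega
    · intro a _ b _ h; simp only at h; omega
  rw [h4]; linarith

lemma vol_aux (X x a b h : ℝ) (hX0 : 0 < X) (hh0 : 0 < h) (hx : x ∈ Set.Icc X (3*X)) (hXh : X*h = 1/X) (hhX : h ≤ 1/X*(1/2))
    (hX1 : 1/X ≤ 1/2) (ha : -h ≤ a ∧ a ≤ h) (hb : -h ≤ b ∧ b ≤ h) : |x*(a+b) + (a^2+a*b+b^2)/3| ≤ 7*(1/X) := by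
  have hx0 : 0 < x := by linarith [hx.1]
  have hxh : x * h ≤ 3 * (1/X) := by rw [← hXh]; nlinarith [hx.2]
  have hab2 : |a+b| ≤ 2*h := by rw [abs_le]; constructor <;> linarith
  have h1 : |x*(a+b)| ≤ 6*(1/X) := by
    rw [abs_mul, abs_of_pos hx0]; nlinarith
  have a2 : a^2 ≤ h^2 := sq_le_sq' ha.1 ha.2
  have b2 : b^2 ≤ h^2 := sq_le_sq' hb.1 hb.2
  have hhsq : h^2 ≤ 1/X := by
    have : h ≤ 1 := by linarith
    nlinarith
  have h2 : |(a^2+a*b+b^2)/3| ≤ 1/X := by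
    have u1 := sq_nonneg (a-b)
    have u2 := sq_nonneg (a+b)
    have u3 : 0 < 1/X := by positivity
    rw [abs_le]; constructor
    · linarith [show 0 ≤ a^2 + a*b+b^2 by linarith [sq_nonneg a, sq_nonneg b]]
    · linarith
  exact (abs_add_le _ _).trans (by linarith)

lemma window : ∃ C : ℝ, 0 ≤ C ∧ ∀ (X a b : ℝ) (Y M : ℕ), 2 ≤ X → 1 ≤ Y → (Y:ℝ) ≤ X → b - a = (X^2)⁻¹ → |a| ≤ (X^2)⁻¹ → |b| ≤ (X^2)⁻¹ →
    16*X^2 ≤ M → ∃ L0, Y ≤ L0 ∧ ∀ x ∈ Set.Icc X (3*X),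
      |1/(b-a) * (∫ t in (x+a)..(x+b), VM M t) - volB * x^2 - PY Y x - TL Y L0 a b x| ≤ C / X := by
  obtain ⟨C1, hC1, hv⟩ := voronoi
  obtain ⟨C2, hC2, hn⟩ := avg_near
  obtain ⟨C3, hC3, hk⟩ := kap_sum 1 one_pos le_rfl
  have hB : 0 ≤ volB := ENNReal.toReal_nonneg
  refine ⟨2*C1 + C2 + 1 + 7*volB, by positivity, fun X a b Y M hX hY hYX hab ha hb hM => ?_⟩
  have hX0 : 0 < X := by linarith
  set h := (X^2)⁻¹ with hh
  have hh0 : 0 < h := by positivity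
  have hhX : h ≤ 1/X * (1/2) := by
    rw [hh, one_div, pow_two, mul_inv]
    gcongr
    rw [inv_le_comm₀ hX0 (by norm_num)]; norm_num; exact hX
  have hX1 : 1/X ≤ 1/2 := by rw [div_le_div_iff₀ hX0 (by norm_num)]; linarith
  have hXh : X * h = 1/X := by rw [hh]; field_simp
  obtain ⟨L0, hL0, hL⟩ := summ_tail _ (hk X a b (by linarith) hab).1 (fun l => mul_nonneg (aw_nonneg l) (norm_nonneg _)) (1/X) (by positivity) Y
  refine ⟨L0, hL0, fun x hx => ?_⟩
  have hba : 0 < b - a := by rw [hab]; exact hh0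
  rw [abs_le] at ha hb
  have hy1 : X/2 ≤ x + a := by nlinarith [hx.1]
  have hy2 : x + b ≤ 4*X := by nlinarith [hx.2]
  obtain ⟨e, he, ht⟩ := hv (x+a) (x+b) (by linarith) (by linarith) M (by nlinarith) (by nlinarith)
  have ht2 := ht.const_mul (1/(b-a))
  set Q := 1/(b-a) * ∫ t in (x+a)..(x+b), PY Y t with hQ
  have hlim : |1/(b-a) * ((∫ t in (x+a)..(x+b), VM M t) - volB * ((x+b)^3-(x+a)^3)/3 - e) - Q - TL Y L0 a b x| ≤ 1/X := by
    have t3 : Tendsto (fun L => |1/(b-a) * (∫ t in (x+a)..(x+b), PY L t) - Q - TL Y L0 a b x|) atTop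
      (nhds |1/(b-a) * ((∫ t in (x+a)..(x+b), VM M t) - volB * ((x+b)^3-(x+a)^3)/3 - e) - Q - TL Y L0 a b x|) :=
      ((ht2.sub_const _).sub_const _).abs
    refine le_of_tendsto t3 ?_
    filter_upwards [eventually_ge_atTop L0] with L hLL
    rw [avg_PY_split Y L (hL0.trans hLL), TL_split Y L0 L hL0 hLL, ← hQ]
    rw [show Q + (TL Y L0 a b x + TL L0 L a b x) - Q - TL Y L0 a b x = TL L0 L a b x by ring]
    exact (TL_abs _ _ _ _ _).trans (hL L hLL)
  have hnear := hn Y a b x h (by linarith) (abs_le.mpr ha) (abs_le.mpr hb)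
  rw [← hQ] at hnear
  have hnear2 : C2 * Y * h ≤ C2 * (1/X) := by
    rw [← hXh, mul_assoc]; gcongr
  have hvol : 1/(b-a) * (volB * ((x+b)^3-(x+a)^3)/3) = volB * x^2 + volB * (x*(a+b) + (a^2+a*b+b^2)/3) := by
    field_simp; ring
  have hvol2 : |volB * (x*(a+b) + (a^2+a*b+b^2)/3)| ≤ 7*volB*(1/X) := by
    rw [abs_mul, abs_of_nonneg hB]
    have := vol_aux X x a b h hX0 hh0 hx hXh hhX hX1 ha hb
    calc _ ≤ volB * (7*(1/X)) := by gcongr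
      _ = _ := by ring
  have he2 : |1/(b-a)*e| ≤ 2*C1*(1/X) := by
    rw [abs_mul, abs_of_pos (by positivity)]
    calc _ ≤ 1/(b-a) * (C1 * ((x+b-(x+a))/(x+a))) := by gcongr
      _ = C1 / (x+a) := by
          rw [show x+b-(x+a) = b-a by ring]; field_simp
      _ ≤ C1 / (X/2) := by gcongr
      _ = _ := by field_simp
  have hfin : 1/(b-a) * (∫ t in (x+a)..(x+b), VM M t) - volB * x^2 - PY Y x - TL Y L0 a b x
     = (1/(b-a) * ((∫ t in (x+a)..(x+b), VM M t) - volB * ((x+b)^3-(x+a)^3)/3 - e) - Q - TL Y L0 a b x)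
      + (Q - PY Y x) + volB * (x*(a+b) + (a^2+a*b+b^2)/3) + 1/(b-a)*e := by
    rw [mul_sub, mul_sub, hvol]; ring
  rw [hfin]
  calc _ ≤ 1/X + C2*(1/X) + 7*volB*(1/X) + 2*C1*(1/X) := by
        refine (abs_add_le _ _).trans (add_le_add ((abs_add_le _ _).trans (add_le_add ((abs_add_le _ _).trans (add_le_add hlim (hnear.trans hnear2))) hvol2)) he2)
    _ = _ := by ring

end window

section vmprop

lemma bintOn {h : ℝ → ℝ} {B : ℝ} {a b : ℝ} (hab : a ≤ b) (hm : Measurable h) (hb : ∀ s ∈ Set.Icc a b, |h s| ≤ B) :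
    IntervalIntegrable h volume a b := by
  rw [intervalIntegrable_iff, Set.uIoc_of_le hab]
  refine Measure.integrableOn_of_bounded (by simp) hm.aestronglyMeasurable (M := B) ?_
  rw [ae_restrict_iff' measurableSet_Ioc]
  exact Eventually.of_forall fun s hs => hb s ⟨hs.1.le, hs.2⟩

lemma VM_mono (M : ℕ) : MonotoneOn (VM M) (Set.Ioi 0) := by
  intro x hx y hy hxy
  have hx0 : 0 < x := hx
  unfold VM
  gcongr

lemma VM_int (M : ℕ) (a b : ℝ) (ha : 0 < a) (hb : 0 < b) : IntervalIntegrable (VM M) volume a b := by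
  apply MonotoneOn.intervalIntegrable
  apply (VM_mono M).mono
  intro x hx
  rw [Set.mem_uIcc] at hx
  rw [Set.mem_Ioi]
  rcases hx with h | h <;> linarith [h.1]

lemma VM_avg_ge (M : ℕ) (x h : ℝ) (hx : 0 < x) (hh : 0 < h) : VM M x ≤ 1/(h-0) * ∫ t in (x+0)..(x+h), VM M t := by
  have := intervalIntegral.integral_mono_on (a := x+0) (b := x+h) (f := fun _ => VM M x) (g := VM M) (by linarith) (by simp)
    (VM_int M _ _ (by linarith) (by linarith)) (fun t ht => VM_mono M (by exact hx) (by have := ht.1; rw [Set.mem_Ioi]; linarith) (by linarith [ht.1]))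
  rw [intervalIntegral.integral_const, smul_eq_mul] at this
  rw [sub_zero, one_div, le_inv_mul_iff₀ hh]
  linarith

lemma VM_avg_le (M : ℕ) (x h : ℝ) (hx : h < x) (hh : 0 < h) : 1/(0-(-h)) * (∫ t in (x+(-h))..(x+0), VM M t) ≤ VM M x := by
  have := intervalIntegral.integral_mono_on (a := x+(-h)) (b := x+0) (f := VM M) (g := fun _ => VM M x) (by linarith)
    (VM_int M _ _ (by linarith) (by linarith)) (by simp) (fun t ht => VM_mono M (by have := ht.1; rw [Set.mem_Ioi]; linarith) (by rw [Set.mem_Ioi]; linarith) (by linarith [ht.2]))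
  rw [intervalIntegral.integral_const, smul_eq_mul] at this
  rw [zero_sub, neg_neg, one_div, inv_mul_le_iff₀ hh]
  linarith

lemma VM_meas (M : ℕ) : Measurable (VM M) := by
  unfold VM
  apply Measurable.const_mul
  apply Finset.measurable_fun_sum
  intro m _
  fun_prop

lemma TL_cont (Y L : ℕ) (a b : ℝ) : Continuous (TL Y L a b) := by
  have := eC_cont
  unfold TL
  apply Continuous.mul continuous_const
  apply Complex.continuous_re.comp
  fun_prop

lemma TL_L2 (ε : ℝ) (hε : 0 < ε) : ∃ C : ℝ, 0 ≤ C ∧ ∀ (X a b : ℝ) (Y L : ℕ), 1 ≤ X → 1 ≤ Y → (Y:ℝ) ≤ X → a < b →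
    ∫ x in X..(3*X), TL Y L a b x ^ 2 ≤ C * X^(1+ε) / Y := by
  obtain ⟨C1, hC1, hd⟩ := diag_sum ε hε
  obtain ⟨C2, hC2, ho⟩ := off_sum
  refine ⟨2*C1 + C2, by positivity, fun X a b Y L hX hY hYX hab => ?_⟩
  have hX0 : 0 < X := by linarith
  have hY0 : (1:ℝ) ≤ Y := by exact_mod_cast hY
  have q := quad_bound X hX0 (Finset.Ioc Y L) (fun l => (aw l : ℂ) * kap (√(l:ℝ)) a b) (by
    intro l _
    rw [norm_mul, Complex.norm_real, Real.norm_of_nonneg (aw_nonneg l)]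
    exact mul_le_of_le_one_right (aw_nonneg l) (kap_le_one _ _ _ hab))
  have o := ho (Finset.Ioc Y L) (fun l hl => by rw [Finset.mem_Ioc] at hl; omega)
  have d := hd Y L hY
  have e : ∫ x in X..(3*X), TL Y L a b x ^ 2 ≤ ∫ x in X..(3*X),
      ((∑ l ∈ Finset.Ioc Y L, ((aw l : ℂ) * kap (√(l:ℝ)) a b) * eC (√(l:ℝ)*x)).re)^2 := by
    have := eC_cont
    apply intervalIntegral.integral_mono_on (by linarith)
    · exact ((TL_cont Y L a b).pow 2).intervalIntegrable _ _
    · apply Continuous.intervalIntegrable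
      apply Continuous.pow
      apply Complex.continuous_re.comp
      fun_prop
    · intro x _
      unfold TL
      rw [mul_pow, neg_sq]
      apply mul_le_of_le_one_left (sq_nonneg _)
      exact pow_le_one₀ c0_bd.1 c0_bd.2
  have d2 : (Y:ℝ)^(ε-1) ≤ X^ε / Y := by
    rw [Real.rpow_sub_one (by linarith)]
    gcongr
  have o2 : C2 ≤ C2 * X^(1+ε) / Y := by
    rw [le_div_iff₀ (by linarith)]
    gcongr
    refine hYX.trans ?_
    exact Real.self_le_rpow_of_one_le hX (by linarith)
  calc _ ≤ 2*X*(C1 * (Y:ℝ)^(ε-1)) + C2 := by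
        refine e.trans (q.trans ?_)
        gcongr
    _ ≤ 2*X*(C1 * (X^ε / Y)) + C2 * X^(1+ε) / Y := by gcongr
    _ = _ := by rw [Real.rpow_add hX0, Real.rpow_one]; ring

lemma VM_propA (ε : ℝ) (hε : 0 < ε) (hε1 : ε ≤ 1) : ∃ C : ℝ, 0 ≤ C ∧ ∀ (X : ℝ) (Y M : ℕ), 2 ≤ X → 1 ≤ Y → (Y:ℝ) ≤ X → 16*X^2 ≤ M →
    (∀ x ∈ Set.Icc X (3*X), |VM M x - volB * x^2 - PY Y x| ≤ C * X^ε) ∧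
    ∫ x in X..(3*X), (VM M x - volB * x^2 - PY Y x)^2 ≤ C * X^(1+ε) / Y := by
  obtain ⟨C1, hC1, hw⟩ := window
  obtain ⟨C2, hC2, ht⟩ := TL_L2 ε hε
  obtain ⟨C3, hC3, hk⟩ := kap_sum ε hε hε1
  refine ⟨(2*C3 + C1) + (3*(2*C2 + 2*C1^2)), by positivity, fun X Y M hX hY hYX hM => ?_⟩
  have hX0 : 0 < X := by linarith
  have hY0 : (1:ℝ) ≤ Y := by exact_mod_cast hY
  set h := (X^2)⁻¹ with hh
  have hh0 : 0 < h := by positivity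
  have hh1 : h ≤ 1 := by rw [hh]; apply inv_le_one_of_one_le₀; nlinarith
  obtain ⟨L1, hL1, h1⟩ := hw X 0 h Y M hX hY hYX (by ring) (by rw [abs_zero]; exact hh0.le) (by rw [abs_of_pos hh0]) hM
  obtain ⟨L2, hL2, h2⟩ := hw X (-h) 0 Y M hX hY hYX (by ring) (by rw [abs_neg, abs_of_pos hh0]) (by rw [abs_zero]; exact hh0.le) hM
  have key : ∀ x ∈ Set.Icc X (3*X), |VM M x - volB * x^2 - PY Y x| ≤ |TL Y L1 0 h x| + |TL Y L2 (-h) 0 x| + C1/X := by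
    intro x hx
    have a1 := h1 x hx
    have a2 := h2 x hx
    have b1 := VM_avg_ge M x h (by linarith [hx.1]) hh0
    have b2 := VM_avg_le M x h (by linarith [hx.1]) hh0
    rw [abs_le] at a1 a2
    have c1 := le_abs_self (TL Y L1 0 h x)
    have c2 := neg_abs_le (TL Y L2 (-h) 0 x)
    have c3 := abs_nonneg (TL Y L1 0 h x)
    have c4 := abs_nonneg (TL Y L2 (-h) 0 x)
    rw [abs_le]
    constructor <;> linarith [a1.1, a1.2, a2.1, a2.2]
  have hXe : 1 ≤ X^ε := Real.one_le_rpow (by linarith) hε.le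
  have part1 : ∀ x ∈ Set.Icc X (3*X), |VM M x - volB * x^2 - PY Y x| ≤ (2*C3 + C1) * X^ε := by
    intro x hx
    have tb : ∀ L a b, b - a = h → |TL Y L a b x| ≤ C3 * X^ε := by
      intro L a b hab
      obtain ⟨s1, s2⟩ := hk X a b (by linarith) hab
      exact (TL_abs _ _ _ _ _).trans ((s1.sum_le_tsum _ (fun l _ => mul_nonneg (aw_nonneg l) (norm_nonneg _))).trans s2)
    have t1 := tb L1 0 h (by ring)
    have t2 := tb L2 (-h) 0 (by ring)
    have t3 : C1/X ≤ C1 * X^ε := by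
      rw [div_le_iff₀ hX0, mul_assoc]
      apply le_mul_of_one_le_right hC1
      nlinarith
    have := key x hx
    linarith
  constructor
  · intro x hx
    refine (part1 x hx).trans ?_
    apply mul_le_mul_of_nonneg_right _ (by positivity)
    linarith [show 0 ≤ 3*(2*C2+2*C1^2) by positivity]
  · have i1 := ht X 0 h Y L1 (by linarith) hY hYX hh0
    have i2 := ht X (-h) 0 Y L2 (by linarith) hY hYX (by linarith)
    have tc1 := TL_cont Y L1 0 h
    have tc2 := TL_cont Y L2 (-h) 0
    have pc := PY_cont Y
    have hint : IntervalIntegrable (fun x => (VM M x - volB * x^2 - PY Y x)^2) volume X (3*X) := by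
      apply bintOn (B := ((2*C3 + C1) * X^ε)^2) (by linarith)
      · exact (((VM_meas M).sub (by fun_prop)).sub pc.measurable).pow_const 2
      · intro x hx
        have := part1 x hx
        rw [abs_pow]
        gcongr
    have hm : ∫ x in X..(3*X), (VM M x - volB * x^2 - PY Y x)^2 ≤
        ∫ x in X..(3*X), 3*(TL Y L1 0 h x^2 + TL Y L2 (-h) 0 x^2 + (C1/X)^2) := by
      apply intervalIntegral.integral_mono_on (by linarith) hint
      · apply Continuous.intervalIntegrable; fun_prop
      · intro x hx
        have := key x hx
        rw [← sq_abs (VM M x - _ - _), ← sq_abs (TL Y L1 0 h x), ← sq_abs (TL Y L2 (-h) 0 x)]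
        have t3 : 0 ≤ C1/X := by positivity
        calc _ ≤ (|TL Y L1 0 h x| + |TL Y L2 (-h) 0 x| + C1/X)^2 := by gcongr
          _ ≤ _ := by
            nlinarith [sq_nonneg (|TL Y L1 0 h x| - |TL Y L2 (-h) 0 x|), sq_nonneg (|TL Y L1 0 h x| - C1/X), sq_nonneg (|TL Y L2 (-h) 0 x| - C1/X)]
    refine hm.trans ?_
    rw [intervalIntegral.integral_const_mul, intervalIntegral.integral_add, intervalIntegral.integral_add,
      intervalIntegral.integral_const, smul_eq_mul]
    · have c : (3*X-X)*(C1/X)^2 ≤ 2*C1^2 * X^(1+ε)/Y := by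
        rw [le_div_iff₀ (by linarith)]
        have : (3*X-X)*(C1/X)^2 * Y = 2*C1^2 * (Y/X) := by field_simp; ring
        rw [this]
        gcongr
        have : (Y:ℝ)/X ≤ 1 := by rw [div_le_one hX0]; exact hYX
        exact this.trans (Real.one_le_rpow (by linarith) (by linarith))
      have hp : 0 ≤ (2*C3+C1) * X^(1+ε)/Y := by positivity
      calc _ ≤ 3*(C2 * X^(1+ε)/Y + C2 * X^(1+ε)/Y + 2*C1^2 * X^(1+ε)/Y) := by gcongr
        _ ≤ 3*(C2 * X^(1+ε)/Y + C2 * X^(1+ε)/Y + 2*C1^2 * X^(1+ε)/Y) + (2*C3+C1) * X^(1+ε)/Y := by linarith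
        _ = _ := by ring
    all_goals apply Continuous.intervalIntegrable; fun_prop

end vmprop

section count

lemma lc_set (x : ℝ) (hx : 0 < x) : {p : ℤ × ℤ × ℤ | ((p.1 : ℝ), (p.2.1 : ℝ), (p.2.2 : ℝ)) ∈ heisDil x '' cyganBall}
    = {p : ℤ × ℤ × ℤ | ((p.1:ℝ)^2 + (p.2.1:ℝ)^2)^2 + (p.2.2:ℝ)^2 ≤ x^4} := by
  ext ⟨a, b, c⟩
  simp only [Set.mem_ofPred_eq, Set.mem_image, cball_eq, heisDil]
  constructor
  · rintro ⟨u, hu, h⟩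
    simp only [Prod.mk.injEq] at h
    obtain ⟨h1, h2, h3⟩ := h
    rw [← h1, ← h2, ← h3]
    have : ((x*u.1)^2+(x*u.2.1)^2)^2 + (x^2*u.2.2)^2 = x^4 * ((u.1^2+u.2.1^2)^2+u.2.2^2) := by ring
    rw [this]
    exact mul_le_of_le_one_right (by positivity) hu
  · intro h
    refine ⟨((a:ℝ)/x, (b:ℝ)/x, (c:ℝ)/x^2), ?_, ?_⟩
    · have : (((a:ℝ)/x)^2+((b:ℝ)/x)^2)^2 + ((c:ℝ)/x^2)^2 = (((a:ℝ)^2+(b:ℝ)^2)^2+(c:ℝ)^2)/x^4 := by field_simp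
      simp only [this]
      rw [div_le_one (by positivity)]; exact h
    · simp only [Prod.mk.injEq]
      refine ⟨?_, ?_, ?_⟩ <;> field_simp

lemma fib_card (s : ℝ) (m B : ℕ) (hB : s ≤ (B:ℝ)^2) :
    ∑ c ∈ Finset.Icc (-(B:ℤ)) B, (if (m:ℝ)^2 + (c:ℝ)^2 ≤ s then (1:ℝ) else 0)
      = if (m:ℝ)^2 ≤ s then 2*(⌊√(s-(m:ℝ)^2)⌋:ℝ)+1 else 0 := by
  split_ifs with h
  · rw [Finset.sum_boole]
    set k := ⌊√(s-(m:ℝ)^2)⌋ with hk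
    have hk0 : 0 ≤ k := Int.floor_nonneg.mpr (Real.sqrt_nonneg _)
    have : Finset.filter (fun c : ℤ => (m:ℝ)^2 + (c:ℝ)^2 ≤ s) (Finset.Icc (-(B:ℤ)) B) = Finset.Icc (-k) k := by
      ext c
      rw [Finset.mem_filter, Finset.mem_Icc, Finset.mem_Icc, ← abs_le, ← abs_le]
      have e : (m:ℝ)^2 + (c:ℝ)^2 ≤ s ↔ |c| ≤ k := by
        rw [hk, Int.le_floor, Real.le_sqrt (by positivity) (by linarith)]
        push_cast
        rw [sq_abs]
        constructor <;> intro h <;> linarith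
      rw [e]
      constructor
      · exact fun h => h.2
      · intro h1
        refine ⟨?_, h1⟩
        have h2 := e.mpr h1
        have h3 : (c:ℝ)^2 ≤ (B:ℝ)^2 := by nlinarith [sq_nonneg (m:ℝ)]
        have h4 := abs_le_of_sq_le_sq h3 (by positivity)
        exact_mod_cast h4
    rw [this, Int.card_Icc]
    have : ((k+1-(-k)).toNat : ℤ) = 2*k+1 := by omega
    have : (((k+1-(-k)).toNat : ℤ):ℝ) = 2*k+1 := by rw [this]; push_cast; ring
    exact_mod_cast this
  · apply Finset.sum_eq_zero
    intro c _
    rw [if_neg]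
    intro h2; apply h; nlinarith [sq_nonneg (c:ℝ)]

lemma lc_eq (x : ℝ) (hx : 0 < x) (M : ℕ) (hM : x^2 ≤ M) : (latticeCount x : ℝ) =
    ∑ m ∈ Finset.range (M+1), (r2 m : ℝ) * (if (m:ℝ)^2 ≤ x^4 then 2*(⌊√(x^4-(m:ℝ)^2)⌋:ℝ)+1 else 0) := by
  classical
  unfold latticeCount
  rw [lc_set x hx]
  have hs : {p : ℤ × ℤ × ℤ | ((p.1:ℝ)^2 + (p.2.1:ℝ)^2)^2 + (p.2.2:ℝ)^2 ≤ x^4} =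
    (Equiv.prodAssoc ℤ ℤ ℤ) '' (↑((zball M ×ˢ Finset.Icc (-(M:ℤ)) M).filter
      (fun q : (ℤ×ℤ)×ℤ => ((((q.1.1^2+q.1.2^2).toNat : ℕ):ℝ))^2 + (q.2:ℝ)^2 ≤ x^4)) : Set ((ℤ×ℤ)×ℤ)) := by
    have ht : ∀ a b : ℤ, (((a^2+b^2).toNat : ℕ):ℝ) = (a:ℝ)^2+(b:ℝ)^2 := by
      intro a b
      have : (((a^2+b^2).toNat : ℕ):ℤ) = a^2+b^2 := Int.toNat_of_nonneg (by positivity)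
      exact_mod_cast congrArg (fun z : ℤ => (z:ℝ)) this
    ext ⟨a, b, c⟩
    constructor
    · intro h
      simp only [Set.mem_ofPred_eq] at h
      refine ⟨((a,b),c), ?_, rfl⟩
      simp only [Finset.coe_filter, Set.mem_ofPred_eq, Finset.mem_product, mem_zball, ht, h, and_true, Finset.mem_Icc]
      have e1 : ((a:ℝ)^2+(b:ℝ)^2)^2 ≤ (x^2)^2 := by nlinarith [sq_nonneg (c:ℝ)]
      have e2 : (c:ℝ)^2 ≤ (x^2)^2 := by nlinarith [sq_nonneg ((a:ℝ)^2+(b:ℝ)^2)]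
      have e3 := (abs_le_of_sq_le_sq' e1 (by positivity)).2.trans hM
      have e4 := abs_le_of_sq_le_sq' e2 (by positivity)
      refine ⟨by exact_mod_cast e3, ?_, ?_⟩
      · have : -(M:ℝ) ≤ c := by linarith [e4.1]
        exact_mod_cast this
      · have : (c:ℝ) ≤ M := by linarith [e4.2]
        exact_mod_cast this
    · rintro ⟨⟨⟨a', b'⟩, c'⟩, h, he⟩
      simp only [Equiv.prodAssoc_apply, Prod.mk.injEq] at he
      obtain ⟨rfl, rfl, rfl⟩ := he
      simp only [Finset.coe_filter, Set.mem_ofPred_eq, ht] at h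
      exact h.2
  rw [hs, Set.ncard_image_of_injective _ (Equiv.injective _), Set.ncard_coe_finset, Finset.card_filter]
  push_cast
  rw [Finset.sum_product]
  have hM2 : x^4 ≤ (M:ℝ)^2 := by
    calc x^4 = (x^2)^2 := by ring
      _ ≤ _ := by gcongr
  have := zball_sum M (fun m : ℕ => ∑ c ∈ Finset.Icc (-(M:ℤ)) M, (if (m:ℝ)^2 + (c:ℝ)^2 ≤ x^4 then (1:ℝ) else 0))
  simp only at this ⊢
  rw [this]
  apply Finset.sum_congr rfl
  intro m _
  rw [fib_card _ _ _ hM2, nsmul_eq_mul]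

lemma lc_decomp (x : ℝ) (hx : 0 < x) (M : ℕ) (hM : x^2 ≤ M) : (latticeCount x : ℝ) = x^2 * VM M x - 2 * PsiS M (x^4) := by
  rw [lc_eq x hx M hM, VM, PsiS, mul_left_comm, ← mul_sub, Finset.mul_sum, ← Finset.sum_sub_distrib, Finset.mul_sum]
  apply Finset.sum_congr rfl
  intro m _
  have e : √(x^4-(m:ℝ)^2) = x^2 * √(1-(m:ℝ)^2/x^4) := by
    rw [show x^4-(m:ℝ)^2 = (x^2)^2 * (1-(m:ℝ)^2/x^4) by field_simp, Real.sqrt_mul (by positivity), Real.sqrt_sq (by positivity)]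
  split_ifs with h
  · have : sawtooth √(x^4-(m:ℝ)^2) = x^2 * √(1-(m:ℝ)^2/x^4) - ⌊√(x^4-(m:ℝ)^2)⌋ - 1/2 := by
      unfold sawtooth; rw [e]
    rw [this]; ring
  · have : √(1-(m:ℝ)^2/x^4) = 0 := by
      apply Real.sqrt_eq_zero_of_nonpos
      rw [sub_nonpos, one_le_div (by positivity)]
      linarith
    rw [this]; ring

lemma VM_indep (x : ℝ) (hx : 0 < x) (M M' : ℕ) (hM : x^2 ≤ M) (hMM : M ≤ M') : VM M' x = VM M x := by
  unfold VM
  congr 1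
  symm
  apply Finset.sum_subset
  · intro m; rw [Finset.mem_range, Finset.mem_range]; omega
  · intro m _ h
    rw [Finset.mem_range] at h
    have h1 : (M:ℝ) ≤ m := by exact_mod_cast (by omega : M ≤ m)
    have : √(1-(m:ℝ)^2/x^4) = 0 := by
      apply Real.sqrt_eq_zero_of_nonpos
      rw [sub_nonpos, one_le_div (by positivity)]
      calc x^4 = (x^2)^2 := by ring
        _ ≤ (m:ℝ)^2 := by gcongr; linarith
    rw [this, mul_zero]

lemma PsiS_indep (s : ℝ) (M M' : ℕ) (hM : s < ((M:ℝ)+1)^2) (hMM : M ≤ M') : PsiS M' s = PsiS M s := by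
  unfold PsiS
  symm
  apply Finset.sum_subset
  · intro m; rw [Finset.mem_range, Finset.mem_range]; omega
  · intro m _ h
    rw [Finset.mem_range] at h
    have h1 : (M:ℝ) + 1 ≤ m := by exact_mod_cast (by omega : M + 1 ≤ m)
    rw [if_neg, mul_zero]
    rw [not_le]
    calc s < ((M:ℝ)+1)^2 := hM
      _ ≤ _ := by gcongr

def GG (y : ℝ) : ℝ := ((latticeCount y : ℝ) - volB * y^4) / y^2

lemma GG_eq (X y : ℝ) (M : ℕ) (hX : 1 ≤ X) (hM : 16*X^2 ≤ M) (hy : y ∈ Set.Icc X (3*X)) :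
    GG y = VM M y - volB * y^2 - 2 * PsiS ⌊9*X^2⌋₊ (y^4) / y^2 := by
  have hy0 : 0 < y := by linarith [hy.1]
  have hy2 : y^2 ≤ 9*X^2 := by nlinarith [hy.2]
  unfold GG
  rw [lc_decomp y hy0 M (by nlinarith), PsiS_indep (y^4) ⌊9*X^2⌋₊ M]
  · field_simp; ring
  · have := Nat.lt_floor_add_one (9*X^2)
    calc y^4 = (y^2)^2 := by ring
      _ < _ := by gcongr; linarith
  · apply Nat.floor_le_of_le; nlinarith

lemma GG_meas (X : ℝ) (hX : 1 ≤ X) : ∃ g : ℝ → ℝ, Measurable g ∧ ∀ y ∈ Set.Icc X (3*X), GG y = g y := by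
  refine ⟨fun y => VM ⌈16*X^2⌉₊ y - volB * y^2 - 2 * PsiS ⌊9*X^2⌋₊ (y^4) / y^2, ?_, fun y hy => GG_eq X y _ hX (Nat.le_ceil _) hy⟩
  have p := (PsiS_meas ⌊9*X^2⌋₊).comp (by fun_prop : Measurable fun x : ℝ => x^4)
  have p2 : Measurable fun x : ℝ => PsiS ⌊9*X^2⌋₊ (x^4) := p
  have v := VM_meas ⌈16*X^2⌉₊
  fun_prop

lemma propA (ε : ℝ) (hε : 0 < ε) (hε1 : ε ≤ 1) : ∃ C : ℝ, 0 ≤ C ∧ ∀ (X : ℝ) (Y : ℕ), 2 ≤ X → 1 ≤ Y → (Y:ℝ) ≤ X →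
    (∀ x ∈ Set.Icc X (3*X), |GG x - PY Y x| ≤ C * X^ε) ∧
    ∫ x in X..(3*X), (GG x - PY Y x)^2 ≤ C * X^(1+ε) / Y := by
  obtain ⟨C1, hC1, hV⟩ := VM_propA ε hε hε1
  obtain ⟨C2, hC2, hP⟩ := PsiS_L2 ε hε
  obtain ⟨C3, hC3, hr⟩ := r2_bound_X ε hε
  refine ⟨(C1 + 20*C3) + (2*C1 + 8*C2), by positivity, fun X Y hX hY hYX => ?_⟩
  have hX0 : 0 < X := by linarith
  have hY0 : (1:ℝ) ≤ Y := by exact_mod_cast hY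
  set M := ⌈16*X^2⌉₊ with hMdef
  have hM : 16*X^2 ≤ M := Nat.le_ceil _
  obtain ⟨v1, v2⟩ := hV X Y M hX hY hYX hM
  set m0 := ⌊9*X^2⌋₊ with hm0
  have hps : ∀ s, |PsiS m0 s| ≤ 10*C3*X^ε*X^2 := by
    intro s
    refine (PsiS_abs _ _).trans ?_
    calc _ ≤ ∑ m ∈ Finset.range (m0+1), C3*X^ε := by
          apply Finset.sum_le_sum
          intro m hm
          rw [Finset.mem_range] at hm
          exact hr X (by linarith) m (by omega)
      _ = ((m0:ℝ)+1)*(C3*X^ε) := by rw [Finset.sum_const, Finset.card_range, nsmul_eq_mul]; push_cast; ring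
      _ ≤ (10*X^2)*(C3*X^ε) := by
          gcongr
          have := Nat.floor_le (by positivity : 0 ≤ 9*X^2)
          nlinarith
      _ = _ := by ring
  have key : ∀ x ∈ Set.Icc X (3*X), |GG x - PY Y x| ≤ |VM M x - volB * x^2 - PY Y x| + 2 * |PsiS m0 (x^4)| / X^2 := by
    intro x hx
    rw [GG_eq X x M (by linarith) hM hx, ← hm0]
    rw [show VM M x - volB * x^2 - 2 * PsiS m0 (x^4) / x^2 - PY Y x = (VM M x - volB * x^2 - PY Y x) - 2 * PsiS m0 (x^4) / x^2 by ring]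
    refine (abs_sub _ _).trans ?_
    gcongr
    rw [abs_div, abs_mul, abs_of_pos (by norm_num : (0:ℝ)<2), abs_of_nonneg (sq_nonneg x)]
    gcongr
    exact hx.1
  have hXe : 1 ≤ X^ε := Real.one_le_rpow (by linarith) hε.le
  have part1 : ∀ x ∈ Set.Icc X (3*X), |GG x - PY Y x| ≤ (C1 + 20*C3) * X^ε := by
    intro x hx
    have h1 := v1 x hx
    have h2 : 2 * |PsiS m0 (x^4)| / X^2 ≤ 20*C3*X^ε := by
      rw [div_le_iff₀ (by positivity)]
      have := hps (x^4)
      linarith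
    linarith [key x hx]
  constructor
  · intro x hx
    refine (part1 x hx).trans ?_
    apply mul_le_mul_of_nonneg_right _ (by positivity)
    linarith
  · have pc := PY_cont Y
    have hgm : IntervalIntegrable (fun x => (GG x - PY Y x)^2) volume X (3*X) := by
      have h0 : Measurable (fun x => (VM M x - volB * x^2 - 2 * PsiS m0 (x^4) / x^2 - PY Y x)^2) := by
        have p := (PsiS_meas m0).comp (by fun_prop : Measurable fun x : ℝ => x^4)
        have p2 : Measurable fun x : ℝ => PsiS m0 (x^4) := p
        have v := VM_meas M
        have pm := pc.measurable
        fun_prop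
      have h1 : IntervalIntegrable (fun x => (VM M x - volB * x^2 - 2 * PsiS m0 (x^4) / x^2 - PY Y x)^2) volume X (3*X) := by
        apply bintOn (B := ((C1 + 20*C3) * X^ε)^2) (by linarith) h0
        intro x hx
        have := part1 x hx
        rw [GG_eq X x M (by linarith) hM hx, ← hm0] at this
        rw [abs_pow]
        gcongr
      apply h1.congr
      intro x hx
      rw [Set.uIoc_of_le (by linarith)] at hx
      simp only
      rw [GG_eq X x M (by linarith) hM ⟨hx.1.le, hx.2⟩]
    have i1 : IntervalIntegrable (fun x => (VM M x - volB * x^2 - PY Y x)^2) volume X (3*X) := by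
      have v := VM_meas M
      have pm := pc.measurable
      apply bintOn (B := (C1 * X^ε)^2) (by linarith) (by fun_prop)
      intro x hx
      have := v1 x hx
      rw [abs_pow]; gcongr
    have i2 : IntervalIntegrable (fun x => PsiS m0 (x^4)^2) volume X (3*X) := by
      have p := (PsiS_meas m0).comp (by fun_prop : Measurable fun x : ℝ => x^4)
      have p2 : Measurable fun x : ℝ => PsiS m0 (x^4) := p
      apply bintOn (B := (10*C3*X^ε*X^2)^2) (by linarith) (by fun_prop)
      intro x hx
      have := hps (x^4)
      rw [abs_pow]; gcongr
    have hm : ∫ x in X..(3*X), (GG x - PY Y x)^2 ≤ ∫ x in X..(3*X), (2*(VM M x - volB * x^2 - PY Y x)^2 + 8/X^4 * PsiS m0 (x^4)^2) := by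
      apply intervalIntegral.integral_mono_on (by linarith) hgm ((i1.const_mul 2).add (i2.const_mul _))
      intro x hx
      have := key x hx
      rw [← sq_abs (GG x - _), ← sq_abs (VM M x - _ - _), ← sq_abs (PsiS m0 _)]
      calc _ ≤ (|VM M x - volB * x^2 - PY Y x| + 2 * |PsiS m0 (x^4)| / X^2)^2 := by gcongr
        _ ≤ 2*|VM M x - volB * x^2 - PY Y x|^2 + 2*(2 * |PsiS m0 (x^4)| / X^2)^2 := by
            nlinarith [sq_nonneg (|VM M x - volB * x^2 - PY Y x| - 2 * |PsiS m0 (x^4)| / X^2)]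
        _ = _ := by field_simp; ring
    refine hm.trans ?_
    rw [intervalIntegral.integral_add (i1.const_mul 2) (i2.const_mul _), intervalIntegral.integral_const_mul, intervalIntegral.integral_const_mul]
    have q := hP X (by linarith)
    have q2 : 8/X^4 * (C2 * X^(4+ε)) ≤ 8*C2*X^(1+ε)/Y := by
      rw [Real.rpow_add hX0, Real.rpow_add hX0, Real.rpow_one, le_div_iff₀ (by linarith)]
      have : X^(4:ℝ) = X^4 := by exact_mod_cast Real.rpow_natCast X 4
      rw [this]
      have : 8/X^4 * (C2*(X^4*X^ε))*Y = 8*C2*X^ε*Y := by field_simp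
      rw [this]
      calc _ ≤ 8*C2*X^ε*X := by gcongr
        _ = _ := by ring
    have hp : 0 ≤ (C1 + 20*C3) * X^(1+ε)/Y := by positivity
    calc _ ≤ 2*(C1 * X^(1+ε)/Y) + 8/X^4 * (C2 * X^(4+ε)) := by gcongr
      _ ≤ 2*(C1 * X^(1+ε)/Y) + 8*C2*X^(1+ε)/Y + (C1 + 20*C3) * X^(1+ε)/Y := by linarith
      _ = _ := by ring

end count

section bmsec

def BM (a b : ℝ) (f : ℝ → ℝ) : Prop :=
  AEStronglyMeasurable f (volume.restrict (Set.Icc a b)) ∧ ∃ B, ∀ x ∈ Set.Icc a b, |f x| ≤ B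

lemma BM_int {a b : ℝ} {f : ℝ → ℝ} (hab : a ≤ b) (h : BM a b f) : IntervalIntegrable f volume a b := by
  rw [intervalIntegrable_iff, Set.uIoc_of_le hab]
  obtain ⟨hm, B, hB⟩ := h
  apply IntegrableOn.mono_set _ Set.Ioc_subset_Icc_self
  refine Integrable.of_bound hm B ?_
  rw [ae_restrict_iff' measurableSet_Icc]
  exact Eventually.of_forall fun s hs => hB s hs

lemma BM_comp {a b : ℝ} {f Φ : ℝ → ℝ} (h : BM a b f) (hΦ : Continuous Φ) : BM a b (fun x => Φ (f x)) := by
  obtain ⟨hm, B, hB⟩ := h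
  refine ⟨hΦ.comp_aestronglyMeasurable hm, ?_⟩
  obtain ⟨B', hB'⟩ := (isCompact_Icc (a := -B) (b := B)).exists_bound_of_continuousOn hΦ.continuousOn
  exact ⟨B', fun x hx => hB' _ (abs_le.mp (hB x hx))⟩

lemma BM_add {a b : ℝ} {f g : ℝ → ℝ} (h : BM a b f) (h' : BM a b g) : BM a b (fun x => f x + g x) := by
  obtain ⟨hm, B, hB⟩ := h
  obtain ⟨hm', B', hB'⟩ := h'
  exact ⟨hm.add hm', B + B', fun x hx => (abs_add_le _ _).trans (add_le_add (hB x hx) (hB' x hx))⟩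

lemma BM_mul {a b : ℝ} {f g : ℝ → ℝ} (h : BM a b f) (h' : BM a b g) : BM a b (fun x => f x * g x) := by
  obtain ⟨hm, B, hB⟩ := h
  obtain ⟨hm', B', hB'⟩ := h'
  refine ⟨hm.mul hm', B * B', fun x hx => ?_⟩
  rw [abs_mul]
  exact mul_le_mul (hB x hx) (hB' x hx) (abs_nonneg _) ((abs_nonneg _).trans (hB x hx))

lemma BM_sub {a b : ℝ} {f g : ℝ → ℝ} (h : BM a b f) (h' : BM a b g) : BM a b (fun x => f x - g x) := by
  have := BM_add h (BM_comp h' continuous_neg)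
  simpa only [← sub_eq_add_neg] using this

lemma BM_cont {a b : ℝ} {f : ℝ → ℝ} (h : ContinuousOn f (Set.Icc a b)) : BM a b f := by
  obtain ⟨B, hB⟩ := isCompact_Icc.exists_bound_of_continuousOn h
  exact ⟨h.aestronglyMeasurable measurableSet_Icc, B, hB⟩

lemma BM_congr {a b : ℝ} {f g : ℝ → ℝ} (h : BM a b f) (hfg : ∀ x ∈ Set.Icc a b, g x = f x) : BM a b g := by
  obtain ⟨hm, B, hB⟩ := h
  refine ⟨hm.congr ?_, B, fun x hx => by rw [hfg x hx]; exact hB x hx⟩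
  rw [EventuallyEq, ae_restrict_iff' measurableSet_Icc]
  exact Eventually.of_forall fun x hx => (hfg x hx).symm

lemma BM_pow {a b : ℝ} {f : ℝ → ℝ} (h : BM a b f) (n : ℕ) : BM a b (fun x => f x ^ n) :=
  BM_comp h (Φ := fun y => y^n) (by fun_prop)

end bmsec

section shell

lemma Ehat_eq (ω : ℝ → ℝ) (x : ℝ) (hx : 0 < x) (hw : 0 < ω x) : Ehat ω x = GG (x + ω x) * (1 + ω x / x)^2 - GG x := by
  unfold Ehat Eshell GG
  have h4 : ∑ j ∈ Finset.Icc 1 4, (Nat.choose 4 j : ℝ) * x ^ (4 - j) * ω x ^ j = (x + ω x)^4 - x^4 := by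
    rw [show Finset.Icc 1 4 = ({1,2,3,4} : Finset ℕ) by decide]
    rw [Finset.sum_insert (by decide), Finset.sum_insert (by decide), Finset.sum_insert (by decide), Finset.sum_singleton]
    norm_num [Nat.choose]
    ring
  rw [h4]
  have : x + ω x ≠ 0 := by positivity
  field_simp
  ring

lemma cov (X : ℝ) (hX : 0 < X) (φ φ' f : ℝ → ℝ) (hd : ∀ x ∈ Set.Icc X (2*X), HasDerivAt φ (φ' x) x)
    (hφ : ∀ x ∈ Set.Icc X (2*X), 1/2 ≤ φ' x) (hm : ∀ x ∈ Set.Icc X (2*X), φ x ∈ Set.Icc X (3*X))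
    (hf0 : ∀ x, 0 ≤ f x) (hf : IntervalIntegrable f volume X (3*X))
    (hc : IntervalIntegrable (fun x => f (φ x)) volume X (2*X)) :
    ∫ x in X..(2*X), f (φ x) ≤ 2 * ∫ x in X..(3*X), f x := by
  have hi : Set.InjOn φ (Set.Icc X (2*X)) := by
    apply StrictMonoOn.injOn
    apply strictMonoOn_of_deriv_pos (convex_Icc _ _)
    · exact fun x hx => (hd x hx).continuousAt.continuousWithinAt
    · intro x hx
      rw [interior_Icc] at hx
      have hx2 : x ∈ Set.Icc X (2*X) := ⟨hx.1.le, hx.2.le⟩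
      rw [(hd x hx2).deriv]; linarith [hφ x hx2]
  have hd' : ∀ x ∈ Set.Icc X (2*X), HasDerivWithinAt φ (φ' x) (Set.Icc X (2*X)) x := fun x hx => (hd x hx).hasDerivWithinAt
  have e := integral_image_eq_integral_abs_deriv_smul measurableSet_Icc hd' hi f
  have hsub : φ '' Set.Icc X (2*X) ⊆ Set.Icc X (3*X) := by rintro _ ⟨x, hx, rfl⟩; exact hm x hx
  rw [intervalIntegrable_iff_integrableOn_Icc_of_le (by linarith)] at hf hc
  have hint := (integrableOn_image_iff_integrableOn_abs_deriv_smul measurableSet_Icc hd' hi f).mp (hf.mono_set hsub)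
  rw [intervalIntegral.integral_of_le (by linarith), intervalIntegral.integral_of_le (by linarith),
    ← integral_Icc_eq_integral_Ioc, ← integral_Icc_eq_integral_Ioc]
  have h1 : ∫ x in Set.Icc X (2*X), f (φ x) ≤ ∫ x in Set.Icc X (2*X), 2 * (|φ' x| • f (φ x)) := by
    apply setIntegral_mono_on hc (hint.const_mul 2) measurableSet_Icc
    intro x hx
    have := hφ x hx
    rw [abs_of_nonneg (by linarith), smul_eq_mul]
    nlinarith [hf0 (φ x)]
  rw [integral_const_mul, ← e] at h1
  refine h1.trans ?_
  have := setIntegral_mono_set hf (Eventually.of_forall hf0) (LE.le.eventuallyLE hsub)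
  linarith

lemma PY_abs : ∃ A : ℝ, 0 ≤ A ∧ ∀ (Y : ℕ) x, |PY Y x| ≤ A * Y := by
  obtain ⟨A, hA, h⟩ := aw_bound
  refine ⟨A, hA.le, fun Y x => ?_⟩
  unfold PY
  rw [abs_mul, abs_neg, abs_of_nonneg c0_bd.1]
  refine (mul_le_of_le_one_left (abs_nonneg _) c0_bd.2).trans ?_
  refine (Finset.abs_sum_le_sum_abs _ _).trans ?_
  calc _ ≤ ∑ l ∈ Finset.Icc 1 Y, A := by
        apply Finset.sum_le_sum
        intro l _
        rw [abs_mul, abs_of_nonneg (aw_nonneg l)]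
        exact (mul_le_of_le_one_right (aw_nonneg l) (Real.abs_cos_le_one _)).trans (h l)
    _ = _ := by rw [Finset.sum_const, Nat.card_Icc, nsmul_eq_mul]; push_cast; ring

lemma GG_BM (X : ℝ) (hX : 2 ≤ X) (a b : ℝ) (φ : ℝ → ℝ) (hc : ContinuousOn φ (Set.Icc a b)) (hm : ∀ x ∈ Set.Icc a b, φ x ∈ Set.Icc X (3*X)) :
    BM a b (fun x => GG (φ x)) := by
  obtain ⟨g, hg, he⟩ := GG_meas X (by linarith)
  obtain ⟨C, hC, hA⟩ := propA 1 one_pos le_rfl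
  obtain ⟨A, hA0, hP⟩ := PY_abs
  have h1 := (hA X 1 hX le_rfl (by push_cast; linarith)).1
  refine BM_congr (f := fun x => g (φ x)) ⟨?_, C * X^(1:ℝ) + A * (1:ℕ), ?_⟩ (fun x hx => he _ (hm x hx))
  · have := hc.aemeasurable (μ := volume) measurableSet_Icc
    exact (hg.comp_aemeasurable this).aestronglyMeasurable
  · intro x hx
    simp only
    rw [← he _ (hm x hx)]
    have a1 := h1 _ (hm x hx)
    have a2 := hP 1 (φ x)
    have := abs_sub_abs_le_abs_sub (GG (φ x)) (PY 1 (φ x))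
    linarith

/-- Regularity package for the shell at scale `X`. -/
lemma shell_reg (ω : ℝ → ℝ) (hω : OmegaClass ω) : ∀ᶠ X in atTop, 2 ≤ X ∧
    (∀ x ∈ Set.Icc X (2*X), HasDerivAt (fun x => x + ω x) (1 + deriv ω x) x ∧ 1/2 ≤ 1 + deriv ω x ∧ 0 < ω x ∧ ω x ≤ 1 ∧
      x + ω x ∈ Set.Icc X (3*X)) ∧ ContinuousOn ω (Set.Icc X (2*X)) ∧ ContinuousOn (fun x => x + ω x) (Set.Icc X (2*X)) ∧
    BM X (2*X) (Ehat ω) := by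
  obtain ⟨C, hC, hr⟩ := omega_reg ω hω 1 one_pos
  obtain ⟨A, hA⟩ := eventually_atTop.mp hω.deriv_small
  filter_upwards [hr, eventually_ge_atTop 2, eventually_ge_atTop A] with X h hX hXA
  obtain ⟨_, hd, _, hc, hw, _⟩ := h
  have hc2 : ContinuousOn (fun x => x + ω x) (Set.Icc X (2*X)) := continuousOn_id.add hc
  have hm : ∀ x ∈ Set.Icc X (2*X), x + ω x ∈ Set.Icc X (3*X) := by
    intro x hx
    obtain ⟨h1, h2⟩ := hw x hx
    exact ⟨by linarith [hx.1], by linarith [hx.2]⟩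
  refine ⟨hX, fun x hx => ⟨(hasDerivAt_id x).add (hd x hx), ?_, (hw x hx).1, (hw x hx).2, hm x hx⟩, hc, hc2, ?_⟩
  · have := hA x (by linarith [hx.1])
    rw [abs_lt] at this; linarith [this.1]
  · have b1 := GG_BM X hX X (2*X) (fun x => x + ω x) hc2 hm
    have b2 := GG_BM X hX X (2*X) (fun x => x) continuousOn_id (fun x hx => ⟨hx.1, by linarith [hx.2]⟩)
    have b3 : BM X (2*X) (fun x => (1 + ω x / x)^2) := by
      apply BM_cont
      apply ContinuousOn.pow
      apply continuousOn_const.add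
      apply hc.div continuousOn_id
      intro x hx
      have := hx.1
      simp only [id]; linarith
    refine BM_congr (BM_sub (BM_mul b1 b3) b2) ?_
    intro x hx
    exact Ehat_eq ω x (by linarith [hx.1]) (hw x hx).1

lemma dP_BM (Y : ℕ) (ω : ℝ → ℝ) (X : ℝ) (hc : ContinuousOn (fun x => x + ω x) (Set.Icc X (2*X))) : BM X (2*X) (dP Y ω) := by
  apply BM_cont
  unfold dP
  exact ((PY_cont Y).comp_continuousOn hc).sub (PY_cont Y).continuousOn

end shell

section rbound

lemma R_bound (ω : ℝ → ℝ) (hω : OmegaClass ω) (ε : ℝ) (hε : 0 < ε) (hε1 : ε ≤ 1/4) : ∃ C : ℝ, 0 ≤ C ∧ ∀ᶠ X in atTop, ∀ Y : ℕ, 1 ≤ Y →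
    (Y:ℝ) ≤ X^((1:ℝ)/4) → (∀ x ∈ Set.Icc X (2*X), |Ehat ω x - dP Y ω x| ≤ C * X^ε) ∧
    (1/X) * ∫ x in X..(2*X), (Ehat ω x - dP Y ω x)^2 ≤ C * X^ε / Y := by
  obtain ⟨C, hC, hA⟩ := propA ε hε (by linarith)
  obtain ⟨A, hA0, hP⟩ := PY_abs
  refine ⟨(2*C + 3*(C+A)) + (9*C + 27*(C+A)^2), by positivity, ?_⟩
  filter_upwards [shell_reg ω hω] with X hX Y hY hYX
  obtain ⟨hX2, hreg, hc, hc2, hE⟩ := hX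
  have hX0 : 0 < X := by linarith
  have hY0 : (1:ℝ) ≤ Y := by exact_mod_cast hY
  have hq1 : X^((1:ℝ)/4) ≤ X := by
    conv_rhs => rw [← Real.rpow_one X]
    exact Real.rpow_le_rpow_of_exponent_le (by linarith) (by norm_num)
  have hYX1 : (Y:ℝ) ≤ X := hYX.trans hq1
  obtain ⟨p1, p2⟩ := hA X Y hX2 hY hYX1
  have hXe : 1 ≤ X^ε := Real.one_le_rpow (by linarith) hε.le
  have hXe4 : X^ε ≤ X^((1:ℝ)/4) := Real.rpow_le_rpow_of_exponent_le (by linarith) hε1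
  set K := C + A with hK
  have hK0 : 0 ≤ K := by positivity
  have hIcc : ∀ x ∈ Set.Icc X (2*X), x ∈ Set.Icc X (3*X) := fun x hx => ⟨hx.1, by linarith [hx.2]⟩
  have key : ∀ x ∈ Set.Icc X (2*X), |Ehat ω x - dP Y ω x| ≤ |GG (x + ω x) - PY Y (x + ω x)| + |GG x - PY Y x| + 3*K*X^((1:ℝ)/4)/X := by
    intro x hx
    obtain ⟨_, _, w0, w1, wm⟩ := hreg x hx
    have hx0 : 0 < x := by linarith [hx.1]
    have e : Ehat ω x - dP Y ω x = (GG (x + ω x) - PY Y (x + ω x)) - (GG x - PY Y x) + GG (x + ω x) * ((1+ω x/x)^2-1) := by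
      rw [Ehat_eq ω x hx0 w0, dP]; ring
    rw [e]
    refine (abs_add_le _ _).trans (add_le_add (abs_sub _ _) ?_)
    have hq : |(1+ω x/x)^2-1| ≤ 3/X := by
      have u0 : 0 ≤ ω x / x := by positivity
      have u1 : ω x / x ≤ 1/X := by
        apply div_le_div₀ (by norm_num) w1 hX0 hx.1
      have u2 : 1/X ≤ 1 := by rw [div_le_one hX0]; linarith
      rw [abs_of_nonneg (by nlinarith), show 3/X = 3*(1/X) by ring]
      nlinarith
    have hG : |GG (x + ω x)| ≤ K * X^((1:ℝ)/4) := by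
      have a1 := p1 _ wm
      have a2 := hP Y (x + ω x)
      have a3 := abs_sub_abs_le_abs_sub (GG (x + ω x)) (PY Y (x + ω x))
      have a4 : A * Y ≤ A * X^((1:ℝ)/4) := by gcongr
      have a5 : C * X^ε ≤ C * X^((1:ℝ)/4) := by gcongr
      rw [hK, add_mul]; linarith
    rw [abs_mul]
    calc _ ≤ (K * X^((1:ℝ)/4)) * (3/X) := mul_le_mul hG hq (abs_nonneg _) (by positivity)
      _ = _ := by ring
  have h34 : X^((1:ℝ)/4)/X ≤ 1 := by rw [div_le_one hX0]; exact hq1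
  constructor
  · intro x hx
    have a1 := p1 _ (hreg x hx).2.2.2.2
    have a2 := p1 _ (hIcc x hx)
    have a3 := key x hx
    have a4 : 3*K*X^((1:ℝ)/4)/X ≤ 3*K*X^ε := by
      rw [mul_div_assoc]; gcongr; linarith
    calc _ ≤ (2*C+3*K)*X^ε := by linarith
      _ ≤ _ := by
        apply mul_le_mul_of_nonneg_right _ (by positivity)
        linarith [show 0 ≤ 9*C+27*K^2 by positivity]
  · have bG1 := GG_BM X hX2 X (2*X) (fun x => x + ω x) hc2 (fun x hx => (hreg x hx).2.2.2.2)
    have bG2 := GG_BM X hX2 X (2*X) (fun x => x) continuousOn_id hIcc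
    have bP1 : BM X (2*X) (fun x => PY Y (x + ω x)) := BM_cont ((PY_cont Y).comp_continuousOn hc2)
    have bP2 : BM X (2*X) (fun x => PY Y x) := BM_cont (PY_cont Y).continuousOn
    have b1 := BM_pow (BM_sub bG1 bP1) 2
    have b2 := BM_pow (BM_sub bG2 bP2) 2
    have bG3 := GG_BM X hX2 X (3*X) (fun x => x) continuousOn_id (fun x hx => hx)
    have bP3 : BM X (3*X) (fun x => PY Y x) := BM_cont (PY_cont Y).continuousOn
    have b3 := BM_pow (BM_sub bG3 bP3) 2
    have i1 := BM_int (by linarith) b1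
    have i2 := BM_int (by linarith) b2
    have i3 := BM_int (by linarith) b3
    have iE := BM_int (by linarith) (BM_pow (BM_sub hE (dP_BM Y ω X hc2)) 2)
    have c1 := cov X hX0 (fun x => x + ω x) (fun x => 1 + deriv ω x) (fun y => (GG y - PY Y y)^2)
      (fun x hx => (hreg x hx).1) (fun x hx => (hreg x hx).2.1) (fun x hx => (hreg x hx).2.2.2.2) (fun y => sq_nonneg _) i3 i1
    have c2 : ∫ x in X..(2*X), (GG x - PY Y x)^2 ≤ ∫ x in X..(3*X), (GG x - PY Y x)^2 := by
      apply intervalIntegral.integral_mono_interval le_rfl (by linarith) (by linarith) _ i3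
      exact Eventually.of_forall fun y => sq_nonneg _
    have hm : ∫ x in X..(2*X), (Ehat ω x - dP Y ω x)^2 ≤ ∫ x in X..(2*X), (3*(GG (x+ω x) - PY Y (x+ω x))^2 + 3*(GG x - PY Y x)^2 + 27*K^2/X) := by
      apply intervalIntegral.integral_mono_on (by linarith) iE (((i1.const_mul 3).add (i2.const_mul 3)).add (by simp))
      intro x hx
      have := key x hx
      set r3 := 3*K*X^((1:ℝ)/4)/X with hr3
      have hr30 : 0 ≤ r3 := by positivity
      have hr3b : r3^2 ≤ 9*K^2/X := by
        have : (X^((1:ℝ)/4))^2 ≤ X := by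
          rw [← Real.rpow_natCast, ← Real.rpow_mul hX0.le]
          conv_rhs => rw [← Real.rpow_one X]
          exact Real.rpow_le_rpow_of_exponent_le (by linarith) (by norm_num)
        rw [hr3, div_pow, mul_pow, div_le_div_iff₀ (by positivity) hX0]
        calc (3*K)^2 * (X^((1:ℝ)/4))^2 * X ≤ (3*K)^2 * X * X := by gcongr
          _ = _ := by ring
      rw [← sq_abs (Ehat ω x - _), ← sq_abs (GG (x+ω x) - _), ← sq_abs (GG x - _)]
      set u := |GG (x + ω x) - PY Y (x + ω x)|
      set v := |GG x - PY Y x|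
      have : 27*K^2/X = 3*(9*K^2/X) := by ring
      calc _ ≤ (u + v + r3)^2 := by gcongr
        _ ≤ 3*u^2+3*v^2+3*r3^2 := by nlinarith [sq_nonneg (u-v), sq_nonneg (u-r3), sq_nonneg (v-r3)]
        _ ≤ _ := by rw [this]; gcongr
    rw [intervalIntegral.integral_add ((i1.const_mul 3).add (i2.const_mul 3)) (by simp), intervalIntegral.integral_add (i1.const_mul 3) (i2.const_mul 3),
      intervalIntegral.integral_const_mul, intervalIntegral.integral_const_mul, intervalIntegral.integral_const, smul_eq_mul] at hm
    have hm2 : ∫ x in X..(2*X), (Ehat ω x - dP Y ω x)^2 ≤ 9*(C * X^(1+ε)/Y) + 27*K^2 := by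
      refine hm.trans ?_
      have : (2*X-X)*(27*K^2/X) = 27*K^2 := by field_simp; ring
      rw [this]
      linarith
    have hYi : 1/X ≤ X^ε/Y := by
      rw [div_le_div_iff₀ hX0 (by linarith)]; nlinarith
    calc _ ≤ (1/X) * (9*(C * X^(1+ε)/Y) + 27*K^2) := by gcongr
      _ = 9*C*X^ε/Y + 27*K^2*(1/X) := by rw [Real.rpow_add hX0, Real.rpow_one]; field_simp
      _ ≤ 9*C*X^ε/Y + 27*K^2*(X^ε/Y) := by gcongr
      _ ≤ 9*C*X^ε/Y + 27*K^2*(X^ε/Y) + (2*C+3*K)*(X^ε/Y) := by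
          linarith [show 0 ≤ (2*C+3*K)*(X^ε/Y) by positivity]
      _ = _ := by ring

end rbound

section moments

lemma Ychoice (X η : ℝ) (hX : 1 ≤ X) (hη : 0 < η) : ∃ Y : ℕ, 1 ≤ Y ∧ (Y:ℝ) ≤ X^η ∧ X^η ≤ 2*Y := by
  have h1 : 1 ≤ X^η := Real.one_le_rpow hX hη.le
  have hY : 1 ≤ ⌊X^η⌋₊ := (Nat.one_le_floor_iff _).mpr h1
  have hY' : (1:ℝ) ≤ ⌊X^η⌋₊ := by exact_mod_cast hY
  refine ⟨⌊X^η⌋₊, hY, Nat.floor_le (by linarith), ?_⟩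
  have := Nat.lt_floor_add_one (X^η)
  linarith

lemma Ypow (X : ℝ) (hX : 1 ≤ X) (D Y : ℕ) (η : ℝ) (hη : η = 1/(4*((D:ℝ)+1))) (hY : (Y:ℝ) ≤ X^η) :
    X^(-(1/2):ℝ) * (Y:ℝ)^D ≤ X^(-(η/2)) := by
  have hX0 : 0 < X := by linarith
  have hD : (0:ℝ) ≤ D := by positivity
  have h1 : η * D ≤ 1/4 := by
    rw [hη, div_mul_eq_mul_div, div_le_div_iff₀ (by positivity) (by norm_num)]; linarith
  have h2 : η ≤ 1/4 := by
    rw [hη, div_le_div_iff₀ (by positivity) (by norm_num)]; linarith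
  calc _ ≤ X^(-(1/2):ℝ) * (X^η)^D := by gcongr
    _ = X^(-(1/2) + η*D) := by rw [← Real.rpow_natCast (X^η), ← Real.rpow_mul hX0.le, ← Real.rpow_add hX0]
    _ ≤ _ := Real.rpow_le_rpow_of_exponent_le hX (by linarith)

lemma mom_upper (ω : ℝ → ℝ) (hω : OmegaClass ω) (j : ℕ) : ∃ C : ℝ, 0 ≤ C ∧ ∀ᶠ X in atTop,
    (1/X) * ∫ x in X..(2*X), Ehat ω x ^ (2*(j+1)) ≤ C * Mom 2 X ω ^ (j+1) := by
  obtain ⟨C1, hC1, D, hU⟩ := propB_upper ω hω (j+1)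
  set η : ℝ := 1/(4*((D:ℝ)+1)) with hη
  have hη0 : 0 < η := by positivity
  have hη4 : η ≤ 1/4 := by
    rw [hη, div_le_div_iff₀ (by positivity) (by norm_num)]; linarith [show (0:ℝ) ≤ D by positivity]
  set ε : ℝ := η/(4*((j:ℝ)+1)) with hε
  have hε0 : 0 < ε := by positivity
  have hεη : ε * (4*((j:ℝ)+1)) = η := by rw [hε]; field_simp
  have hj : (0:ℝ) ≤ j := by positivity
  have hε4 : ε ≤ 1/4 := by nlinarith
  obtain ⟨C2, hC2, hR⟩ := R_bound ω hω ε hε0 hε4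
  obtain ⟨c, hc, hlow⟩ := hω.mom2_lower (η/(2*((j:ℝ)+1))) (by positivity)
  have hL := (hω.Llim_exists (2*(j+1)) (even_two_mul _)).eventually (gt_mem_nhds (lt_add_one _))
  set L := Llim ω (2*(j+1)) + 1 with hLdef
  set K := C1 + 2*C2^(2*j+1) with hK
  refine ⟨2^(2*(j+1)-1) * (C1 * |L| + K * (c^(j+1))⁻¹), by positivity, ?_⟩
  filter_upwards [hU, hR, hlow, hL, shell_reg ω hω] with X hU hR hlow hL hreg
  obtain ⟨hX2, hreg, hcω, hc2, hE⟩ := hreg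
  have hX0 : 0 < X := by linarith
  have hX1 : 1 ≤ X := by linarith
  obtain ⟨Y, hY1, hY2, hY3⟩ := Ychoice X η hX1 hη0
  have hY0 : (1:ℝ) ≤ Y := by exact_mod_cast hY1
  have hU := hU Y hY1
  obtain ⟨r1, r2⟩ := hR Y hY1 (hY2.trans (Real.rpow_le_rpow_of_exponent_le hX1 hη4))
  have bD := dP_BM Y ω X hc2
  have bR := BM_sub hE bD
  have iD := BM_int (by linarith) (BM_pow bD (2*(j+1)))
  have iR := BM_int (by linarith) (BM_pow bR (2*(j+1)))
  have iR2 := BM_int (by linarith) (BM_pow bR 2)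
  have iE := BM_int (by linarith) (BM_pow hE (2*(j+1)))
  have hm0 : 0 < Mom 2 X ω := lt_of_lt_of_le (by positivity) hlow
  -- the main split
  have s1 : ∫ x in X..(2*X), Ehat ω x ^ (2*(j+1)) ≤ ∫ x in X..(2*X), 2^(2*(j+1)-1) * (dP Y ω x ^ (2*(j+1)) + (Ehat ω x - dP Y ω x)^(2*(j+1))) := by
    apply intervalIntegral.integral_mono_on (by linarith) iE ((iD.add iR).const_mul _)
    intro x _
    have := Even.add_pow_le (even_two_mul (j+1)) (a := dP Y ω x) (b := Ehat ω x - dP Y ω x)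
    rw [add_sub_cancel] at this
    exact this
  rw [intervalIntegral.integral_const_mul, intervalIntegral.integral_add iD iR] at s1
  -- the remainder
  have s2 : ∫ x in X..(2*X), (Ehat ω x - dP Y ω x)^(2*(j+1)) ≤ ∫ x in X..(2*X), (C2*X^ε)^(2*j) * (Ehat ω x - dP Y ω x)^2 := by
    apply intervalIntegral.integral_mono_on (by linarith) iR (iR2.const_mul _)
    intro x hx
    have := r1 x hx
    rw [show 2*(j+1) = 2*j + 2 by ring, pow_add]
    apply mul_le_mul_of_nonneg_right _ (sq_nonneg _)
    rw [← Even.pow_abs (even_two_mul j)]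
    gcongr
  rw [intervalIntegral.integral_const_mul] at s2
  have hYinv : X^ε/Y ≤ 2*X^(ε-η) := by
    rw [Real.rpow_sub hX0, div_le_iff₀ (by linarith), mul_div_assoc', div_mul_eq_mul_div, le_div_iff₀ (by positivity)]
    nlinarith [Real.rpow_pos_of_pos hX0 ε]
  have s3 : (1/X) * ∫ x in X..(2*X), (Ehat ω x - dP Y ω x)^(2*(j+1)) ≤ 2*C2^(2*j+1) * X^(-(η/2)) := by
    calc _ ≤ (1/X) * ((C2*X^ε)^(2*j) * ∫ x in X..(2*X), (Ehat ω x - dP Y ω x)^2) := by gcongr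
      _ = (C2*X^ε)^(2*j) * ((1/X) * ∫ x in X..(2*X), (Ehat ω x - dP Y ω x)^2) := by ring
      _ ≤ (C2*X^ε)^(2*j) * (C2 * X^ε / Y) := by gcongr
      _ = (C2*X^ε)^(2*j) * (C2 * (X^ε / Y)) := by ring
      _ ≤ (C2*X^ε)^(2*j) * (C2 * (2*X^(ε-η))) := by gcongr
      _ = 2*C2^(2*j+1) * X^(ε*(2*j) + (ε-η)) := by
          rw [Real.rpow_add hX0, Real.rpow_mul hX0.le, mul_pow, pow_succ]
          have : (X^ε)^(2*(j:ℝ)) = (X^ε)^(2*j) := by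
            rw [← Real.rpow_natCast]; push_cast; rfl
          rw [this]; ring
      _ ≤ _ := by
          gcongr
          nlinarith
  have s4 := Ypow X hX1 D Y η hη hY2
  have s5 : Mom (2*(j+1)) X ω ≤ |L| * Mom 2 X ω ^ (j+1) := by
    rw [Nat.mul_div_cancel_left _ (by norm_num : 0 < 2), div_lt_iff₀ (by positivity)] at hL
    refine hL.le.trans ?_
    gcongr
    exact le_abs_self L
  have s6 : X^(-(η/2)) ≤ (c^(j+1))⁻¹ * Mom 2 X ω ^ (j+1) := by
    rw [le_inv_mul_iff₀ (by positivity)]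
    calc c^(j+1) * X^(-(η/2)) = (c * X^(-(η/(2*((j:ℝ)+1)))))^(j+1) := by
          rw [mul_pow, ← Real.rpow_natCast (X^(_:ℝ)), ← Real.rpow_mul hX0.le]
          congr 2; push_cast; field_simp
      _ ≤ _ := by gcongr
  calc _ ≤ (1/X) * (2^(2*(j+1)-1) * ((∫ x in X..(2*X), dP Y ω x ^ (2*(j+1))) + ∫ x in X..(2*X), (Ehat ω x - dP Y ω x)^(2*(j+1)))) := by
        gcongr
    _ = 2^(2*(j+1)-1) * ((1/X) * (∫ x in X..(2*X), dP Y ω x ^ (2*(j+1))) + (1/X) * ∫ x in X..(2*X), (Ehat ω x - dP Y ω x)^(2*(j+1))) := by ring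
    _ ≤ 2^(2*(j+1)-1) * ((C1 * Mom (2*(j+1)) X ω + C1 * X^(-(1/2):ℝ) * (Y:ℝ)^D) + 2*C2^(2*j+1) * X^(-(η/2))) := by
        gcongr
    _ = 2^(2*(j+1)-1) * ((C1 * Mom (2*(j+1)) X ω + C1 * (X^(-(1/2):ℝ) * (Y:ℝ)^D)) + 2*C2^(2*j+1) * X^(-(η/2))) := by ring
    _ ≤ 2^(2*(j+1)-1) * ((C1 * (|L| * Mom 2 X ω ^ (j+1)) + C1 * X^(-(η/2))) + 2*C2^(2*j+1) * X^(-(η/2))) := by gcongr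
    _ = 2^(2*(j+1)-1) * (C1 * (|L| * Mom 2 X ω ^ (j+1)) + K * X^(-(η/2))) := by rw [hK]; ring
    _ ≤ 2^(2*(j+1)-1) * (C1 * (|L| * Mom 2 X ω ^ (j+1)) + K * ((c^(j+1))⁻¹ * Mom 2 X ω ^ (j+1))) := by gcongr
    _ = _ := by ring

lemma sig_lower (ω : ℝ → ℝ) (hω : OmegaClass ω) : ∃ c : ℝ, 0 < c ∧ ∀ᶠ X in atTop, 0 < Mom 2 X ω ∧
    c * Mom 2 X ω ≤ (1/X) * ∫ x in X..(2*X), Ehat ω x ^ 2 := by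
  obtain ⟨c, hc, C1, hC1, D, hU⟩ := propB_lower ω hω
  set η : ℝ := 1/(4*((D:ℝ)+1)) with hη
  have hη0 : 0 < η := by positivity
  have hη4 : η ≤ 1/4 := by
    rw [hη, div_le_div_iff₀ (by positivity) (by norm_num)]; linarith [show (0:ℝ) ≤ D by positivity]
  obtain ⟨C2, hC2, hR⟩ := R_bound ω hω (η/2) (by positivity) (by linarith)
  obtain ⟨c', hc', hlow⟩ := hω.mom2_lower (η/4) (by positivity)
  set K := (3*C1 + 4*C2)/2 with hK
  have hK0 : 0 ≤ K := by positivity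
  have hsm : Tendsto (fun X : ℝ => K/c' * X^(-(η/4))) atTop (nhds (K/c' * 0)) :=
    (tendsto_rpow_neg_atTop (by positivity)).const_mul _
  rw [mul_zero] at hsm
  have hsm := hsm.eventually (gt_mem_nhds (show 0 < c/4 by positivity))
  refine ⟨c/4, by positivity, ?_⟩
  filter_upwards [hU, hR, hlow, hsm, shell_reg ω hω] with X hU hR hlow hsm hreg
  obtain ⟨hX2, hreg, hcω, hc2, hE⟩ := hreg
  have hX0 : 0 < X := by linarith
  have hX1 : 1 ≤ X := by linarith
  obtain ⟨Y, hY1, hY2, hY3⟩ := Ychoice X η hX1 hη0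
  have hY0 : (1:ℝ) ≤ Y := by exact_mod_cast hY1
  have hU := hU Y hY1
  obtain ⟨r1, r2⟩ := hR Y hY1 (hY2.trans (Real.rpow_le_rpow_of_exponent_le hX1 hη4))
  have bD := dP_BM Y ω X hc2
  have bR := BM_sub hE bD
  have iD := BM_int (by linarith) (BM_pow bD 2)
  have iR2 := BM_int (by linarith) (BM_pow bR 2)
  have iE := BM_int (by linarith) (BM_pow hE 2)
  have hm0 : 0 < Mom 2 X ω := lt_of_lt_of_le (by positivity) hlow
  refine ⟨hm0, ?_⟩
  have s1 : ∫ x in X..(2*X), dP Y ω x ^ 2 ≤ ∫ x in X..(2*X), (2*Ehat ω x^2 + 2*(Ehat ω x - dP Y ω x)^2) := by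
    apply intervalIntegral.integral_mono_on (by linarith) iD ((iE.const_mul 2).add (iR2.const_mul 2))
    intro x _
    nlinarith [sq_nonneg (2*Ehat ω x - dP Y ω x)]
  rw [intervalIntegral.integral_add (iE.const_mul 2) (iR2.const_mul 2), intervalIntegral.integral_const_mul, intervalIntegral.integral_const_mul] at s1
  have s2 : (1/X) * ∫ x in X..(2*X), dP Y ω x ^ 2 ≤ 2*((1/X) * ∫ x in X..(2*X), Ehat ω x^2) + 2*((1/X) * ∫ x in X..(2*X), (Ehat ω x - dP Y ω x)^2) := by
    calc _ ≤ (1/X) * (2 * (∫ x in X..(2*X), Ehat ω x^2) + 2*∫ x in X..(2*X), (Ehat ω x - dP Y ω x)^2) := by gcongr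
      _ = _ := by ring
  have hYinv : X^(η/2)/Y ≤ 2*X^(-(η/2)) := by
    rw [show -(η/2) = η/2-η by ring, Real.rpow_sub hX0, div_le_iff₀ (by linarith), mul_div_assoc', div_mul_eq_mul_div, le_div_iff₀ (by positivity)]
    nlinarith [Real.rpow_pos_of_pos hX0 (η/2)]
  have s3 : C2 * X^(η/2) / Y ≤ 2*C2*X^(-(η/2)) := by
    calc _ = C2 * (X^(η/2) / Y) := by ring
      _ ≤ C2 * (2*X^(-(η/2))) := by gcongr
      _ = _ := by ring
  have s4 := Ypow X hX1 D Y η hη hY2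
  have s5 : (Y:ℝ)^(-(1/2):ℝ) ≤ 2*X^(-(η/2)) := by
    have h1 : (Y:ℝ)^(-(1/2):ℝ) ≤ (X^η/2)^(-(1/2):ℝ) := by
      apply Real.rpow_le_rpow_of_nonpos (by positivity) (by linarith) (by norm_num)
    refine h1.trans ?_
    rw [Real.div_rpow (by positivity) (by norm_num), ← Real.rpow_mul hX0.le, show η * -(1/2) = -(η/2) by ring, div_eq_mul_inv,
      ← Real.rpow_neg (by norm_num), mul_comm]
    gcongr
    calc (2:ℝ)^(-(-(1/2)):ℝ) ≤ 2^(1:ℝ) := Real.rpow_le_rpow_of_exponent_le (by norm_num) (by norm_num)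
      _ = 2 := Real.rpow_one 2
  have s6 : K * X^(-(η/2)) ≤ c/4 * Mom 2 X ω := by
    calc K * X^(-(η/2)) = (K/c' * X^(-(η/4))) * (c' * X^(-(η/4))) := by
          rw [show -(η/2) = -(η/4) + -(η/4) by ring, Real.rpow_add hX0]; field_simp
      _ ≤ c/4 * Mom 2 X ω := by
          apply mul_le_mul hsm.le hlow (by positivity) (by positivity)
  have s7 : C1 * (Y:ℝ)^(-(1/2):ℝ) ≤ C1 * (2*X^(-(η/2))) := by gcongr
  have s8 : C1 * X^(-(1/2):ℝ) * (Y:ℝ)^D ≤ C1 * X^(-(η/2)) := by rw [mul_assoc]; gcongr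
  rw [hK] at s6
  have s9 : (3*C1+4*C2)/2 * X^(-(η/2)) = (3*(C1*X^(-(η/2))) + 4*(C2*X^(-(η/2))))/2 := by ring
  rw [s9] at s6
  have s10 : 2*C2*X^(-(η/2)) = 2*(C2*X^(-(η/2))) := by ring
  have s11 : C1 * (2*X^(-(η/2))) = 2*(C1*X^(-(η/2))) := by ring
  linarith

end moments

section final

lemma norm_int (ω : ℝ → ℝ) (hω : OmegaClass ω) : ∀ᶠ X in atTop, 2 ≤ X ∧ ∀ Φ : ℝ → ℝ, Continuous Φ →
    IntervalIntegrable (fun x => Φ (Ehat ω x / sigmaShell ω X)) volume X (2*X) := by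
  filter_upwards [shell_reg ω hω] with X h
  obtain ⟨hX, _, _, _, hb⟩ := h
  refine ⟨hX, fun Φ hΦ => ?_⟩
  exact BM_int (by linarith) (BM_comp hb (Φ := fun y => Φ (y / sigmaShell ω X)) (by fun_prop))

lemma norm_mom (ω : ℝ → ℝ) (hω : OmegaClass ω) (j : ℕ) : ∃ B, 0 ≤ B ∧ ∀ᶠ X in atTop,
    (1/X) * ∫ x in X..(2*X), (Ehat ω x / sigmaShell ω X)^(2*(j+1)) ≤ B := by
  obtain ⟨C, hC, h1⟩ := mom_upper ω hω j
  obtain ⟨c, hc, h2⟩ := sig_lower ω hω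
  refine ⟨C / c^(j+1), by positivity, ?_⟩
  filter_upwards [h1, h2] with X h1 h2
  obtain ⟨hM, h2⟩ := h2
  have hs : sigmaShell ω X ^ 2 = (1 / X) * ∫ x in X..(2 * X), Ehat ω x ^ 2 := by
    unfold sigmaShell
    exact Real.sq_sqrt (le_trans (by positivity) h2)
  have hs2 : c * Mom 2 X ω ≤ sigmaShell ω X ^ 2 := by rw [hs]; exact h2
  have he : ∀ x, (Ehat ω x / sigmaShell ω X)^(2*(j+1)) = Ehat ω x ^(2*(j+1)) / (sigmaShell ω X ^ 2)^(j+1) := by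
    intro x
    rw [div_pow, pow_mul (sigmaShell ω X)]
  simp_rw [he]
  rw [intervalIntegral.integral_div, ← mul_div_assoc]
  have hp : 0 < c * Mom 2 X ω := by positivity
  calc _ ≤ (C * Mom 2 X ω ^ (j+1)) / (c * Mom 2 X ω)^(j+1) := by gcongr
    _ = C / c^(j+1) := by
      rw [mul_pow]
      field_simp

def chi (T α : ℝ) : ℝ := max 0 (min 1 (T + 1 - |α|))

lemma chi_cont (T : ℝ) : Continuous (chi T) := by unfold chi; fun_prop
lemma chi_nonneg (T α : ℝ) : 0 ≤ chi T α := le_max_left _ _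
lemma chi_le (T α : ℝ) : chi T α ≤ 1 := max_le zero_le_one (min_le_left _ _)
lemma chi_one (T α : ℝ) (h : |α| ≤ T) : chi T α = 1 := by
  unfold chi
  rw [min_eq_left (by linarith), max_eq_right zero_le_one]
lemma chi_zero (T α : ℝ) (h : T + 1 ≤ |α|) : chi T α = 0 := by
  unfold chi
  rw [max_eq_left]
  exact (min_le_right _ _).trans (by linarith)

lemma cut_diff (F : ℝ → ℝ) (C : ℝ) (hC : 0 < C) (n : ℕ) (hg : ∀ α, |F α| ≤ C * (1 + |α|) ^ n) (T : ℝ) (hT : 1 ≤ T) (α : ℝ) :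
    |F α - F α * chi T α| ≤ C * 2^n / T * α^(2*(n+1)) := by
  have hev : α^(2*(n+1)) = |α|^(2*(n+1)) := by
    rw [pow_mul, pow_mul, sq_abs]
  rw [hev]
  by_cases h : |α| ≤ T
  · rw [chi_one T α h]; simp; positivity
  · push Not at h
    have h1 : 1 ≤ |α| := by linarith
    have : |F α - F α * chi T α| ≤ |F α| := by
      rw [show F α - F α * chi T α = F α * (1 - chi T α) by ring, abs_mul]
      have : |1 - chi T α| ≤ 1 := by
        rw [abs_le]; constructor <;> linarith [chi_nonneg T α, chi_le T α]
      exact mul_le_of_le_one_right (abs_nonneg _) this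
    refine this.trans ((hg α).trans ?_)
    calc C * (1 + |α|)^n ≤ C * (2 * |α|)^n := by gcongr; linarith
      _ = C * 2^n / T * (|α|^n * T) := by rw [mul_pow]; field_simp
      _ ≤ C * 2^n / T * (|α|^n * |α|^(n+2)) := by
        gcongr
        exact h.le.trans (le_self_pow₀ h1 (by omega))
      _ = _ := by rw [← pow_add]; congr 2; ring

lemma mu_mom (μ : Measure ℝ) [IsProbabilityMeasure μ] (k : ℕ) (B : ℝ) (hB : 0 ≤ B)
    (h : ∀ R : ℕ, ∫ α, min (α^(2*k)) (R:ℝ) ∂μ ≤ B) :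
    Integrable (fun α => α^(2*k)) μ ∧ ∫ α, α^(2*k) ∂μ ≤ B := by
  have hnn : ∀ α : ℝ, 0 ≤ α^(2*k) := fun α => by rw [pow_mul]; positivity
  have hl : ∫⁻ α, ENNReal.ofReal (α^(2*k)) ∂μ ≤ ENNReal.ofReal B := by
    have h1 : ∀ α : ℝ, liminf (fun R : ℕ => ENNReal.ofReal (min (α^(2*k)) (R:ℝ))) atTop = ENNReal.ofReal (α^(2*k)) := by
      intro α
      apply Tendsto.liminf_eq
      apply tendsto_const_nhds.congr'
      filter_upwards [eventually_ge_atTop ⌈α^(2*k)⌉₊] with R hR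
      rw [min_eq_left (Nat.ceil_le.mp hR)]
    calc _ = ∫⁻ α, liminf (fun R : ℕ => ENNReal.ofReal (min (α^(2*k)) (R:ℝ))) atTop ∂μ := by simp_rw [h1]
      _ ≤ liminf (fun R : ℕ => ∫⁻ α, ENNReal.ofReal (min (α^(2*k)) (R:ℝ)) ∂μ) atTop := by
        apply lintegral_liminf_le
        intro R
        fun_prop
      _ ≤ liminf (fun R : ℕ => ENNReal.ofReal B) atTop := by
        refine liminf_le_liminf ?_
        refine Eventually.of_forall fun R => ?_
        show _ ≤ ENNReal.ofReal B
        rw [← ofReal_integral_eq_lintegral_ofReal]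
        · exact ENNReal.ofReal_le_ofReal (h R)
        · refine Integrable.of_bound (Continuous.aestronglyMeasurable (by fun_prop)) (R:ℝ) (Eventually.of_forall fun α => ?_)
          rw [Real.norm_eq_abs, abs_of_nonneg (le_min (hnn α) (Nat.cast_nonneg R))]
          exact min_le_right _ _
        · exact Eventually.of_forall fun α => le_min (hnn α) (Nat.cast_nonneg R)
      _ = _ := liminf_const _
  have hi : Integrable (fun α : ℝ => α^(2*k)) μ := by
    refine ⟨Continuous.aestronglyMeasurable (by fun_prop), ?_⟩
    rw [hasFiniteIntegral_iff_ofReal (Eventually.of_forall hnn)]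
    exact hl.trans_lt ENNReal.ofReal_lt_top
  refine ⟨hi, ?_⟩
  rw [← ofReal_integral_eq_lintegral_ofReal hi (Eventually.of_forall hnn)] at hl
  exact (ENNReal.ofReal_le_ofReal_iff hB).mp hl

end final

/-- The weak convergence to the limiting distribution extends to continuous
functions of polynomial growth. -/
theorem limiting_distribution_polynomial_growth (ω : ℝ → ℝ) (hω : OmegaClass ω)
    (μ : Measure ℝ) [IsProbabilityMeasure μ]
    (hμ : ∀ F : ℝ → ℝ, Continuous F → (∃ C, ∀ α, |F α| ≤ C) →
      Tendsto (fun X => (1 / X) * ∫ x in X..(2 * X), F (Ehat ω x / sigmaShell ω X))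
        atTop (nhds (∫ α, F α ∂μ)))
    (F : ℝ → ℝ) (hF : Continuous F)
    (hgrowth : ∃ C > (0 : ℝ), ∃ n : ℕ, ∀ α, |F α| ≤ C * (1 + |α|) ^ n) :
    Tendsto (fun X => (1 / X) * ∫ x in X..(2 * X), F (Ehat ω x / sigmaShell ω X))
      atTop (nhds (∫ α, F α ∂μ)) := by
  obtain ⟨C, hC, n, hg⟩ := hgrowth
  obtain ⟨B, hB, hmom⟩ := norm_mom ω hω n
  have hint := norm_int ω hω
  have hnn : ∀ α : ℝ, 0 ≤ α^(2*(n+1)) := fun α => by rw [pow_mul]; positivity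
  have hmu := mu_mom μ (n+1) B hB (by
    intro R
    have hcont : Continuous (fun α : ℝ => min (α^(2*(n+1))) (R:ℝ)) := by fun_prop
    have ht := hμ (fun α => min (α^(2*(n+1))) (R:ℝ)) hcont
      ⟨R, fun α => by
        rw [abs_of_nonneg (le_min (hnn α) (Nat.cast_nonneg R))]
        exact min_le_right _ _⟩
    refine le_of_tendsto ht ?_
    filter_upwards [hmom, hint] with X h1 h2
    obtain ⟨hX, h2⟩ := h2
    refine le_trans ?_ h1
    apply mul_le_mul_of_nonneg_left _ (by positivity)
    apply intervalIntegral.integral_mono_on (by linarith) (h2 _ hcont) (h2 (fun α => α^(2*(n+1))) (by fun_prop))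
    intro x _
    exact min_le_left _ _)
  obtain ⟨hmi, hmB⟩ := hmu
  have hFi : Integrable F μ := by
    refine Integrable.mono' (g := fun α => C * 2^n * (1 + α^(2*(n+1)))) (((integrable_const 1).add hmi).const_mul _)
      hF.aestronglyMeasurable (Eventually.of_forall fun α => ?_)
    rw [Real.norm_eq_abs]
    refine (hg α).trans ?_
    rw [mul_assoc]
    gcongr
    have hev : α^(2*(n+1)) = |α|^(2*(n+1)) := by
      rw [pow_mul, pow_mul, sq_abs]
    rw [hev]
    rcases le_total |α| 1 with h | h
    · calc (1+|α|)^n ≤ 2^n := by gcongr; linarith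
        _ ≤ 2^n * (1 + |α|^(2*(n+1))) := by
          apply le_mul_of_one_le_right (by positivity)
          have : 0 ≤ |α|^(2*(n+1)) := by positivity
          linarith
    · calc (1+|α|)^n ≤ (2*|α|)^n := by gcongr; linarith
        _ = 2^n * |α|^n := mul_pow _ _ _
        _ ≤ 2^n * (1 + |α|^(2*(n+1))) := by
          gcongr
          have : |α|^n ≤ |α|^(2*(n+1)) := pow_le_pow_right₀ h (by omega)
          linarith
  rw [Metric.tendsto_nhds]
  intro ε hε
  obtain ⟨T, hT1, hT⟩ : ∃ T : ℝ, 1 ≤ T ∧ C * 2^n / T * B < ε / 3 := by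
    refine ⟨max 1 (3 * (C * 2^n * B + 1) / ε), le_max_left _ _, ?_⟩
    have h1 : 0 < max 1 (3 * (C * 2^n * B + 1) / ε) := lt_of_lt_of_le one_pos (le_max_left _ _)
    have h2 := le_max_right 1 (3 * (C * 2^n * B + 1) / ε)
    rw [div_le_iff₀ hε] at h2
    rw [div_mul_eq_mul_div, div_lt_iff₀ h1]
    linarith
  have hFc : Continuous (fun α => F α * chi T α) := hF.mul (chi_cont T)
  have hbd : ∀ α, |F α * chi T α| ≤ C * (1 + (T+1))^n := by
    intro α
    rcases le_total (T+1) |α| with h | h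
    · rw [chi_zero T α h]; simp; positivity
    · rw [abs_mul, abs_of_nonneg (chi_nonneg T α)]
      calc _ ≤ |F α| * 1 := by gcongr; exact chi_le T α
        _ ≤ C * (1 + |α|)^n := by rw [mul_one]; exact hg α
        _ ≤ _ := by gcongr
  have hlim := hμ (fun α => F α * chi T α) hFc ⟨_, hbd⟩
  rw [Metric.tendsto_nhds] at hlim
  have hFTi : Integrable (fun α => F α * chi T α) μ :=
    Integrable.of_bound hFc.aestronglyMeasurable _ (Eventually.of_forall hbd)
  have hmu2 : |∫ α, F α ∂μ - ∫ α, F α * chi T α ∂μ| ≤ C * 2^n / T * B := by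
    rw [← integral_sub hFi hFTi]
    calc _ ≤ ∫ α, |F α - F α * chi T α| ∂μ := abs_integral_le_integral_abs
      _ ≤ ∫ α, C * 2^n / T * α^(2*(n+1)) ∂μ :=
        integral_mono (hFi.sub hFTi).abs (hmi.const_mul _) (fun α => cut_diff F C hC n hg T hT1 α)
      _ = C * 2^n / T * ∫ α, α^(2*(n+1)) ∂μ := integral_const_mul _ _
      _ ≤ _ := by gcongr
  filter_upwards [hlim (ε/3) (by positivity), hmom, hint] with X h1 h2 h3
  obtain ⟨hX, h3⟩ := h3
  rw [Real.dist_eq] at h1 ⊢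
  have h4 : |(1 / X) * (∫ x in X..(2 * X), F (Ehat ω x / sigmaShell ω X))
      - (1 / X) * ∫ x in X..(2 * X), F (Ehat ω x / sigmaShell ω X) * chi T (Ehat ω x / sigmaShell ω X)| ≤ C * 2^n / T * B := by
    rw [← mul_sub, ← intervalIntegral.integral_sub (h3 F hF) (h3 _ hFc), abs_mul, abs_of_nonneg (by positivity : (0:ℝ) ≤ 1/X)]
    have hXX : X ≤ 2*X := by linarith
    have hd : Continuous (fun α => |F α - F α * chi T α|) := (hF.sub hFc).abs
    calc _ ≤ (1/X) * ∫ x in X..(2*X), |F (Ehat ω x / sigmaShell ω X) - F (Ehat ω x / sigmaShell ω X) * chi T (Ehat ω x / sigmaShell ω X)| := by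
          gcongr
          exact intervalIntegral.abs_integral_le_integral_abs hXX
      _ ≤ (1/X) * ∫ x in X..(2*X), C * 2^n / T * (Ehat ω x / sigmaShell ω X)^(2*(n+1)) := by
          apply mul_le_mul_of_nonneg_left _ (by positivity)
          apply intervalIntegral.integral_mono_on hXX (h3 _ hd) (h3 (fun α => C * 2^n / T * α^(2*(n+1))) (by fun_prop))
          intro x _
          exact cut_diff F C hC n hg T hT1 _
      _ = C * 2^n / T * ((1/X) * ∫ x in X..(2*X), (Ehat ω x / sigmaShell ω X)^(2*(n+1))) := by
          rw [intervalIntegral.integral_const_mul]; ring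
      _ ≤ _ := by gcongr
  rw [abs_lt] at h1 ⊢
  rw [abs_le] at h4 hmu2
  constructor <;> linarith [h1.1, h1.2, h4.1, h4.2, hmu2.1, hmu2.2]
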